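/- Let ∂G be piecewise analytic, with the smallest exterior angle λπ, 0 < λ < 2, at the junction points of its analytic arcs. Suppose ζ ∈ F, where F ⊂ G is compact. Then there is a constant C₄(G,F) > 0, depending only on G and F, such that for every n ∈ ℕ: max_{z∈F} |φ(z) − J_{2n+1}(z)| ≤ C₄(G,F) · n^{−λ/(2−λ)} (i.e., on compact subsets of G the rate of convergence is essentially the square of the rate on the closure of G). -/

import Mathlib

open Complex MeasureTheory Set Filter Metric

noncomputable section

/-- A bounded Jordan domain `G ⊆ ℂ` whose boundary is a rectifiable Jordan curve
of length `l`, given together with a unit-speed (arclength) parametrization `γ`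
of the boundary curve `L = frontier G`. -/
structure JordanDomain where
  /-- the domain -/
  G : Set ℂ
  isOpen : IsOpen G
  nonempty : G.Nonempty
  bounded : Bornology.IsBounded G
  connected : IsConnected G
  simplyConnected : SimplyConnectedSpace ↥G
  /-- the length of the boundary curve -/
  l : ℝ
  l_pos : 0 < l
  /-- arclength parametrization of the boundary curve -/
  γ : ℝ → ℂ
  γ_cont : Continuous γ
  γ_periodic : Function.Periodic γ l
  γ_injOn : InjOn γ (Ico 0 l)
  γ_boundary : γ '' Ico 0 l = frontier G
  /-- `γ` is a unit-speed (arclength) parametrization; in particular the boundary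
  is rectifiable with length `l`. -/
  γ_unitSpeed : ∀ s t : ℝ, s ≤ t → t ≤ s + l →
    eVariationOn γ (Icc s t) = ENNReal.ofReal (t - s)

/-- The `E₂(G)`-norm of (the boundary trace of) a function, computed through the
arclength parametrization of the boundary: `‖g‖₂ = ((1/l) ∫₀^l ‖g(s)‖² ds)^{1/2}`. -/
def JordanDomain.bnorm (D : JordanDomain) (g : ℝ → ℂ) : ℝ :=
  Real.sqrt ((1 / D.l) * ∫ s in (0:ℝ)..D.l, ‖g s‖ ^ 2)

/-- `p` is the sequence of orthonormal polynomials of `E₂(G)` obtained by Gram–Schmidt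
orthonormalization of the monomials `1, z, z², …`: `deg p k = k`, the leading
coefficients are positive reals, and the polynomials are orthonormal with respect to
the arclength inner product `(f,g) = (1/l) ∫_L f conj(g) |dz|`. -/
def JordanDomain.IsONPolys (D : JordanDomain) (p : ℕ → Polynomial ℂ) : Prop :=
  (∀ k, (p k).natDegree = k) ∧
  (∀ k, ∃ c : ℝ, 0 < c ∧ (p k).leadingCoeff = (c : ℂ)) ∧
  (∀ j k, (1 / (D.l : ℂ)) * (∫ s in (0:ℝ)..D.l,
      (p j).eval (D.γ s) * (starRingEnd ℂ) ((p k).eval (D.γ s))) =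
    if j = k then 1 else 0)

/-- The `n`-th partial sum `Σ_{k=0}^n conj(p_k(ζ))·p_k(z)` of the Szegő kernel expansion. -/
def partialSum (p : ℕ → Polynomial ℂ) (ζ : ℂ) (n : ℕ) : ℂ → ℂ := fun z =>
  ∑ k ∈ Finset.range (n + 1), (starRingEnd ℂ) ((p k).eval ζ) * (p k).eval z

/-- The Szegő kernel `K(z,ζ) = Σ_{k=0}^∞ conj(p_k(ζ))·p_k(z)`. -/
def szegoKernel (p : ℕ → Polynomial ℂ) (ζ z : ℂ) : ℂ :=
  ∑' k : ℕ, (starRingEnd ℂ) ((p k).eval ζ) * (p k).eval z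

/-- The approximating polynomials
`J_{2n+1}(z) = (2π/l)·(∫_ζ^z (Σ_{k=0}^n conj(p_k(ζ))p_k(t))² dt) / (Σ_{k=0}^n |p_k(ζ)|²)`;
the (path-independent) integral of the polynomial integrand is written out explicitly,
using `∫_ζ^z t^i dt = (z^{i+1} - ζ^{i+1})/(i+1)`. -/
def Jfun (D : JordanDomain) (p : ℕ → Polynomial ℂ) (ζ : ℂ) (n : ℕ) : ℂ → ℂ := fun z =>
  let S : Polynomial ℂ :=
    (∑ k ∈ Finset.range (n + 1), Polynomial.C ((starRingEnd ℂ) ((p k).eval ζ)) * p k) ^ 2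
  (((2 * Real.pi / D.l : ℝ) : ℂ) / (∑ k ∈ Finset.range (n + 1), ((‖(p k).eval ζ‖ : ℂ)) ^ 2)) *
    ∑ i ∈ Finset.range (S.natDegree + 1),
      S.coeff i * ((z ^ (i + 1) - ζ ^ (i + 1)) / ((i : ℂ) + 1))

/-- `Q_n(z) = ((l/2π)·Σ_{k=0}^n |p_k(ζ)|²)^{-1/2} · Σ_{k=0}^n conj(p_k(ζ))·p_k(z)`,
so that `J'_{2n+1} = Q_n²`. -/
def Qfun (D : JordanDomain) (p : ℕ → Polynomial ℂ) (ζ : ℂ) (n : ℕ) : ℂ → ℂ := fun z =>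
  ((Real.sqrt ((D.l / (2 * Real.pi)) *
      ∑ k ∈ Finset.range (n + 1), ‖(p k).eval ζ‖ ^ 2) : ℝ) : ℂ)⁻¹ * partialSum p ζ n z

/-- The sup norm `⨆_{z ∈ K} ‖f(z)‖` on a set `K ⊆ ℂ`. -/
def supNormOn (K : Set ℂ) (f : ℂ → ℂ) : ℝ := ⨆ z : K, ‖f (z : ℂ)‖

/-- `g` has nontangential limit `v` at the boundary point `w` of `G`:
`g(z) → v` as `z → w` inside every cone `{z ∈ G : ‖z - w‖ ≤ M·dist(z, ∂G)}`. -/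
def NTLim (G : Set ℂ) (g : ℂ → ℂ) (w v : ℂ) : Prop :=
  ∀ M : ℝ, 1 < M →
    Tendsto g (nhdsWithin w {z | z ∈ G ∧ ‖z - w‖ ≤ M * infDist z (frontier G)}) (nhds v)

/-- `φ` is the conformal map of `G` onto the unit disk `D` normalized by
`φ(ζ) = 0` and `φ'(ζ) > 0`. -/
structure ConformalOnto (G : Set ℂ) (φ : ℂ → ℂ) (ζ : ℂ) : Prop where
  differentiable : ∀ z ∈ G, DifferentiableAt ℂ φ z
  bijOn : BijOn φ G (ball (0 : ℂ) 1)
  map_center : φ ζ = 0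
  deriv_center_pos : ∃ c : ℝ, 0 < c ∧ deriv φ ζ = (c : ℂ)

/-- `G` is a Smirnov domain: for any conformal map `ψ` of the unit disk onto `G`,
`log|ψ'|` is represented by the Poisson integral of its (radial) boundary values.
(By the Keldysh–Lavrentiev theorem this is equivalent to polynomials being dense
in the Smirnov classes `E_p(G)`.) -/
def IsSmirnovDomain (G : Set ℂ) : Prop :=
  ∀ ψ : ℂ → ℂ,
    (∀ w ∈ ball (0 : ℂ) 1, DifferentiableAt ℂ ψ w) →
    BijOn ψ (ball (0 : ℂ) 1) G →
    ∃ h : ℝ → ℝ,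
      IntervalIntegrable h volume 0 (2 * Real.pi) ∧
      (∀ᵐ (θ : ℝ) ∂(volume.restrict (Ioc (0 : ℝ) (2 * Real.pi))),
        Tendsto (fun r : ℝ => Real.log ‖deriv ψ ((r : ℂ) * Complex.exp ((θ : ℂ) * Complex.I))‖)
          (nhdsWithin 1 (Iio 1)) (nhds (h θ))) ∧
      (∀ w ∈ ball (0 : ℂ) 1,
        Real.log ‖deriv ψ w‖ =
          (1 / (2 * Real.pi)) * ∫ θ in (0 : ℝ)..(2 * Real.pi),
            ((1 - ‖w‖ ^ 2) / ‖Complex.exp ((θ : ℂ) * Complex.I) - w‖ ^ 2) * h θ)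

/-- The (interior) opening angle of `G` at the boundary point `z₀` equals `a`:
the angular measure of the set of directions in which `G` is seen from `z₀`
at distance `r` tends to `a` as `r → 0⁺`. -/
def HasCornerAngle (G : Set ℂ) (z₀ : ℂ) (a : ℝ) : Prop :=
  Tendsto (fun r : ℝ =>
      (volume {θ : ℝ | θ ∈ Ico 0 (2 * Real.pi) ∧
        z₀ + (r : ℂ) * Complex.exp ((θ : ℂ) * Complex.I) ∈ G}).toReal)
    (nhdsWithin 0 (Ioi 0)) (nhds a)

/-- The boundary of the Jordan domain `D` is piecewise analytic: it is a union of
finitely many analytic arcs `τ i '' [0,1]` (each `τ i` is conformal, i.e. injective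
and holomorphic, on an open neighborhood `U i` of the segment `[0,1]`), consecutive
arcs are joined at the junction points `τ i 1 = τ (i+1) 0`, and at the junction
point `τ i 1` the exterior angle of `G` is `extAngle i · π` (so the interior
opening angle there is `(2 - extAngle i) · π`). -/
structure PiecewiseAnalyticBoundary (D : JordanDomain) where
  /-- number of analytic arcs -/
  m : ℕ
  m_pos : 0 < m
  /-- conformal parametrizations of the arcs -/
  τ : Fin m → ℂ → ℂ
  /-- neighborhoods of the segment `[0,1]` on which the `τ i` are conformal -/
  U : Fin m → Set ℂ
  U_open : ∀ i, IsOpen (U i)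
  seg_sub : ∀ i, (Complex.ofReal '' Icc (0 : ℝ) 1) ⊆ U i
  analytic : ∀ i, DifferentiableOn ℂ (τ i) (U i)
  inj : ∀ i, InjOn (τ i) (U i)
  cover : (⋃ i, τ i '' (Complex.ofReal '' Icc (0 : ℝ) 1)) = frontier D.G
  junction : ∀ i : Fin m,
    τ i 1 = τ (Fin.mk ((i.val + 1) % m) (Nat.mod_lt _ m_pos)) 0
  /-- `extAngle i · π` is the exterior angle at the junction point `τ i 1` -/
  extAngle : Fin m → ℝ
  extAngle_mem : ∀ i, extAngle i ∈ Ioo (0 : ℝ) 2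
  extAngle_spec : ∀ i, HasCornerAngle D.G (τ i 1) ((2 - extAngle i) * Real.pi)

end

open scoped Topology

local notation "𝟘" => (0:ℝ)
local notation "𝕀c" => Icc (0:ℝ) 1
local notation "𝕀o" => Ioo (0:ℝ) 1
local notation "½" => (1 / 2 : ℝ)
local notation "ℭ" => starRingEnd ℂ
local notation "ℓ" => (by linarith)
local notation "ℓₙ" => (by nlinarith)
local notation "℘" => (by positivity)
local notation:max "ϖ" x:max => x * (1 - x)
local notation "𝕫" => (0:ℂ)
local notation "ħ" => (-(1 / 2) : ℝ)
local notation "𝕥" => 2 * Real.pi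
local notation "𝔰" => (by simp)
local notation "𝔫" => norm_nonneg _
local notation "𝔩" => min_le_left _ _
local notation "𝔯" => min_le_right _ _
local notation "𝔭" => Real.pi / 2

lemma local_pow {f : ℂ → ℂ} {z₀ : ℂ} (hf : AnalyticAt ℂ f z₀)
    (hne : ¬ ∀ᶠ z in 𝓝 z₀, f z = f z₀) :
    ∃ (m : ℕ) (h : ℂ → ℂ), 1 ≤ m ∧ AnalyticAt ℂ h z₀ ∧ h z₀ = 0 ∧ deriv h z₀ ≠ 0 ∧
      ∀ᶠ z in 𝓝 z₀, f z = f z₀ + h z ^ m := by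
  have hf1 : AnalyticAt ℂ (fun z => f z - f z₀) z₀ := hf.sub analyticAt_const
  obtain ⟨n, g, hg, hg0, hfg⟩ := (hf1.exists_eventuallyEq_pow_smul_nonzero_iff).2 (by
    simpa [sub_eq_zero] using hne)
  have hn : n ≠ 0 := by
    rintro rfl
    have := hfg.self_of_nhds
    simp at this; exact hg0 this.symm
  have hsl : g z₀ / g z₀ ∈ slitPlane := by rw [div_self hg0]; simp
  have hA : AnalyticAt ℂ (fun z => (g z₀) ^ ((1:ℂ)/n) * (g z / g z₀) ^ ((1:ℂ)/n)) z₀ :=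
    analyticAt_const.mul ((hg.div analyticAt_const hg0).cpow analyticAt_const hsl)
  set q : ℂ → ℂ := fun z => (g z₀) ^ ((1:ℂ)/n) * (g z / g z₀) ^ ((1:ℂ)/n) with hq
  have hqn : ∀ z, q z ^ n = g z := by
    intro z
    have : (1:ℂ)/n = (n:ℂ)⁻¹ := by simp
    rw [hq]; simp only [this, mul_pow]
    rw [cpow_nat_inv_pow _ hn, cpow_nat_inv_pow _ hn]; field_simp
  have hq0 : q z₀ ≠ 0 := by
    intro h; have := hqn z₀; rw [h, zero_pow hn] at this; exact hg0 this.symm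
  have hd : HasDerivAt (fun z => (z - z₀) * q z) (q z₀) z₀ := by
    have := ((hasDerivAt_id z₀).sub_const z₀).mul hA.differentiableAt.hasDerivAt
    simpa using! this
  refine ⟨n, fun z => (z - z₀) * q z, Nat.one_le_iff_ne_zero.2 hn,
    (analyticAt_id.sub analyticAt_const).mul hA, by simp, by rw [hd.deriv]; exact hq0, ?_⟩
  filter_upwards [hfg] with z hz
  rw [mul_pow, hqn]; rw [smul_eq_mul] at hz; rw [← hz]; ring

lemma deriv_ne_zero_of_inj {f : ℂ → ℂ} {s : Set ℂ} (hs : IsOpen s)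
    (hf : DifferentiableOn ℂ f s) (hi : InjOn f s) {z₀ : ℂ} (hz : z₀ ∈ s) : deriv f z₀ ≠ 0 := by
  have hA : AnalyticAt ℂ f z₀ := hf.analyticAt (hs.mem_nhds hz)
  have hne : ¬ ∀ᶠ z in 𝓝 z₀, f z = f z₀ := by
    intro h
    have h2 : ∀ᶠ z in 𝓝 z₀, z = z₀ := by
      filter_upwards [h, hs.mem_nhds hz] with z h1 h2 using hi h2 hz h1
    have : ∀ᶠ z in 𝓝[≠] z₀, False := by
      filter_upwards [nhdsWithin_le_nhds h2, self_mem_nhdsWithin] with z h1 h2 using h2 h1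
    exact (this.exists).elim fun _ h => h
  obtain ⟨m, h, hm, hh, h0, hd, hfh⟩ := local_pow hA hne
  have hst := hh.hasStrictDerivAt
  rcases Nat.lt_or_ge 1 m with hm1 | hm1
  · exfalso
    have hmap := hst.map_nhds_eq hd
    rw [h0] at hmap
    have hU : {z | z ∈ s ∧ f z = f z₀ + h z ^ m} ∈ 𝓝 z₀ := (hs.mem_nhds hz |> fun h1 => by
      filter_upwards [h1, hfh] with z a b using ⟨a, b⟩)
    have hI : h '' {z | z ∈ s ∧ f z = f z₀ + h z ^ m} ∈ 𝓝 𝕫 := by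
      rw [← hmap]; exact image_mem_map hU
    obtain ⟨ε, hε, hb⟩ := Metric.mem_nhds_iff.1 hI
    set ω := Complex.exp (2 * Real.pi * I / m) with hω
    have hprim := Complex.isPrimitiveRoot_exp m (by omega)
    have h1 : ((ε/2 : ℝ) : ℂ) ∈ ball 𝕫 ε := by
      simp [abs_of_pos hε, hε]
    have hω1 : ‖ω‖ = 1 := hprim.norm'_eq_one (by omega)
    have h2 : ω * ((ε/2 : ℝ) : ℂ) ∈ ball 𝕫 ε := by
      simp [abs_of_pos hε, hε, hω1]
    obtain ⟨z1, ⟨hz1, hf1⟩, he1⟩ := hb h1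
    obtain ⟨z2, ⟨hz2, hf2⟩, he2⟩ := hb h2
    have : f z1 = f z2 := by
      rw [hf1, hf2, he1, he2, mul_pow, hprim.pow_eq_one, one_mul]
    have h12 := hi hz1 hz2 this
    rw [h12, he2] at he1
    have hω' : ω = 1 := by
      have : ((ε/2 : ℝ) : ℂ) ≠ 0 := by exact_mod_cast (by positivity : (ε/2:ℝ) ≠ 0)
      exact mul_right_cancel₀ this (by rw [he1, one_mul])
    exact hprim.ne_one hm1 hω'
  · have hm' : m = 1 := le_antisymm hm1 hm
    subst hm'
    have : f =ᶠ[𝓝 z₀] fun z => f z₀ + h z := by filter_upwards [hfh] with z hz; simpa using hz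
    rw [this.deriv_eq, deriv_const_add]; exact hd

/-- Hopf type lemma. -/
lemma hopf {H : ℂ → ℂ} {x₀ : ℝ} {ρ : ℝ} (hρ : 0 < ρ) (hH : DifferentiableOn ℂ H (ball (x₀:ℂ) ρ))
    (hneg : ∀ z ∈ ball (x₀:ℂ) ρ, 0 < z.im → (H z).re < 0)
    (hre : ∀ z ∈ ball (x₀:ℂ) ρ, z.im = 0 → (H z).re = 0) :
    ∃ c : ℝ, 0 < c ∧ deriv H x₀ = c * I := by
  have hx : (x₀:ℂ) ∈ ball (x₀:ℂ) ρ := mem_ball_self hρ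
  have hA : AnalyticAt ℂ H x₀ := hH.analyticAt (isOpen_ball.mem_nhds hx)
  have hD : HasDerivAt H (deriv H x₀) x₀ := hA.differentiableAt.hasDerivAt
  have hev : ∀ᶠ z in 𝓝 (x₀:ℂ), z ∈ ball (x₀:ℂ) ρ := isOpen_ball.mem_nhds hx
  -- real part of derivative
  have hcr : HasDerivAt (fun t : ℝ => (H (x₀ + t)).re) (deriv H x₀).re 0 := by
    have h1 : HasDerivAt (fun t : ℝ => (x₀:ℂ) + t) 1 0 := by
      simpa using (Complex.ofRealCLM.hasDerivAt (x := 𝟘)).const_add (x₀:ℂ)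
    have h2 : HasDerivAt (fun t : ℝ => H (x₀ + t)) (deriv H x₀ * 1) 0 :=
      HasDerivAt.comp 𝟘 (h₂ := H) (by simpa using hD) h1
    have := (Complex.reCLM.hasFDerivAt.comp_hasDerivAt 𝟘 h2)
    simpa using! this
  have hct : Tendsto (fun t : ℝ => (x₀:ℂ) + t) (𝓝 0) (𝓝 (x₀:ℂ)) := by
    have : Continuous (fun t : ℝ => (x₀:ℂ) + t) := by fun_prop
    simpa using this.tendsto 0
  have hr0 : (deriv H x₀).re = 0 := by
    have : (fun t : ℝ => (H (x₀ + t)).re) =ᶠ[𝓝 0] fun _ => 0 := by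
      filter_upwards [hct hev] with t ht
      exact hre _ ht 𝔰
    exact hcr.unique ((hasDerivAt_const 𝟘 𝟘).congr_of_eventuallyEq this)
  have hne : ¬ ∀ᶠ z in 𝓝 (x₀:ℂ), H z = H x₀ := by
    intro h
    obtain ⟨ε, hε, hb⟩ := Metric.mem_nhds_iff.1 (inter_mem h hev)
    have h1 : (x₀:ℂ) + (ε/2:ℝ) * I ∈ ball (x₀:ℂ) ε := by
      simp [abs_of_pos hε, hε]
    have := hneg _ (hb h1).2 (by simp [hε])
    rw [(hb h1).1, hre _ hx 𝔰] at this
    exact lt_irrefl _ this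
  obtain ⟨m, h, hm, hh, h0, hd, hfh⟩ := local_pow hA hne
  set d := deriv h x₀ with hdd
  -- for every direction e with im e > 0, Re ((d e)^m) ≤ 0
  have key : ∀ e : ℂ, 0 < e.im → ((d * e) ^ m).re ≤ 0 := by
    intro e he
    have hline : HasDerivAt (fun t : ℝ => h (x₀ + t * e)) (d * e) 0 := by
      have h1 : HasDerivAt (fun t : ℝ => (x₀:ℂ) + t * e) (1 * e) 0 :=
        ((Complex.ofRealCLM.hasDerivAt (x := 𝟘)).mul_const e).const_add (x₀:ℂ)
      rw [one_mul] at h1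
      exact HasDerivAt.comp 𝟘 (h₂ := h) (by rw [ofReal_zero, zero_mul, add_zero]; exact hh.differentiableAt.hasDerivAt) h1
    have hsl : Tendsto (fun t : ℝ => (((t:ℂ)⁻¹ * h (x₀ + t * e)) ^ m).re) (𝓝[>] 0)
        (𝓝 ((d * e) ^ m).re) := by
      have h2 := hline.tendsto_slope_zero_right
      have h3 : Tendsto (fun t : ℝ => (t:ℂ)⁻¹ * h (x₀ + t * e)) (𝓝[>] 0) (𝓝 (d * e)) := by
        refine h2.congr fun t => ?_
        simp [h0]
      exact (Complex.continuous_re.tendsto _).comp (h3.pow m)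
    refine le_of_tendsto hsl ?_
    have hct2 : Tendsto (fun t : ℝ => (x₀:ℂ) + t * e) (𝓝[>] 0) (𝓝 (x₀:ℂ)) := by
      have : Continuous (fun t : ℝ => (x₀:ℂ) + t * e) := by fun_prop
      simpa using (this.tendsto 0).mono_left nhdsWithin_le_nhds
    filter_upwards [hct2 (inter_mem hfh hev), self_mem_nhdsWithin] with t ht ht0
    have ht0' : 𝟘 < t := ht0
    have h3 := hneg _ ht.2 (by simp; positivity)
    have h4 : H (x₀ + t * e) = H x₀ + h (x₀ + t * e) ^ m := ht.1
    rw [h4, add_re, hre _ hx 𝔰, zero_add] at h3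
    rw [mul_pow, ← ofReal_inv, ← ofReal_pow, re_ofReal_mul]
    exact mul_nonpos_of_nonneg_of_nonpos ℘ h3.le
  have hm1 : m = 1 := by
    by_contra hm1
    have hm2 : 2 ≤ m := by omega
    -- choose direction
    have hmR : (2:ℝ) ≤ m := by exact_mod_cast hm2
    have hmp : 𝟘 < m := by linarith
    -- e = exp(iθ), θ ∈ (0,π), with Re ((d e)^m) = |d|^m cos(m (arg d + θ)) > 0
    have : ∃ θ : ℝ, 0 < θ ∧ θ < Real.pi ∧ 0 < Real.cos (m * (arg d + θ)) := by
      by_contra hcon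
      push Not at hcon
      have hpi := Real.pi_pos
      have c1 := hcon (Real.pi / (4*m)) ℘ (by
        rw [div_lt_iff₀ ℘]; nlinarith)
      have c2 := hcon (Real.pi / (4*m) + Real.pi / (2*m)) ℘ (by
        rw [← sub_pos]
        have : Real.pi - (Real.pi / (4*m) + Real.pi / (2*m)) = Real.pi / (4*m) * (4*m-3) := by
          field_simp; ring
        rw [this]; apply mul_pos ℘; linarith)
      have c3 := hcon (Real.pi / (4*m) + Real.pi / m) ℘ (by
        rw [← sub_pos]
        have : Real.pi - (Real.pi / (4*m) + Real.pi / m) = Real.pi / (4*m) * (4*m-5) := by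
          field_simp; ring
        rw [this]; apply mul_pos ℘; linarith)
      set A := m * (arg d + Real.pi / (4*m)) with hAdef
      have e2 : m * (arg d + (Real.pi / (4*m) + Real.pi / (2*m))) = A + Real.pi/2 := by
        rw [hAdef]; field_simp; ring
      have e3 : m * (arg d + (Real.pi / (4*m) + Real.pi / m)) = A + Real.pi := by
        rw [hAdef]; field_simp; ring
      rw [e2, Real.cos_add_pi_div_two] at c2
      rw [e3, Real.cos_add_pi] at c3
      have hc0 : Real.cos A = 0 := by linarith
      have hs1 : Real.sin A = 1 := by
        have := Real.sin_sq_add_cos_sq A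
        rw [hc0] at this
        nlinarith
      -- perturb: θ = π/(2m) gives cos (A + π/4)... use π/(4m)+5π/(4m)
      have c4 := hcon (Real.pi / (4*m) + 5 * Real.pi / (4*m)) ℘ (by
        rw [← sub_pos]
        have : Real.pi - (Real.pi / (4*m) + 5 * Real.pi / (4*m)) = Real.pi / (4*m) * (4*m-6) := by
          field_simp; ring
        rw [this]; apply mul_pos ℘; linarith)
      have e4 : m * (arg d + (Real.pi / (4*m) + 5 * Real.pi / (4*m))) = A + Real.pi/4 + Real.pi := by
        rw [hAdef]; field_simp; ring
      rw [e4, Real.cos_add_pi, Real.cos_add, hc0, hs1, Real.sin_pi_div_four] at c4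
      have : 0 < Real.sqrt 2 := by positivity
      linarith
    obtain ⟨θ, h1, h2, h3⟩ := this
    have := key (exp (θ * I)) (by rw [exp_ofReal_mul_I_im]; exact Real.sin_pos_of_pos_of_lt_pi h1 h2)
    have e : (d * exp (θ * I)) ^ m = ((‖d‖ ^ m : ℝ) : ℂ) * exp (((m * (arg d + θ) : ℝ) : ℂ) * I) := by
      conv_lhs => rw [← norm_mul_exp_arg_mul_I d]
      rw [mul_assoc, ← Complex.exp_add, mul_pow, ← Complex.exp_nat_mul]
      push_cast; ring_nf
    rw [e, re_ofReal_mul, exp_ofReal_mul_I_re] at this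
    have hpos : 0 < ‖d‖ ^ m := pow_pos (norm_pos_iff.2 hd) _
    nlinarith [mul_pos hpos h3]
  subst hm1
  have hHd : deriv H x₀ = d := by
    have : H =ᶠ[𝓝 (x₀:ℂ)] fun z => H x₀ + h z := by filter_upwards [hfh] with z hz; simpa using hz
    rw [this.deriv_eq, deriv_const_add]
  have hk := key I 𝔰
  simp at hk
  rw [hHd] at hr0 ⊢
  have him : d.im ≠ 0 := fun h => hd (Complex.ext hr0 h)
  exact ⟨d.im, lt_of_le_of_ne hk him.symm, Complex.ext (by simp [hr0]) 𝔰⟩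

/-- General maximum principle with limsup boundary condition. -/
lemma maxp {V : Set ℂ} (hV : IsOpen V) (hb : Bornology.IsBounded V) {g : ℂ → ℂ}
    (hg : DifferentiableOn ℂ g V) {A : ℝ}
    (h : ∀ w ∈ frontier V, ∀ A' > A, ∀ᶠ z in 𝓝[V] w, ‖g z‖ ≤ A') : ∀ z ∈ V, ‖g z‖ ≤ A := by
  intro z hz
  refine le_of_forall_gt_imp_ge_of_dense fun A' hA' => ?_
  by_contra hcon
  push Not at hcon
  set V' := V ∩ {z | A' < ‖g z‖} with hV'
  have hVo' : IsOpen V' := hg.continuousOn.norm.isOpen_inter_preimage hV isOpen_Ioi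
  have hcl : closure V' ⊆ V := by
    intro w hw
    by_contra hwV
    have hwc : w ∈ closure V := closure_mono inter_subset_left hw
    have hwf : w ∈ frontier V := by rw [hV.frontier_eq]; exact ⟨hwc, hwV⟩
    have h1 := h w hwf A' hA'
    have h2 : ∀ᶠ z in 𝓝[V'] w, False := by
      filter_upwards [nhdsWithin_mono w (inter_subset_left : V' ⊆ V) h1, self_mem_nhdsWithin]
        with z h3 h4
      exact absurd h4.2 (not_lt.2 h3)
    rw [mem_closure_iff_nhdsWithin_neBot] at hw
    exact h2.exists.elim fun _ h => h
  have hd : DiffContOnCl ℂ g V' := (hg.mono hcl).diffContOnCl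
  have := Complex.norm_le_of_forall_mem_frontier_norm_le (hb.subset inter_subset_left) hd
    (C := A') (fun w hw => by
      by_contra hc
      push Not at hc
      have : w ∈ V' := ⟨hcl hw.1, hc⟩
      rw [hVo'.frontier_eq] at hw
      exact hw.2 this) (subset_closure ⟨hz, hcon⟩ : z ∈ closure V')
  linarith

lemma circle_approx {F : ℂ → ℝ} {r : ℝ} (hr : 0 < r) (hF : ContinuousOn F (sphere 0 r)) {ε : ℝ}
    (hε : 0 < ε) : ∃ P : Polynomial ℂ, ∀ z ∈ sphere 𝕫 r, |F z - (P.eval z).re| ≤ ε := by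
  have : Fact (0 < 2 * Real.pi) := ⟨Real.two_pi_pos⟩
  have hc : Continuous (fun t : AddCircle 𝕥 =>
      ((F (r * (AddCircle.toCircle t : ℂ)) : ℝ) : ℂ)) := by
    refine Complex.continuous_ofReal.comp (hF.comp_continuous (by fun_prop) fun t => ?_)
    simp [abs_of_pos hr, Circle.norm_coe]
  let f : C(AddCircle 𝕥, ℂ) := ⟨_, hc⟩
  have hf : f ∈ (Submodule.span ℂ (range (@fourier 𝕥))).topologicalClosure := by
    rw [span_fourier_closure_eq_top]; trivial
  obtain ⟨g, hg, hfg⟩ := Metric.mem_closure_iff.1 hf ε hε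
  have key : ∀ g ∈ Submodule.span ℂ (range (@fourier 𝕥)), ∃ P Q : Polynomial ℂ,
      ∀ t, g t = P.eval (r * (AddCircle.toCircle t : ℂ)) +
        ℭ (Q.eval (r * (AddCircle.toCircle t : ℂ))) := by
    intro g hg
    induction hg using Submodule.span_induction with
    | mem x hx =>
      obtain ⟨n, rfl⟩ := hx
      have hrc : (r:ℂ) ≠ 0 := by exact_mod_cast hr.ne'
      rcases Int.eq_nat_or_neg n with ⟨k, rfl | rfl⟩
      · refine ⟨Polynomial.C ((r:ℂ)⁻¹ ^ k) * Polynomial.X ^ k, 0, fun t => ?_⟩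
        simp [fourier_apply, mul_pow, hrc, AddCircle.toCircle_nsmul]
      · refine ⟨0, Polynomial.C ((r:ℂ)⁻¹ ^ k) * Polynomial.X ^ k, fun t => ?_⟩
        simp [fourier_apply, mul_pow, hrc, AddCircle.toCircle_nsmul, AddCircle.toCircle_neg,
          ← Circle.coe_inv_eq_conj]
    | zero => exact ⟨0, 0, fun t => by simp⟩
    | add x y _ _ hx hy =>
      obtain ⟨P, Q, h1⟩ := hx; obtain ⟨P', Q', h2⟩ := hy
      exact ⟨P + P', Q + Q', fun t => by simp [h1, h2]; ring⟩
    | smul c x _ hx =>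
      obtain ⟨P, Q, h1⟩ := hx
      exact ⟨Polynomial.C c * P, Polynomial.C (ℭ c) * Q, fun t => by
        simp [h1]; ring⟩
  obtain ⟨P, Q, hPQ⟩ := key g hg
  refine ⟨P + Q, fun z hz => ?_⟩
  have hz' : ‖z‖ = r := by simpa using hz
  have hzz : z = r * (AddCircle.toCircle ((arg z : ℝ) : AddCircle 𝕥) : ℂ) := by
    rw [AddCircle.toCircle_apply_mk, Circle.coe_exp, ← hz']
    have : 2 * Real.pi / 𝕥 = 1 := div_self Real.two_pi_pos.ne'
    rw [this, one_mul]
    exact (norm_mul_exp_arg_mul_I z).symm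
  have h1 := (ContinuousMap.dist_lt_iff hε).1 hfg ((arg z : ℝ) : AddCircle 𝕥)
  rw [hPQ, Complex.dist_eq] at h1
  have h2 : f ((arg z : ℝ) : AddCircle 𝕥) = (F z : ℂ) := by
    change ((F (r * _) : ℝ) : ℂ) = _
    rw [← hzz]
  rw [h2, ← hzz] at h1
  have h3 := (Complex.abs_re_le_norm _).trans h1.le
  simpa using h3

/-- Reflection lemma on the unit disc. -/
lemma reflect_unit {h : ℂ → ℂ} {M : ℝ} (hM : 0 < M)
    (hd : DifferentiableOn ℂ h (ball 0 1 ∩ {z | 0 < z.im}))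
    (h0 : ∀ z ∈ ball 𝕫 1 ∩ {z | 0 < z.im}, h z ≠ 0 ∧ -Real.log ‖h z‖ ≤ M ∧ ‖h z‖ < 1)
    (hl : ∀ x ∈ ball 𝕫 1, x.im = 0 →
      Tendsto (fun z => ‖h z‖) (𝓝[{z | 0 < z.im}] x) (𝓝 1)) :
    ∃ H : ℂ → ℂ, DifferentiableOn ℂ H (ball 0 (1/2)) ∧
      (∀ z ∈ ball 𝕫 (1/2), 0 < z.im → h z = exp (H z)) ∧
      (∀ z ∈ ball 𝕫 (1/2), H (ℭ z) = - ℭ (H z)) ∧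
      (∀ z ∈ ball 𝕫 (1/2), ‖H z - H 0‖ ≤ 2 * M * ‖z‖ / (1/2 - ‖z‖)) := by
  set W : Set ℂ := ball 0 1 ∩ {z | 0 < z.im} with hW
  have hWo : IsOpen W := isOpen_ball.inter (isOpen_lt continuous_const Complex.continuous_im)
  set u : ℂ → ℝ := fun z => if 0 < z.im then Real.log ‖h z‖ else 0 with hu
  set U : ℂ → ℝ := fun z => u z - u (ℭ z) with hU
  have hUodd : ∀ z, U (ℭ z) = - U z := fun z => by simp [hU]
  have hUpos : ∀ z, 0 < z.im → U z = Real.log ‖h z‖ := fun z hz => by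
    simp [hU, hu, hz, not_lt.2 hz.le]
  have huc : ContinuousOn u (ball 0 1) := by
    intro x hx
    rcases lt_trichotomy x.im 0 with hx0 | hx0 | hx0
    · refine ContinuousAt.continuousWithinAt ?_
      have : u =ᶠ[𝓝 x] fun _ => 0 := by
        filter_upwards [(isOpen_lt Complex.continuous_im continuous_const).mem_nhds hx0] with z hz
        have hz' : z.im < 0 := hz
        simp [hu, not_lt.2 hz'.le]
      exact continuousAt_const.congr this.symm
    · refine ContinuousAt.continuousWithinAt ?_
      have hux : u x = 0 := by simp [hu, hx0]
      rw [ContinuousAt, hux]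
      refine Tendsto.if ?_ tendsto_const_nhds
      have := (Real.continuousAt_log one_ne_zero).tendsto.comp (hl x hx hx0)
      rw [Real.log_one] at this
      exact this
    · refine ContinuousAt.continuousWithinAt ?_
      have hxW : x ∈ W := ⟨hx, hx0⟩
      have : u =ᶠ[𝓝 x] fun z => Real.log ‖h z‖ := by
        filter_upwards [hWo.mem_nhds hxW] with z hz
        simp [hu, show 0 < z.im from hz.2]
      have hc : ContinuousAt h x := (hd.continuousOn.continuousAt (hWo.mem_nhds hxW))
      exact ((hc.norm.log (norm_ne_zero_iff.2 (h0 x hxW).1))).congr this.symm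
  have hUc : ContinuousOn U (ball 0 1) := huc.sub (huc.comp (by fun_prop) fun z hz => by
    simpa using hz)
  have hUM : ∀ z ∈ ball 𝕫 1, |U z| ≤ M := by
    have hp : ∀ z ∈ ball 𝕫 1, 0 < z.im → |U z| ≤ M := by
      intro z hz hz0
      have := h0 z ⟨hz, hz0⟩
      rw [hUpos z hz0, abs_of_nonpos (Real.log_nonpos 𝔫 this.2.2.le)]
      exact this.2.1
    intro z hz
    rcases lt_trichotomy z.im 0 with hx0 | hx0 | hx0
    · have := hp (ℭ z) (by simpa using hz) (by simpa using hx0)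
      rwa [hUodd, abs_neg] at this
    · have : U z = 0 := by simp [hU, hu, hx0]
      simp [this, hM.le]
    · exact hp z hz hx0
  -- approximation
  have happ : ∀ ε > 0, ∃ p : ℂ → ℂ, Differentiable ℂ p ∧ p 0 = 0 ∧
      (∀ z, p (ℭ z) = - ℭ (p z)) ∧
      ∀ z ∈ ball 𝕫 (3/4), |U z - (p z).re| ≤ ε := by
    intro ε hε
    obtain ⟨P, hP⟩ := circle_approx (r := 3/4) (by norm_num)
      (hUc.mono (sphere_subset_ball (by norm_num))) hε
    set Pc : Polynomial ℂ := P.map ℭ with hPc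
    have hPce : ∀ z, Pc.eval z = ℭ (P.eval (ℭ z)) := by
      intro z
      have := Polynomial.eval_map_apply ℭ (p := P) (ℭ z)
      simpa using this
    set q : ℂ → ℂ := fun z => (P.eval z - Pc.eval z) / 2 with hq
    have hqd : Differentiable ℂ q := by
      simp only [hq]; exact (P.differentiable.sub Pc.differentiable).div_const 2
    have hqre : ∀ z, (q z).re = ((P.eval z).re - (P.eval (ℭ z)).re) / 2 := by
      intro z; simp only [hq, hPce]
      rw [show (2:ℂ) = ((2:ℝ):ℂ) by norm_num, Complex.div_ofReal_re]; simp
    have hqs2 : ∀ z, q (ℭ z) = - ℭ (q z) := by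
      intro z; simp only [hq, hPce, map_div₀, map_sub, map_ofNat, Complex.conj_conj]; ring
    have hqodd : ∀ z, (q (ℭ z)).re = - (q z).re := by
      intro z; rw [hqre, hqre]; simp; ring
    have hqs : ∀ z ∈ sphere 𝕫 (3/4), |U z - (q z).re| ≤ ε := by
      intro z hz
      have h1 := hP z hz
      have h2 := hP (ℭ z) (by simpa using hz)
      rw [hUodd] at h2
      rw [hqre]
      rw [abs_le] at *
      constructor <;> linarith [h1.1, h1.2, h2.1, h2.2]
    have hpos : ∀ z ∈ ball 𝕫 (3/4), 0 < z.im → |U z - (q z).re| ≤ ε := by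
      set V : Set ℂ := ball 0 (3/4) ∩ {z | 0 < z.im} with hV
      have hVW : V ⊆ W := inter_subset_inter_left _ (ball_subset_ball (by norm_num))
      have hVo : IsOpen V := isOpen_ball.inter (isOpen_lt continuous_const Complex.continuous_im)
      have hVb : Bornology.IsBounded V := isBounded_ball.subset inter_subset_left
      have hfr : ∀ w ∈ frontier V, w ∈ ball 𝕫 1 ∧ |U w - (q w).re| ≤ ε := by
        intro w hw
        have hwc : w ∈ closedBall 𝕫 (3/4) :=
          closure_minimal (inter_subset_left.trans ball_subset_closedBall) isClosed_closedBall hw.1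
        have hwi : 0 ≤ w.im := by
          have : closure V ⊆ {z : ℂ | 0 ≤ z.im} := closure_minimal
            (fun z hz => (show 𝟘 ≤ z.im from le_of_lt hz.2)) (isClosed_le continuous_const Complex.continuous_im)
          exact this hw.1
        refine ⟨closedBall_subset_ball (by norm_num) hwc, ?_⟩
        rcases eq_or_lt_of_le (mem_closedBall.1 hwc) with h1 | h1
        · exact hqs w h1
        · have : w.im = 0 := by
            by_contra hne
            have : w ∈ V := ⟨h1, lt_of_le_of_ne hwi (Ne.symm hne)⟩
            rw [hVo.frontier_eq] at hw; exact hw.2 this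
          have hcw : ℭ w = w := Complex.conj_eq_iff_im.2 this
          have e1 := hUodd w
          have e2 := hqodd w
          rw [hcw] at e1 e2
          have : U w = 0 := by linarith
          have h3 : (q w).re = 0 := by linarith
          simp [this, h3, hε.le]
      have hNc : ∀ w ∈ ball 𝕫 1, ContinuousAt (fun z => U z - (q z).re) w := fun w hw =>
        (hUc.continuousAt (isOpen_ball.mem_nhds hw)).sub
          (Complex.continuous_re.continuousAt.comp hqd.continuous.continuousAt)
      have hlog : ∀ z ∈ V, ‖h z * exp (-q z)‖ = Real.exp (U z - (q z).re) := by
        intro z hz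
        have hz0 := (h0 z (hVW hz)).1
        rw [norm_mul, Complex.norm_exp, hUpos z hz.2, Real.exp_sub, Real.exp_log (norm_pos_iff.2 hz0),
          neg_re, Real.exp_neg]; rfl
      have hlog' : ∀ z ∈ V, ‖(h z)⁻¹ * exp (q z)‖ = Real.exp (-(U z - (q z).re)) := by
        intro z hz
        rw [Real.exp_neg, ← hlog z hz, norm_mul, norm_mul, mul_inv, norm_inv, Complex.norm_exp,
          Complex.norm_exp, neg_re, Real.exp_neg, inv_inv]
      have m1 := maxp hVo hVb (g := fun z => h z * exp (-q z)) (A := Real.exp ε)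
        ((hd.mono hVW).mul (hqd.neg.cexp.differentiableOn)) (by
          intro w hw A' hA'
          have h1 := (Real.continuous_exp.continuousAt.comp (hNc w (hfr w hw).1)).tendsto
          have h2 : Real.exp (U w - (q w).re) < A' :=
            lt_of_le_of_lt (Real.exp_le_exp.2 (abs_le.1 (hfr w hw).2).2) hA'
          filter_upwards [nhdsWithin_le_nhds (h1.eventually_lt_const h2), self_mem_nhdsWithin]
            with z hz hzV
          rw [hlog z hzV]; exact hz.le)
      have m2 := maxp hVo hVb (g := fun z => (h z)⁻¹ * exp (q z)) (A := Real.exp ε)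
        (((hd.mono hVW).inv fun z hz => (h0 z (hVW hz)).1).mul (hqd.cexp.differentiableOn)) (by
          intro w hw A' hA'
          have h1 := (Real.continuous_exp.continuousAt.comp (hNc w (hfr w hw).1).neg).tendsto
          have h2 : Real.exp (-(U w - (q w).re)) < A' :=
            lt_of_le_of_lt (Real.exp_le_exp.2 (by linarith [(abs_le.1 (hfr w hw).2).1])) hA'
          filter_upwards [nhdsWithin_le_nhds (h1.eventually_lt_const h2), self_mem_nhdsWithin]
            with z hz hzV
          rw [hlog' z hzV]; exact hz.le)
      intro z hz hz0
      have a1 := m1 z ⟨hz, hz0⟩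
      have a2 := m2 z ⟨hz, hz0⟩
      simp only [hlog z ⟨hz, hz0⟩, hlog' z ⟨hz, hz0⟩, Real.exp_le_exp] at a1 a2
      rw [abs_le]; constructor <;> linarith
    refine ⟨fun z => q z - q 0, hqd.sub_const _, by simp, fun z => by
      have h1 := hqs2 0
      rw [map_zero] at h1
      change q _ - q 0 = - ℭ (q z - q 0)
      rw [map_sub, hqs2 z]
      linear_combination -h1, fun z hz => ?_⟩
    have hq0 : (q 0).re = 0 := by have := hqodd 0; simp at this; linarith
    rw [sub_re, hq0, sub_zero]
    rcases lt_trichotomy z.im 0 with hx0 | hx0 | hx0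
    · have := hpos (ℭ z) (by simpa using hz) (by simpa using hx0)
      rw [hUodd, hqodd] at this
      rw [← abs_neg]; convert this using 2; ring
    · have hcw : ℭ z = z := Complex.conj_eq_iff_im.2 hx0
      have e1 := hUodd z
      have e2 := hqodd z
      rw [hcw] at e1 e2
      have : U z = 0 := by linarith
      have h3 : (q z).re = 0 := by linarith
      simp [this, h3, hε.le]
    · exact hpos z hz hx0
  choose! p hpd hp0 hps hpU using happ
  set P : ℕ → ℂ → ℂ := fun k => p (1 / ((k:ℝ) + 1)) with hP
  have hpos : ∀ k : ℕ, 0 < 1 / ((k:ℝ) + 1) := fun k => by positivity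
  have hBC : ∀ k l : ℕ, ∀ z ∈ ball 𝕫 (1/2), ‖P k z - P l z‖ ≤
      4 * (1 / ((k:ℝ) + 1) + 1 / ((l:ℝ) + 1)) := by
    intro k l z hz
    have hMp : 0 < 1 / ((k:ℝ) + 1) + 1 / ((l:ℝ) + 1) := add_pos (hpos k) (hpos l)
    have := Complex.borelCaratheodory_zero (f := fun z => P k z - P l z) (R := 3/4) hMp
      ((hpd _ (hpos k)).sub (hpd _ (hpos l))).differentiableOn (fun w hw => by
        have h1 := abs_le.1 (hpU _ (hpos k) w hw)
        have h2 := abs_le.1 (hpU _ (hpos l) w hw)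
        simp only [mem_ofPred_eq, sub_re]
        change (p (1 / ((k:ℝ) + 1)) w).re - (p (1 / ((l:ℝ) + 1)) w).re ≤ _
        linarith [h1.1, h2.2]) (by norm_num) (ball_subset_ball (by norm_num) hz)
        (by change p _ 0 - p _ 0 = 0; rw [hp0 _ (hpos k), hp0 _ (hpos l), sub_zero])
    refine this.trans ?_
    have hz' : ‖z‖ < 1/2 := by simpa using hz
    rw [div_le_iff₀ ℓ]
    nlinarith [norm_nonneg z]
  have hlim : ∀ z ∈ ball 𝕫 (1/2), ∃ a, Tendsto (fun k => P k z) atTop (𝓝 a) := by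
    intro z hz
    refine cauchySeq_tendsto_of_complete (cauchySeq_of_le_tendsto_0
      (fun n : ℕ => 8 * (1 / ((n:ℝ) + 1))) (fun k l N hk hl => ?_) ?_)
    · rw [dist_eq_norm]
      refine (hBC k l z hz).trans ?_
      have h1 : 1 / ((k:ℝ) + 1) ≤ 1 / ((N:ℝ) + 1) := by gcongr
      have h2 : 1 / ((l:ℝ) + 1) ≤ 1 / ((N:ℝ) + 1) := by gcongr
      linarith
    · simpa using (tendsto_one_div_add_atTop_nhds_zero_nat (𝕜 := ℝ)).const_mul 8
  choose! H1 hH1 using hlim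
  have hunif : TendstoUniformlyOn P H1 atTop (ball 0 (1/2)) := by
    rw [Metric.tendstoUniformlyOn_iff]
    intro ε hε
    have h8 : Tendsto (fun n : ℕ => 4 * (1 / ((n:ℝ) + 1))) atTop (𝓝 0) := by
      simpa using (tendsto_one_div_add_atTop_nhds_zero_nat (𝕜 := ℝ)).const_mul 4
    filter_upwards [h8.eventually_lt_const hε] with n hn z hz
    have : Tendsto (fun k : ℕ => 4 * (1 / ((k:ℝ) + 1) + 1 / ((n:ℝ) + 1))) atTop
        (𝓝 (4 * (0 + 1 / ((n:ℝ) + 1)))) :=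
      ((tendsto_one_div_add_atTop_nhds_zero_nat (𝕜 := ℝ)).add_const _).const_mul 4
    have h2 := le_of_tendsto_of_tendsto (((hH1 z hz).sub_const (P n z)).norm) this
      (Eventually.of_forall fun k => hBC k n z hz)
    rw [dist_eq_norm]
    rw [zero_add] at h2
    linarith
  have hH1d : DifferentiableOn ℂ H1 (ball 0 (1/2)) :=
    hunif.tendstoLocallyUniformlyOn.differentiableOn
      (Eventually.of_forall fun k => (hpd _ (hpos k)).differentiableOn) isOpen_ball
  have hH1re : ∀ z ∈ ball 𝕫 (1/2), (H1 z).re = U z := by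
    intro z hz
    have h1 : Tendsto (fun k => (P k z).re) atTop (𝓝 (H1 z).re) :=
      (Complex.continuous_re.tendsto _).comp (hH1 z hz)
    refine tendsto_nhds_unique h1 ?_
    rw [tendsto_iff_norm_sub_tendsto_zero]
    refine squeeze_zero (fun _ => norm_nonneg _) (fun k => ?_)
      (tendsto_one_div_add_atTop_nhds_zero_nat (𝕜 := ℝ))
    rw [Real.norm_eq_abs, abs_sub_comm]
    exact hpU _ (hpos k) z (ball_subset_ball (by norm_num) hz)
  -- unimodular constant
  set V : Set ℂ := ball 0 (1/2) ∩ {z | 0 < z.im} with hV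
  have hVo : IsOpen V := isOpen_ball.inter (isOpen_lt continuous_const Complex.continuous_im)
  have hVW : V ⊆ W := inter_subset_inter_left _ (ball_subset_ball (by norm_num))
  have hVc : IsPreconnected V :=
    ((convex_ball _ _).inter (convex_halfSpace_im_gt 0)).isPreconnected
  have hg1 : ∀ z ∈ V, ‖h z * exp (-H1 z)‖ = 1 := by
    intro z hz
    rw [norm_mul, Complex.norm_exp, neg_re, hH1re z hz.1, hUpos z hz.2, Real.exp_neg,
      Real.exp_log (norm_pos_iff.2 (h0 z (hVW hz)).1),
      mul_inv_cancel₀ (norm_ne_zero_iff.2 (h0 z (hVW hz)).1)]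
  have hz1 : (I/4 : ℂ) ∈ V := by
    constructor
    · simp; norm_num
    · simp
  have hconst := Complex.eqOn_of_isPreconnected_of_isMaxOn_norm hVc hVo
    (f := fun z => h z * exp (-H1 z))
    ((hd.mono hVW).mul ((hH1d.mono inter_subset_left).neg.cexp)) hz1 (fun z hz => by
      simp only [mem_ofPred_eq, Function.comp, hg1 z hz, hg1 _ hz1, le_refl])
  set c := h (I/4) * exp (-H1 (I/4)) with hc
  have hcn : ‖c‖ = 1 := hg1 _ hz1
  have hc0 : c ≠ 0 := norm_ne_zero_iff.1 (by rw [hcn]; norm_num)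
  have hlc : (log c).re = 0 := by rw [log_re, hcn, Real.log_one]
  refine ⟨fun z => H1 z + log c, hH1d.add_const _, fun z hz hz0 => ?_, fun z hz => ?_,
    fun z hz => ?_⟩
  · have h1 : h z * exp (-H1 z) = c := hconst ⟨hz, hz0⟩
    rw [Complex.exp_add, exp_log hc0, ← h1, Complex.exp_neg]
    field_simp [Complex.exp_ne_zero]
  · have hz' : ℭ z ∈ ball 𝕫 (1/2) := by simpa using hz
    have h1 : H1 (ℭ z) = - ℭ (H1 z) := by
      refine tendsto_nhds_unique (hH1 _ hz') ?_
      refine (((Complex.continuous_conj.tendsto _).comp (hH1 z hz)).neg).congr fun k => ?_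
      exact (hps _ (hpos k) z).symm
    have h2 : ℭ (log c) = - log c := by
      apply Complex.ext <;> simp [hlc]
    change H1 _ + log c = - ℭ (H1 z + log c)
    rw [map_add, h1, h2]; ring
  · have h0' : 𝕫 ∈ ball 𝕫 (1/2) := by simp
    have hU0 : U 0 = 0 := by simp [hU, hu]
    have := Complex.borelCaratheodory_zero (f := fun z => H1 z - H1 0) (R := 1/2) hM
      (hH1d.sub_const _) (fun w hw => by
        simp only [mem_ofPred_eq, sub_re, hH1re w hw, hH1re 0 h0', hU0, sub_zero]
        exact (abs_le.1 (hUM w (ball_subset_ball (by norm_num) hw))).2) (by norm_num) hz 𝔰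
    simpa using this

lemma reflect_ball {h : ℂ → ℂ} {x ρ M : ℝ} (hρ : 0 < ρ) (hM : 0 < M)
    (hd : DifferentiableOn ℂ h (ball (x:ℂ) ρ ∩ {z | 0 < z.im}))
    (h0 : ∀ z ∈ ball (x:ℂ) ρ, 0 < z.im → h z ≠ 0 ∧ -Real.log ‖h z‖ ≤ M ∧ ‖h z‖ < 1)
    (hl : ∀ y ∈ ball (x:ℂ) ρ, y.im = 0 →
      Tendsto (fun z => ‖h z‖) (𝓝[{z | 0 < z.im}] y) (𝓝 1)) :
    ∃ H : ℂ → ℂ, DifferentiableOn ℂ H (ball (x:ℂ) (ρ/4)) ∧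
      (∀ z ∈ ball (x:ℂ) (ρ/4), 0 < z.im → h z = exp (H z)) ∧
      (∀ z ∈ ball (x:ℂ) (ρ/4), H (ℭ z) = - ℭ (H z)) ∧
      (∀ z ∈ ball (x:ℂ) (ρ/4), |(H z).re| ≤ 2 * M) ∧
      (∀ z ∈ ball (x:ℂ) (ρ/8), ‖deriv H z‖ ≤ 16 * M / ρ) := by
  have hρc : (ρ:ℂ) ≠ 0 := by exact_mod_cast hρ.ne'
  have hm : ∀ (w : ℂ), w ∈ ball 𝕫 1 → (x:ℂ) + ρ * w ∈ ball (x:ℂ) ρ := by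
    intro w hw
    have : ‖w‖ < 1 := by simpa using hw
    rw [mem_ball_iff_norm, add_sub_cancel_left, norm_mul, norm_real, Real.norm_of_nonneg hρ.le]
    nlinarith
  have hi : ∀ w : ℂ, ((x:ℂ) + ρ * w).im = ρ * w.im := fun w => by simp
  have hm' : ∀ r : ℝ, ∀ z ∈ ball (x:ℂ) (ρ * r), (z - x) / ρ ∈ ball 𝕫 r := by
    intro r z hz
    rw [mem_ball_iff_norm] at hz
    rw [mem_ball_zero_iff, norm_div, norm_real, Real.norm_of_nonneg hρ.le, div_lt_iff₀ hρ]
    linarith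
  obtain ⟨H, H1, H2, H3, H4⟩ := reflect_unit (h := fun w => h (x + ρ * w)) hM
    (hd.comp (by fun_prop) fun w hw => ⟨hm w hw.1, by
      have : 0 < w.im := hw.2
      change 0 < ((x:ℂ) + ρ * w).im
      rw [hi]; positivity⟩)
    (fun w hw => h0 _ (hm w hw.1) (by
      have : 0 < w.im := hw.2
      rw [hi]; positivity))
    (fun w hw hw0 => by
      have h1 := hl _ (hm w hw) (by rw [hi, hw0, mul_zero])
      refine h1.comp (tendsto_nhdsWithin_iff.2 ⟨?_, ?_⟩)
      · exact (Continuous.tendsto (by fun_prop) w).mono_left nhdsWithin_le_nhds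
      · filter_upwards [self_mem_nhdsWithin] with v hv
        have : 0 < v.im := hv
        change 0 < ((x:ℂ) + ρ * v).im
        rw [hi]; positivity)
  have hin : ∀ z ∈ ball (x:ℂ) (ρ/4), (z - x) / ρ ∈ ball 𝕫 (1/4) := fun z hz =>
    hm' _ z (by convert hz using 2; ring)
  have hin2 : ∀ z ∈ ball (x:ℂ) (ρ/4), (z - x) / ρ ∈ ball 𝕫 (1/2) := fun z hz =>
    ball_subset_ball (by norm_num) (hin z hz)
  have hHd : DifferentiableOn ℂ (fun z => H ((z - x) / ρ)) (ball (x:ℂ) (ρ/4)) :=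
    H1.comp (by fun_prop) hin2
  have hb : ∀ z ∈ ball (x:ℂ) (ρ/4), ‖H ((z - x) / ρ) - H 0‖ ≤ 2 * M := by
    intro z hz
    refine (H4 _ (hin2 z hz)).trans ?_
    have : ‖(z - x) / ρ‖ < 1/4 := by simpa using hin z hz
    rw [div_le_iff₀ ℓ]
    nlinarith [norm_nonneg ((z - x) / (ρ:ℂ))]
  have hre0 : (H 0).re = 0 := by
    have := congrArg re (H3 0 𝔰)
    simp at this; linarith
  refine ⟨fun z => H ((z - x) / ρ), hHd, fun z hz hz0 => ?_, fun z hz => ?_, fun z hz => ?_,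
    fun z hz => ?_⟩
  · have := H2 _ (hin2 z hz) (by
      rw [Complex.div_ofReal_im]; simp; positivity)
    rw [← this]; congr 1; field_simp; ring
  · change H _ = - ℭ (H _)
    rw [← H3 _ (hin2 z hz)]; simp
  · have := (Complex.abs_re_le_norm _).trans (hb z hz)
    rwa [sub_re, hre0, sub_zero] at this
  · have hsub : closedBall z (ρ/8) ⊆ ball (x:ℂ) (ρ/4) := by
      intro w hw
      rw [mem_closedBall] at hw; rw [mem_ball] at hz ⊢
      linarith [dist_triangle w z x]
    have := Complex.norm_deriv_le_of_forall_mem_sphere_norm_le (c := z) (R := ρ/8) (C := 2 * M)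
      (f := fun z => H ((z - x) / ρ) - H 0) ℘
      (DifferentiableOn.diffContOnCl (by
        rw [closure_ball _ ℘]; exact (hHd.sub_const _).mono hsub))
      (fun w hw => hb w (hsub (sphere_subset_closedBall hw)))
    rw [deriv_sub_const] at this
    refine this.trans (le_of_eq ?_)
    field_simp; norm_num

def Tent (k1 k2 : ℝ) : Set ℂ := {z | 0 < z.re ∧ z.re < 1 ∧
  -(k1 * ϖ z.re) < z.im ∧ z.im < k2 * ϖ z.re}

lemma Tent.convex {k1 k2 : ℝ} (h1 : 0 ≤ k1) (h2 : 0 ≤ k2) : Convex ℝ (Tent k1 k2) := by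
  intro z hz w hw a b ha hb hab
  obtain ⟨z1, z2, z3, z4⟩ := hz
  obtain ⟨w1, w2, w3, w4⟩ := hw
  obtain rfl : b = 1 - a := by linarith
  have hre : (a • z + (1 - a) • w).re = a * z.re + (1 - a) * w.re := by simp
  have him : (a • z + (1 - a) • w).im = a * z.im + (1 - a) * w.im := by simp
  have key : a * ϖ z.re + (1 - a) * ϖ w.re ≤
      (a * z.re + (1 - a) * w.re) * (1 - (a * z.re + (1 - a) * w.re)) := by
    nlinarith [mul_nonneg (mul_nonneg ha hb) (sq_nonneg (z.re - w.re))]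
  unfold Tent
  refine ⟨?_, ?_, ?_, ?_⟩ <;> simp only [hre, him]
  · rcases ha.eq_or_lt with rfl | h
    · simpa using w1
    · nlinarith
  · rcases ha.eq_or_lt with rfl | h
    · simpa using w2
    · nlinarith
  · have := mul_le_mul_of_nonneg_left key h1
    rcases ha.eq_or_lt with rfl | h
    · simpa using w3
    · nlinarith
  · have := mul_le_mul_of_nonneg_left key h2
    rcases ha.eq_or_lt with rfl | h
    · simpa using w4
    · nlinarith

lemma Tent.isOpen (k1 k2 : ℝ) : IsOpen (Tent k1 k2) := by
  unfold Tent
  simp only [setOf_and]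
  have hc : Continuous fun z : ℂ => z.re * (1 - z.re) := by fun_prop
  exact (isOpen_lt continuous_const continuous_re).inter
    ((isOpen_lt continuous_re continuous_const).inter
    ((isOpen_lt (by fun_prop) continuous_im).inter (isOpen_lt continuous_im (by fun_prop))))

lemma Tent.mono {k1 k2 l1 l2 : ℝ} (h1 : k1 ≤ l1) (h2 : k2 ≤ l2) : Tent k1 k2 ⊆ Tent l1 l2 := by
  rintro z ⟨z1, z2, z3, z4⟩
  have : 0 < z.re * (1 - z.re) := mul_pos z1 ℓ
  exact ⟨z1, z2, by nlinarith, by nlinarith⟩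

lemma Tent.real {k1 k2 x : ℝ} (h1 : 0 < k1) (h2 : 0 < k2) (hx : x ∈ 𝕀o) :
    (x:ℂ) ∈ Tent k1 k2 := by
  have : 0 < x * (1 - x) := mul_pos hx.1 (by linarith [hx.2])
  refine ⟨by simpa using hx.1, by simpa using hx.2, ?_, ?_⟩ <;>
    simp only [ofReal_re, ofReal_im, Left.neg_neg_iff] <;> positivity

structure Net (G : Set ℂ) (lam : ℝ) where
  lam0 : 0 < lam
  Go : IsOpen G
  Gb : Bornology.IsBounded G
  Gc : IsConnected G
  N : ℕ
  nxt : Equiv.Perm (Fin N)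
  i0 : Fin N
  σ : Fin N → ℂ → ℂ
  V : Fin N → Set ℂ
  κ : ℝ
  κ0 : 0 < κ
  κ1 : κ ≤ 1
  m : ℝ
  M : ℝ
  m0 : 0 < m
  M0 : 0 < M
  Vo : ∀ j, IsOpen (V j)
  diff : ∀ j, DifferentiableOn ℂ (σ j) (V j)
  lipl : ∀ j, ∀ z ∈ V j, ∀ w ∈ V j, m * ‖z - w‖ ≤ ‖σ j z - σ j w‖
  lipu : ∀ j, ∀ z ∈ V j, ∀ w ∈ V j, ‖σ j z - σ j w‖ ≤ M * ‖z - w‖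
  tV : ∀ j, Tent κ κ ⊆ V j
  V0 : ∀ j, 0 ∈ V j
  V1 : ∀ j, 1 ∈ V j
  up : ∀ j, ∀ z ∈ Tent κ κ, 0 < z.im → σ j z ∈ G
  low : ∀ j, ∀ z ∈ Tent κ κ, z.im < 0 → σ j z ∉ closure G
  bd : ∀ j, ∀ x ∈ 𝕀c, σ j x ∈ frontier G
  cover : ∀ z ∈ frontier G, ∃ j, ∃ x ∈ 𝕀c, z = σ j x
  joint : ∀ j, σ j 1 = σ (nxt j) 0
  e : Fin N → ℂ
  la : Fin N → ℝ
  e1 : ∀ j, ‖e j‖ = 1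
  la1 : ∀ j, lam ≤ la j
  la2 : ∀ j, la j < 2
  K : ℝ
  δ : ℝ
  K0 : 0 < K
  δ0 : 0 < δ
  n1 : ∀ j z, z ∈ closure G → z ≠ σ j 0 → ‖z - σ j 0‖ < δ →
    |arg ((z - σ j 0) / e j)| ≤ (2 - la j) * Real.pi / 2 + K * ‖z - σ j 0‖
  n2 : ∀ j z, z ∉ G → z ≠ σ j 0 → ‖z - σ j 0‖ < δ →
    |arg (-(z - σ j 0) / e j)| ≤ la j * Real.pi / 2 + K * ‖z - σ j 0‖
  tan0 : ∀ j, deriv (σ j) 0 =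
    ‖deriv (σ j) 0‖ * e j * exp ((-((2 - la j) * Real.pi / 2) : ℝ) * I)
  tan1 : ∀ j, -deriv (σ j) 1 =
    ‖deriv (σ j) 1‖ * e (nxt j) * exp (((2 - la (nxt j)) * Real.pi / 2 : ℝ) * I)
  ext : IsPreconnected (closure G)ᶜ
  sep : ∀ i j, ∀ x ∈ 𝕀o, ∀ y ∈ 𝕀o, σ i x = σ j y → i = j

structure Cf (G : Set ℂ) (φ ψ : ℂ → ℂ) : Prop where
  d : DifferentiableOn ℂ φ G
  d' : DifferentiableOn ℂ ψ (ball 0 1)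
  m : MapsTo φ G (ball 0 1)
  m' : MapsTo ψ (ball 0 1) G
  l : ∀ z ∈ G, ψ (φ z) = z
  r : ∀ w ∈ ball 𝕫 1, φ (ψ w) = w

lemma Cf.exists {G : Set ℂ} (hG : IsOpen G) {φ : ℂ → ℂ} (hd : DifferentiableOn ℂ φ G)
    (hb : BijOn φ G (ball 0 1)) : ∃ ψ, Cf G φ ψ := by
  have hl : LeftInvOn (Function.invFunOn φ G) φ G := hb.injOn.leftInvOn_invFunOn
  have hr : RightInvOn (Function.invFunOn φ G) φ (ball 0 1) := hb.surjOn.rightInvOn_invFunOn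
  have hm' : MapsTo (Function.invFunOn φ G) (ball 0 1) G := hb.surjOn.mapsTo_invFunOn
  refine ⟨Function.invFunOn φ G, hd, ?_, hb.mapsTo, hm', fun z hz => hl hz, fun w hw => hr hw⟩
  intro w hw
  set z := Function.invFunOn φ G w with hz
  have hzG : z ∈ G := hm' hw
  have hφz : φ z = w := hr hw
  have hne := deriv_ne_zero_of_inj hG hd hb.injOn hzG
  have hA : AnalyticAt ℂ φ z := hd.analyticAt (hG.mem_nhds hzG)
  have hs : HasStrictDerivAt φ (deriv φ z) z := hA.hasStrictDerivAt
  have hc : ContinuousAt (Function.invFunOn φ G) w := by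
    intro O hO
    have h1 : φ '' (O ∩ G) ∈ 𝓝 w := by
      rw [← hφz, ← hs.map_nhds_eq hne]
      exact image_mem_map (inter_mem hO (hG.mem_nhds hzG))
    refine mem_map.2 (mem_of_superset h1 ?_)
    rintro _ ⟨v, hv, rfl⟩
    rw [mem_preimage, hl hv.2]; exact hv.1
  exact (HasDerivAt.of_local_left_inverse hc hs.hasDerivAt hne (by
    filter_upwards [isOpen_ball.mem_nhds hw] with y hy using hr hy)).differentiableAt.differentiableWithinAt

section
variable {G : Set ℂ} {φ ψ : ℂ → ℂ}

lemma Cf.injOn (C : Cf G φ ψ) : InjOn φ G := fun z hz w hw h => by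
  rw [← C.l z hz, ← C.l w hw, h]

lemma Cf.compact (C : Cf G φ ψ) {ρ : ℝ} (hρ : ρ < 1) : IsCompact {z | z ∈ G ∧ ‖φ z‖ ≤ ρ} := by
  have : {z | z ∈ G ∧ ‖φ z‖ ≤ ρ} = ψ '' closedBall 0 ρ := by
    ext z; constructor
    · rintro ⟨h1, h2⟩
      exact ⟨φ z, by simpa using h2, C.l z h1⟩
    · rintro ⟨w, hw, rfl⟩
      have hw' : w ∈ ball 𝕫 1 := closedBall_subset_ball hρ hw
      exact ⟨C.m' hw', by rw [C.r w hw']; simpa using hw⟩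
  rw [this]
  exact (isCompact_closedBall _ _).image_of_continuousOn
    (C.d'.continuousOn.mono (closedBall_subset_ball hρ))

lemma Cf.far (C : Cf G φ ψ) {ρ : ℝ} (hρ : ρ < 1) (hG : IsOpen G) : ∃ d > 0, ∀ z ∈ G, ∀ w ∉ G,
    ‖z - w‖ < d → ρ < ‖φ z‖ := by
  obtain ⟨d, hd, h⟩ := (C.compact hρ).exists_thickening_subset_open hG (fun z hz => hz.1)
  refine ⟨d, hd, fun z hz w hw hzw => ?_⟩
  by_contra hcon
  push Not at hcon
  refine hw (h (mem_thickening_iff.2 ⟨z, ⟨hz, hcon⟩, ?_⟩))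
  rwa [dist_comm, dist_eq_norm]

lemma Cf.bdry (C : Cf G φ ψ) (hG : IsOpen G) {w : ℂ} (hw : w ∉ G) :
    Tendsto (fun z => ‖φ z‖) (𝓝[G] w) (𝓝 1) := by
  rw [tendsto_order]
  refine ⟨fun a ha => ?_, fun a ha => ?_⟩
  · obtain ⟨d, hd, h⟩ := C.far ha hG
    filter_upwards [self_mem_nhdsWithin, nhdsWithin_le_nhds (ball_mem_nhds w hd)] with z hz hz'
    exact h z hz w hw (by simpa [dist_eq_norm] using hz')
  · filter_upwards [self_mem_nhdsWithin] with z hz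
    have := C.m hz
    rw [mem_ball_zero_iff] at this
    linarith
end

lemma trigB {α t : ℝ} (h0 : 0 < α) (h2 : α < 2) (h3 : Real.pi / 2 - α * Real.pi / 12 ≤ t)
    (h4 : t ≤ Real.pi / 2 + α * Real.pi / 12) :
    Real.cos (t * (1 + α / 2)) ≤ - Real.sin (α * Real.pi / 12) := by
  have hpi := Real.pi_pos
  have e : Real.cos (t * (1 + α / 2)) = - Real.sin (t * (1 + α / 2) - Real.pi / 2) := by
    rw [Real.sin_sub_pi_div_two]; ring
  rw [e, neg_le_neg_iff]
  set y := t * (1 + α / 2) - Real.pi / 2 with hy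
  have y1 : α * Real.pi / 12 ≤ y := by
    have := mul_le_mul_of_nonneg_right h3 (by linarith : 0 ≤ 1 + α / 2)
    nlinarith [mul_pos h0 hpi, mul_pos (mul_pos h0 hpi) (by linarith : 0 < 2 - α)]
  have y2 : y ≤ Real.pi - α * Real.pi / 12 := by
    have := mul_le_mul_of_nonneg_right h4 (by linarith : 0 ≤ 1 + α / 2)
    nlinarith [mul_pos h0 hpi, mul_pos (mul_pos h0 hpi) (by linarith : 0 < 2 - α), mul_pos hpi (by linarith : 0 < 2 - α)]
  rcases le_total y 𝔭 with h | h
  · exact Real.sin_le_sin_of_le_of_le_pi_div_two (by nlinarith [mul_pos h0 hpi]) h y1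
  · rw [← Real.sin_pi_sub y]
    exact Real.sin_le_sin_of_le_of_le_pi_div_two (by nlinarith [mul_pos h0 hpi]) ℓ
      ℓ

set_option maxHeartbeats 400000 in
lemma barE {α K : ℝ} (h0 : 0 < α) (h2 : α < 2) (hK : 0 < K) : ∃ r0 > 0, r0 ≤ 1 ∧ ∃ c > 0,
    ∀ w : ℂ, w ≠ 0 → ‖w‖ < r0 → |arg w| ≤ α * Real.pi / 2 + K * ‖w‖ → |arg w| < Real.pi ∧
      c * ‖w‖ ^ (1 / α + 1 / 2) ≤ (w ^ ((1 / α : ℝ) : ℂ) - w ^ ((1 / α + 1 / 2 : ℝ) : ℂ)).re := by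
  have hpi := Real.pi_pos
  set ε := α * Real.pi / 12 with hε
  have hε0 : 0 < ε := by positivity
  have hε1 : ε < Real.pi / 2 := by nlinarith
  set s := Real.sin ε with hs
  have hs0 : 0 < s := Real.sin_pos_of_pos_of_lt_pi hε0 ℓ
  have hs1 : s ≤ 1 := Real.sin_le_one _
  set q := s / (2 * (1 + K / α)) with hq
  have hq0 : 0 < q := by positivity
  refine ⟨min (min 1 (q ^ 2)) (min (ε * α / K) ((2 - α) * Real.pi / (2 * K))),
    by have : 0 < 2 - α := by linarith
       positivity, (min_le_left _ _).trans 𝔩, s / 2, ℘, ?_⟩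
  intro w hw hr harg
  have hr1 : ‖w‖ < 1 := hr.trans_le ((min_le_left _ _).trans 𝔩)
  have hr2 : ‖w‖ < q ^ 2 := hr.trans_le ((min_le_left _ _).trans 𝔯)
  have hr3 : ‖w‖ < ε * α / K := hr.trans_le ((min_le_right _ _).trans 𝔩)
  have hr4 : ‖w‖ < (2 - α) * Real.pi / (2 * K) :=
    hr.trans_le ((min_le_right _ _).trans 𝔯)
  have hw0 : 0 < ‖w‖ := norm_pos_iff.2 hw
  rw [lt_div_iff₀ ℘] at hr3 hr4
  refine ⟨by nlinarith, ?_⟩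
  set r := ‖w‖ with hrdef
  set u := r ^ ½ with hu
  have hu0 : 0 < u := Real.rpow_pos_of_pos hw0 _
  have huu : u * u = r := by rw [hu, ← Real.rpow_add hw0]; norm_num
  have huq : u < q := lt_of_pow_lt_pow_left₀ 2 hq0.le (by rw [sq, huu]; exact hr2)
  have hR : r ^ (1 / α + 1 / 2) = r ^ (1 / α) * u := Real.rpow_add hw0 _ _
  have hRp : 0 < r ^ (1 / α) := Real.rpow_pos_of_pos hw0 _
  rw [sub_re, cpow_ofReal_re, cpow_ofReal_re, hR, ← Real.cos_abs (arg w * (1 / α)),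
    ← Real.cos_abs (arg w * (1 / α + 1 / 2)), abs_mul, abs_mul,
    abs_of_pos (by positivity : 0 < 1 / α), abs_of_pos (by positivity : 0 < 1 / α + 1 / 2)]
  set θ := |arg w| with hθ
  have hθ0 : 0 ≤ θ := abs_nonneg _
  set t := θ * (1 / α) with ht
  have ht2 : θ * (1 / α + 1 / 2) = t * (1 + α / 2) := by rw [ht]; field_simp
  rw [ht2]
  have htu : t ≤ Real.pi / 2 + K / α * r := by
    rw [ht, mul_one_div, div_le_iff₀ h0]
    have : (Real.pi / 2 + K / α * r) * α = α * Real.pi / 2 + K * r := by field_simp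
    linarith
  have hKr : K / α * r < ε := by
    rw [div_mul_eq_mul_div, div_lt_iff₀ h0]; linarith
  have hqs : q * (1 + K / α) = s / 2 := by rw [hq]; field_simp
  have hKα : 0 < K / α := by positivity
  have hmain : s / 2 * u ≤ Real.cos t - u * Real.cos (t * (1 + α / 2)) := by
    rcases le_total t (Real.pi / 2 - ε) with h | h
    · have c1 : s ≤ Real.cos t := by
        rw [hs, ← Real.cos_pi_div_two_sub]
        exact Real.cos_le_cos_of_nonneg_of_le_pi ℘ ℓ h
      have c2 := mul_le_mul_of_nonneg_left (Real.cos_le_one (t * (1 + α / 2))) hu0.le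
      have c3 : u ≤ s / 2 := by rw [← hqs]; nlinarith
      have c4 : s / 2 * u ≤ s / 2 * 1 := by gcongr; linarith
      linarith
    · have c1 := trigB h0 h2 h (htu.trans ℓ)
      have c2 : - (K / α * r) ≤ Real.cos t := by
        rw [← Real.sin_pi_div_two_sub]
        rcases le_total t 𝔭 with h5 | h5
        · have := Real.sin_nonneg_of_nonneg_of_le_pi (by linarith : 0 ≤ Real.pi / 2 - t) ℓ
          have : 0 ≤ K / α * r := by positivity
          linarith
        · have := Real.sin_le (by linarith : 0 ≤ t - Real.pi / 2)
          rw [← neg_sub, Real.sin_neg]; linarith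
      have c3 : u * s ≤ - (u * Real.cos (t * (1 + α / 2))) := by
        have := mul_le_mul_of_nonneg_left c1 hu0.le
        linarith
      have c4 : K / α * r ≤ s / 2 * u := by
        have a1 : K / α * u ≤ s / 2 := by rw [← hqs]; nlinarith
        have a2 := mul_le_mul_of_nonneg_right a1 hu0.le
        rw [← huu]; linarith
      linarith
  have := mul_le_mul_of_nonneg_left hmain hRp.le
  linarith

section
variable {G : Set ℂ} {lam : ℝ} {φ ψ : ℂ → ℂ}

lemma Net.lam2 (N : Net G lam) : lam < 2 := (N.la1 N.i0).trans_lt (N.la2 N.i0)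

lemma Net.p_not (N : Net G lam) (j) {x : ℝ} (hx : x ∈ 𝕀c) : N.σ j x ∉ G := by
  have := N.bd j x hx
  rw [N.Go.frontier_eq] at this; exact this.2

lemma Net.log_bound (N : Net G lam) (C : Cf G φ ψ) (j) : ∃ C > 0, ∀ z ∈ G, 1 / 2 ≤ ‖φ z‖ →
    -Real.log ‖φ z‖ ≤ C * ‖z - N.σ j 0‖ ^ (1 / (2 - lam)) := by
  have hα0 : 0 < 2 - lam := by linarith [N.lam2]
  have hα2 : 2 - lam < 2 := by linarith [N.lam0]
  have hpG : N.σ j 0 ∉ G := by simpa using N.p_not j (x := 0) 𝔰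
  set p := N.σ j 0 with hp
  obtain ⟨r0, hr0, hr01, c, hc, hbar⟩ := barE hα0 hα2 N.K0
  obtain ⟨d, hd, hfar⟩ := C.far (ρ := 1/2) (by norm_num) N.Go
  set β := 1 / (2 - lam) with hβ
  have hβ0 : 0 < β := by positivity
  set R := min (min r0 N.δ) d / 2 with hR
  have hR0 : 0 < R := by have := N.δ0; positivity
  have hRr : 2 * R ≤ r0 := by rw [hR]; linarith [min_le_left (min r0 N.δ) d, min_le_left r0 N.δ]
  have hRδ : 2 * R ≤ N.δ := by rw [hR]; linarith [min_le_left (min r0 N.δ) d, min_le_right r0 N.δ]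
  have hRd : 2 * R ≤ d := by rw [hR]; linarith [min_le_right (min r0 N.δ) d]
  set b : ℂ → ℂ := fun z => ((z - p) / N.e j) ^ (β : ℂ) - ((z - p) / N.e j) ^ ((β + 1 / 2 : ℝ) : ℂ)
    with hb
  have he : N.e j ≠ 0 := norm_ne_zero_iff.1 (by rw [N.e1]; norm_num)
  have hnw : ∀ z, ‖(z - p) / N.e j‖ = ‖z - p‖ := fun z => by rw [norm_div, N.e1, div_one]
  have hzb : ∀ z ∈ G, ‖z - p‖ < 2 * R → z - p ≠ 0 ∧ (z - p) / N.e j ∈ slitPlane ∧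
      c * ‖z - p‖ ^ (β + 1 / 2) ≤ (b z).re ∧ 1/2 < ‖φ z‖ := by
    intro z hz hzR
    have hzp : z ≠ p := fun h => hpG (h ▸ hz)
    have h1 := N.n1 j z (subset_closure hz) hzp ℓ
    have hne : (z - p) / N.e j ≠ 0 := div_ne_zero (sub_ne_zero.2 hzp) he
    have h2 := hbar ((z - p) / N.e j) hne (by rw [hnw]; linarith) (by
      rw [hnw]; refine h1.trans ?_
      have := N.la1 j
      have := Real.pi_pos
      gcongr)
    refine ⟨sub_ne_zero.2 hzp, mem_slitPlane_iff_arg.2 ⟨fun h => ?_, hne⟩, ?_,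
      hfar z hz p hpG ℓ⟩
    · rw [h, abs_of_pos Real.pi_pos] at h2; exact lt_irrefl _ h2.1
    · rw [hnw] at h2; exact h2.2
  set C0 := Real.log 2 / (c * R ^ (β + 1 / 2)) with hC0
  have hl2 : 0 < Real.log 2 := Real.log_pos (by norm_num)
  have hC00 : 0 < C0 := by positivity
  set g : ℂ → ℂ := fun z => (φ z)⁻¹ * exp (-(C0 * b z)) with hg
  have hgd : ∀ z ∈ G, ‖z - p‖ < 2 * R → DifferentiableAt ℂ g z := by
    intro z hz hzR
    obtain ⟨h1, h2, h3, h4⟩ := hzb z hz hzR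
    have hφ : DifferentiableAt ℂ φ z := C.d.differentiableAt (N.Go.mem_nhds hz)
    have hd1 : DifferentiableAt ℂ (fun z => (z - p) / N.e j) z := by fun_prop
    refine (hφ.inv (norm_pos_iff.1 ℓ)).mul ?_
    refine DifferentiableAt.cexp (DifferentiableAt.neg (DifferentiableAt.const_mul ?_ _))
    exact (hd1.cpow_const h2).sub (hd1.cpow_const h2)
  have hgn : ∀ z, ‖g z‖ = ‖φ z‖⁻¹ * Real.exp (-(C0 * (b z).re)) := by
    intro z; rw [hg]; simp only [norm_mul, norm_inv, Complex.norm_exp, neg_re, re_ofReal_mul]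
  have hsub : ∀ z ∈ G ∩ ball p R, ‖z - p‖ < 2 * R := fun z hz => by
    have := mem_ball_iff_norm.1 hz.2; linarith
  have key := maxp (V := G ∩ ball p R) (g := g) (A := 1) (N.Go.inter isOpen_ball)
    (isBounded_ball.subset inter_subset_right)
    (fun z hz => (hgd z hz.1 (hsub z hz)).differentiableWithinAt) (by
      intro w hw A' hA'
      by_cases hwG : w ∈ G
      · have hwR : ‖w - p‖ = R := by
          have h1 : w ∈ closedBall p R :=
            closure_minimal (inter_subset_right.trans ball_subset_closedBall) isClosed_closedBall hw.1
          rw [(N.Go.inter isOpen_ball).frontier_eq] at hw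
          rw [mem_closedBall_iff_norm] at h1
          refine le_antisymm h1 (not_lt.1 fun h => hw.2 ⟨hwG, mem_ball_iff_norm.2 h⟩)
        obtain ⟨h1, h2, h3, h4⟩ := hzb w hwG ℓ
        have : ‖g w‖ < A' := by
          refine lt_of_le_of_lt ?_ hA'
          rw [hgn]
          have h5 : Real.exp (-(C0 * (b w).re)) ≤ 1 / 2 := by
            rw [← Real.log_le_log_iff (Real.exp_pos _) (by norm_num), Real.log_exp, one_div,
              Real.log_inv]
            rw [hwR] at h3
            have : C0 * (c * R ^ (β + 1 / 2)) = Real.log 2 := by rw [hC0]; field_simp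
            nlinarith
          have h6 : ‖φ w‖⁻¹ ≤ 2 := by
            rw [inv_le_comm₀ ℓ (by norm_num)]; linarith
          nlinarith [Real.exp_pos (-(C0 * (b w).re)), inv_nonneg.2 (norm_nonneg (φ w))]
        have := ((hgd w hwG ℓ).continuousAt.norm.eventually_lt_const this)
        filter_upwards [nhdsWithin_le_nhds this] with z hz using hz.le
      · have hA0 : 0 < A' := by linarith
        have h1 := (C.bdry N.Go hwG).eventually_const_lt (inv_lt_one_of_one_lt₀ hA')
        filter_upwards [nhdsWithin_mono _ inter_subset_left h1, self_mem_nhdsWithin] with z hz hzV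
        obtain ⟨k1, k2, k3, k4⟩ := hzb z hzV.1 (hsub z hzV)
        rw [hgn]
        have h5 : Real.exp (-(C0 * (b z).re)) ≤ 1 := by
          rw [Real.exp_le_one_iff]
          have : 0 ≤ (b z).re := le_trans ℘ k3
          nlinarith
        have h6 : ‖φ z‖⁻¹ ≤ A' := by rw [inv_le_comm₀ ℓ hA0]; exact hz.le
        nlinarith [Real.exp_pos (-(C0 * (b z).re)), inv_nonneg.2 (norm_nonneg (φ z))])
  refine ⟨max (2 * C0) (Real.log 2 / R ^ β), ℘, fun z hz hz2 => ?_⟩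
  by_cases hzR : ‖z - p‖ < R
  · obtain ⟨k1, k2, k3, k4⟩ := hzb z hz ℓ
    have h1 := key z ⟨hz, mem_ball_iff_norm.2 hzR⟩
    rw [hgn, ← Real.log_le_log_iff ℘ one_pos, Real.log_mul ℘
      (Real.exp_pos _).ne', Real.log_exp, Real.log_inv, Real.log_one] at h1
    have hr0 : 0 < ‖z - p‖ := norm_pos_iff.2 k1
    have h2 : (b z).re ≤ 2 * ‖z - p‖ ^ β := by
      refine (re_le_norm _).trans ((norm_sub_le _ _).trans ?_)
      have hne : (z - p) / N.e j ≠ 0 := slitPlane_ne_zero k2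
      rw [norm_cpow_real, norm_cpow_real, hnw]
      have : ‖z - p‖ ^ (β + 1 / 2) ≤ ‖z - p‖ ^ β :=
        Real.rpow_le_rpow_of_exponent_ge hr0 ℓ ℓ
      linarith
    calc _ ≤ C0 * (b z).re := by linarith
      _ ≤ C0 * (2 * ‖z - p‖ ^ β) := by gcongr
      _ = 2 * C0 * ‖z - p‖ ^ β := by ring
      _ ≤ _ := by gcongr; exact le_max_left _ _
  · push Not at hzR
    have h1 : -Real.log ‖φ z‖ ≤ Real.log 2 := by
      rw [← Real.log_inv]
      apply Real.log_le_log ℘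
      rw [inv_le_comm₀ ℓ (by norm_num)]; linarith
    calc _ ≤ Real.log 2 := h1
      _ = Real.log 2 / R ^ β * R ^ β := by field_simp
      _ ≤ Real.log 2 / R ^ β * ‖z - p‖ ^ β := by gcongr
      _ ≤ _ := by gcongr; exact le_max_right _ _

lemma neBot_up (y : ℂ) (hy : y.im = 0) : (𝓝[{z : ℂ | 0 < z.im}] y).NeBot := by
  rw [← mem_closure_iff_nhdsWithin_neBot]
  rw [Complex.closure_setOf_lt_im]
  exact hy.ge

lemma tent_ball {k x : ℝ} (h0 : 0 < k) (h1 : k ≤ 1) (hx : x ∈ 𝕀o) {z : ℂ}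
    (hz : z ∈ ball (x:ℂ) (k * ϖ x / 4)) :
    z ∈ Tent k k ∧ 3 / 4 * ϖ x ≤ z.re * (1 - z.re) ∧
      z.re * (1 - z.re) ≤ 5 / 4 * ϖ x := by
  rw [mem_ball, dist_eq_norm] at hz
  have hp : 0 < x * (1 - x) := mul_pos hx.1 (by linarith [hx.2])
  have hk : k * ϖ x ≤ x * (1 - x) := mul_le_of_le_one_left hp.le h1
  have hq : x * (1 - x) ≤ x := by nlinarith [hx.1]
  have hq' : x * (1 - x) ≤ 1 - x := by nlinarith [hx.2]
  have a1 := (abs_re_le_norm (z - x)).trans_lt hz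
  have a2 := (abs_im_le_norm (z - x)).trans_lt hz
  simp only [sub_re, ofReal_re, sub_im, ofReal_im, sub_zero, abs_lt] at a1 a2
  have r0 : 0 < z.re := by linarith [hx.1]
  have r1 : z.re < 1 := by linarith [hx.2]
  have e : z.re * (1 - z.re) = x * (1 - x) + (z.re - x) * (1 - x - z.re) := by ring
  have : |(z.re - x) * (1 - x - z.re)| ≤ x * (1 - x) / 4 * 1 := by
    rw [abs_mul]
    refine mul_le_mul ?_ ?_ (abs_nonneg _) ℘
    · rw [abs_le]; constructor <;> linarith
    · rw [abs_le]; constructor <;> linarith [hx.1, hx.2]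
  rw [abs_le] at this
  have b1 : 3 / 4 * ϖ x ≤ z.re * (1 - z.re) := by rw [e]; linarith
  have b2 : z.re * (1 - z.re) ≤ 5 / 4 * ϖ x := by rw [e]; linarith
  refine ⟨⟨r0, r1, ?_, ?_⟩, b1, b2⟩ <;>
  · have := mul_le_mul_of_nonneg_left b1 h0.le
    linarith [mul_pos h0 hp]

lemma refl_arc {h : ℂ → ℂ} {k ρ A β : ℝ} (hk : 0 < k) (hk1 : k ≤ 1) (hρ : 0 < ρ) (hA : 0 < A) (hβ : 0 < β)
    (hd : DifferentiableOn ℂ h (Tent k k ∩ {z | 0 < z.im}))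
    (hi : InjOn h (Tent k k ∩ {z | 0 < z.im}))
    (hb : ∀ z ∈ Tent k k, 0 < z.im → ρ < ‖h z‖ ∧ ‖h z‖ < 1 ∧
      -Real.log ‖h z‖ ≤ A * ϖ z.re ^ β)
    (hl : ∀ x ∈ 𝕀o, Tendsto (fun z => ‖h z‖) (𝓝[{z | 0 < z.im}] (x:ℂ)) (𝓝 1)) :
    ∃ B, ∃ H : ℂ → ℂ, DifferentiableOn ℂ H (Tent (k / 64) (k / 64)) ∧
      (∀ z ∈ Tent (k / 64) (k / 64), 0 < z.im → H z = h z) ∧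
      (∀ z ∈ Tent (k / 64) (k / 64), z.im < 0 → 1 < ‖H z‖) ∧
      (∀ z ∈ Tent (k / 64) (k / 64), ρ < ‖H z‖ ∧ ‖H z‖ < 1 / ρ ∧ deriv H z ≠ 0 ∧
        ‖deriv H z‖ ≤ B * ϖ z.re ^ (β - 1)) ∧
      (∀ x ∈ 𝕀o, ‖H x‖ = 1 ∧ ∃ c : ℝ, 0 < c ∧ deriv H x = c * I * H x) := by
  have key : ∀ x : ℝ, ∃ Hx : ℂ → ℂ, x ∈ 𝕀o →
      DifferentiableOn ℂ Hx (ball x (k * ϖ x / 16)) ∧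
      (∀ z ∈ ball (x:ℂ) (k * ϖ x / 16), 0 < z.im → h z = exp (Hx z)) ∧
      (∀ z ∈ ball (x:ℂ) (k * ϖ x / 16), Hx (ℭ z) = -ℭ (Hx z)) ∧
      (∀ z ∈ ball (x:ℂ) (k * ϖ x / 32),
        ‖deriv Hx z‖ ≤ 64 * A * (5 / 4) ^ β / k * ϖ x ^ (β - 1)) := by
    intro x
    by_cases hx : x ∈ 𝕀o
    swap
    · exact ⟨0, fun h => absurd h hx⟩
    have hp : 0 < x * (1 - x) := mul_pos hx.1 (by linarith [hx.2])
    have hM : 0 < A * (5 / 4 * ϖ x) ^ β := by positivity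
    obtain ⟨H, h1, h2, h3, -, h5⟩ := reflect_ball (h := h) (x := x) (ρ := k * ϖ x / 4)
      ℘ hM (hd.mono fun z hz => ⟨(tent_ball hk hk1 hx hz.1).1, hz.2⟩)
      (fun z hz hz' => by
        obtain ⟨t1, t2, t3⟩ := tent_ball hk hk1 hx hz
        obtain ⟨b1, b2, b3⟩ := hb z t1 hz'
        refine ⟨fun h0 => ?_, b3.trans ?_, b2⟩
        · rw [h0, norm_zero] at b1; linarith
        · have : 0 ≤ z.re * (1 - z.re) := le_trans ℘ t2
          gcongr)
      (fun y hy hy' => by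
        obtain ⟨t1, -⟩ := tent_ball hk hk1 hx hy
        have : y = (y.re : ℂ) := by apply Complex.ext <;> simp [hy']
        rw [this]
        exact hl _ ⟨t1.1, t1.2.1⟩)
    have e1 : k * ϖ x / 4 / 4 = k * ϖ x / 16 := by ring
    have e2 : k * ϖ x / 4 / 8 = k * ϖ x / 32 := by ring
    rw [e1] at h1 h2 h3
    rw [e2] at h5
    refine ⟨H, fun _ => ⟨h1, h2, h3, fun z hz => (h5 z hz).trans_eq ?_⟩⟩
    rw [Real.mul_rpow (by norm_num) hp.le, Real.rpow_sub hp, Real.rpow_one]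
    field_simp
    ring
  choose Hx hHx using key
  set H : ℂ → ℂ := fun z => exp (Hx z.re z) with hH
  have mem : ∀ z ∈ Tent (k / 64) (k / 64), z.re ∈ 𝕀o ∧
      z ∈ ball (z.re:ℂ) (k * ϖ z.re / 64) := by
    rintro z ⟨t1, t2, t3, t4⟩
    refine ⟨⟨t1, t2⟩, ?_⟩
    rw [mem_ball, dist_eq_norm]
    have : z - (z.re:ℂ) = z.im * I := by apply Complex.ext <;> simp
    rw [this, norm_mul, norm_I, mul_one, norm_real, Real.norm_eq_abs, abs_lt]
    constructor <;> linarith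
  have cj : ∀ (x : ℝ) r, ∀ z ∈ ball (x:ℂ) r, ℭ z ∈ ball (x:ℂ) r := by
    intro x r z hz
    rw [mem_ball, dist_eq_norm] at *
    have : ℭ z - x = ℭ (z - x) := by simp
    rwa [this, norm_conj]
  have sm : ∀ x ∈ 𝕀o, ball (x:ℂ) (k * ϖ x / 64) ⊆ ball (x:ℂ) (k * ϖ x / 32) ∧
      ball (x:ℂ) (k * ϖ x / 32) ⊆ ball (x:ℂ) (k * ϖ x / 16) := by
    intro x hx
    have hp : 0 < k * ϖ x := mul_pos hk (mul_pos hx.1 (by linarith [hx.2]))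
    constructor <;> apply ball_subset_ball <;> linarith
  have eqx : ∀ x ∈ 𝕀o, ∀ x' ∈ 𝕀o, ∀ z ∈ ball (x:ℂ) (k * ϖ x / 16),
      z ∈ ball (x':ℂ) (k * (x' * (1 - x')) / 16) → exp (Hx x z) = exp (Hx x' z) := by
    intro x hx x' hx' z hz hz'
    obtain ⟨a1, a2, a3, -⟩ := hHx x hx
    obtain ⟨b1, b2, b3, -⟩ := hHx x' hx'
    rcases lt_trichotomy z.im 0 with hs | hs | hs
    · have c0 : 0 < (ℭ z).im := by simpa using hs
      have c1 := a2 _ (cj _ _ _ hz) c0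
      have c2 := b2 _ (cj _ _ _ hz') c0
      rw [a3 z hz] at c1
      rw [b3 z hz', c1, exp_neg, exp_neg, inv_inj, exp_conj, exp_conj] at c2
      exact (starRingEnd ℂ).injective c2
    · haveI := neBot_up z hs
      have l1 : Tendsto h (𝓝[{z | 0 < z.im}] z) (𝓝 (exp (Hx x z))) := by
        have : ContinuousAt (fun z => exp (Hx x z)) z :=
          (a1.continuousOn.continuousAt (isOpen_ball.mem_nhds hz)).cexp
        refine (this.tendsto.mono_left nhdsWithin_le_nhds).congr' ?_
        filter_upwards [nhdsWithin_le_nhds (isOpen_ball.mem_nhds hz), self_mem_nhdsWithin] with w h1 h2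
        exact (a2 w h1 h2).symm
      have l2 : Tendsto h (𝓝[{z | 0 < z.im}] z) (𝓝 (exp (Hx x' z))) := by
        have : ContinuousAt (fun z => exp (Hx x' z)) z :=
          (b1.continuousOn.continuousAt (isOpen_ball.mem_nhds hz')).cexp
        refine (this.tendsto.mono_left nhdsWithin_le_nhds).congr' ?_
        filter_upwards [nhdsWithin_le_nhds (isOpen_ball.mem_nhds hz'), self_mem_nhdsWithin] with w h1 h2
        exact (b2 w h1 h2).symm
      exact tendsto_nhds_unique l1 l2
    · rw [← a2 z hz hs, ← b2 z hz' hs]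
  have loc : ∀ z ∈ Tent (k / 64) (k / 64), H =ᶠ[𝓝 z] fun w => exp (Hx z.re w) := by
    intro z hz
    obtain ⟨m1, m2⟩ := mem z hz
    filter_upwards [(Tent.isOpen _ _).mem_nhds hz, isOpen_ball.mem_nhds m2] with w hw hw'
    obtain ⟨n1, n2⟩ := mem w hw
    exact eqx _ n1 _ m1 w ((sm _ n1).2 ((sm _ n1).1 n2)) ((sm _ m1).2 ((sm _ m1).1 hw'))
  have der : ∀ z ∈ Tent (k / 64) (k / 64), HasDerivAt H (H z * deriv (Hx z.re) z) z := by
    intro z hz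
    obtain ⟨m1, m2⟩ := mem z hz
    have : DifferentiableAt ℂ (Hx z.re) z := (hHx _ m1).1.differentiableAt
      (isOpen_ball.mem_nhds ((sm _ m1).2 ((sm _ m1).1 m2)))
    exact (this.hasDerivAt.cexp).congr_of_eventuallyEq (loc z hz)
  have upp : ∀ z ∈ Tent (k / 64) (k / 64), 0 < z.im → H z = h z := by
    intro z hz h0
    obtain ⟨m1, m2⟩ := mem z hz
    exact ((hHx _ m1).2.1 z ((sm _ m1).2 ((sm _ m1).1 m2)) h0).symm
  have big : Tent (k / 64) (k / 64) ⊆ Tent k k := Tent.mono ℓ ℓ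
  have cT : ∀ z ∈ Tent (k / 64) (k / 64), ℭ z ∈ Tent (k / 64) (k / 64) := by
    rintro z ⟨t1, t2, t3, t4⟩
    refine ⟨?_, ?_, ?_, ?_⟩ <;> simp only [conj_re, conj_im] <;> linarith
  have symm : ∀ z ∈ Tent (k / 64) (k / 64), H (ℭ z) = (ℭ (H z))⁻¹ := by
    intro z hz
    obtain ⟨m1, m2⟩ := mem z hz
    rw [hH]
    simp only [conj_re]
    rw [(hHx _ m1).2.2.1 z ((sm _ m1).2 ((sm _ m1).1 m2)), exp_neg, ← exp_conj]
  have nr : ∀ z ∈ Tent (k / 64) (k / 64), z.im = 0 → ‖H z‖ = 1 := by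
    intro z hz h0
    have := symm z hz
    rw [conj_eq_iff_im.2 h0] at this
    have h2 := congrArg norm this
    rw [norm_inv, norm_conj] at h2
    have h3 : 0 < ‖H z‖ := norm_pos_iff.2 (exp_ne_zero _)
    have h4 := mul_inv_cancel₀ h3.ne'
    rw [← h2] at h4
    nlinarith
  have ρ1 : ρ < 1 := by
    have hw : (⟨1 / 2, k / 8⟩ : ℂ) ∈ Tent k k := by
      refine ⟨?_, ?_, ?_, ?_⟩ <;> norm_num <;> linarith
    obtain ⟨a, b, -⟩ := hb _ hw (by change 0 < k / 8; linarith)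
    linarith
  have dne_up : ∀ z ∈ Tent (k / 64) (k / 64), 0 < z.im → deriv H z ≠ 0 := by
    intro z hz h0
    have ho : IsOpen (Tent k k ∩ {z | 0 < z.im}) :=
      (Tent.isOpen _ _).inter (isOpen_lt continuous_const continuous_im)
    have := deriv_ne_zero_of_inj ho hd hi ⟨big hz, h0⟩
    have e : H =ᶠ[𝓝 z] h := by
      filter_upwards [(Tent.isOpen _ _).mem_nhds hz,
        (isOpen_lt continuous_const continuous_im).mem_nhds h0] with w hw hw'
      exact upp w hw hw'
    rwa [e.deriv_eq]
  have real_der : ∀ x ∈ 𝕀o, ∃ c : ℝ, 0 < c ∧ deriv H x = c * I * H x := by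
    intro x hx
    have hp : 0 < k * ϖ x := mul_pos hk (mul_pos hx.1 (by linarith [hx.2]))
    have hxT : (x:ℂ) ∈ Tent (k / 64) (k / 64) := Tent.real ℘ ℘ hx
    obtain ⟨a1, a2, a3, a4⟩ := hHx x hx
    obtain ⟨c, c0, hc⟩ := hopf (H := Hx x) (x₀ := x) (ρ := k * ϖ x / 16) ℘ a1
      (by
        intro z hz h0
        have hz' : z ∈ Tent k k := (tent_ball hk hk1 hx (ball_subset_ball ℓ hz)).1
        have := (hb z hz' h0).2.1
        rw [a2 z hz h0, norm_exp, Real.exp_lt_one_iff] at this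
        exact this)
      (by
        intro z hz h0
        have := a3 z hz
        rw [conj_eq_iff_im.2 h0] at this
        have h2 := congrArg re this
        rw [neg_re, conj_re] at h2
        linarith)
    refine ⟨c, c0, ?_⟩
    rw [(der x hxT).deriv, ofReal_re, hc]; ring
  have lo : ∀ z ∈ Tent (k / 64) (k / 64), z.im < 0 → 1 < ‖H z‖ := by
    intro z hz hs
    have c0 : 0 < (ℭ z).im := by simpa using hs
    obtain ⟨b1, b2, -⟩ := hb _ (big (cT z hz)) c0
    rw [← upp _ (cT z hz) c0, symm z hz, norm_inv, norm_conj] at b1 b2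
    have h3 : 0 < ‖H z‖ := norm_pos_iff.2 (exp_ne_zero _)
    by_contra hcon; push Not at hcon
    have := (one_le_inv₀ h3).2 hcon
    linarith
  refine ⟨1 / ρ * (64 * A * (5 / 4) ^ β / k), H, fun z hz => (der z hz).differentiableAt.differentiableWithinAt,
    upp, lo, fun z hz => ?_, fun x hx => ⟨nr _ (Tent.real ℘ ℘ hx) 𝔰, real_der x hx⟩⟩
  have h1ρ : 1 < 1 / ρ := by rw [lt_div_iff₀ hρ]; linarith
  have hbd : ρ < ‖H z‖ ∧ ‖H z‖ < 1 / ρ := by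
    rcases lt_trichotomy z.im 0 with hs | hs | hs
    · have c0 : 0 < (ℭ z).im := by simpa using hs
      obtain ⟨b1, b2, -⟩ := hb _ (big (cT z hz)) c0
      rw [← upp _ (cT z hz) c0, symm z hz, norm_inv, norm_conj] at b1 b2
      have h3 : 0 < ‖H z‖ := norm_pos_iff.2 (exp_ne_zero _)
      have := lo z hz hs
      exact ⟨ℓ, by rw [one_div, lt_inv_comm₀ h3 hρ]; exact b1⟩
    · rw [nr z hz hs]; exact ⟨ρ1, h1ρ⟩
    · obtain ⟨b1, b2, -⟩ := hb _ (big hz) hs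
      rw [upp z hz hs]; exact ⟨b1, ℓ⟩
  obtain ⟨m1, m2⟩ := mem z hz
  refine ⟨hbd.1, hbd.2, ?_, ?_⟩
  · rcases lt_trichotomy z.im 0 with hs | hs | hs
    · have c0 : 0 < (ℭ z).im := by simpa using hs
      have hne := dne_up _ (cT z hz) c0
      intro hcon
      apply hne
      have d1 := (der z hz)
      rw [← d1.deriv, hcon] at d1
      have d2 := d1.conj_conj
      have d3 := d2.inv (by rw [Function.comp_apply, Function.comp_apply, Complex.conj_conj]; exact (map_ne_zero _).2 (exp_ne_zero _))
      have d4 : HasDerivAt H 0 (ℭ z) := by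
        refine HasDerivAt.congr_of_eventuallyEq (f := fun w => (ℭ (H (ℭ w)))⁻¹) ?_ ?_
        · simpa [Function.comp_def] using! d3
        · filter_upwards [(Tent.isOpen _ _).mem_nhds (cT z hz)] with w hw
          have := symm _ (cT w hw)
          simpa using this
      exact d4.deriv
    · have : z = (z.re : ℂ) := by apply Complex.ext <;> simp [hs]
      obtain ⟨c, c0, hc⟩ := real_der _ m1
      rw [this, hc]
      simp only [ne_eq, mul_eq_zero, ofReal_eq_zero, I_ne_zero, or_false, not_or]
      exact ⟨c0.ne', exp_ne_zero _⟩
    · exact dne_up z hz hs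
  · rw [(der z hz).deriv, norm_mul, mul_assoc]
    exact mul_le_mul hbd.2.le ((hHx _ m1).2.2.2 z ((sm _ m1).1 m2)) 𝔫 ℘


def Net.shrink (N : Net G lam) (k : ℝ) (h0 : 0 < k) (h1 : k ≤ N.κ) : Net G lam :=
  { N with
    κ := k
    κ0 := h0
    κ1 := h1.trans N.κ1
    tV := fun j => (Tent.mono h1 h1).trans (N.tV j)
    up := fun j z hz => N.up j z (Tent.mono h1 h1 hz)
    low := fun j z hz => N.low j z (Tent.mono h1 h1 hz) }

structure Rf (N : Net G lam) (φ : ℂ → ℂ) (ρ B : ℝ) (H : Fin N.N → ℂ → ℂ) : Prop where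
  d : ∀ j, DifferentiableOn ℂ (H j) (Tent N.κ N.κ)
  up : ∀ j, ∀ z ∈ Tent N.κ N.κ, 0 < z.im → H j z = φ (N.σ j z)
  lo : ∀ j, ∀ z ∈ Tent N.κ N.κ, z.im < 0 → 1 < ‖H j z‖
  b : ∀ j, ∀ z ∈ Tent N.κ N.κ, ρ < ‖H j z‖ ∧ ‖H j z‖ < 1 / ρ ∧ deriv (H j) z ≠ 0 ∧
        ‖deriv (H j) z‖ ≤ B * ϖ z.re ^ (1 / (2 - lam) - 1)
  re : ∀ j, ∀ x ∈ 𝕀o, ‖H j x‖ = 1 ∧ ∃ c : ℝ, 0 < c ∧ deriv (H j) x = c * I * H j x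

lemma Net.near (N : Net G lam) (j) {z : ℂ} (hz : z ∈ Tent N.κ N.κ) :
    ‖N.σ j z - N.σ j z.re‖ ≤ N.M * |z.im| ∧ ‖N.σ j z - N.σ j 0‖ ≤ N.M * (2 * z.re) ∧
    ‖N.σ j z - N.σ j 1‖ ≤ N.M * (2 * (1 - z.re)) := by
  obtain ⟨t1, t2, t3, t4⟩ := id hz
  have hr : (z.re : ℂ) ∈ N.V j := N.tV j (Tent.real N.κ0 N.κ0 ⟨t1, t2⟩)
  have e : z - (z.re:ℂ) = z.im * I := by apply Complex.ext <;> simp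
  have hp : 0 ≤ z.re * (1 - z.re) := mul_nonneg t1.le ℓ
  have h1 : N.κ * ϖ z.re ≤ z.re * (1 - z.re) := mul_le_of_le_one_left hp N.κ1
  have h2 : |z.im| ≤ z.re * (1 - z.re) := by rw [abs_le]; constructor <;> linarith
  refine ⟨?_, (N.lipu j z (N.tV j hz) 0 (N.V0 j)).trans ?_, (N.lipu j z (N.tV j hz) 1 (N.V1 j)).trans ?_⟩
  · simpa [e] using! N.lipu j z (N.tV j hz) z.re hr
  · refine mul_le_mul_of_nonneg_left ?_ N.M0.le
    refine (norm_le_abs_re_add_abs_im _).trans ?_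
    simp only [sub_zero, abs_of_pos t1]
    nlinarith
  · refine mul_le_mul_of_nonneg_left ?_ N.M0.le
    refine (norm_le_abs_re_add_abs_im _).trans ?_
    simp only [sub_re, one_re, sub_im, one_im, sub_zero]
    rw [abs_of_nonpos (by linarith : z.re - 1 ≤ 0)]
    nlinarith

lemma Net.inj (N : Net G lam) (j) : InjOn (N.σ j) (N.V j) := fun z hz w hw h => by
  have := N.lipl j z hz w hw
  rw [h, sub_self, norm_zero] at this
  have h2 : ‖z - w‖ ≤ 0 := by nlinarith [N.m0, norm_nonneg (z - w)]
  exact sub_eq_zero.1 (norm_le_zero_iff.1 h2)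

lemma Rf.exists (N : Net G lam) (C : Cf G φ ψ) {ρ : ℝ} (hρ : 1 / 2 ≤ ρ) (hρ1 : ρ < 1) :
    ∃ k, ∃ h0 : 0 < k, ∃ h1 : k ≤ N.κ, ∃ B H, Rf (N.shrink k h0 h1) φ ρ B H := by
  obtain ⟨d, hd, hfar⟩ := C.far hρ1 N.Go
  have hα0 : 0 < 2 - lam := by linarith [N.lam2]
  choose A hA hlog using fun j => N.log_bound C j
  obtain ⟨A', hA'⟩ := Finite.exists_le A
  have hA'0 : 0 < A' := (hA N.i0).trans_le (hA' _)
  set k := min N.κ (d / N.M) with hk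
  have hk0 : 0 < k := lt_min N.κ0 (div_pos hd N.M0)
  have hkκ : k ≤ N.κ := min_le_left _ _
  have hT : Tent k k ⊆ Tent N.κ N.κ := Tent.mono hkκ hkκ
  have hupG : ∀ j, ∀ z ∈ Tent k k, 0 < z.im → N.σ j z ∈ G := fun j z hz => N.up j z (hT hz)
  have hσd : ∀ j, DifferentiableOn ℂ (N.σ j) (Tent k k ∩ {z | 0 < z.im}) := fun j =>
    (N.diff j).mono fun z hz => N.tV j (hT hz.1)
  have key : ∀ j, _ := fun j => refl_arc (h := fun z => φ (N.σ j z)) (k := k) (ρ := ρ)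
    (A := A' * (N.M * 4) ^ (1 / (2 - lam)) ) (β := 1 / (2 - lam))
    hk0 (hkκ.trans N.κ1) ℓ (by have := N.M0; positivity) ℘
    (C.d.comp (hσd j) fun z hz => hupG j z hz.1 hz.2)
    (fun z hz w hw h => N.inj j (N.tV j (hT hz.1)) (N.tV j (hT hw.1))
      (C.injOn (hupG j z hz.1 hz.2) (hupG j w hw.1 hw.2) h))
    (by
      intro z hz h0
      obtain ⟨t1, t2, t3, t4⟩ := id hz
      obtain ⟨n1, n2, n3⟩ := N.near j (hT hz)
      have hzG := hupG j z hz h0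
      have hp : 0 < z.re * (1 - z.re) := mul_pos t1 ℓ
      have hf : ρ < ‖φ (N.σ j z)‖ := by
        refine hfar _ hzG _ (N.p_not j (x := z.re) ⟨t1.le, t2.le⟩) (n1.trans_lt ?_)
        rw [abs_of_pos h0]
        have : k ≤ d / N.M := min_le_right _ _
        rw [le_div_iff₀ N.M0] at this
        have h3 : z.re * (1 - z.re) ≤ 1 := by nlinarith
        have h4 : z.im < k := t4.trans_le (mul_le_of_le_one_right hk0.le h3)
        nlinarith [N.M0]
      refine ⟨hf, by simpa using C.m hzG, ?_⟩
      have hc : ∀ i : Fin N.N, ‖N.σ j z - N.σ i 0‖ ≤ N.M * 4 * ϖ z.re →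
          -Real.log ‖φ (N.σ j z)‖ ≤ A' * (N.M * 4) ^ (1 / (2 - lam)) * ϖ z.re ^ (1 / (2 - lam)) := by
        intro i hi
        refine (hlog i _ hzG ℓ).trans ?_
        rw [mul_assoc, ← Real.mul_rpow (by have := N.M0; positivity) hp.le]
        exact mul_le_mul (hA' i) (Real.rpow_le_rpow 𝔫 hi ℘)
          ℘ hA'0.le
      rcases le_total z.re (1 / 2) with h | h
      · refine hc j (n2.trans ?_)
        rw [mul_assoc]
        exact mul_le_mul_of_nonneg_left ℓₙ N.M0.le
      · refine hc (N.nxt j) ?_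
        rw [← N.joint, mul_assoc]
        exact n3.trans (mul_le_mul_of_nonneg_left ℓₙ N.M0.le))
    (by
      intro x hx
      have hxT : (x:ℂ) ∈ Tent k k := Tent.real hk0 hk0 hx
      have hb := C.bdry N.Go (N.p_not j ⟨hx.1.le, hx.2.le⟩)
      refine hb.comp (tendsto_nhdsWithin_iff.2 ⟨?_, ?_⟩)
      · exact ((N.diff j).continuousOn.continuousAt ((N.Vo j).mem_nhds (N.tV j (hT hxT)))).tendsto.mono_left
          nhdsWithin_le_nhds
      · filter_upwards [self_mem_nhdsWithin, nhdsWithin_le_nhds ((Tent.isOpen k k).mem_nhds hxT)] with z h1 h2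
        exact hupG j z h2 h1)
  choose B H h1 h2 h2' h3 h4 using key
  obtain ⟨B', hB'⟩ := Finite.exists_le B
  refine ⟨k / 64, ℘, ℓ, B', H, h1, h2, h2', fun j z hz => ?_, h4⟩
  obtain ⟨a1, a2, a3, a4⟩ := h3 j z hz
  refine ⟨a1, a2, a3, a4.trans ?_⟩
  have hp : 0 ≤ z.re * (1 - z.re) := mul_nonneg hz.1.le (by linarith [hz.2.1])
  gcongr
  exact hB' j

def cp (η x : ℝ) : ℂ := ⟨x, -(η * ϖ x)⟩
def cd (η x : ℝ) : ℂ := ⟨1, -(η * (1 - 2 * x))⟩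

lemma cp_hasDerivAt (η x : ℝ) : HasDerivAt (cp η) (cd η x) x := by
  have h1 : HasDerivAt (fun x : ℝ => (x:ℂ) + (-(η * ϖ x) : ℝ) * I) (cd η x) x := by
    have a := (hasDerivAt_id x).ofReal_comp
    have b : HasDerivAt (fun x : ℝ => -(η * ϖ x)) (-(η * (1 - 2 * x))) x := by
      have := (((hasDerivAt_id x).mul ((hasDerivAt_id x).const_sub 1)).const_mul η).neg
      refine this.congr_deriv ?_
      simp only [id]; ring
    refine (a.add (b.ofReal_comp.mul_const I)).congr_deriv ?_
    apply Complex.ext <;> simp [cd]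
  refine h1.congr_of_eventuallyEq (Eventually.of_forall fun x => ?_)
  apply Complex.ext <;> simp [cp]

lemma cd_cont (η : ℝ) : Continuous (cd η) := by
  have : cd η = fun x : ℝ => (1:ℂ) + (-(η * (1 - 2 * x)) : ℝ) * I := by
    ext x; apply Complex.ext <;> simp [cd]
  rw [this]; fun_prop

lemma cd_le {η x : ℝ} (hx : x ∈ 𝕀c) : ‖cd η x‖ ≤ 1 + |η| := by
  refine (norm_le_abs_re_add_abs_im _).trans ?_
  simp only [cd, abs_one, abs_neg, abs_mul]
  have : |1 - 2 * x| ≤ 1 := by rw [abs_le]; constructor <;> linarith [hx.1, hx.2]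
  nlinarith [abs_nonneg η]

lemma cp_mem {k1 k2 η x : ℝ} (h1 : η < k1) (h2 : -k2 < η) (hx : x ∈ 𝕀o) : cp η x ∈ Tent k1 k2 := by
  have hp : 0 < x * (1 - x) := mul_pos hx.1 (by linarith [hx.2])
  refine ⟨hx.1, hx.2, ?_, ?_⟩ <;> simp only [cp] <;> nlinarith

lemma xx_int {a : ℝ} (ha : -1 < a) : IntervalIntegrable (fun x : ℝ => ϖ x ^ a) volume 0 1 := by
  have := (Complex.betaIntegral_convergent (u := (a + 1 : ℝ)) (v := (a + 1 : ℝ))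
    (by rw [ofReal_re]; linarith) (by rw [ofReal_re]; linarith)).norm
  rw [intervalIntegrable_iff_integrableOn_Ioo_of_le zero_le_one] at *
  refine this.congr_fun (fun x hx => ?_) measurableSet_Ioo
  have h1 : 𝟘 < 1 - x := by linarith [hx.2]
  have e : (1 - (x:ℂ)) = ((1 - x : ℝ) : ℂ) := by push_cast; ring
  have e2 : ((a + 1 : ℝ):ℂ) - 1 = (a:ℂ) := by push_cast; ring
  simp only [norm_mul, e, e2]
  rw [norm_cpow_eq_rpow_re_of_pos hx.1, norm_cpow_eq_rpow_re_of_pos h1, ofReal_re,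
    Real.mul_rpow hx.1.le h1.le]

lemma cont_ends {q : ℝ → ℂ} (hc : ContinuousOn q (Icc 0 1)) :
    Tendsto q (𝓝[>] 0) (𝓝 (q 0)) ∧ Tendsto q (𝓝[<] 1) (𝓝 (q 1)) := by
  rw [← nhdsWithin_Ioo_eq_nhdsGT (zero_lt_one (α := ℝ)), ← nhdsWithin_Ioo_eq_nhdsLT (zero_lt_one (α := ℝ))]
  exact ⟨(hc 0 𝔰).mono_left (nhdsWithin_mono _ Ioo_subset_Icc_self),
    (hc 1 𝔰).mono_left (nhdsWithin_mono _ Ioo_subset_Icc_self)⟩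

set_option maxHeartbeats 600000 in
/-- primitive along tents -/
lemma arc_prim {κ k C : ℝ} (hκ : 0 < κ) (hk : 0 < k) {g : ℂ → ℂ}
    (hg : DifferentiableOn ℂ g (Tent κ k))
    (hb : ∀ z ∈ Tent κ k, ‖g z‖ ≤ C * ϖ z.re ^ ħ) :
    ∃ P : ℂ → ℂ, (∀ z ∈ Tent κ k, HasDerivAt P (g z) z) ∧ ∃ u v : ℂ, ∀ η, η < κ → -k < η →
      Tendsto (fun x => P (cp η x)) (𝓝[>] 0) (𝓝 v) ∧ Tendsto (fun x => P (cp η x)) (𝓝[<] 1) (𝓝 u) ∧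
      IntervalIntegrable (fun x => g (cp η x) * cd η x) volume 0 1 ∧
      ∫ x in 𝟘..1, g (cp η x) * cd η x = u - v := by
  have hconv := Tent.convex hκ.le hk.le
  have hopen := Tent.isOpen κ k
  have hhalf : (½ : ℂ) ∈ Tent κ k := Tent.real hκ hk ⟨by norm_num, by norm_num⟩
  have C0 : 0 ≤ C := by
    have := (norm_nonneg _).trans (hb _ hhalf)
    by_contra hcon; push Not at hcon
    rw [ofReal_re] at this
    have h2 : 0 < (½ * (1 - 1 / 2)) ^ ħ := by positivity
    nlinarith
  obtain ⟨P, hP⟩ := hconv.exists_forall_hasDerivWithinAt hg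
  have hP' : ∀ z ∈ Tent κ k, HasDerivAt P (g z) z := fun z hz => (hP z hz).hasDerivAt (hopen.mem_nhds hz)
  have hder : ∀ η, η < κ → -k < η → ∀ x ∈ 𝕀o,
      HasDerivAt (fun x => P (cp η x)) (g (cp η x) * cd η x) x := fun η h1 h2 x hx =>
    (hP' _ (cp_mem h1 h2 hx)).comp x (cp_hasDerivAt η x)
  have hint : ∀ η, η < κ → -k < η → IntervalIntegrable (fun x => g (cp η x) * cd η x) volume 0 1 := by
    intro η h1 h2
    have h0 := (xx_int (a := -(1 / 2)) (by norm_num)).const_mul (C * (1 + |η|))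
    rw [intervalIntegrable_iff_integrableOn_Ioo_of_le zero_le_one] at *
    refine h0.mono' ?_ ?_
    · refine ContinuousOn.aestronglyMeasurable ?_ measurableSet_Ioo
      refine ContinuousOn.mul (hg.continuousOn.comp ?_ fun x hx => cp_mem h1 h2 hx) (cd_cont η).continuousOn
      exact fun x _ => (cp_hasDerivAt η x).continuousAt.continuousWithinAt
    · refine (ae_restrict_iff' measurableSet_Ioo).2 (Eventually.of_forall fun x hx => ?_)
      rw [norm_mul]
      have a1 := hb _ (cp_mem h1 h2 hx)
      simp only [cp] at a1
      have a2 := cd_le (η := η) ⟨hx.1.le, hx.2.le⟩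
      have : 0 ≤ ϖ x ^ ħ :=
        Real.rpow_nonneg (mul_nonneg hx.1.le (by linarith [hx.2])) _
      calc _ ≤ (C * ϖ x ^ ħ) * (1 + |η|) :=
            mul_le_mul a1 a2 𝔫 ℘
        _ = _ := by ring
  have hlim : ∀ η, η < κ → -k < η → ∃ u v, Tendsto (fun x => P (cp η x)) (𝓝[>] 0) (𝓝 v) ∧
      Tendsto (fun x => P (cp η x)) (𝓝[<] 1) (𝓝 u) := by
    intro η h1 h2
    have hi := hint η h1 h2
    have hc : ContinuousOn (fun x => ∫ t in 𝟘..x, g (cp η t) * cd η t) (Icc 0 1) := by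
      have := intervalIntegral.continuousOn_primitive_interval' (b₁ := 𝟘) (b₂ := 1) hi left_mem_uIcc
      rwa [uIcc_of_le zero_le_one] at this
    set q : ℝ → ℂ := fun x => ∫ t in 𝟘..x, g (cp η t) * cd η t with hq
    have he : ∀ x ∈ 𝕀o, P (cp η x) = q x + (P (cp η (1 / 2)) - q (1 / 2)) := by
      intro x hx
      have s1 : ∀ a b, a ∈ 𝕀c → b ∈ 𝕀c →
          IntervalIntegrable (fun x => g (cp η x) * cd η x) volume a b := fun a b ha hb =>
        hi.mono_set (by rw [uIcc_of_le zero_le_one]; exact uIcc_subset_Icc ha hb)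
      have hxx : x ∈ 𝕀c := ⟨hx.1.le, hx.2.le⟩
      have hh : ½ ∈ 𝕀c := ⟨by norm_num, by norm_num⟩
      have e1 := intervalIntegral.integral_eq_sub_of_hasDerivAt (a := 1 / 2) (b := x)
        (f := fun x => P (cp η x)) (f' := fun x => g (cp η x) * cd η x) (fun t ht => hder η h1 h2 t (by
          have : uIcc ½ x ⊆ Ioo 0 1 := ordConnected_Ioo.uIcc_subset ⟨by norm_num, by norm_num⟩ hx
          exact this ht)) (s1 _ _ hh hxx)
      have e2 := intervalIntegral.integral_interval_sub_left (s1 0 x 𝔰 hxx) (s1 0 (1 / 2) 𝔰 hh)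
      simp only [hq]
      rw [e1] at e2
      linear_combination -e2
    refine ⟨q 1 + (P (cp η (1 / 2)) - q (1 / 2)), q 0 + (P (cp η (1 / 2)) - q (1 / 2)), ?_, ?_⟩
    · refine ((cont_ends hc).1.add_const _).congr' ?_
      filter_upwards [Ioo_mem_nhdsGT zero_lt_one] with x hx using (he x hx).symm
    · refine ((cont_ends hc).2.add_const _).congr' ?_
      filter_upwards [Ioo_mem_nhdsLT zero_lt_one] with x hx using (he x hx).symm
  have hdiff : ∀ η, η < κ → -k < η → ∀ x ∈ 𝕀o,
      ‖P (cp η x) - P (cp 0 x)‖ ≤ C * |η| * ϖ x ^ ½ := by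
    intro η h1 h2 x hx
    have hp : 0 < x * (1 - x) := mul_pos hx.1 (by linarith [hx.2])
    have hre : ∀ z ∈ segment ℝ (cp 0 x) (cp η x), z ∈ Tent κ k ∧ z.re = x := by
      intro z hz
      refine ⟨hconv.segment_subset (cp_mem hκ ℓ hx) (cp_mem h1 h2 hx) hz, ?_⟩
      obtain ⟨a, b, ha, hb, hab, rfl⟩ := hz
      simp only [cp, add_re, real_smul, re_ofReal_mul]
      rw [← add_mul, hab, one_mul]
    have := (convex_segment (cp 0 x) (cp η x)).norm_image_sub_le_of_norm_hasDerivWithin_le (f := P) (f' := g)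
      (C := C * ϖ x ^ ħ)
      (fun z hz => (hP' z (hre z hz).1).hasDerivWithinAt)
      (fun z hz => by have := hb z (hre z hz).1; rwa [(hre z hz).2] at this)
      (left_mem_segment _ _ _) (right_mem_segment _ _ _)
    refine this.trans_eq ?_
    have e : cp η x - cp 0 x = ((-(η * ϖ x) : ℝ) : ℂ) * I := by
      apply Complex.ext <;> simp [cp]
    rw [e, norm_mul, norm_I, mul_one, norm_real, Real.norm_eq_abs, abs_neg, abs_mul, abs_of_pos hp]
    have : ϖ x ^ ½ = ϖ x ^ ħ * ϖ x := by
      conv_rhs => rw [← Real.rpow_one ϖ x, ← Real.rpow_mul hp.le, ← Real.rpow_add hp]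
      norm_num
    rw [this]; ring
  obtain ⟨u, v, l1, l2⟩ := hlim 0 hκ ℓ
  have hz : ∀ a ∈ ({0, 1} : Set ℝ), ∀ η, Tendsto (fun x : ℝ => C * |η| * ϖ x ^ ½) (𝓝 a) (𝓝 0) := by
    intro a ha η
    have hc : Continuous fun x : ℝ => C * |η| * ϖ x ^ ½ :=
      continuous_const.mul ((by fun_prop : Continuous fun x : ℝ => x * (1 - x)).rpow_const
        fun x => Or.inr (by norm_num))
    have := hc.tendsto a
    have h0 : a * (1 - a) = 0 := by rcases ha with rfl | rfl <;> norm_num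
    rwa [h0, Real.zero_rpow (by norm_num), mul_zero] at this
  refine ⟨P, hP', u, v, fun η h1 h2 => ?_⟩
  have m1 : Tendsto (fun x => P (cp η x)) (𝓝[>] 0) (𝓝 v) := by
    have : Tendsto (fun x => P (cp η x) - P (cp 0 x)) (𝓝[>] 0) (𝓝 0) :=
      squeeze_zero_norm' (by
        filter_upwards [Ioo_mem_nhdsGT zero_lt_one] with x hx using hdiff η h1 h2 x hx)
        ((hz 0 𝔰 η).mono_left nhdsWithin_le_nhds)
    simpa using this.add l1
  have m2 : Tendsto (fun x => P (cp η x)) (𝓝[<] 1) (𝓝 u) := by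
    have : Tendsto (fun x => P (cp η x) - P (cp 0 x)) (𝓝[<] 1) (𝓝 0) :=
      squeeze_zero_norm' (by
        filter_upwards [Ioo_mem_nhdsLT zero_lt_one] with x hx using hdiff η h1 h2 x hx)
        ((hz 1 𝔰 η).mono_left nhdsWithin_le_nhds)
    simpa using this.add l2
  exact ⟨m1, m2, hint η h1 h2, intervalIntegral.integral_eq_sub_of_hasDerivAt_of_tendsto zero_lt_one
    (fun x hx => hder η h1 h2 x hx) (hint η h1 h2) m1 m2⟩


structure Adm (N : Net G lam) (Y : ℂ → ℂ) (Yj : Fin N.N → ℂ → ℂ) : Prop where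
  d : DifferentiableOn ℂ Y G
  t : ∃ k, 0 < k ∧ k ≤ N.κ ∧ ∃ C, ∀ j, DifferentiableOn ℂ (Yj j) (Tent N.κ k) ∧
    (∀ z ∈ Tent N.κ k, 0 < z.im → Yj j z = Y (N.σ j z)) ∧
    ∀ z ∈ Tent N.κ k, ‖Yj j z‖ ≤ C * ϖ z.re ^ ħ
  c : ∀ j, ∀ ε > 0, Tendsto (fun z => (z - N.σ j 0) * Y z)
    (𝓝[{z | z ∈ G ∧ ε * ‖z - N.σ j 0‖ ≤ infDist z Gᶜ}] (N.σ j 0)) (𝓝 0)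

lemma Net.core (N : Net G lam) (j) {θ : ℝ} (hθ : 0 < θ) : ∃ ε > 0, ∃ R : ℝ, ∀ L : ℂ, L.re < R →
    |L.im| ≤ (2 - N.la j) * Real.pi / 2 - θ → N.σ j 0 + N.e j * exp L ∈ G ∧
      ε * ‖N.e j * exp L‖ ≤ infDist (N.σ j 0 + N.e j * exp L) Gᶜ := by
  have hla := N.la2 j
  have hla0 : 0 < N.la j := N.lam0.trans_le (N.la1 j)
  have hpi := Real.pi_pos
  have he : N.e j ≠ 0 := by rw [← norm_pos_iff, N.e1]; norm_num
  have hpG : N.σ j 0 ∈ Gᶜ := by simpa using N.p_not j (x := 0) 𝔰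
  -- continuity of arg at 1
  have hcont : ContinuousAt arg 1 := continuousAt_arg 𝔰
  obtain ⟨ε', hε', harg⟩ := Metric.continuousAt_iff.1 hcont (θ / 2) ℘
  set ε := min (min ε' 1) 1 / 2 with hε
  have ε0 : 0 < ε := by positivity
  have ε1 : ε ≤ 1 / 2 := by
    have : min (min ε' 1) 1 ≤ 1 := min_le_right _ _
    linarith
  have ε2 : ε < ε' := by
    have : min (min ε' 1) 1 ≤ ε' := (min_le_left _ _).trans 𝔩
    have : 0 < min (min ε' 1) 1 := by positivity
    linarith
  have main : ∃ R : ℝ, ∀ L : ℂ, L.re < R → |L.im| ≤ (2 - N.la j) * Real.pi / 2 - θ →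
      ∀ w ∉ G, ε * ‖N.e j * exp L‖ ≤ ‖N.σ j 0 + N.e j * exp L - w‖ := by
    refine ⟨Real.log (min (N.δ / 2) (θ / (4 * N.K)) / 2), fun L hL hI w hw => ?_⟩
    by_contra hcon
    push Not at hcon
    have hb0 : 0 < min (N.δ / 2) (θ / (4 * N.K)) / 2 := by have := N.δ0; have := N.K0; positivity
    have hr : ‖N.e j * exp L‖ < min (N.δ / 2) (θ / (4 * N.K)) / 2 := by
      rw [norm_mul, N.e1, one_mul, norm_exp]
      rwa [Real.lt_log_iff_exp_lt hb0] at hL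
    have hn0 : 0 < ‖N.e j * exp L‖ := norm_pos_iff.2 (mul_ne_zero he (exp_ne_zero _))
    set u := (w - N.σ j 0) / (N.e j * exp L) with hu
    have hu1 : dist u 1 < ε := by
      rw [dist_eq_norm, hu, div_sub_one (norm_pos_iff.1 hn0), norm_div, div_lt_iff₀ hn0, ← norm_neg]
      have e0 : -(w - N.σ j 0 - N.e j * exp L) = N.σ j 0 + N.e j * exp L - w := by ring
      rwa [e0]
    have hue : w - N.σ j 0 = N.e j * exp L * u := by rw [hu]; field_simp
    have hu0 : u ≠ 0 := by rintro h; rw [h, dist_eq_norm] at hu1; norm_num at hu1; linarith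
    have ha := harg (hu1.trans ε2)
    rw [arg_one, dist_zero_right, Real.norm_eq_abs] at ha
    have hun : ‖u‖ ≤ 2 := by
      have := norm_le_norm_add_norm_sub' u 1
      rw [dist_eq_norm] at hu1; rw [norm_one] at this; linarith
    have hwn : ‖w - N.σ j 0‖ < min (N.δ / 2) (θ / (4 * N.K)) := by
      rw [hue, norm_mul]; nlinarith
    have hw0 : w ≠ N.σ j 0 := by
      intro h
      rw [h, sub_self] at hue
      exact mul_ne_zero (mul_ne_zero he (exp_ne_zero _)) hu0 hue.symm
    have h2 := N.n2 j w hw hw0 (hwn.trans_le ((min_le_left _ _).trans (by linarith [N.δ0])))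
    have hKr : N.K * ‖w - N.σ j 0‖ ≤ θ / 4 := by
      have : ‖w - N.σ j 0‖ ≤ θ / (4 * N.K) := hwn.le.trans 𝔯
      rw [le_div_iff₀ (by have := N.K0; positivity)] at this
      linarith
    -- arg of (w-p)/e
    have ht : (w - N.σ j 0) / N.e j = ‖exp L * u‖ * exp ((L.im + arg u : ℝ) * I) := by
      rw [hue]
      have e1 : exp L = Real.exp L.re * exp (L.im * I) := by
        rw [ofReal_exp, ← exp_add, re_add_im]
      have e2 := (norm_mul_exp_arg_mul_I u).symm
      rw [norm_mul, norm_exp]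
      have : exp ((L.im + arg u : ℝ) * I) = exp (L.im * I) * exp (arg u * I) := by
        rw [← exp_add]; push_cast; ring_nf
      rw [this]
      conv_lhs => rw [e2, e1]
      push_cast
      field_simp
    have hlu : 0 < ‖exp L * u‖ := norm_pos_iff.2 (mul_ne_zero (exp_ne_zero _) hu0)
    set t := L.im + arg u with htt
    have htb : |t| ≤ (2 - N.la j) * Real.pi / 2 - θ / 2 := by
      have := abs_add_le L.im (arg u); linarith
    rw [neg_div, ht] at h2
    have hneg : |arg (-(‖exp L * u‖ * exp ((t : ℝ) * I)))| = Real.pi - |t| := by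
      have htp : |t| < Real.pi := by nlinarith
      rcases le_or_gt 0 t with h | h
      · have : -((‖exp L * u‖ : ℂ) * exp ((t : ℝ) * I)) = (‖exp L * u‖ : ℝ) * (exp ((t - Real.pi : ℝ) * I)) := by
          push_cast; rw [sub_mul, exp_sub, exp_pi_mul_I]; ring
        rw [abs_of_nonneg h] at htp ⊢
        rcases h.eq_or_lt with h0 | h0
        · rw [← h0]; simp only [ofReal_zero, zero_mul, exp_zero, mul_one]
          rw [← ofReal_neg, arg_ofReal_of_neg ℓ, abs_of_pos hpi, sub_zero]
        · rw [this, arg_real_mul _ hlu, arg_exp_mul_I, (toIocMod_eq_self Real.two_pi_pos).2 ⟨ℓ, ℓ⟩,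
            abs_of_neg ℓ]
          ring
      · have : -((‖exp L * u‖ : ℂ) * exp ((t : ℝ) * I)) = (‖exp L * u‖ : ℝ) * (exp ((t + Real.pi : ℝ) * I)) := by
          push_cast; rw [add_mul, exp_add, exp_pi_mul_I]; ring
        rw [abs_of_neg h] at htp ⊢
        rw [this, arg_real_mul _ hlu, arg_exp_mul_I, (toIocMod_eq_self Real.two_pi_pos).2 ⟨ℓ, ℓ⟩,
            abs_of_pos ℓ]
        ring
    rw [hneg] at h2
    linarith
  obtain ⟨R, hR⟩ := main
  refine ⟨ε, ε0, R, fun L h1 h2 => ⟨?_, ?_⟩⟩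
  · by_contra hcon
    have := hR L h1 h2 _ hcon
    rw [sub_self, norm_zero] at this
    have h3 : 0 < ‖N.e j * exp L‖ := norm_pos_iff.2 (mul_ne_zero he (exp_ne_zero _))
    nlinarith
  · refine (le_infDist ⟨_, hpG⟩).2 fun w hw => ?_
    rw [dist_eq_norm]
    exact hR L h1 h2 w hw

lemma endlog {f : ℝ → ℂ} {f' : ℂ} (hf : HasDerivAt f f' 0) (h0 : f 0 = 0) (hs : f' ∈ slitPlane) :
    Tendsto (fun s : ℝ => log (f s) - Real.log s) (𝓝[>] 0) (𝓝 (log f')) ∧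
      ∀ᶠ s in 𝓝[>] 0, f s ≠ 0 := by
  have h1 : Tendsto (fun s : ℝ => ((s⁻¹ : ℝ) : ℂ) * f s) (𝓝[>] 0) (𝓝 f') := by
    have := hf.tendsto_slope_zero_right
    simpa [h0] using this
  have hne : ∀ᶠ s : ℝ in 𝓝[>] 0, ((s⁻¹ : ℝ) : ℂ) * f s ≠ 0 := h1.eventually_ne (slitPlane_ne_zero hs)
  refine ⟨((continuousAt_clog hs).tendsto.comp h1).congr' ?_, ?_⟩
  · filter_upwards [hne, self_mem_nhdsWithin] with s h hs
    have hs : 0 < s := hs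
    rw [Function.comp_apply, log_ofReal_mul (inv_pos.2 hs) (right_ne_zero_of_mul h), Real.log_inv]
    push_cast; ring
  · filter_upwards [hne] with s h using right_ne_zero_of_mul h

lemma polar_log {r θ : ℝ} (hr : 0 < r) (hθ : |θ| < Real.pi) {z : ℂ} (hz : z = r * exp (θ * I)) :
    z ∈ slitPlane ∧ (log z).im = θ := by
  rw [abs_lt] at hθ
  have ha : arg z = θ := by
    rw [hz, arg_real_mul _ hr, arg_exp_mul_I, (toIocMod_eq_self Real.two_pi_pos).2 ⟨ℓ, ℓ⟩]
  refine ⟨mem_slitPlane_iff_arg.2 ⟨by rw [ha]; linarith, ?_⟩, by rw [log_im, ha]⟩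
  rw [hz]; exact mul_ne_zero (by exact_mod_cast hr.ne') (exp_ne_zero _)


lemma Net.dV (N : Net G lam) (j) {z : ℂ} (hz : z ∈ N.V j) : HasDerivAt (N.σ j) (deriv (N.σ j) z) z :=
  ((N.diff j).differentiableAt ((N.Vo j).mem_nhds hz)).hasDerivAt

lemma Net.dbd (N : Net G lam) (j) {z : ℂ} (hz : z ∈ N.V j) : N.m ≤ ‖deriv (N.σ j) z‖ ∧
    ‖deriv (N.σ j) z‖ ≤ N.M := by
  have h := (N.dV j hz).tendsto_slope.norm
  have hV : ∀ᶠ w in 𝓝[≠] z, w ∈ N.V j := nhdsWithin_le_nhds ((N.Vo j).mem_nhds hz)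
  constructor
  · refine ge_of_tendsto h ?_
    filter_upwards [hV, self_mem_nhdsWithin] with w hw hne
    have : 0 < ‖w - z‖ := norm_pos_iff.2 (sub_ne_zero.2 hne)
    rw [slope_def_field, norm_div, le_div_iff₀ this]
    exact N.lipl j w hw z hz
  · refine le_of_tendsto h ?_
    filter_upwards [hV, self_mem_nhdsWithin] with w hw hne
    have : 0 < ‖w - z‖ := norm_pos_iff.2 (sub_ne_zero.2 hne)
    rw [slope_def_field, norm_div, div_le_iff₀ this]
    exact N.lipu j w hw z hz

lemma Net.e0 (N : Net G lam) (j) : N.e j ≠ 0 := by rw [← norm_pos_iff, N.e1]; norm_num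

lemma Net.join (N : Net G lam) (j) {Ψ Y : ℂ → ℂ} (hΨ : ∀ z ∈ G, HasDerivAt Ψ (Y z) z)
    (hc : ∀ ε > 0, Tendsto (fun z => (z - N.σ (N.nxt j) 0) * Y z)
      (𝓝[{z | z ∈ G ∧ ε * ‖z - N.σ (N.nxt j) 0‖ ≤ infDist z Gᶜ}] (N.σ (N.nxt j) 0)) (𝓝 0))
    {k : ℝ} (hk : 0 < k) {u v : ℂ}
    (hu : ∀ η < 0, -k < η → Tendsto (fun x => Ψ (N.σ j (cp η x))) (𝓝[<] 1) (𝓝 u))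
    (hv : ∀ η < 0, -k < η → Tendsto (fun x => Ψ (N.σ (N.nxt j) (cp η x))) (𝓝[>] 0) (𝓝 v)) : u = v := by
  set i := N.nxt j with hi
  set p := N.σ i 0 with hp
  have hpi := Real.pi_pos
  have hla := N.la2 i
  have hla0 : 0 < N.la i := N.lam0.trans_le (N.la1 i)
  set α := 2 - N.la i with hα
  have hα0 : 0 < α := by linarith
  have hα2 : α < 2 := by linarith
  obtain ⟨η, hη0, hηk, hη1⟩ : ∃ η : ℝ, η < 0 ∧ -k < η ∧ arg (1 - η * I) < α * Real.pi / 2 := by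
    have hcont : ContinuousAt (fun η : ℝ => arg (1 - η * I)) 0 := by
      refine ContinuousAt.comp (f := fun η : ℝ => (1:ℂ) - η * I) (continuousAt_arg 𝔰) (by fun_prop)
    have : ∀ᶠ η : ℝ in 𝓝[<] 0, arg (1 - η * I) < α * Real.pi / 2 :=
      nhdsWithin_le_nhds (hcont.eventually_lt_const (by simp; positivity))
    obtain ⟨η, h1, h2⟩ := (this.and (Ioo_mem_nhdsLT (by linarith : -k < 0))).exists
    exact ⟨η, h2.2, h2.1, h1⟩
  set θ := arg (1 - η * I) with hθ
  have hθ0 : 0 < θ := by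
    have h1 : 0 ≤ θ := arg_nonneg_iff.2 (by simp; linarith)
    refine h1.lt_of_ne fun h => ?_
    have := (arg_eq_zero_iff.1 h.symm).2
    simp at this; linarith
  have e1 : (1 - η * I : ℂ) = ‖(1 - η * I : ℂ)‖ * exp (θ * I) := (norm_mul_exp_arg_mul_I _).symm
  have e2 : (1 + η * I : ℂ) = ‖(1 - η * I : ℂ)‖ * exp ((-θ : ℝ) * I) := by
    have := congrArg ℭ e1
    rw [map_mul, ← exp_conj] at this
    simp only [map_sub, map_one, map_mul, conj_ofReal, conj_I] at this
    rw [show (1 + η * I : ℂ) = 1 - η * -I by ring, this]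
    push_cast; ring_nf
  have hn : 0 < ‖(1 - η * I : ℂ)‖ := by
    rw [norm_pos_iff]; intro h
    have := congrArg re h; simp at this
  have hD1 : 0 < ‖deriv (N.σ j) 1‖ := N.m0.trans_le (N.dbd j (N.V1 j)).1
  have hD0 : 0 < ‖deriv (N.σ i) 0‖ := N.m0.trans_le (N.dbd i (N.V0 i)).1
  have he := N.e0 i
  have habs : |α * Real.pi / 2 - θ| < α * Real.pi / 2 - θ / 2 := by rw [abs_lt]; constructor <;> linarith
  have hpi' : |α * Real.pi / 2 - θ| < Real.pi := habs.trans ℓₙ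
  -- the two curves
  have hA : HasDerivAt (fun s : ℝ => (N.σ j (cp η (1 - s)) - p) / N.e i)
      (-deriv (N.σ j) 1 * (1 + η * I) / N.e i) 0 := by
    have h1 : HasDerivAt (fun s : ℝ => cp η (1 - s)) (-cd η (1 - 0)) 0 := by
      have := (cp_hasDerivAt η (1 - 0)).scomp 𝟘 ((hasDerivAt_id 𝟘).const_sub 1)
      simpa using! this
    have hcp : cp η (1 - 0) = 1 := by apply Complex.ext <;> simp [cp]
    have h2 : HasDerivAt (N.σ j) (deriv (N.σ j) 1) (cp η (1 - 0)) := by rw [hcp]; exact N.dV j (N.V1 j)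
    refine (((h2.comp 𝟘 h1).sub_const p).div_const (N.e i)).congr_deriv ?_
    have : cd η (1 - 0) = 1 + η * I := by apply Complex.ext <;> simp [cd]; ring
    rw [this]; ring
  have hB : HasDerivAt (fun s : ℝ => (N.σ i (cp η s) - p) / N.e i)
      (deriv (N.σ i) 0 * (1 - η * I) / N.e i) 0 := by
    have hcp : cp η 0 = 0 := by apply Complex.ext <;> simp [cp]
    have h2 : HasDerivAt (N.σ i) (deriv (N.σ i) 0) (cp η 0) := by rw [hcp]; exact N.dV i (N.V0 i)
    refine (((h2.comp 𝟘 (cp_hasDerivAt η 0)).sub_const p).div_const (N.e i)).congr_deriv ?_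
    have : cd η 0 = 1 - η * I := by apply Complex.ext <;> simp [cd]
    rw [this]
  obtain ⟨sA, iA⟩ := polar_log (r := ‖deriv (N.σ j) 1‖ * ‖(1 - η * I : ℂ)‖) (θ := α * Real.pi / 2 - θ)
    ℘ hpi' (z := -deriv (N.σ j) 1 * (1 + η * I) / N.e i) (by
      have t1 := N.tan1 j
      rw [← hi] at t1
      generalize hd1 : ‖deriv (N.σ j) 1‖ = d1 at t1
      rw [t1, e2]
      have : exp ((α * Real.pi / 2 - θ : ℝ) * I) = exp (((2 - N.la i) * Real.pi / 2 : ℝ) * I) * exp ((-θ : ℝ) * I) := by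
        rw [← exp_add]; push_cast [hα]; ring_nf
      rw [this]
      generalize exp (((2 - N.la i) * Real.pi / 2 : ℝ) * I) = E1
      push_cast
      field_simp)
  obtain ⟨sB, iB⟩ := polar_log (r := ‖deriv (N.σ i) 0‖ * ‖(1 - η * I : ℂ)‖) (θ := -(α * Real.pi / 2 - θ))
    ℘ (by rwa [abs_neg]) (z := deriv (N.σ i) 0 * (1 - η * I) / N.e i) (by
      have t1 := N.tan0 i
      generalize hd1 : ‖deriv (N.σ i) 0‖ = d1 at t1
      rw [t1]
      have : exp ((-(α * Real.pi / 2 - θ) : ℝ) * I) = exp ((-((2 - N.la i) * Real.pi / 2) : ℝ) * I) * exp (θ * I) := by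
        rw [← exp_add]; push_cast [hα]; ring_nf
      rw [this]
      generalize exp ((-((2 - N.la i) * Real.pi / 2) : ℝ) * I) = E1
      rw [show (((d1 * ‖(1 - η * I : ℂ)‖ : ℝ)):ℂ) * (E1 * exp (θ * I)) = d1 * E1 * (‖(1 - η * I : ℂ)‖ * exp (θ * I)) by push_cast; ring, ← e1]
      field_simp)
  obtain ⟨lA, nA⟩ := endlog hA (by
    have hcp : cp η (1 - 0) = 1 := by apply Complex.ext <;> simp [cp]
    simp only [hcp, N.joint j]; rw [← hi, ← hp, sub_self, zero_div]) sA
  obtain ⟨lB, nB⟩ := endlog hB (by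
    have hcp : cp η 0 = 0 := by apply Complex.ext <;> simp [cp]
    simp only [hcp]; rw [← hp, sub_self, zero_div]) sB
  -- limits of Ψ
  have tu : Tendsto (fun s : ℝ => Ψ (N.σ j (cp η (1 - s)))) (𝓝[>] 0) (𝓝 u) := by
    have : Tendsto (fun s : ℝ => 1 - s) (𝓝[>] 0) (𝓝[<] 1) := by
      refine tendsto_nhdsWithin_iff.2 ⟨?_, ?_⟩
      · have : Tendsto (fun s : ℝ => 1 - s) (𝓝 0) (𝓝 (1 - 0)) := (by fun_prop : Continuous fun s : ℝ => 1 - s).tendsto 0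
        rw [sub_zero] at this
        exact this.mono_left nhdsWithin_le_nhds
      · filter_upwards [self_mem_nhdsWithin] with s hs
        have : 𝟘 < s := hs
        show 1 - s < 1
        linarith
    exact (hu η hη0 hηk).comp this
  have tv := hv η hη0 hηk
  have lim := (tu.sub tv).norm
  obtain ⟨ε, hε, R, hcore⟩ := N.core i (θ := θ / 2) ℘
  set D := ‖log (-deriv (N.σ j) 1 * (1 + η * I) / N.e i) - log (deriv (N.σ i) 0 * (1 - η * I) / N.e i)‖ + 1 with hD
  have hDpos : 0 < D := by positivity
  refine sub_eq_zero.1 (norm_le_zero_iff.1 (le_of_forall_pos_le_add fun τ hτ => ?_))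
  rw [zero_add]
  refine le_of_tendsto lim ?_
  -- smallness
  have hsm := (Metric.tendsto_nhds.1 (hc ε hε) (τ / D) ℘)
  rw [eventually_nhdsWithin_iff, Metric.eventually_nhds_iff] at hsm
  obtain ⟨r, hr, hsm⟩ := hsm
  set R' := min R (Real.log r) with hR'
  have ereA : Tendsto (fun s : ℝ => (log ((N.σ j (cp η (1 - s)) - p) / N.e i)).re) (𝓝[>] 0) atBot := by
    have h1 := (continuous_re.tendsto _).comp lA
    have h2 := h1.add_atBot Real.tendsto_log_nhdsGT_zero
    refine h2.congr fun s => ?_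
    simp
  have ereB : Tendsto (fun s : ℝ => (log ((N.σ i (cp η s) - p) / N.e i)).re) (𝓝[>] 0) atBot := by
    have h1 := (continuous_re.tendsto _).comp lB
    have h2 := h1.add_atBot Real.tendsto_log_nhdsGT_zero
    refine h2.congr fun s => ?_
    simp
  have imA : ∀ᶠ s : ℝ in 𝓝[>] 0, |(log ((N.σ j (cp η (1 - s)) - p) / N.e i)).im| < α * Real.pi / 2 - θ / 2 := by
    have h1 := ((continuous_im.tendsto _).comp lA).abs
    rw [iA] at h1
    filter_upwards [h1.eventually_lt_const habs] with s hs
    simpa using! hs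
  have imB : ∀ᶠ s : ℝ in 𝓝[>] 0, |(log ((N.σ i (cp η s) - p) / N.e i)).im| < α * Real.pi / 2 - θ / 2 := by
    have h1 := ((continuous_im.tendsto _).comp lB).abs
    rw [iB, abs_neg] at h1
    filter_upwards [h1.eventually_lt_const habs] with s hs
    simpa using! hs
  have dAB : ∀ᶠ s : ℝ in 𝓝[>] 0, ‖log ((N.σ j (cp η (1 - s)) - p) / N.e i) - log ((N.σ i (cp η s) - p) / N.e i)‖ < D := by
    have h1 := (lA.sub lB).norm
    filter_upwards [h1.eventually_lt_const (lt_add_one _)] with s hs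
    simpa only [sub_sub_sub_cancel_right] using! hs
  filter_upwards [ereA.eventually_lt_atBot R', ereB.eventually_lt_atBot R', imA, imB, dAB, nA, nB] with s a1 a2 a3 a4 a5 a6 a7
  set LA := log ((N.σ j (cp η (1 - s)) - p) / N.e i) with hLA
  set LB := log ((N.σ i (cp η s) - p) / N.e i) with hLB
  have eA : p + N.e i * exp LA = N.σ j (cp η (1 - s)) := by
    rw [hLA, exp_log a6]; field_simp; ring
  have eB : p + N.e i * exp LB = N.σ i (cp η s) := by
    rw [hLB, exp_log a7]; field_simp; ring
  have hconv : Convex ℝ {L : ℂ | L.re < R' ∧ |L.im| ≤ α * Real.pi / 2 - θ / 2} := by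
    have : {L : ℂ | L.re < R' ∧ |L.im| ≤ α * Real.pi / 2 - θ / 2} =
        {L : ℂ | L.re < R'} ∩ ({L : ℂ | -(α * Real.pi / 2 - θ / 2) ≤ L.im} ∩ {L : ℂ | L.im ≤ α * Real.pi / 2 - θ / 2}) := by
      ext L; simp [abs_le]
    rw [this]
    exact (convex_halfSpace_re_lt _).inter ((convex_halfSpace_im_ge _).inter (convex_halfSpace_im_le _))
  have := hconv.norm_image_sub_le_of_norm_hasDerivWithin_le (f := fun L => Ψ (p + N.e i * exp L))
    (f' := fun L => Y (p + N.e i * exp L) * (N.e i * exp L)) (C := τ / D) (x := LB) (y := LA) ?_ ?_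
    ⟨a2, a4.le⟩ ⟨a1, a3.le⟩
  · simp only [eA, eB] at this
    refine this.trans ?_
    calc τ / D * ‖LA - LB‖ ≤ τ / D * D := by gcongr
      _ = τ := by field_simp
  · rintro L ⟨l1, l2⟩
    have := (hcore L (l1.trans_le 𝔩) l2).1
    exact ((hΨ _ this).comp L (((hasDerivAt_exp L).const_mul (N.e i)).const_add p)).hasDerivWithinAt
  · rintro L ⟨l1, l2⟩
    obtain ⟨c1, c2⟩ := hcore L (l1.trans_le 𝔩) l2
    have hz : p + N.e i * exp L - p = N.e i * exp L := by ring
    have := hsm (y := p + N.e i * exp L) (by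
      rw [dist_eq_norm, hz, norm_mul, N.e1, one_mul, norm_exp]
      exact (Real.lt_log_iff_exp_lt hr).1 (l1.trans_le 𝔯)) ⟨c1, by rw [hz]; exact c2⟩
    rw [dist_zero_right, hz, mul_comm] at this
    exact this.le

lemma Cf.prim (C : Cf G φ ψ) (hG : IsOpen G) {Y : ℂ → ℂ} (hY : DifferentiableOn ℂ Y G) :
    ∃ Ψ : ℂ → ℂ, ∀ z ∈ G, HasDerivAt Ψ (Y z) z := by
  have hd : DifferentiableOn ℂ (fun w => Y (ψ w) * deriv ψ w) (ball 0 1) :=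
    (hY.comp C.d' C.m').mul (C.d'.deriv isOpen_ball)
  obtain ⟨P, hP⟩ := (convex_ball 𝕫 1).exists_forall_hasDerivWithinAt hd
  refine ⟨fun z => P (φ z), fun z hz => ?_⟩
  have h1 := (hP (φ z) (C.m hz)).hasDerivAt (isOpen_ball.mem_nhds (C.m hz))
  have h2 := (C.d.differentiableAt (hG.mem_nhds hz)).hasDerivAt
  have h3 := (C.d'.differentiableAt (isOpen_ball.mem_nhds (C.m hz))).hasDerivAt
  have h4 : deriv ψ (φ z) * deriv φ z = 1 := by
    have a := h3.comp z h2
    have b : HasDerivAt (ψ ∘ φ) 1 z := (hasDerivAt_id z).congr_of_eventuallyEq (by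
      filter_upwards [hG.mem_nhds hz] with w hw using C.l w hw)
    exact a.unique b
  refine (h1.comp z h2).congr_deriv ?_
  rw [C.l z hz]; linear_combination Y z * h4

lemma Adm.T {N : Net G lam} {Y : ℂ → ℂ} {Yj : Fin N.N → ℂ → ℂ} (A : Adm N Y Yj) (C : Cf G φ ψ) {η : ℝ}
    (h0 : 0 ≤ η) (h1 : η < N.κ) :
    (∀ j, IntervalIntegrable (fun x => Yj j (cp η x) * deriv (N.σ j) (cp η x) * cd η x) volume 0 1) ∧
    ∑ j, ∫ x in 𝟘..1, Yj j (cp η x) * deriv (N.σ j) (cp η x) * cd η x = 0 := by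
  obtain ⟨Ψ, hΨ⟩ := C.prim N.Go A.d
  obtain ⟨k, hk, hkκ, B, hB⟩ := A.t
  have hT : Tent N.κ k ⊆ Tent N.κ N.κ := Tent.mono le_rfl hkκ
  have hVT : ∀ j, Tent N.κ k ⊆ N.V j := fun j => hT.trans (N.tV j)
  choose P hP u v hPη using fun j => arc_prim (C := B * N.M) N.κ0 hk (g := fun z => Yj j z * deriv (N.σ j) z)
    ((hB j).1.mul (((N.diff j).deriv (N.Vo j)).mono (hVT j)))
    (fun z hz => by
      have a1 := (hB j).2.2 z hz
      have a2 := (N.dbd j (hVT j hz)).2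
      rw [norm_mul]
      calc _ ≤ (B * ϖ z.re ^ ħ) * N.M :=
            mul_le_mul a1 a2 𝔫 ((norm_nonneg _).trans a1)
        _ = _ := by ring)
  have hcv : Convex ℝ (Tent N.κ k ∩ {z | 0 < z.im}) := (Tent.convex N.κ0.le hk.le).inter (convex_halfSpace_im_gt 0)
  have hup : ∀ η, η < 0 → -k < η → ∀ x ∈ 𝕀o, cp η x ∈ Tent N.κ k ∩ {z | 0 < z.im} := by
    intro η a b x hx
    refine ⟨cp_mem (a.trans N.κ0) b hx, ?_⟩
    have hp : 0 < x * (1 - x) := mul_pos hx.1 (by linarith [hx.2])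
    show 0 < -(η * ϖ x)
    nlinarith
  have hconst : ∀ j, ∃ a : ℂ, ∀ z ∈ Tent N.κ k ∩ {z | 0 < z.im}, P j z = Ψ (N.σ j z) + a := by
    intro j
    have hz0 := hup (-k / 2) ℓ ℓ (1 / 2) ⟨by norm_num, by norm_num⟩
    refine ⟨P j (cp (-k / 2) (1 / 2)) - Ψ (N.σ j (cp (-k / 2) (1 / 2))), fun z hz => ?_⟩
    have := hcv.norm_image_sub_le_of_norm_hasDerivWithin_le (f := fun z => P j z - Ψ (N.σ j z))
      (f' := fun _ => 0) (C := 0) (fun w hw => by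
        have d1 := hP j w hw.1
        have d2 := (hΨ _ (N.up j w (hT hw.1) hw.2)).comp w (N.dV j (hVT j hw.1))
        rw [← (hB j).2.1 w hw.1 hw.2] at d2
        exact ((d1.sub d2).congr_deriv (sub_self _)).hasDerivWithinAt) (fun _ _ => by simp) hz0 hz
    rw [zero_mul] at this
    have h3 := sub_eq_zero.1 (norm_le_zero_iff.1 this)
    linear_combination h3
  choose a ha using hconst
  have l1 : ∀ j, ∀ η < 0, -k < η → Tendsto (fun x => Ψ (N.σ j (cp η x))) (𝓝[<] 1) (𝓝 (u j - a j)) := by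
    intro j η h h'
    refine ((hPη j η (h.trans N.κ0) h').2.1.sub_const (a j)).congr' ?_
    filter_upwards [Ioo_mem_nhdsLT zero_lt_one] with x hx
    rw [ha j _ (hup η h h' x hx)]; ring
  have l0 : ∀ j, ∀ η < 0, -k < η → Tendsto (fun x => Ψ (N.σ j (cp η x))) (𝓝[>] 0) (𝓝 (v j - a j)) := by
    intro j η h h'
    refine ((hPη j η (h.trans N.κ0) h').1.sub_const (a j)).congr' ?_
    filter_upwards [Ioo_mem_nhdsGT zero_lt_one] with x hx
    rw [ha j _ (hup η h h' x hx)]; ring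
  have hj : ∀ j, u j - a j = v (N.nxt j) - a (N.nxt j) := fun j =>
    N.join j hΨ (A.c _) hk (l1 j) (l0 _)
  refine ⟨fun j => (hPη j η h1 ℓ).2.2.1, ?_⟩
  have : ∀ j, ∫ x in 𝟘..1, Yj j (cp η x) * deriv (N.σ j) (cp η x) * cd η x = (u j - a j) - (v j - a j) := by
    intro j; rw [(hPη j η h1 ℓ).2.2.2]; ring
  simp only [this, hj]
  rw [Finset.sum_sub_distrib]
  rw [Equiv.sum_comp N.nxt (fun j => v j - a j), sub_self]

lemma mob_lt {b w : ℂ} (hb : ‖b‖ < 1) (hw : ‖w‖ < 1) : 1 - ℭ b * w ≠ 0 ∧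
    ‖(w - b) / (1 - ℭ b * w)‖ < 1 := by
  have h1 : ‖ℭ b * w‖ < 1 := by
    rw [norm_mul, norm_conj]; nlinarith [norm_nonneg b, norm_nonneg w]
  have hne : 1 - ℭ b * w ≠ 0 := by
    intro h
    rw [← sub_eq_zero.1 h, norm_one] at h1; exact lt_irrefl _ h1
  refine ⟨hne, ?_⟩
  rw [norm_div, div_lt_one (norm_pos_iff.2 hne), ← sq_lt_sq₀ 𝔫 𝔫,
    ← normSq_eq_norm_sq, ← normSq_eq_norm_sq]
  have hb2 : normSq b < 1 := by rw [normSq_eq_norm_sq]; nlinarith [norm_nonneg b]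
  have hw2 : normSq w < 1 := by rw [normSq_eq_norm_sq]; nlinarith [norm_nonneg w]
  simp only [normSq_apply, sub_re, sub_im, mul_re, mul_im, conj_re, conj_im, one_re, one_im] at *
  nlinarith [mul_pos (sub_pos.2 hb2) (sub_pos.2 hw2)]


lemma Cf.mob (C : Cf G φ ψ) (hG : IsOpen G) {b : ℂ} (hb : ‖b‖ < 1) :
    ∃ ψ', Cf G (fun z => (φ z - b) / (1 - ℭ b * φ z)) ψ' := by
  have hn : ∀ z ∈ G, ‖φ z‖ < 1 := fun z hz => by simpa using C.m hz
  refine Cf.exists hG ?_ ⟨fun z hz => by simpa using (mob_lt hb (hn z hz)).2, ?_, ?_⟩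
  · exact (C.d.sub_const b).div ((C.d.const_mul _).const_sub 1) fun z hz => (mob_lt hb (hn z hz)).1
  · intro z hz w hw h
    refine C.injOn hz hw ?_
    simp only at h
    rw [div_eq_div_iff (mob_lt hb (hn z hz)).1 (mob_lt hb (hn w hw)).1] at h
    have h2 : (1 - ℭ b * b) ≠ 0 := (mob_lt hb hb).1
    have h3 : (φ z - φ w) * (1 - ℭ b * b) = 0 := by linear_combination h
    exact sub_eq_zero.1 ((mul_eq_zero.1 h3).resolve_right h2)
  · intro w hw
    have hw' : ‖w‖ < 1 := by simpa using hw
    obtain ⟨m1, m2⟩ := mob_lt (b := -b) (by simpa using hb) hw'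
    have m3 := (mob_lt hb hb).1
    simp only [map_neg, neg_mul, sub_neg_eq_add] at m1 m2
    refine ⟨ψ ((w + b) / (1 + ℭ b * w)), C.m' (by simpa using m2), ?_⟩
    simp only
    rw [C.r _ (by simpa using m2)]
    have m4 := (mob_lt hb m2).1
    rw [div_eq_iff m4]
    have m1' : 1 + w * ℭ b ≠ 0 := by rwa [mul_comm]
    field_simp
    ring

lemma Cf.pick (C : Cf G φ ψ) (hG : IsOpen G) (hne : Gᶜ.Nonempty) {z : ℂ} (hz : z ∈ G) :
    ‖deriv φ z‖ * infDist z Gᶜ ≤ 2 * (1 - ‖φ z‖) := by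
  have hb : ‖φ z‖ < 1 := by simpa using C.m hz
  obtain ⟨ψ', C'⟩ := C.mob hG hb
  have hd : 0 < infDist z Gᶜ := (hG.isClosed_compl.notMem_iff_infDist_pos hne).1 (by simpa using hz)
  have hball : ball z (infDist z Gᶜ) ⊆ G := by
    intro w hw
    by_contra hcon
    have := infDist_le_dist_of_mem (x := z) (s := Gᶜ) hcon
    rw [mem_ball, dist_comm] at hw; linarith
  have h2 : (1 - ℭ (φ z) * φ z) ≠ 0 := (mob_lt hb hb).1
  have h1 := norm_deriv_le_div_of_mapsTo_ball (f := fun w => (φ w - φ z) / (1 - ℭ (φ z) * φ w))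
    (c := z) (R₁ := infDist z Gᶜ) (R₂ := 1) (C'.d.mono hball)
    (fun w hw => by simp only [sub_self, zero_div]; exact ball_subset_closedBall (C'.m (hball hw))) hd
  have hφ := (C.d.differentiableAt (hG.mem_nhds hz)).hasDerivAt
  have hdv : HasDerivAt (fun w => (φ w - φ z) / (1 - ℭ (φ z) * φ w))
      (deriv φ z / (1 - ℭ (φ z) * φ z)) z := by
    refine ((hφ.sub_const (φ z)).div ((hφ.const_mul _).const_sub 1) h2).congr_deriv ?_
    field_simp; ring
  rw [hdv.deriv, norm_div, le_div_iff₀ hd] at h1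
  have e : ‖1 - ℭ (φ z) * φ z‖ = 1 - ‖φ z‖ ^ 2 := by
    rw [← normSq_eq_conj_mul_self, normSq_eq_norm_sq, ← ofReal_one, ← ofReal_sub, norm_real, Real.norm_of_nonneg]
    nlinarith [norm_nonneg (φ z)]
  rw [e] at h1
  have hp : 0 < 1 - ‖φ z‖ ^ 2 := by nlinarith [norm_nonneg (φ z)]
  have h3 : ‖deriv φ z‖ * infDist z Gᶜ ≤ 1 - ‖φ z‖ ^ 2 := by
    rw [div_mul_eq_mul_div, div_le_one hp] at h1; exact h1
  nlinarith [norm_nonneg (φ z)]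

lemma conv_sqrt {O : Set ℂ} (hO : IsOpen O) (hc : Convex ℝ O) {x : ℂ} (hx : x ∈ O) {h : ℂ → ℂ}
    (hd : DifferentiableOn ℂ h O) (h0 : ∀ z ∈ O, h z ≠ 0) :
    ∃ s : ℂ → ℂ, DifferentiableOn ℂ s O ∧ ∀ z ∈ O, s z ^ 2 = h z := by
  obtain ⟨P, hP⟩ := hc.exists_forall_hasDerivWithinAt (f := fun z => deriv h z / h z) ((hd.deriv hO).div hd h0)
  have hconst : ∀ z ∈ O, h z * exp (-P z) = h x * exp (-P x) := by
    intro z hz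
    have := hc.norm_image_sub_le_of_norm_hasDerivWithin_le (f := fun z => h z * exp (-P z)) (f' := fun _ => 0) (C := 0)
      (fun w hw => by
        have d1 := (hd.differentiableAt (hO.mem_nhds hw)).hasDerivAt
        have d2 := (hP w hw).hasDerivAt (hO.mem_nhds hw)
        refine ((d1.mul d2.neg.cexp).congr_deriv ?_).hasDerivWithinAt
        have := h0 w hw
        simp only [Pi.neg_apply]
        field_simp; ring) (fun _ _ => by simp) hx hz
    rw [zero_mul] at this
    exact sub_eq_zero.1 (norm_le_zero_iff.1 this)
  refine ⟨fun z => exp ((P z - P x + log (h x)) / 2), ?_, fun z hz => ?_⟩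
  · have hPd : DifferentiableOn ℂ P O := fun z hz => (hP z hz).differentiableWithinAt
    exact (((hPd.sub_const _).add_const _).div_const 2).cexp
  · rw [← exp_nat_mul, show ((2:ℕ):ℂ) * ((P z - P x + log (h x)) / 2) = P z + -P x + log (h x) by push_cast; ring,
      exp_add, exp_log (h0 x hx), exp_add]
    have := hconst z hz
    rw [mul_assoc, mul_comm (exp (-P x)), ← this, exp_neg]
    field_simp

structure Sq (N : Net G lam) (φ : ℂ → ℂ) (H : Fin N.N → ℂ → ℂ) (f : ℂ → ℂ) (F : Fin N.N → ℂ → ℂ) (B : ℝ) : Prop where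
  d : DifferentiableOn ℂ f G
  sq : ∀ z ∈ G, f z ^ 2 = deriv φ z
  dj : ∀ j, DifferentiableOn ℂ (F j) (Tent N.κ N.κ)
  up : ∀ j, ∀ z ∈ Tent N.κ N.κ, 0 < z.im → F j z = f (N.σ j z)
  sj : ∀ j, ∀ z ∈ Tent N.κ N.κ, F j z ^ 2 * deriv (N.σ j) z = deriv (H j) z
  b : ∀ j, ∀ z ∈ Tent N.κ N.κ, ‖F j z‖ ≤ B * ϖ z.re ^ ((1 / (2 - lam) - 1) / 2)

lemma Rf.up' {N : Net G lam} {ρ B : ℝ} {H} (R : Rf N φ ρ B H) (C : Cf G φ ψ) (j) {z : ℂ} (hz : z ∈ Tent N.κ N.κ)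
    (h0 : 0 < z.im) : deriv (H j) z = deriv φ (N.σ j z) * deriv (N.σ j) z := by
  have h1 := (C.d.differentiableAt (N.Go.mem_nhds (N.up j z hz h0))).hasDerivAt.comp z (N.dV j (N.tV j hz))
  refine (h1.congr_of_eventuallyEq ?_).deriv
  filter_upwards [(Tent.isOpen _ _).mem_nhds hz, (isOpen_lt continuous_const continuous_im).mem_nhds h0] with w hw hw'
  exact R.up j w hw hw'

lemma Sq.exists {N : Net G lam} (C : Cf G φ ψ) {ρ B : ℝ} {H} (R : Rf N φ ρ B H) : ∃ f F B', Sq N φ H f F B' := by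
  have hφ0 : ∀ z ∈ G, deriv φ z ≠ 0 := fun z hz => deriv_ne_zero_of_inj N.Go C.d C.injOn hz
  obtain ⟨s, s1, s2⟩ := conv_sqrt isOpen_ball (convex_ball 𝕫 1) (mem_ball_self one_pos)
    (h := fun w => deriv φ (ψ w)) ((C.d.deriv N.Go).comp C.d' C.m') fun w hw => hφ0 _ (C.m' hw)
  have hx0 : (½ : ℂ) ∈ Tent N.κ N.κ := Tent.real N.κ0 N.κ0 ⟨by norm_num, by norm_num⟩
  have hσ0 : ∀ j, ∀ z ∈ Tent N.κ N.κ, deriv (N.σ j) z ≠ 0 := fun j z hz =>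
    norm_pos_iff.1 (N.m0.trans_le (N.dbd j (N.tV j hz)).1)
  have key : ∀ j, ∃ F : ℂ → ℂ, DifferentiableOn ℂ F (Tent N.κ N.κ) ∧
      (∀ z ∈ Tent N.κ N.κ, 0 < z.im → F z = s (φ (N.σ j z))) ∧
      (∀ z ∈ Tent N.κ N.κ, F z ^ 2 * deriv (N.σ j) z = deriv (H j) z) := by
    intro j
    obtain ⟨F, F1, F2⟩ := conv_sqrt (Tent.isOpen N.κ N.κ) (Tent.convex N.κ0.le N.κ0.le) hx0
      (h := fun z => deriv (H j) z / deriv (N.σ j) z)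
      (((R.d j).deriv (Tent.isOpen _ _)).div (((N.diff j).deriv (N.Vo j)).mono (N.tV j)) (hσ0 j))
      fun z hz => div_ne_zero (R.b j z hz).2.2.1 (hσ0 j z hz)
    have hpre : IsPreconnected (Tent N.κ N.κ ∩ {z | 0 < z.im}) :=
      ((Tent.convex N.κ0.le N.κ0.le).inter (convex_halfSpace_im_gt 0)).isPreconnected
    have F2' : ∀ z ∈ Tent N.κ N.κ, F z ^ 2 * deriv (N.σ j) z = deriv (H j) z := fun z hz => by
      rw [F2 z hz]; have := hσ0 j z hz; field_simp
    have hsφ : ∀ z ∈ Tent N.κ N.κ ∩ {z | 0 < z.im}, s (φ (N.σ j z)) ^ 2 = deriv φ (N.σ j z) := fun z hz => by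
      rw [s2 _ (C.m (N.up j z hz.1 hz.2)), C.l _ (N.up j z hz.1 hz.2)]
    have hco : ContinuousOn (fun z => s (φ (N.σ j z))) (Tent N.κ N.κ ∩ {z | 0 < z.im}) :=
      s1.continuousOn.comp (C.d.continuousOn.comp ((N.diff j).continuousOn.mono fun z hz => N.tV j hz.1)
        fun z hz => N.up j z hz.1 hz.2) fun z hz => C.m (N.up j z hz.1 hz.2)
    rcases hpre.eq_or_eq_neg_of_sq_eq (f := F) (g := fun z => s (φ (N.σ j z))) (F1.continuousOn.mono inter_subset_left) hco
      (fun z hz => by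
        simp only [Pi.pow_apply]
        rw [F2 z hz.1, hsφ z hz, R.up' C j hz.1 hz.2]
        have := hσ0 j z hz.1; field_simp)
      (fun {z} hz h0 => by
        have := hsφ z hz
        rw [h0] at this
        exact hφ0 _ (N.up j z hz.1 hz.2) (by rw [← this]; ring)) with h | h
    · exact ⟨F, F1, fun z hz h0 => h ⟨hz, h0⟩, F2'⟩
    · refine ⟨fun z => -F z, F1.neg, fun z hz h0 => ?_, fun z hz => by rw [neg_sq, F2' z hz]⟩
      have := h ⟨hz, h0⟩
      show -F z = _
      simp only [Pi.neg_apply] at this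
      rw [this, neg_neg]
  choose F F1 F2 F3 using key
  refine ⟨fun z => s (φ z), F, Real.sqrt (B / N.m), s1.comp C.d C.m, fun z hz => ?_, F1, F2, F3, fun j z hz => ?_⟩
  · rw [s2 _ (C.m hz), C.l z hz]
  · have hp : 0 < z.re * (1 - z.re) := mul_pos hz.1 (by linarith [hz.2.1])
    have e := congrArg norm (F3 j z hz)
    rw [norm_mul, norm_pow] at e
    have h1 := (R.b j z hz).2.2.2
    have h2 := (N.dbd j (N.tV j hz)).1
    have h3 : ‖F j z‖ ^ 2 ≤ B / N.m * ϖ z.re ^ (1 / (2 - lam) - 1) := by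
      rw [div_mul_eq_mul_div, le_div_iff₀ N.m0]
      nlinarith [sq_nonneg ‖F j z‖]
    rw [div_eq_mul_one_div _ (2:ℝ), Real.rpow_mul hp.le, ← Real.sqrt_eq_rpow,
      ← Real.sqrt_mul' _ (Real.rpow_nonneg hp.le _)]
    exact Real.le_sqrt_of_sq_le h3


lemma Net.dpos (N : Net G lam) {z : ℂ} (hz : z ∈ G) : 0 < infDist z Gᶜ :=
  (N.Go.isClosed_compl.notMem_iff_infDist_pos ⟨_, N.p_not N.i0 (x := 0) 𝔰⟩).1 (by simpa using hz)

lemma Net.lowG (N : Net G lam) (j) {w : ℂ} (hw : w ∈ Tent N.κ N.κ) (h : w.im ≤ 0) : N.σ j w ∉ G := by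
  rcases h.lt_or_eq with h | h
  · exact fun hc => N.low j w hw h (subset_closure hc)
  · have : w = (w.re : ℂ) := by apply Complex.ext <;> simp [h]
    rw [this]; exact N.p_not j ⟨hw.1.le, hw.2.1.le⟩

lemma Net.away (N : Net G lam) {z : ℂ} (hz : z ∈ G) : ∃ k, 0 < k ∧ k ≤ N.κ ∧ ∃ d > 0, ∀ j, ∀ w ∈ Tent N.κ k,
    d ≤ ‖N.σ j w - z‖ := by
  have hd := N.dpos hz
  set d := infDist z Gᶜ
  have hM := N.M0
  refine ⟨min N.κ (d / (2 * N.M)), lt_min N.κ0 ℘, min_le_left _ _, d / 2, ℘, fun j w hw => ?_⟩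
  have hw' : w ∈ Tent N.κ N.κ := Tent.mono le_rfl 𝔩 hw
  have far : ∀ q, q ∉ G → d ≤ ‖q - z‖ := fun q hq => by
    have := infDist_le_dist_of_mem (x := z) (s := Gᶜ) hq
    rwa [dist_comm, dist_eq_norm] at this
  rcases le_or_gt w.im 0 with h | h
  · linarith [far _ (N.lowG j hw' h)]
  · have h1 := (N.near j hw').1
    have h2 := far _ (N.p_not j (x := w.re) ⟨hw.1.le, hw.2.1.le⟩)
    have h3 : |w.im| ≤ d / (2 * N.M) := by
      rw [abs_of_pos h]
      have hp : w.re * (1 - w.re) ≤ 1 := by nlinarith [hw.1, hw.2.1]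
      have h4 := hw.2.2.2
      have : min N.κ (d / (2 * N.M)) * ϖ w.re ≤ min N.κ (d / (2 * N.M)) * 1 :=
        mul_le_mul_of_nonneg_left hp (le_min N.κ0.le ℘)
      linarith [min_le_right N.κ (d / (2 * N.M))]
    have h5 : N.M * |w.im| ≤ d / 2 := by
      refine (mul_le_mul_of_nonneg_left h3 hM.le).trans (le_of_eq ?_); field_simp
    have h6 := norm_sub_norm_le (N.σ j w.re - z) (N.σ j w.re - N.σ j w)
    rw [norm_sub_rev (N.σ j w.re) (N.σ j w), show N.σ j w.re - z - (N.σ j w.re - N.σ j w) = N.σ j w - z by ring] at h6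
    linarith

lemma one_le_rr {z : ℂ} (h0 : 0 < z.re) (h1 : z.re < 1) : (1:ℝ) ≤ ϖ z.re ^ ħ :=
  Real.one_le_rpow_of_pos_of_le_one_of_nonpos (mul_pos h0 ℓ) ℓₙ (by norm_num)

lemma Adm.div {N : Net G lam} {X Xj} (A : Adm N X Xj) {z : ℂ} (hz : z ∈ G) :
    Adm N (dslope X z) (fun j w => (Xj j w - X z) / (N.σ j w - z)) := by
  obtain ⟨k, k0, k1, d, d0, hd⟩ := N.away hz
  obtain ⟨k', k0', k1', C, hC⟩ := A.t
  refine ⟨(differentiableOn_dslope (N.Go.mem_nhds hz)).2 A.d, ⟨min k k', lt_min k0 k0', (min_le_left _ _).trans k1,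
    (C + ‖X z‖) / d, fun j => ?_⟩, fun j ε hε => ?_⟩
  · have t1 : Tent N.κ (min k k') ⊆ Tent N.κ k := Tent.mono le_rfl 𝔩
    have t2 : Tent N.κ (min k k') ⊆ Tent N.κ k' := Tent.mono le_rfl 𝔯
    have t3 : Tent N.κ (min k k') ⊆ Tent N.κ N.κ := Tent.mono le_rfl ((min_le_left _ _).trans k1)
    have hne : ∀ w ∈ Tent N.κ (min k k'), N.σ j w - z ≠ 0 := fun w hw =>
      norm_pos_iff.1 (d0.trans_le (hd j w (t1 hw)))
    obtain ⟨c1, c2, c3⟩ := hC j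
    refine ⟨((c1.mono t2).sub_const _).div ((((N.diff j).mono (N.tV j)).mono t3).sub_const _) hne, fun w hw h0 => ?_,
      fun w hw => ?_⟩
    · skip
      rw [dslope_of_ne _ (sub_ne_zero.1 (hne w hw)), slope_def_field, c2 w (t2 hw) h0]
    · skip
      rw [norm_div, div_le_iff₀ (norm_pos_iff.2 (hne w hw))]
      have h1 := one_le_rr hw.1 hw.2.1
      have h2 := c3 w (t2 hw)
      have h3 := hd j w (t1 hw)
      have h4 : ‖Xj j w - X z‖ ≤ (C + ‖X z‖) * ϖ w.re ^ ħ := by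
        refine (norm_sub_le _ _).trans ?_
        nlinarith [norm_nonneg (X z)]
      refine h4.trans ?_
      have h5 : (C + ‖X z‖) * ϖ w.re ^ ħ =
        (C + ‖X z‖) / d * ϖ w.re ^ ħ * d := by field_simp
      rw [h5]
      refine mul_le_mul_of_nonneg_left h3 ?_
      rw [div_mul_eq_mul_div]
      exact div_nonneg ((norm_nonneg _).trans h4) d0.le
  · have hp : N.σ j 0 ∉ G := by simpa using N.p_not j (x := 0) 𝔰
    have hpz : N.σ j 0 - z ≠ 0 := sub_ne_zero.2 fun h => hp (h ▸ hz)
    have hid : Tendsto (fun t : ℂ => t) (𝓝[{t | t ∈ G ∧ ε * ‖t - N.σ j 0‖ ≤ infDist t Gᶜ}] (N.σ j 0)) (𝓝 (N.σ j 0)) :=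
      tendsto_id.mono_left nhdsWithin_le_nhds
    have h1 := ((A.c j ε hε).sub ((hid.sub_const (N.σ j 0)).mul_const (X z))).div (hid.sub_const z) hpz
    simp only [sub_self, zero_mul, zero_div] at h1
    refine h1.congr' ?_
    filter_upwards [hid.eventually_ne (sub_ne_zero.1 hpz)] with t ht
    simp only [Pi.div_apply]
    rw [dslope_of_ne _ ht, slope_def_field]; ring

noncomputable def Net.Ig (N : Net G lam) (η : ℝ) (Y : Fin N.N → ℂ → ℂ) : ℂ :=
  ∑ j, ∫ x in 𝟘..1, Y j (cp η x) * deriv (N.σ j) (cp η x) * cd η x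

def Net.Jg (N : Net G lam) (η : ℝ) (Y : Fin N.N → ℂ → ℂ) : Prop :=
  ∀ j, IntervalIntegrable (fun x => Y j (cp η x) * deriv (N.σ j) (cp η x) * cd η x) volume 0 1

lemma Net.wind (N : Net G lam) {z : ℂ} (hz : z ∈ G) : ∃ W : ℂ, exp W = 1 ∧ ∀ η, 0 ≤ η → η < N.κ →
    N.Jg η (fun j w => 1 / (N.σ j w - z)) ∧ N.Ig η (fun j w => 1 / (N.σ j w - z)) = W := by
  obtain ⟨k, k0, k1, d, d0, hd⟩ := N.away hz
  have t3 : Tent N.κ k ⊆ Tent N.κ N.κ := Tent.mono le_rfl k1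
  have hne : ∀ j, ∀ w ∈ Tent N.κ k, N.σ j w - z ≠ 0 := fun j w hw => norm_pos_iff.1 (d0.trans_le (hd j w hw))
  have key : ∀ j, ∃ D : ℂ, exp D = (N.σ j 1 - z) / (N.σ j 0 - z) ∧ ∀ η, 0 ≤ η → η < N.κ →
      IntervalIntegrable (fun x => 1 / (N.σ j (cp η x) - z) * deriv (N.σ j) (cp η x) * cd η x) volume 0 1 ∧
      ∫ x in 𝟘..1, 1 / (N.σ j (cp η x) - z) * deriv (N.σ j) (cp η x) * cd η x = D := by
    intro j
    have hsub : Tent N.κ k ⊆ N.V j := t3.trans (N.tV j)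
    obtain ⟨P, hP, u, v, huv⟩ := arc_prim N.κ0 k0 (C := 1 / d * N.M) (g := fun w => 1 / (N.σ j w - z) * deriv (N.σ j) w)
      (((differentiableOn_const 1).div (((N.diff j).mono hsub).sub_const _) (hne j)).mul
        (((N.diff j).deriv (N.Vo j)).mono hsub)) (fun w hw => by
        rw [norm_mul, norm_div, norm_one]
        have h1 := one_le_rr hw.1 hw.2.1
        have h2 := (N.dbd j (hsub hw)).2
        have h3 : 1 / ‖N.σ j w - z‖ ≤ 1 / d := one_div_le_one_div_of_le d0 (hd j w hw)
        have h4 : 1 / ‖N.σ j w - z‖ * ‖deriv (N.σ j) w‖ ≤ 1 / d * N.M :=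
          mul_le_mul h3 h2 𝔫 ℘
        have : 0 ≤ 1 / d * N.M := by have := N.M0; positivity
        nlinarith)
    refine ⟨u - v, ?_, fun η h0 h1 => ⟨(huv η h1 ℓ).2.2.1, (huv η h1 ℓ).2.2.2⟩⟩
    obtain ⟨l0, l1, -, -⟩ := huv 0 N.κ0 ℓ
    have hxT : (½ : ℂ) ∈ Tent N.κ k := Tent.real N.κ0 k0 ⟨by norm_num, by norm_num⟩
    have hconst : ∀ w ∈ Tent N.κ k, (N.σ j w - z) * exp (-P w) = (N.σ j ½ - z) * exp (-P ½) := by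
      intro w hw
      have := (Tent.convex N.κ0.le k0.le).norm_image_sub_le_of_norm_hasDerivWithin_le
        (f := fun w => (N.σ j w - z) * exp (-P w)) (f' := fun _ => 0) (C := 0)
        (fun w hw => by
          refine ((((N.dV j (hsub hw)).sub_const z).mul (hP w hw).neg.cexp).congr_deriv ?_).hasDerivWithinAt
          have := hne j w hw
          simp only [Pi.neg_apply]
          field_simp; ring) (fun _ _ => by simp) hxT hw
      rw [zero_mul] at this
      exact sub_eq_zero.1 (norm_le_zero_iff.1 this)
    have hcp : ∀ x : ℝ, cp 0 x = x := fun x => by apply Complex.ext <;> simp [cp]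
    have hco : ContinuousOn (fun x : ℝ => N.σ j x - z) (Icc 0 1) := by
      refine ContinuousOn.sub ?_ continuousOn_const
      refine (N.diff j).continuousOn.comp continuous_ofReal.continuousOn fun x hx => ?_
      rcases eq_or_lt_of_le hx.1 with rfl | h0
      · simpa using N.V0 j
      rcases eq_or_lt_of_le hx.2 with rfl | h1
      · simpa using N.V1 j
      exact N.tV j (Tent.real N.κ0 N.κ0 ⟨h0, h1⟩)
    obtain ⟨s0, s1⟩ := cont_ends hco
    simp only [hcp] at l0 l1
    set c := (N.σ j ½ - z) * exp (-P ½)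
    have e0 : (N.σ j 0 - z) * exp (-v) = c := by
      have := tendsto_nhds_unique ((s0.mul ((continuous_exp.tendsto _).comp l0.neg)).congr' (f₂ := fun _ => c) (by
        filter_upwards [Ioo_mem_nhdsGT (zero_lt_one (α := ℝ))] with x hx
        exact hconst _ (Tent.real N.κ0 k0 hx))) tendsto_const_nhds
      simpa using this
    have e1 : (N.σ j 1 - z) * exp (-u) = c := by
      have := tendsto_nhds_unique ((s1.mul ((continuous_exp.tendsto _).comp l1.neg)).congr' (f₂ := fun _ => c) (by
        filter_upwards [Ioo_mem_nhdsLT (zero_lt_one (α := ℝ))] with x hx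
        exact hconst _ (Tent.real N.κ0 k0 hx))) tendsto_const_nhds
      simpa using this
    have hp : N.σ j 0 ∉ G := by simpa using N.p_not j (x := 0) 𝔰
    have hpz : N.σ j 0 - z ≠ 0 := sub_ne_zero.2 fun h => hp (h ▸ hz)
    rw [← e1, exp_neg, exp_neg] at e0
    rw [exp_sub]
    have := exp_ne_zero u; have := exp_ne_zero v
    field_simp at e0 ⊢
    exact e0
  choose D hD hI using key
  refine ⟨∑ j, D j, ?_, fun η h0 h1 => ⟨fun j => (hI j η h0 h1).1, Finset.sum_congr rfl fun j _ => (hI j η h0 h1).2⟩⟩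
  rw [exp_sum, Finset.prod_congr rfl fun j _ => hD j, Finset.prod_div_distrib]
  simp only [N.joint]
  rw [Equiv.prod_comp N.nxt (fun j => N.σ j 0 - z), div_self]
  refine Finset.prod_ne_zero_iff.2 fun j _ => ?_
  have hp : N.σ j 0 ∉ G := by simpa using N.p_not j (x := 0) 𝔰
  exact sub_ne_zero.2 fun h => hp (h ▸ hz)

lemma Adm.cauchy0 {N : Net G lam} {X Xj} (A : Adm N X Xj) (C : Cf G φ ψ) {z : ℂ} (hz : z ∈ G) {η : ℝ}
    (h0 : 0 ≤ η) (h1 : η < N.κ) : N.Jg η (fun j w => Xj j w / (N.σ j w - z)) ∧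
    N.Ig η (fun j w => Xj j w / (N.σ j w - z)) = X z * N.Ig η (fun j w => 1 / (N.σ j w - z)) := by
  obtain ⟨i1, e1⟩ := (A.div hz).T C h0 h1
  obtain ⟨W, -, hW⟩ := N.wind hz
  have i2 := (hW η h0 h1).1
  have e : ∀ j x, Xj j (cp η x) / (N.σ j (cp η x) - z) * deriv (N.σ j) (cp η x) * cd η x =
      (Xj j (cp η x) - X z) / (N.σ j (cp η x) - z) * deriv (N.σ j) (cp η x) * cd η x +
      X z * (1 / (N.σ j (cp η x) - z) * deriv (N.σ j) (cp η x) * cd η x) := fun j x => by ring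
  constructor
  · intro j
    simp only [e]
    exact (i1 j).add ((i2 j).const_mul _)
  · unfold Net.Ig
    simp only [e]
    rw [Finset.mul_sum, ← zero_add (∑ j, X z * _), ← e1, ← Finset.sum_add_distrib]
    refine Finset.sum_congr rfl fun j _ => ?_
    rw [intervalIntegral.integral_add (i1 j) ((i2 j).const_mul _), intervalIntegral.integral_const_mul]

structure Bd (N : Net G lam) (R : ℂ → ℂ) (Rj : Fin N.N → ℂ → ℂ) : Prop where
  d : DifferentiableOn ℂ R G
  b : ∃ C, ∀ z ∈ G, ‖R z‖ ≤ C
  t : ∃ k, 0 < k ∧ k ≤ N.κ ∧ ∃ C, ∀ j, DifferentiableOn ℂ (Rj j) (Tent N.κ k) ∧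
    (∀ z ∈ Tent N.κ k, 0 < z.im → Rj j z = R (N.σ j z)) ∧ ∀ z ∈ Tent N.κ k, ‖Rj j z‖ ≤ C

lemma Adm.mul {N : Net G lam} {X Xj R Rj} (A : Adm N X Xj) (D : Bd N R Rj) :
    Adm N (fun z => X z * R z) (fun j z => Xj j z * Rj j z) := by
  obtain ⟨k, k0, k1, C, hC⟩ := D.t
  obtain ⟨k', k0', k1', C', hC'⟩ := A.t
  refine ⟨A.d.mul D.d, ⟨min k k', lt_min k0 k0', (min_le_left _ _).trans k1, C' * C, fun j => ?_⟩, fun j ε hε => ?_⟩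
  · have t1 : Tent N.κ (min k k') ⊆ Tent N.κ k := Tent.mono le_rfl 𝔩
    have t2 : Tent N.κ (min k k') ⊆ Tent N.κ k' := Tent.mono le_rfl 𝔯
    refine ⟨((hC' j).1.mono t2).mul ((hC j).1.mono t1), fun z hz h => ?_, fun z hz => ?_⟩
    · simp only [(hC' j).2.1 z (t2 hz) h, (hC j).2.1 z (t1 hz) h]
    · rw [norm_mul, mul_right_comm]
      exact mul_le_mul ((hC' j).2.2 z (t2 hz)) ((hC j).2.2 z (t1 hz)) 𝔫
        ((norm_nonneg _).trans ((hC' j).2.2 z (t2 hz)))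
  · obtain ⟨C, hC⟩ := D.b
    have h := (A.c j ε hε).norm.mul_const C
    rw [norm_zero, zero_mul] at h
    refine squeeze_zero_norm' ?_ h
    filter_upwards [self_mem_nhdsWithin] with z hz
    rw [← mul_assoc, norm_mul]
    exact mul_le_mul_of_nonneg_left (hC z hz.1) 𝔫

lemma Cf.slope (C : Cf G φ ψ) (hG : IsOpen G) (hb : Bornology.IsBounded G) {ζ : ℂ} (hζ : ζ ∈ G) :
    (∀ z ∈ G, dslope φ ζ z ≠ 0) ∧ ∃ c, ∀ z ∈ G, ‖(dslope φ ζ z)⁻¹‖ ≤ c := by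
  have hn : ∀ z ∈ G, ‖φ z‖ < 1 := fun z hz => by simpa using C.m hz
  have h1 : ∀ z ∈ G, dslope φ ζ z ≠ 0 := by
    intro z hz
    by_cases h : z = ζ
    · rw [h, dslope_same]; exact deriv_ne_zero_of_inj hG C.d C.injOn hζ
    · rw [dslope_of_ne _ h, slope_def_field]
      exact div_ne_zero (sub_ne_zero.2 fun h' => h (C.injOn hz hζ h')) (sub_ne_zero.2 h)
  refine ⟨h1, ?_⟩
  have hd : DifferentiableOn ℂ (dslope φ ζ) G := (differentiableOn_dslope (hG.mem_nhds hζ)).2 C.d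
  obtain ⟨ρ, r1, r2⟩ := exists_between (hn ζ hζ)
  obtain ⟨c, hc⟩ := (C.compact r2).exists_bound_of_continuousOn
    (f := fun z => (dslope φ ζ z)⁻¹) ((hd.continuousOn.inv₀ h1).mono fun z hz => hz.1)
  obtain ⟨R, hR⟩ := hb.exists_norm_le
  refine ⟨max c ((R + R) / (ρ - ‖φ ζ‖)), fun z hz => ?_⟩
  by_cases h : ‖φ z‖ ≤ ρ
  · exact (hc z ⟨hz, h⟩).trans (le_max_left _ _)
  · refine le_trans ?_ (le_max_right _ _)
    have hne : z ≠ ζ := by rintro rfl; exact h r1.le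
    rw [dslope_of_ne _ hne, slope_def_field, inv_div, norm_div]
    have h3 := norm_sub_norm_le (φ z) (φ ζ)
    push Not at h
    exact div_le_div₀ (by linarith [norm_nonneg z, hR z hz]) ((norm_sub_le _ _).trans (add_le_add (hR z hz) (hR ζ hζ)))
      ℓ ℓ

lemma Net.sbd (N : Net G lam) : ∃ R, ∀ j, ∀ w ∈ Tent N.κ N.κ, ‖N.σ j w‖ ≤ R := by
  obtain ⟨R, hR⟩ := Finite.exists_le fun j => ‖N.σ j 0‖
  refine ⟨R + N.M * 2, fun j w hw => ?_⟩
  have h1 := (N.near j hw).2.1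
  have h2 := norm_sub_norm_le (N.σ j w) (N.σ j 0)
  have h3 := hR j
  have : N.M * (2 * w.re) ≤ N.M * 2 := mul_le_mul_of_nonneg_left (by linarith [hw.2.1]) N.M0.le
  linarith

variable {N : Net G lam} {ρ B : ℝ} {H : Fin N.N → ℂ → ℂ}

lemma Rf.bd1 (R : Rf N φ ρ B H) (C : Cf G φ ψ) {ζ : ℂ} (hζ : ζ ∈ G) (hb : ‖φ ζ‖ < ρ) :
    Bd N (fun z => (dslope φ ζ z)⁻¹) (fun j w => (N.σ j w - ζ) / (H j w - φ ζ)) := by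
  obtain ⟨h1, h2⟩ := C.slope N.Go N.Gb hζ
  obtain ⟨S, hS⟩ := N.sbd
  have hne : ∀ j, ∀ w ∈ Tent N.κ N.κ, ρ - ‖φ ζ‖ ≤ ‖H j w - φ ζ‖ := fun j w hw => by
    have := norm_sub_norm_le (H j w) (φ ζ)
    linarith [(R.b j w hw).1]
  have hne' : ∀ j, ∀ w ∈ Tent N.κ N.κ, H j w - φ ζ ≠ 0 := fun j w hw =>
    norm_pos_iff.1 (lt_of_lt_of_le ℓ (hne j w hw))
  refine ⟨((differentiableOn_dslope (N.Go.mem_nhds hζ)).2 C.d).inv h1, h2, N.κ, N.κ0, le_rfl, (S + ‖ζ‖) / (ρ - ‖φ ζ‖),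
    fun j => ⟨?_, fun z hz h0 => ?_, fun z hz => ?_⟩⟩
  · exact (((N.diff j).mono (N.tV j)).sub_const _).div ((R.d j).sub_const _) (hne' j)
  · have hne2 : N.σ j z ≠ ζ := by
      intro h; apply hne' j z hz
      rw [R.up j z hz h0, h, sub_self]
    rw [dslope_of_ne _ hne2, slope_def_field, inv_div, R.up j z hz h0]
  · rw [norm_div]
    have := hS j z hz
    exact div_le_div₀ (by linarith [norm_nonneg (N.σ j z), norm_nonneg ζ]) ((norm_sub_le _ _).trans ℓ)
      ℓ (hne j z hz)

lemma Rf.bd2 (R : Rf N φ ρ B H) (C : Cf G φ ψ) (hρ : 0 < ρ) {b : ℂ} (hb : ‖b‖ < ρ) (hb1 : ‖b‖ < 1) :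
    Bd N (fun z => (1 - ℭ b * φ z)⁻¹) (fun j w => (1 - ℭ b * H j w)⁻¹) ∧
    ∀ j, ∀ w ∈ Tent N.κ N.κ, ‖(1 - ℭ b * H j w)⁻¹‖ ≤ 1 / (1 - ‖b‖ / ρ) := by
  have hbr : ‖b‖ / ρ < 1 := by rwa [div_lt_one hρ]
  have key : ∀ w : ℂ, ∀ s < 1, ‖b‖ * ‖w‖ ≤ s → 1 - s ≤ ‖1 - ℭ b * w‖ := fun w s _ h => by
    have := norm_sub_norm_le 1 (ℭ b * w)
    rw [norm_mul, norm_conj, norm_one] at this; linarith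
  have inv : ∀ w : ℂ, ∀ s < 1, ‖b‖ * ‖w‖ ≤ s → (1 - ℭ b * w ≠ 0) ∧
      ‖(1 - ℭ b * w)⁻¹‖ ≤ 1 / (1 - s) := fun w s hs h => by
    have := key w s hs h
    refine ⟨norm_pos_iff.1 ℓ, ?_⟩
    rw [norm_inv, inv_eq_one_div]
    exact one_div_le_one_div_of_le ℓ this
  have k1 : ∀ z ∈ G, ‖b‖ * ‖φ z‖ ≤ ‖b‖ := fun z hz => by
    have : ‖φ z‖ < 1 := by simpa using C.m hz
    exact mul_le_of_le_one_right 𝔫 this.le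
  have k2 : ∀ j, ∀ w ∈ Tent N.κ N.κ, ‖b‖ * ‖H j w‖ ≤ ‖b‖ / ρ := fun j w hw => by
    rw [div_eq_mul_one_div]
    exact mul_le_mul_of_nonneg_left (R.b j w hw).2.1.le 𝔫
  refine ⟨⟨((C.d.const_mul _).const_sub 1).inv fun z hz => (inv _ _ hb1 (k1 z hz)).1, ⟨_, fun z hz =>
    (inv _ _ hb1 (k1 z hz)).2⟩, N.κ, N.κ0, le_rfl, _, fun j => ⟨(((R.d j).const_mul _).const_sub 1).inv fun z hz =>
    (inv _ _ hbr (k2 j z hz)).1, fun z hz h0 => by simp only [R.up j z hz h0], fun z hz => (inv _ _ hbr (k2 j z hz)).2⟩⟩,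
    fun j z hz => (inv _ _ hbr (k2 j z hz)).2⟩

lemma Rf.adm (R : Rf N φ ρ B H) (C : Cf G φ ψ) :
    Adm N (deriv φ) (fun j w => deriv (H j) w / deriv (N.σ j) w) := by
  have hσ0 : ∀ j, ∀ z ∈ Tent N.κ N.κ, deriv (N.σ j) z ≠ 0 := fun j z hz =>
    norm_pos_iff.1 (N.m0.trans_le (N.dbd j (N.tV j hz)).1)
  have hl := N.lam2
  have hl0 := N.lam0
  refine ⟨C.d.deriv N.Go, ⟨N.κ, N.κ0, le_rfl, |B| / N.m, fun j => ⟨?_, fun z hz h0 => ?_, fun z hz => ?_⟩⟩, fun j ε hε => ?_⟩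
  · exact ((R.d j).deriv (Tent.isOpen _ _)).div (((N.diff j).deriv (N.Vo j)).mono (N.tV j)) (hσ0 j)
  · skip
    rw [R.up' C j hz h0, mul_div_cancel_right₀ _ (hσ0 j z hz)]
  · have hr : 0 < z.re * (1 - z.re) := mul_pos hz.1 (by linarith [hz.2.1])
    have h1 : ϖ z.re ^ (1 / (2 - lam) - 1) ≤ ϖ z.re ^ ħ := by
      refine Real.rpow_le_rpow_of_exponent_ge hr (by nlinarith [hz.1, hz.2.1]) ?_
      have : 1 / 2 ≤ 1 / (2 - lam) := one_div_le_one_div_of_le ℓ ℓ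
      linarith
    have h2 := (R.b j z hz).2.2.2
    rw [norm_div, div_le_iff₀ (norm_pos_iff.2 (hσ0 j z hz))]
    have h3 := (N.dbd j (N.tV j hz)).1
    have h4 : ‖deriv (H j) z‖ ≤ |B| * ϖ z.re ^ ħ :=
      h2.trans ((mul_le_mul_of_nonneg_right (le_abs_self B) (Real.rpow_nonneg hr.le _)).trans
        (mul_le_mul_of_nonneg_left h1 (abs_nonneg _)))
    refine h4.trans ?_
    have : |B| * ϖ z.re ^ ħ = |B| / N.m * ϖ z.re ^ ħ * N.m := by
      have := N.m0; field_simp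
    rw [this]
    exact mul_le_mul_of_nonneg_left h3 (mul_nonneg (div_nonneg (abs_nonneg _) N.m0.le) (Real.rpow_nonneg hr.le _))
  · have hp : N.σ j 0 ∉ G := by simpa using N.p_not j (x := 0) 𝔰
    have h1 := ((C.bdry N.Go hp).mono_left (nhdsWithin_mono (N.σ j 0)
      (show {z | z ∈ G ∧ ε * ‖z - N.σ j 0‖ ≤ infDist z Gᶜ} ⊆ G from fun z hz => hz.1))).const_sub 1
    have h2 := h1.const_mul (2 / ε)
    rw [sub_self, mul_zero] at h2
    refine squeeze_zero_norm' ?_ h2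
    filter_upwards [self_mem_nhdsWithin] with z hz
    have h3 := C.pick N.Go ⟨_, hp⟩ hz.1
    have h4 : ε * ‖z - N.σ j 0‖ ≤ infDist z Gᶜ := hz.2
    rw [norm_mul, div_mul_eq_mul_div, le_div_iff₀ hε]
    nlinarith [norm_nonneg (deriv φ z)]
end

lemma cp0 (x : ℝ) : cp 0 x = x := by apply Complex.ext <;> simp [cp]
lemma cd0 (x : ℝ) : cd 0 x = 1 := by apply Complex.ext <;> simp [cd]

section
variable {G : Set ℂ} {lam : ℝ} {φ ψ : ℂ → ℂ}

section
variable {N : Net G lam} {ρ B : ℝ} {H : Fin N.N → ℂ → ℂ}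

lemma Rf.glue (R : Rf N φ ρ B H) (C : Cf G φ ψ) {i j} {x y : ℝ} (hx : x ∈ 𝕀o) (hy : y ∈ 𝕀o)
    (h : H i x = H j y) : i = j ∧ x = y := by
  have hT : ∀ {x : ℝ}, x ∈ 𝕀o → (x:ℂ) ∈ Tent N.κ N.κ := fun hx => Tent.real N.κ0 N.κ0 hx
  have hmap : ∀ i, ∀ {x : ℝ}, x ∈ 𝕀o → map (H i) (𝓝 (x:ℂ)) = 𝓝 (H i x) := fun i x hx =>
    ((R.d i).analyticAt ((Tent.isOpen _ _).mem_nhds (hT hx))).hasStrictDerivAt.map_nhds_eq (R.b i x (hT hx)).2.2.1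
  have hin : ∀ i, ∀ z ∈ Tent N.κ N.κ, ‖H i z‖ < 1 → 0 < z.im := by
    intro i z hz hn
    by_contra hc
    rcases (not_lt.1 hc).lt_or_eq with h | h
    · linarith [R.lo i z hz h]
    · have : z = (z.re : ℂ) := by apply Complex.ext <;> simp [h]
      rw [this, (R.re i z.re ⟨hz.1, hz.2.1⟩).1] at hn; exact lt_irrefl _ hn
  have hσ : N.σ i x = N.σ j y := by
    by_contra hne
    obtain ⟨O1, O2, o1, o2, m1, m2, hdis⟩ := t2_separation hne
    have n1 : N.σ i ⁻¹' O1 ∩ Tent N.κ N.κ ∈ 𝓝 (x:ℂ) := inter_mem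
      ((N.dV i (N.tV i (hT hx))).continuousAt.preimage_mem_nhds (o1.mem_nhds m1)) ((Tent.isOpen _ _).mem_nhds (hT hx))
    have n2 : N.σ j ⁻¹' O2 ∩ Tent N.κ N.κ ∈ 𝓝 (y:ℂ) := inter_mem
      ((N.dV j (N.tV j (hT hy))).continuousAt.preimage_mem_nhds (o2.mem_nhds m2)) ((Tent.isOpen _ _).mem_nhds (hT hy))
    have i1 : H i '' (N.σ i ⁻¹' O1 ∩ Tent N.κ N.κ) ∈ 𝓝 (H i x) := by rw [← hmap i hx]; exact image_mem_map n1
    have i2 : H j '' (N.σ j ⁻¹' O2 ∩ Tent N.κ N.κ) ∈ 𝓝 (H i x) := by rw [h, ← hmap j hy]; exact image_mem_map n2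
    have hcl : H i x ∈ closure (ball 𝕫 1) := by
      rw [closure_ball _ one_ne_zero, mem_closedBall_zero_iff, (R.re i x hx).1]
    obtain ⟨w, ⟨⟨z1, ⟨a1, b1⟩, c1⟩, ⟨z2, ⟨a2, b2⟩, c2⟩⟩, hw⟩ := mem_closure_iff_nhds.1 hcl _ (inter_mem i1 i2)
    have hw' : ‖w‖ < 1 := by simpa using hw
    have p1 := hin i z1 b1 (by rwa [c1])
    have p2 := hin j z2 b2 (by rwa [c2])
    have : N.σ i z1 = N.σ j z2 := C.injOn (N.up i z1 b1 p1) (N.up j z2 b2 p2) (by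
      rw [← R.up i z1 b1 p1, ← R.up j z2 b2 p2, c1, c2])
    exact disjoint_left.1 hdis a1 (by rw [this]; exact a2)
  have hij := N.sep i j x hx y hy hσ
  subst hij
  exact ⟨rfl, by exact_mod_cast N.inj i (N.tV i (hT hx)) (N.tV i (hT hy)) hσ⟩

lemma Rf.re' (R : Rf N φ ρ B H) (j) {x : ℝ} (hx : x ∈ 𝕀o) : 0 < ‖deriv (H j) x‖ ∧
    deriv (H j) x = ‖deriv (H j) x‖ * I * H j x := by
  obtain ⟨h1, c, hc, h2⟩ := R.re j x hx
  have : ‖deriv (H j) x‖ = c := by rw [h2]; simp [h1, abs_of_pos hc]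
  rw [this]; exact ⟨hc, h2⟩

lemma Rf.S_le (R : Rf N φ ρ B H) (C : Cf G φ ψ)
    (hi : ∀ j, IntervalIntegrable (fun x : ℝ => ‖deriv (H j) x‖) volume 0 1) :
    ∑ j, ∫ x in 𝟘..1, ‖deriv (H j) x‖ ≤ 2 * Real.pi := by
  have hT : ∀ {x : ℝ}, x ∈ 𝕀o → (x:ℂ) ∈ Tent N.κ N.κ := fun hx => Tent.real N.κ0 N.κ0 hx
  have hd : ∀ j, ∀ x ∈ 𝕀o, HasDerivAt (fun t : ℝ => H j t) (deriv (H j) x) x := fun j x hx =>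
    ((R.d j).differentiableAt ((Tent.isOpen _ _).mem_nhds (hT hx))).hasDerivAt.comp_ofReal
  set U : Fin N.N → Set ℝ := fun j => 𝕀o ∩ (fun t : ℝ => H j t) ⁻¹' slitPlane with hU
  have hUo : ∀ j, IsOpen (U j) := fun j =>
    ContinuousOn.isOpen_inter_preimage (fun x hx => (hd j x hx).continuousAt.continuousWithinAt) isOpen_Ioo isOpen_slitPlane
  set a : Fin N.N → ℝ → ℝ := fun j t => (log (H j t)).im with ha
  have had : ∀ j, ∀ x ∈ U j, HasDerivAt (a j) ‖deriv (H j) x‖ x := by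
    intro j x hx
    have h1 := (hd j x hx.1).clog_real hx.2
    have h2 := imCLM.hasFDerivAt.comp_hasDerivAt x h1
    refine h2.congr_deriv ?_
    have hne : H j x ≠ 0 := slitPlane_ne_zero hx.2
    rw [(R.re' j hx.1).2, mul_div_cancel_right₀ _ hne]
    simp [(R.re j x hx.1).1]
  have hinj : ∀ i j, ∀ x ∈ U i, ∀ y ∈ U j, a i x = a j y → i = j ∧ x = y := by
    intro i j x hx y hy h
    refine R.glue C hx.1 hy.1 ?_
    refine (exp_log (slitPlane_ne_zero hx.2)).symm.trans (Eq.trans ?_ (exp_log (slitPlane_ne_zero hy.2)))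
    congr 1
    apply Complex.ext
    · rw [log_re, log_re, (R.re i x hx.1).1, (R.re j y hy.1).1]
    · exact h
  have hco : ∀ j, ContinuousOn (a j) (U j) := fun j x hx => (had j x hx).continuousAt.continuousWithinAt
  have hii : ∀ j, InjOn (a j) (U j) := fun j x hx y hy h => (hinj j j x hx y hy h).2
  have hm : ∀ j, MeasurableSet (a j '' U j) := fun j => (hUo j).measurableSet.image_of_continuousOn_injOn (hco j) (hii j)
  have hdis : Pairwise (Function.onFun Disjoint fun j => a j '' U j) := by
    intro i j hij
    refine disjoint_left.2 ?_
    rintro _ ⟨x, hx, rfl⟩ ⟨y, hy, h⟩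
    exact hij (hinj i j x hx y hy h.symm).1
  have hv : ∀ j, volume (a j '' U j) = ENNReal.ofReal (∫ x in 𝟘..1, ‖deriv (H j) x‖) := by
    intro j
    have h1 := lintegral_image_eq_lintegral_abs_deriv_mul (hUo j).measurableSet
      (fun x hx => (had j x hx).hasDerivWithinAt) (hii j) (fun _ => 1)
    simp only [lintegral_one, Measure.restrict_apply_univ, mul_one, abs_norm] at h1
    have hae : U j =ᵐ[volume] Ioc 𝟘 1 := by
      refine EventuallyEq.trans ?_ Ioo_ae_eq_Ioc
      refine (ae_eq_of_subset_of_measure_ge (inter_subset_left) ?_ (hUo j).measurableSet.nullMeasurableSet 𝔰)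
      refine (measure_mono (t := U j ∪ (𝕀o \ U j)) (fun x hx => by by_cases h : x ∈ U j <;> simp [h, hx])).trans
        ((measure_union_le _ _).trans (le_of_eq ?_))
      rw [Set.Subsingleton.measure_zero (s := 𝕀o \ U j), add_zero]
      intro x hx y hy
      have hm1 : ∀ x ∈ 𝕀o \ U j, H j x = -1 := by
        intro x hx
        have h0 : H j x ∉ slitPlane := fun h => hx.2 ⟨hx.1, h⟩
        rw [mem_slitPlane_iff] at h0
        push Not at h0
        have hn := (R.re j x hx.1).1
        apply Complex.ext
        · rw [← abs_re_eq_norm.2 h0.2, abs_of_nonpos h0.1] at hn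
          simp; linarith
        · simp [h0.2]
      exact (R.glue C hx.1 hy.1 ((hm1 x hx).trans (hm1 y hy).symm)).2
    rw [h1, setLIntegral_congr hae, intervalIntegral.integral_of_le zero_le_one,
      ofReal_integral_eq_lintegral_ofReal ((intervalIntegrable_iff_integrableOn_Ioc_of_le zero_le_one).1 (hi j))
      (Eventually.of_forall fun x => norm_nonneg _)]
  have hsum : ∑ j, volume (a j '' U j) ≤ ENNReal.ofReal 𝕥 := by
    have h1 := measure_iUnion (μ := volume) hdis hm
    rw [tsum_fintype] at h1
    rw [← h1]
    refine (measure_mono (t := Ioc (-Real.pi) Real.pi) (iUnion_subset fun j => ?_)).trans (by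
      rw [Real.volume_Ioc]; exact ENNReal.ofReal_le_ofReal ℓ)
    rintro _ ⟨x, -, rfl⟩
    exact ⟨neg_pi_lt_log_im _, log_im_le_pi _⟩
  simp only [hv] at hsum
  rw [← ENNReal.ofReal_sum_of_nonneg fun j _ => intervalIntegral.integral_nonneg zero_le_one fun x _ => norm_nonneg _,
    ENNReal.ofReal_le_ofReal_iff ℘] at hsum
  exact hsum
end

lemma Net.wind_val (N : Net G lam) (C : Cf G φ ψ) {z : ℂ} (hz : z ∈ G) {η : ℝ} (h0 : 0 ≤ η) (h1 : η < N.κ) :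
    N.Ig η (fun j w => 1 / (N.σ j w - z)) = 2 * Real.pi * I := by
  obtain ⟨W, hW1, hW⟩ := N.wind hz
  rw [(hW η h0 h1).2, ← (hW 0 le_rfl N.κ0).2]
  have hbz : ‖φ z‖ < 1 := by simpa using C.m hz
  obtain ⟨ψ', C'⟩ := C.mob N.Go hbz
  set φ' := fun t => (φ t - φ z) / (1 - ℭ (φ z) * φ t) with hφ'
  have hφ0 : φ' z = 0 := by simp [hφ']
  obtain ⟨k, k0, k1, B, H, R⟩ := Rf.exists N C' (ρ := 1 / 2) le_rfl (by norm_num)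
  change Fin N.N → ℂ → ℂ at H
  have hA := (R.adm C').mul (R.bd1 C' hz (by rw [hφ0, norm_zero]; norm_num))
  obtain ⟨hJ, hI⟩ := hA.cauchy0 C' hz (η := 0) le_rfl (Net.shrink N k k0 k1).κ0
  have hX : deriv φ' z * (dslope φ' z z)⁻¹ = 1 := by
    rw [dslope_same]; exact mul_inv_cancel₀ (deriv_ne_zero_of_inj N.Go C'.d C'.injOn hz)
  rw [hX, one_mul] at hI
  have hT : ∀ {x : ℝ}, x ∈ 𝕀o → (x:ℂ) ∈ Tent k k := fun hx => Tent.real k0 k0 hx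
  have hpt : ∀ j, ∀ x ∈ 𝕀o, deriv (H j) (cp 0 x) / deriv (N.σ j) (cp 0 x) * ((N.σ j (cp 0 x) - z) /
      (H j (cp 0 x) - φ' z)) / (N.σ j (cp 0 x) - z) * deriv (N.σ j) (cp 0 x) * cd 0 x = ‖deriv (H j) x‖ * I := by
    intro j x hx
    rw [cp0, cd0, hφ0, sub_zero, mul_one]
    have e1 : deriv (N.σ j) x ≠ 0 :=
      norm_pos_iff.1 (N.m0.trans_le (N.dbd j (N.tV j (Tent.real N.κ0 N.κ0 hx))).1)
    have e2 : N.σ j x - z ≠ 0 := sub_ne_zero.2 fun h => N.p_not j ⟨hx.1.le, hx.2.le⟩ (h ▸ hz)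
    have e3 : H j x ≠ 0 := norm_pos_iff.1 (by rw [(R.re j x hx).1]; exact one_pos)
    have e4 := (R.re' j hx).2
    generalize (‖deriv (H j) x‖ : ℂ) = c at e4
    rw [e4]
    field_simp
  have hi : ∀ j, IntervalIntegrable (fun x : ℝ => ‖deriv (H j) x‖) volume 0 1 := by
    intro j
    have h := (hJ j).norm
    rw [intervalIntegrable_iff_integrableOn_Ioo_of_le zero_le_one] at h ⊢
    refine h.congr_fun (fun x hx => ?_) measurableSet_Ioo
    have := congrArg norm (hpt j x hx)
    refine Eq.trans this ?_
    simp
  have hS : (Net.shrink N k k0 k1).Ig 0 (fun j w => deriv (H j) w / deriv (N.σ j) w * ((N.σ j w - z) /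
      (H j w - φ' z)) / (N.σ j w - z)) = ((∑ j, ∫ x in 𝟘..1, ‖deriv (H j) x‖ : ℝ) : ℂ) * I := by
    rw [ofReal_sum, Finset.sum_mul]
    refine Finset.sum_congr rfl fun j _ => ?_
    rw [← intervalIntegral.integral_ofReal, ← intervalIntegral.integral_mul_const]
    refine intervalIntegral.integral_congr_ae ?_
    have hne : ∀ᵐ x : ℝ ∂volume, x ≠ 1 := by simp [ae_iff]
    filter_upwards [hne] with x hx1 hx
    rw [uIoc_of_le zero_le_one] at hx
    exact hpt j x ⟨hx.1, lt_of_le_of_ne hx.2 hx1⟩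
  have hW0 : N.Ig 0 (fun j w => 1 / (N.σ j w - z)) = ((∑ j, ∫ x in 𝟘..1, ‖deriv (H j) x‖ : ℝ) : ℂ) * I :=
    hI.symm.trans hS
  have hle := R.S_le C' hi
  have hpos : 0 < ∑ j, ∫ x in 𝟘..1, ‖deriv (H j) x‖ := by
    refine Finset.sum_pos (fun j _ => intervalIntegral.intervalIntegral_pos_of_pos_on (hi j)
      (fun x hx => (R.re' j hx).1) zero_lt_one) ⟨N.i0, Finset.mem_univ _⟩
  rw [← (hW 0 le_rfl N.κ0).2, hW0] at hW1
  rw [hW0]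
  change (∑ j, ∫ x in 𝟘..1, ‖deriv (H j) x‖) ≤ _ at hle
  set S := ∑ j, ∫ x in 𝟘..1, ‖deriv (H j) x‖
  obtain ⟨n, hn⟩ := exp_eq_one_iff.1 hW1
  have hn' : S = n * 𝕥 := by
    have := congrArg im hn
    simpa using this
  have hpi := Real.pi_pos
  have n1 : 𝟘 < n := by by_contra hc; push Not at hc; nlinarith
  have n2 : (n:ℝ) ≤ 1 := by by_contra hc; push Not at hc; nlinarith
  have : n = 1 := le_antisymm (by exact_mod_cast n2) (by exact_mod_cast n1)
  rw [hn', this]; push_cast; ring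

lemma Adm.cauchy {N : Net G lam} {X Xj} (A : Adm N X Xj) (C : Cf G φ ψ) {z : ℂ} (hz : z ∈ G) {η : ℝ}
    (h0 : 0 ≤ η) (h1 : η < N.κ) : N.Jg η (fun j w => Xj j w / (N.σ j w - z)) ∧
    N.Ig η (fun j w => Xj j w / (N.σ j w - z)) = X z * (2 * Real.pi * I) := by
  rw [← N.wind_val C hz h0 h1]; exact A.cauchy0 C hz h0 h1
end

section
variable {G : Set ℂ} {lam : ℝ} {φ ψ : ℂ → ℂ}

lemma Adm.congr {N : Net G lam} {X Xj X' Xj'} (A : Adm N X Xj) (h : ∀ z ∈ G, X' z = X z)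
    (h' : ∀ j, ∀ w ∈ Tent N.κ N.κ, Xj' j w = Xj j w) : Adm N X' Xj' := by
  obtain ⟨k, k0, k1, C, hC⟩ := A.t
  have t3 : Tent N.κ k ⊆ Tent N.κ N.κ := Tent.mono le_rfl k1
  refine ⟨A.d.congr h, ⟨k, k0, k1, C, fun j => ⟨(hC j).1.congr fun w hw => h' j w (t3 hw), fun z hz h0 => ?_, fun z hz => ?_⟩⟩,
    fun j ε hε => (A.c j ε hε).congr' ?_⟩
  · rw [h' j z (t3 hz), (hC j).2.1 z hz h0, h _ (N.up j z (t3 hz) h0)]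
  · rw [h' j z (t3 hz)]; exact (hC j).2.2 z hz
  · filter_upwards [self_mem_nhdsWithin] with z hz
    rw [h z hz.1]

lemma Net.bd_poly (N : Net G lam) (Q : Polynomial ℂ) : Bd N (fun z => Q.eval z) (fun j w => Q.eval (N.σ j w)) := by
  obtain ⟨S, hS⟩ := N.sbd
  obtain ⟨S', hS'⟩ := N.Gb.exists_norm_le
  obtain ⟨c, hc⟩ := (isCompact_closedBall 𝕫 S).exists_bound_of_continuousOn (f := fun z => Q.eval z) Q.continuous.continuousOn
  obtain ⟨c', hc'⟩ := (isCompact_closedBall 𝕫 S').exists_bound_of_continuousOn (f := fun z => Q.eval z) Q.continuous.continuousOn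
  exact ⟨Q.differentiable.differentiableOn, ⟨c', fun z hz => hc' z (by simpa using hS' z hz)⟩, N.κ, N.κ0, le_rfl, c, fun j =>
    ⟨Q.differentiable.comp_differentiableOn ((N.diff j).mono (N.tV j)), fun z hz h0 => rfl, fun z hz =>
      hc _ (by simpa using hS j z hz)⟩⟩

lemma Net.cpV (N : Net G lam) (j) {η x : ℝ} (h0 : 0 ≤ η) (h1 : η < N.κ) (hx : x ∈ 𝕀c) : cp η x ∈ N.V j := by
  rcases eq_or_lt_of_le hx.1 with rfl | a0
  · convert N.V0 j; apply Complex.ext <;> simp [cp]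
  rcases eq_or_lt_of_le hx.2 with rfl | a1
  · convert N.V1 j; apply Complex.ext <;> simp [cp]
  exact N.tV j (cp_mem h1 (by linarith [N.κ0]) ⟨a0, a1⟩)

lemma cp_cont (η : ℝ) : Continuous (cp η) := continuous_iff_continuousAt.2 fun x => (cp_hasDerivAt η x).continuousAt

lemma Net.cpC (N : Net G lam) (j) {η : ℝ} (h0 : 0 ≤ η) (h1 : η < N.κ) :
    ContinuousOn (fun x => N.σ j (cp η x)) (Icc 0 1) ∧ ContinuousOn (fun x => deriv (N.σ j) (cp η x)) (Icc 0 1) :=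
  ⟨(N.diff j).continuousOn.comp (cp_cont η).continuousOn fun x hx => N.cpV j h0 h1 hx,
   ((N.diff j).deriv (N.Vo j)).continuousOn.comp (cp_cont η).continuousOn fun x hx => N.cpV j h0 h1 hx⟩

/-- a node is not an interior point of an arc -/
lemma Net.nodeNe (N : Net G lam) (i j) {x : ℝ} (hx : x ∈ 𝕀o) : N.σ j 0 ≠ N.σ i x := by
  intro h
  have hT : (x:ℂ) ∈ Tent N.κ N.κ := Tent.real N.κ0 N.κ0 hx
  have hne : deriv (N.σ i) x ≠ 0 := norm_pos_iff.1 (N.m0.trans_le (N.dbd i (N.tV i hT)).1)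
  have hmap := ((N.diff i).analyticAt ((N.Vo i).mem_nhds (N.tV i hT))).hasStrictDerivAt.map_nhds_eq hne
  have hn : {w : ℂ | x / 2 < w.re} ∩ Tent N.κ N.κ ∈ 𝓝 (x:ℂ) := inter_mem
    ((isOpen_lt continuous_const continuous_re).mem_nhds (by simp; linarith [hx.1])) ((Tent.isOpen _ _).mem_nhds hT)
  have hO : N.σ i '' ({w : ℂ | x / 2 < w.re} ∩ Tent N.κ N.κ) ∈ 𝓝 (N.σ j 0) := by
    rw [h, ← hmap]; exact image_mem_map hn
  have hc := (N.cpC j le_rfl N.κ0).1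
  simp only [cp0] at hc
  have ht := (cont_ends hc).1
  simp only [ofReal_zero] at ht
  obtain ⟨y, ⟨w, ⟨hw1, hw2⟩, hw3⟩, hy1, hy2⟩ := ((ht.eventually hO).and
    (Ioo_mem_nhdsGT (show 𝟘 < x / 2 by linarith [hx.1]))).exists
  have hyI : y ∈ 𝕀o := ⟨hy1, by linarith [hx.2]⟩
  have hf := N.bd j y ⟨hyI.1.le, hyI.2.le⟩
  rw [← hw3] at hf
  have him : w.im = 0 := by
    rcases lt_trichotomy w.im 0 with h | h | h
    · exact absurd (frontier_subset_closure hf) (N.low i w hw2 h)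
    · exact h
    · have := N.up i w hw2 h
      rw [N.Go.frontier_eq] at hf; exact absurd this hf.2
  have hwr : w = (w.re : ℂ) := by apply Complex.ext <;> simp [him]
  rw [hwr] at hw3
  have hij := N.sep i j w.re ⟨hw2.1, hw2.2.1⟩ y hyI hw3
  subst hij
  have := N.inj i (by rw [← hwr]; exact N.tV i hw2) (N.tV i (Tent.real N.κ0 N.κ0 hyI)) hw3
  have h5 : w.re = y := by exact_mod_cast this
  have h6 : x / 2 < w.re := hw1
  linarith

lemma Adm.cauchyB {N : Net G lam} {X Xj} (A : Adm N X Xj) (C : Cf G φ ψ) (i) {x₀ : ℝ} (hx : x₀ ∈ 𝕀o) {η : ℝ}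
    (h0 : 0 < η) (h1 : η < N.κ) : N.Jg η (fun j w => Xj j w / (N.σ j w - N.σ i x₀)) ∧
    N.Ig η (fun j w => Xj j w / (N.σ j w - N.σ i x₀)) = Xj i x₀ * (2 * Real.pi * I) := by
  have hT : (x₀:ℂ) ∈ Tent N.κ N.κ := Tent.real N.κ0 N.κ0 hx
  set q := N.σ i x₀ with hq
  have hqf : q ∈ closure G := frontier_subset_closure (N.bd i x₀ ⟨hx.1.le, hx.2.le⟩)
  have hne : ∀ j, ∀ x ∈ 𝕀c, N.σ j (cp η x) ≠ q := by
    intro j x hx'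
    rcases eq_or_lt_of_le hx'.1 with rfl | a0
    · convert N.nodeNe i j hx; apply Complex.ext <;> simp [cp]
    rcases eq_or_lt_of_le hx'.2 with rfl | a1
    · rw [show cp η 1 = 1 by apply Complex.ext <;> simp [cp], N.joint]; exact N.nodeNe i _ hx
    · intro h
      refine N.low j (cp η x) (cp_mem h1 (by linarith [N.κ0]) ⟨a0, a1⟩) ?_ (h ▸ hqf)
      have : 0 < η * ϖ x := mul_pos h0 (mul_pos a0 ℓ)
      simp only [cp]; linarith
  have hr : ∀ j, ∃ r > 0, ∀ x ∈ 𝕀c, r ≤ ‖N.σ j (cp η x) - q‖ := by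
    intro j
    obtain ⟨y, hy, hmin⟩ := isCompact_Icc.exists_isMinOn (nonempty_Icc.2 (zero_le_one (α := ℝ)))
      ((N.cpC j h0.le h1).1.sub (continuousOn_const (c := q))).norm
    exact ⟨_, norm_pos_iff.2 (sub_ne_zero.2 (hne j y hy)), fun x hx => hmin hx⟩
  choose r hr0 hr using hr
  obtain ⟨iT, -⟩ := A.T C h0.le h1
  have e : ∀ z j x, Xj j (cp η x) / (N.σ j (cp η x) - z) * deriv (N.σ j) (cp η x) * cd η x =
    (Xj j (cp η x) * deriv (N.σ j) (cp η x) * cd η x) * (N.σ j (cp η x) - z)⁻¹ := fun z j x => by rw [div_eq_mul_inv]; ring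
  refine ⟨fun j => ?_, ?_⟩
  · simp only [e]
    refine (iT j).mul_continuousOn ?_
    rw [uIcc_of_le zero_le_one]
    exact ((N.cpC j h0.le h1).1.sub continuousOn_const).inv₀ fun x hx => sub_ne_zero.2 (hne j x hx)
  · obtain ⟨k, k0, k1, B, hB⟩ := A.t
    have hTk : (x₀:ℂ) ∈ Tent N.κ k := Tent.real N.κ0 k0 hx
    set l : Filter ℂ := 𝓝[{w : ℂ | 0 < w.im}] (x₀:ℂ) with hl
    haveI : l.NeBot := mem_closure_iff_nhdsWithin_neBot.1 (by
      rw [closure_setOfPred_lt_im]; simp)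
    have q1 : ∀ᶠ w in l, w ∈ Tent N.κ k := nhdsWithin_le_nhds ((Tent.isOpen _ _).mem_nhds hTk)
    have hev : ∀ᶠ w in l, w ∈ Tent N.κ k ∧ 0 < w.im := q1.and self_mem_nhdsWithin
    have t3 : Tent N.κ k ⊆ Tent N.κ N.κ := Tent.mono le_rfl k1
    have hσc : Tendsto (N.σ i) l (𝓝 q) := (N.dV i (N.tV i hT)).continuousAt.tendsto.mono_left nhdsWithin_le_nhds
    have lim1 : Tendsto (fun w => X (N.σ i w) * (2 * Real.pi * I)) l (𝓝 (Xj i x₀ * (2 * Real.pi * I))) := by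
      refine Tendsto.mul_const _ ?_
      refine ((((hB i).1.differentiableAt ((Tent.isOpen _ _).mem_nhds hTk)).continuousAt.tendsto.mono_left
        nhdsWithin_le_nhds)).congr' ?_
      filter_upwards [hev] with w hw using (hB i).2.1 w hw.1 hw.2
    have lim2 : Tendsto (fun w => N.Ig η (fun j t => Xj j t / (N.σ j t - N.σ i w))) l
        (𝓝 (N.Ig η (fun j t => Xj j t / (N.σ j t - q)))) := by
      refine tendsto_finsetSum _ fun j _ => ?_
      refine intervalIntegral.tendsto_integral_filter_of_dominated_convergence
        (fun x => ‖Xj j (cp η x) * deriv (N.σ j) (cp η x) * cd η x‖ * (r j / 2)⁻¹) ?_ ?_ ((iT j).norm.mul_const _) ?_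
      · filter_upwards [hev] with w hw
        have := (A.cauchy C (N.up i w (t3 hw.1) hw.2) h0.le h1).1 j
        rw [intervalIntegrable_iff] at this
        exact this.1
      · have hb := hσc.eventually (ball_mem_nhds q (half_pos (hr0 j)))
        filter_upwards [hb] with w hw
        refine Eventually.of_forall fun x hx' => ?_
        rw [uIoc_of_le zero_le_one] at hx'
        rw [e, norm_mul, norm_inv]
        refine mul_le_mul_of_nonneg_left ?_ 𝔫
        refine inv_anti₀ (half_pos (hr0 j)) ?_
        have a1 := hr j x ⟨hx'.1.le, hx'.2⟩
        have a2 : ‖N.σ i w - q‖ < r j / 2 := by simpa [dist_eq_norm] using hw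
        have a3 := norm_sub_norm_le (N.σ j (cp η x) - q) (N.σ i w - q)
        rw [sub_sub_sub_cancel_right] at a3
        linarith
      · refine Eventually.of_forall fun x hx' => ?_
        rw [uIoc_of_le zero_le_one] at hx'
        exact ((tendsto_const_nhds.div (tendsto_const_nhds.sub hσc) (sub_ne_zero.2 (hne j x ⟨hx'.1.le, hx'.2⟩))).mul_const _).mul_const _
    refine tendsto_nhds_unique lim2 (lim1.congr' ?_)
    filter_upwards [hev] with w hw
    exact (A.cauchy C (N.up i w (t3 hw.1) hw.2) h0.le h1).2.symm

variable {N : Net G lam} {ρ B B' : ℝ} {H F : Fin N.N → ℂ → ℂ} {f : ℂ → ℂ}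

lemma Sq.adm2 (S : Sq N φ H f F B') (R : Rf N φ ρ B H) (C : Cf G φ ψ) :
    Adm N (fun z => f z * f z) (fun j w => F j w * F j w) :=
  (R.adm C).congr (fun z hz => by rw [← S.sq z hz]; ring) fun j w hw => by
    have := norm_pos_iff.1 (N.m0.trans_le (N.dbd j (N.tV j hw)).1)
    rw [← S.sj j w hw]; field_simp

lemma Sq.adm (S : Sq N φ H f F B') (R : Rf N φ ρ B H) (C : Cf G φ ψ) : Adm N f F := by
  have hl := N.lam2
  refine ⟨S.d, ⟨N.κ, N.κ0, le_rfl, |B'|, fun j => ⟨S.dj j, S.up j, fun z hz => ?_⟩⟩, fun j ε hε => ?_⟩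
  · have hr : 0 < z.re * (1 - z.re) := mul_pos hz.1 (by linarith [hz.2.1])
    refine (S.b j z hz).trans (mul_le_mul (le_abs_self _) ?_ (Real.rpow_nonneg hr.le _) (abs_nonneg _))
    refine Real.rpow_le_rpow_of_exponent_ge hr (by nlinarith [hz.1, hz.2.1]) ?_
    have : 0 < 1 / (2 - lam) := one_div_pos.2 ℓ
    linarith
  · have hid : Tendsto (fun t : ℂ => t) (𝓝[{t | t ∈ G ∧ ε * ‖t - N.σ j 0‖ ≤ infDist t Gᶜ}] (N.σ j 0)) (𝓝 (N.σ j 0)) :=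
      tendsto_id.mono_left nhdsWithin_le_nhds
    have h1 := ((hid.sub_const (N.σ j 0)).mul ((S.adm2 R C).c j ε hε)).norm.sqrt
    simp only [sub_self, zero_mul, norm_zero, Real.sqrt_zero] at h1
    refine squeeze_zero_norm (fun z => ?_) h1
    refine Real.le_sqrt_of_sq_le (le_of_eq ?_)
    simp only [norm_mul]; ring

noncomputable def kk (N : Net G lam) (H F : Fin N.N → ℂ → ℂ) (b : ℂ) (j : Fin N.N) (w : ℂ) : ℂ :=
  F j w * (1 - ℭ b * H j w)⁻¹

lemma Sq.conj (S : Sq N φ H f F B') (R : Rf N φ ρ B H) {b : ℂ} (j) {x : ℝ} (hx : x ∈ 𝕀o) :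
    ℭ (kk N H F b j x) * ‖deriv (N.σ j) x‖ = F j x * (H j x - b)⁻¹ * deriv (N.σ j) x / I := by
  have hT : (x:ℂ) ∈ Tent N.κ N.κ := Tent.real N.κ0 N.κ0 hx
  obtain ⟨c0, e1⟩ := R.re' j hx
  have hH := (R.re j x hx).1
  have hH0 : H j x ≠ 0 := norm_pos_iff.1 (by rw [hH]; exact one_pos)
  have e2 := S.sj j x hT
  have hF0 : F j x ≠ 0 := by
    intro h; rw [h] at e2
    exact (R.b j x hT).2.2.1 (by rw [← e2]; ring)
  have e3 : (‖deriv (H j) x‖ : ℂ) = F j x * ℭ (F j x) * ‖deriv (N.σ j) x‖ := by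
    rw [← e2, norm_mul, norm_pow, mul_conj, normSq_eq_norm_sq]; push_cast; ring
  have hc : ℭ (H j x) = (H j x)⁻¹ := by
    rw [inv_def, normSq_eq_norm_sq, hH]; simp
  have e4 : ℭ (F j x) * ‖deriv (N.σ j) x‖ = F j x * deriv (N.σ j) x / (I * H j x) := by
    rw [e1, e3] at e2
    have hI := I_ne_zero
    rw [eq_div_iff (mul_ne_zero hI hH0)]
    refine mul_left_cancel₀ hF0 ?_
    linear_combination -e2
  unfold kk
  rw [map_mul, map_inv₀, map_sub, map_mul, map_one, conj_conj, hc, mul_right_comm, e4]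
  by_cases hb : H j x - b = 0
  · rw [← sub_eq_zero.1 hb, mul_inv_cancel₀ hH0]; simp
  · have : 1 - b * (H j x)⁻¹ = (H j x - b) / H j x := by field_simp
    rw [this, inv_div]
    have hI := I_ne_zero
    field_simp

lemma Sq.rep (S : Sq N φ H f F B') (R : Rf N φ ρ B H) (C : Cf G φ ψ) {ζ : ℂ} (hζ : ζ ∈ G) {Y : ℂ → ℂ}
    {Yj : Fin N.N → ℂ → ℂ} (A : Adm N (fun z => f z * Y z * (dslope φ ζ z)⁻¹)
      (fun j w => F j w * Yj j w * ((N.σ j w - ζ) / (H j w - φ ζ)))) :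
    (∀ j, IntervalIntegrable (fun x : ℝ => Yj j x * ℭ (kk N H F (φ ζ) j x) * ‖deriv (N.σ j) x‖) volume 0 1) ∧
    ∑ j, ∫ x in 𝟘..1, Yj j x * ℭ (kk N H F (φ ζ) j x) * ‖deriv (N.σ j) x‖ = 2 * Real.pi * Y ζ / f ζ := by
  obtain ⟨hJ, hI⟩ := A.cauchy C hζ le_rfl N.κ0
  have hφ := deriv_ne_zero_of_inj N.Go C.d C.injOn hζ
  have hf : f ζ ≠ 0 := fun h => hφ (by rw [← S.sq ζ hζ, h]; ring)
  have key : ∀ j, ∀ x ∈ 𝕀o, F j (cp 0 x) * Yj j (cp 0 x) * ((N.σ j (cp 0 x) - ζ) / (H j (cp 0 x) - φ ζ)) /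
      (N.σ j (cp 0 x) - ζ) * deriv (N.σ j) (cp 0 x) * cd 0 x =
      I * (Yj j x * ℭ (kk N H F (φ ζ) j x) * ‖deriv (N.σ j) x‖) := by
    intro j x hx
    rw [mul_assoc (Yj j x), S.conj R j hx, cp0, cd0]
    have e2 : N.σ j x - ζ ≠ 0 := sub_ne_zero.2 fun h => N.p_not j ⟨hx.1.le, hx.2.le⟩ (h ▸ hζ)
    have hI := I_ne_zero
    have e3 : ∀ A B : ℂ, I * (A * (B / I)) = A * B := fun A B => by field_simp
    rw [e3, mul_div_assoc, div_right_comm, div_self e2, mul_one, one_div]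
    ring
  have hne : ∀ᵐ x : ℝ ∂volume, x ≠ 1 := by simp [ae_iff]
  constructor
  · intro j
    have h := (hJ j).const_mul (I⁻¹)
    rw [intervalIntegrable_iff_integrableOn_Ioo_of_le zero_le_one] at h ⊢
    refine h.congr_fun (fun x hx => ?_) measurableSet_Ioo
    simp only
    rw [key j x hx, inv_mul_cancel_left₀ I_ne_zero]
  · have h2 : I * ∑ j, ∫ x in 𝟘..1, Yj j x * ℭ (kk N H F (φ ζ) j x) * ‖deriv (N.σ j) x‖ =
        f ζ * Y ζ * (dslope φ ζ ζ)⁻¹ * (2 * Real.pi * I) := by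
      rw [← hI, Finset.mul_sum]
      refine Finset.sum_congr rfl fun j _ => ?_
      rw [← intervalIntegral.integral_const_mul]
      refine intervalIntegral.integral_congr_ae ?_
      filter_upwards [hne] with x hx1 hx
      rw [uIoc_of_le zero_le_one] at hx
      exact (key j x ⟨hx.1, lt_of_le_of_ne hx.2 hx1⟩).symm
    rw [dslope_same, ← S.sq ζ hζ] at h2
    refine mul_left_cancel₀ I_ne_zero (h2.trans ?_)
    field_simp

lemma Sq.rep_poly (S : Sq N φ H f F B') (R : Rf N φ ρ B H) (C : Cf G φ ψ) {ζ : ℂ} (hζ : ζ ∈ G) (hb : ‖φ ζ‖ < ρ)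
    (Q : Polynomial ℂ) :
    (∀ j, IntervalIntegrable (fun x : ℝ => Q.eval (N.σ j x) * ℭ (kk N H F (φ ζ) j x) *
      ‖deriv (N.σ j) x‖) volume 0 1) ∧
    ∑ j, ∫ x in 𝟘..1, Q.eval (N.σ j x) * ℭ (kk N H F (φ ζ) j x) * ‖deriv (N.σ j) x‖ =
      2 * Real.pi * Q.eval ζ / f ζ :=
  S.rep R C hζ (((S.adm R C).mul (N.bd_poly Q)).mul (R.bd1 C hζ hb))

lemma Sq.rep_kk (S : Sq N φ H f F B') (R : Rf N φ ρ B H) (C : Cf G φ ψ) (hρ : 0 < ρ) (hρ1 : ρ < 1) {ζ z : ℂ} (hζ : ζ ∈ G)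
    (hz : z ∈ G) (hb : ‖φ ζ‖ < ρ) (hbz : ‖φ z‖ < ρ) :
    (∀ j, IntervalIntegrable (fun x : ℝ => kk N H F (φ z) j x * ℭ (kk N H F (φ ζ) j x) *
      ‖deriv (N.σ j) x‖) volume 0 1) ∧
    ∑ j, ∫ x in 𝟘..1, kk N H F (φ z) j x * ℭ (kk N H F (φ ζ) j x) * ‖deriv (N.σ j) x‖ =
      2 * Real.pi * (1 - ℭ (φ z) * φ ζ)⁻¹ := by
  have hφ := deriv_ne_zero_of_inj N.Go C.d C.injOn hζ
  have hf : f ζ ≠ 0 := fun h => hφ (by rw [← S.sq ζ hζ, h]; ring)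
  have h := S.rep R C hζ (Y := fun t => f t * (1 - ℭ (φ z) * φ t)⁻¹) (Yj := kk N H F (φ z))
    ((((S.adm2 R C).mul (R.bd2 C hρ hbz ℓ).1).mul (R.bd1 C hζ hb)).congr (fun t _ => by ring)
      fun j w _ => by unfold kk; ring)
  refine ⟨h.1, h.2.trans ?_⟩
  field_simp
end

lemma runge {X : Set ℂ} (hX : IsCompact X) (hc : IsPreconnected Xᶜ) {t : ℂ} (ht : t ∉ X) :
    ∃ q : Polynomial ℂ, q.eval t = 1 ∧ ∀ z ∈ X, ‖q.eval z‖ ≤ 1 / 2 := by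
  haveI : CompactSpace X := isCompact_iff_compactSpace.1 hX
  let f : C(X, ℂ) := ⟨Subtype.val, continuous_subtype_val⟩
  let S := (Algebra.adjoin ℂ {f}).topologicalClosure
  haveI hS : IsClosed (S : Set C(X, ℂ)) := Subalgebra.isClosed_topologicalClosure _
  let x : S := ⟨f, subset_closure (Algebra.subset_adjoin rfl)⟩
  have hsp : spectrum ℂ f = X := by rw [ContinuousMap.spectrum_eq_range]; exact Subtype.range_coe
  have h1 := Subalgebra.spectrum_eq_of_isPreconnected_compl (𝕜 := ℂ) S x (by change IsPreconnected (spectrum ℂ f)ᶜ; rwa [hsp])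
  have h2 : t ∉ spectrum ℂ x := by rw [h1]; change t ∉ spectrum ℂ f; rwa [hsp]
  rw [spectrum.notMem_iff] at h2
  obtain ⟨u, hu⟩ := h2
  have hg : ((↑u⁻¹ : S) : C(X, ℂ)) ∈ closure (Algebra.adjoin ℂ {f} : Set C(X, ℂ)) := (↑u⁻¹ : S).2
  obtain ⟨h, hh, hd⟩ := Metric.mem_closure_iff.1 hg (1 / 2 / (‖algebraMap ℂ C(X, ℂ) t - f‖ + 1)) ℘
  rw [Algebra.adjoin_singleton_eq_range_aeval] at hh
  obtain ⟨P, rfl⟩ := hh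
  refine ⟨1 - (Polynomial.C t - Polynomial.X) * P, by simp, fun z hz => ?_⟩
  have e1 : (algebraMap ℂ C(X, ℂ) t - f) * ((↑u⁻¹ : S) : C(X, ℂ)) = 1 := by
    have := congrArg (Subtype.val : S → C(X, ℂ)) u.mul_inv
    rw [hu] at this; exact this
  have e2 : ‖(algebraMap ℂ C(X, ℂ) t - f) * (((↑u⁻¹ : S) : C(X, ℂ)) - Polynomial.aeval f P)‖ ≤ 1 / 2 := by
    refine (norm_mul_le _ _).trans ?_
    rw [dist_eq_norm, lt_div_iff₀ ℘] at hd
    refine le_trans (mul_le_mul_of_nonneg_right (le_add_of_nonneg_right zero_le_one) 𝔫) ?_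
    rw [mul_comm]; exact hd.le
  have e3 := (ContinuousMap.norm_coe_le_norm _ ⟨z, hz⟩).trans e2
  rw [mul_sub, e1] at e3
  have e4 : ((Polynomial.aeval f) P : C(X, ℂ)) ⟨z, hz⟩ = P.eval z := by
    have := Polynomial.aeval_algHom_apply (ContinuousMap.evalAlgHom ℂ ℂ (⟨z, hz⟩ : X)) f P
    rw [ContinuousMap.evalAlgHom_apply] at this
    refine Eq.trans this.symm ?_
    simp [f, Polynomial.aeval_def, Polynomial.eval₂_eq_eval_map]
  simpa [e4, f] using! e3

section
variable {G : Set ℂ} {lam : ℝ}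

/-- normalized functionals annihilating polynomials -/
structure Un (N : Net G lam) (n : ℕ) (u : Fin N.N → ℝ → ℂ) : Prop where
  c : ∀ i, ContinuousOn (u i) (Ioo 0 1)
  s : ∀ i, IntervalIntegrable (fun x => ‖u i x‖ ^ 2) volume 0 1
  e : ∑ i, ∫ x in 𝟘..1, ‖u i x‖ ^ 2 ≤ 1
  o : ∀ Q : Polynomial ℂ, Q.natDegree ≤ n → ∑ i, ∫ x in 𝟘..1, u i x * Q.eval (N.σ i x) = 0

lemma inv_int {m d : ℝ} (hm : 0 < m) (hd : 0 < d) (x₀ : ℝ) :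
    Integrable (fun x : ℝ => (d ^ 2 + m ^ 2 * (x - x₀) ^ 2)⁻¹) ∧
    ∫ x : ℝ, (d ^ 2 + m ^ 2 * (x - x₀) ^ 2)⁻¹ = Real.pi / (m * d) := by
  have e : (fun x : ℝ => (d ^ 2 + m ^ 2 * (x - x₀) ^ 2)⁻¹) = fun x => d⁻¹ ^ 2 * (1 + (m / d * (x - x₀)) ^ 2)⁻¹ := by
    ext x
    rw [inv_pow, ← mul_inv]
    field_simp
  have hmd : m / d ≠ 0 := by positivity
  rw [e]
  constructor
  · exact ((integrable_inv_one_add_sq.comp_mul_left' hmd).comp_sub_right x₀).const_mul _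
  · rw [integral_const_mul, integral_sub_right_eq_self (fun x : ℝ => (1 + (m / d * x) ^ 2)⁻¹),
      Measure.integral_comp_mul_left (fun x : ℝ => (1 + x ^ 2)⁻¹), integral_univ_inv_one_add_sq, abs_of_pos ℘, smul_eq_mul]
    field_simp

lemma Net.σC (N : Net G lam) (i) : ContinuousOn (fun x : ℝ => N.σ i x) (Icc 0 1) := by
  have := (N.cpC i le_rfl N.κ0).1
  simpa only [cp0] using this

lemma Un.bdn (N : Net G lam) : ∃ C > 0, ∀ n u, Un N n u → ∀ (t : ℂ) (d : ℝ), 0 < d →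
    (∀ i, ∀ x ∈ 𝕀c, d ≤ ‖N.σ i x - t‖) → ∀ (v : ℂ → ℂ) (W : ℝ), Continuous v →
    (∀ i, ∀ x ∈ 𝕀c, ‖v (N.σ i x)‖ ≤ W) →
    (∀ i, IntervalIntegrable (fun x => u i x * v (N.σ i x) / (N.σ i x - t)) volume 0 1) ∧
    ∑ i, ∫ x in 𝟘..1, ‖u i x * v (N.σ i x) / (N.σ i x - t)‖ ≤ C * W * d ^ ħ := by
  have hm := N.m0
  refine ⟨1 + N.N * (4 * Real.pi / N.m), ℘, fun n u U t d hd hdist v W vc hW => ?_⟩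
  set r := d ^ ½ with hr
  have hr0 : 0 < r := by positivity
  have hr2 : r ^ 2 = d := by rw [hr, ← Real.rpow_natCast, ← Real.rpow_mul hd.le]; norm_num
  have hrn : d ^ ħ = r⁻¹ := by rw [Real.rpow_neg hd.le]
  have hW0 : 0 ≤ W := (norm_nonneg _).trans (hW N.i0 0 𝔰)
  have hx0 : ∀ i, ∃ x₀ ∈ 𝕀c, ∀ x ∈ 𝕀c, ‖N.σ i x₀ - t‖ ≤ ‖N.σ i x - t‖ := fun i => by
    obtain ⟨y, hy, h⟩ := isCompact_Icc.exists_isMinOn (nonempty_Icc.2 (zero_le_one' ℝ)) ((N.σC i).sub (continuousOn_const (c := t))).norm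
    exact ⟨y, hy, fun x hx => h hx⟩
  choose x₀ hx₀ hmin using hx0
  set b : Fin N.N → ℝ → ℝ := fun i x => (d ^ 2 + (N.m / 2) ^ 2 * (x - x₀ i) ^ 2)⁻¹ with hbdef
  have hb : ∀ i, ∀ x ∈ 𝕀c, (‖N.σ i x - t‖⁻¹) ^ 2 ≤ 2 * b i x := by
    intro i x hx
    have h1 := hdist i x hx
    have h0 := hd.trans_le h1
    have h2 := hmin i x hx
    have hV : ∀ y ∈ 𝕀c, (y:ℂ) ∈ N.V i := fun y hy => by
      have := N.cpV i le_rfl N.κ0 hy; rwa [cp0] at this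
    have h3 := N.lipl i x (hV x hx) (x₀ i) (hV _ (hx₀ i))
    have h4 := norm_sub_le (N.σ i x - t) (N.σ i (x₀ i) - t)
    rw [sub_sub_sub_cancel_right] at h4
    rw [← ofReal_sub, norm_real, Real.norm_eq_abs] at h3
    have h5 : N.m / 2 * |x - x₀ i| ≤ ‖N.σ i x - t‖ := by linarith
    have h6 : (N.m / 2) ^ 2 * (x - x₀ i) ^ 2 ≤ ‖N.σ i x - t‖ ^ 2 := by
      rw [← sq_abs (x - x₀ i), ← mul_pow]; exact pow_le_pow_left₀ ℘ h5 2
    have h7 : d ^ 2 ≤ ‖N.σ i x - t‖ ^ 2 := pow_le_pow_left₀ hd.le h1 2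
    simp only [hbdef]
    rw [inv_pow, ← div_eq_mul_inv, inv_eq_one_div, div_le_div_iff₀ ℘ ℘]
    linarith
  have hbi : ∀ i, IntervalIntegrable (b i) volume 0 1 := fun i => (inv_int (half_pos hm) hd (x₀ i)).1.intervalIntegrable
  have hbv : ∀ i, ∫ x in 𝟘..1, b i x ≤ 2 * Real.pi / (N.m * d) := fun i => by
    rw [intervalIntegral.integral_of_le zero_le_one]
    refine (setIntegral_le_integral (inv_int (half_pos hm) hd (x₀ i)).1 (Eventually.of_forall fun x => ?_)).trans
      ((inv_int (half_pos hm) hd (x₀ i)).2.le.trans (le_of_eq (by field_simp)))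
    change 𝟘 ≤ b i x
    simp only [hbdef]; positivity
  set D : Fin N.N → ℝ → ℝ := fun i x => W * (r⁻¹ * ‖u i x‖ ^ 2 + 2 * r * b i x) with hD
  have hDi : ∀ i, IntervalIntegrable (D i) volume 0 1 := fun i => (((U.s i).const_mul _).add ((hbi i).const_mul _)).const_mul _
  have hle : ∀ i, ∀ x ∈ 𝕀o, ‖u i x * v (N.σ i x) / (N.σ i x - t)‖ ≤ D i x := by
    intro i x hx
    have hx' := Ioo_subset_Icc_self hx
    have h1 := hb i x hx'
    rw [norm_div, norm_mul, div_eq_mul_inv]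
    set a := ‖u i x‖
    set c := ‖N.σ i x - t‖⁻¹
    have hc0 : 0 ≤ c := inv_nonneg.2 𝔫
    have ha0 : 0 ≤ a := norm_nonneg _
    have h2 : a * c ≤ r⁻¹ * a ^ 2 + r * c ^ 2 := by
      have : r⁻¹ * a ^ 2 + r * c ^ 2 - a * c = r⁻¹ * ((a - r * c) ^ 2 + a * (r * c)) := by field_simp; ring
      have : 0 ≤ r⁻¹ * ((a - r * c) ^ 2 + a * (r * c)) := by positivity
      linarith
    calc a * ‖v (N.σ i x)‖ * c ≤ a * W * c := by gcongr; exact hW i x hx'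
      _ = W * (a * c) := by ring
      _ ≤ W * (r⁻¹ * a ^ 2 + r * c ^ 2) := by gcongr
      _ ≤ W * (r⁻¹ * a ^ 2 + r * (2 * b i x)) := by gcongr
      _ = D i x := by simp only [hD]; ring
  have hint : ∀ i, IntervalIntegrable (fun x => u i x * v (N.σ i x) / (N.σ i x - t)) volume 0 1 := by
    intro i
    have h := hDi i
    rw [intervalIntegrable_iff_integrableOn_Ioo_of_le zero_le_one] at h ⊢
    refine h.mono' (ContinuousOn.aestronglyMeasurable ?_ measurableSet_Ioo)
      ((ae_restrict_iff' measurableSet_Ioo).2 (Eventually.of_forall fun x hx => hle i x hx))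
    have s := (N.σC i).mono Ioo_subset_Icc_self
    exact ((U.c i).mul (vc.comp_continuousOn s)).div (s.sub continuousOn_const) fun x hx =>
      norm_pos_iff.1 (hd.trans_le (hdist i x (Ioo_subset_Icc_self hx)))
  refine ⟨hint, ?_⟩
  calc ∑ i, ∫ x in 𝟘..1, ‖u i x * v (N.σ i x) / (N.σ i x - t)‖ ≤ ∑ i, ∫ x in 𝟘..1, D i x := by
        refine Finset.sum_le_sum fun i _ => ?_
        exact intervalIntegral.integral_mono_on_of_le_Ioo zero_le_one (hint i).norm (hDi i) fun x hx => hle i x hx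
    _ = W * r⁻¹ * (∑ i, ∫ x in 𝟘..1, ‖u i x‖ ^ 2) + W * (2 * r) * ∑ i, ∫ x in 𝟘..1, b i x := by
        rw [Finset.mul_sum, Finset.mul_sum, ← Finset.sum_add_distrib]
        refine Finset.sum_congr rfl fun i _ => ?_
        simp only [hD]
        rw [intervalIntegral.integral_const_mul, intervalIntegral.integral_add ((U.s i).const_mul _) ((hbi i).const_mul _),
          intervalIntegral.integral_const_mul, intervalIntegral.integral_const_mul]
        ring
    _ ≤ W * r⁻¹ * 1 + W * (2 * r) * ∑ i : Fin N.N, 2 * Real.pi / (N.m * d) := by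
        gcongr with i
        · exact U.e
        · exact hbv i
    _ = (1 + N.N * (4 * Real.pi / N.m)) * W * d ^ ħ := by
        rw [Finset.sum_const, Finset.card_univ, Fintype.card_fin, nsmul_eq_mul, hrn, ← hr2]
        field_simp
        ring

lemma Un.bd (N : Net G lam) : ∃ C > 0, ∀ n u, Un N n u → ∀ (t : ℂ) (d : ℝ), 0 < d →
    (∀ i, ∀ x ∈ 𝕀c, d ≤ ‖N.σ i x - t‖) → ∀ (v : ℂ → ℂ) (W : ℝ), Continuous v →
    (∀ i, ∀ x ∈ 𝕀c, ‖v (N.σ i x)‖ ≤ W) →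
    (∀ i, IntervalIntegrable (fun x => u i x * v (N.σ i x) / (N.σ i x - t)) volume 0 1) ∧
    ‖∑ i, ∫ x in 𝟘..1, u i x * v (N.σ i x) / (N.σ i x - t)‖ ≤ C * W * d ^ ħ := by
  obtain ⟨C, hC, h⟩ := Un.bdn N
  exact ⟨C, hC, fun n u U t d hd h1 v W h2 h3 => ⟨(h n u U t d hd h1 v W h2 h3).1, (norm_sum_le_of_le _ fun i _ =>
    intervalIntegral.norm_integral_le_integral_norm zero_le_one).trans (h n u U t d hd h1 v W h2 h3).2⟩⟩
end

section
variable {G : Set ℂ} {lam : ℝ} {N : Net G lam} {n : ℕ} {u : Fin N.N → ℝ → ℂ}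

noncomputable def Net.gh (N : Net G lam) (u : Fin N.N → ℝ → ℂ) (t : ℂ) : ℂ := ∑ i, ∫ x in 𝟘..1, u i x / (N.σ i x - t)

lemma Net.bd' (N : Net G lam) (i) {x : ℝ} (hx : x ∈ 𝕀c) : N.σ i x ∈ closure G := frontier_subset_closure (N.bd i x hx)

lemma Net.dG (N : Net G lam) {t : ℂ} (ht : t ∉ closure G) : 0 < infDist t (closure G) :=
  (isClosed_closure.notMem_iff_infDist_pos N.Gc.nonempty.closure).1 ht

lemma Net.dL (N : Net G lam) (t : ℂ) (i) {x : ℝ} (hx : x ∈ 𝕀c) : infDist t (closure G) ≤ ‖N.σ i x - t‖ := by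
  rw [norm_sub_rev, ← dist_eq_norm]; exact infDist_le_dist_of_mem (N.bd' i hx)

lemma Un.bd1 (N : Net G lam) : ∃ C > 0, ∀ n u, Un N n u → ∀ t ∉ closure G,
    ‖N.gh u t‖ ≤ C * infDist t (closure G) ^ ħ := by
  obtain ⟨C, C0, h⟩ := Un.bd N
  refine ⟨C, C0, fun n u U t ht => ?_⟩
  simpa [Net.gh] using (h n u U t _ (N.dG ht) (fun i x hx => N.dL t i hx) (fun _ => 1) 1 continuous_const 𝔰).2

lemma Un.poly (U : Un N n u) {t : ℂ} (ht : t ∉ closure G) {Q : Polynomial ℂ} (hQ : Q.natDegree ≤ n) :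
    Q.eval t * N.gh u t = ∑ i, ∫ x in 𝟘..1, u i x * Q.eval (N.σ i x) / (N.σ i x - t) := by
  obtain ⟨C, -, h⟩ := Un.bd N
  set P := Q /ₘ (Polynomial.X - Polynomial.C t)
  have hP : P.natDegree ≤ n := by
    rw [Polynomial.natDegree_divByMonic _ (Polynomial.monic_X_sub_C t)]; omega
  have e : ∀ z, Q.eval z = Q.eval t + (z - t) * P.eval z := fun z => by
    have := congrArg (Polynomial.eval z) (Polynomial.modByMonic_add_div Q (Polynomial.X - Polynomial.C t))
    rw [Polynomial.modByMonic_X_sub_C_eq_C_eval] at this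
    simpa using this.symm
  have hc : IsCompact (closure G) := N.Gb.isCompact_closure
  have hI : ∀ v : ℂ → ℂ, Continuous v → ∀ i, IntervalIntegrable (fun x => u i x * v (N.σ i x) / (N.σ i x - t)) volume 0 1 := by
    intro v hv
    obtain ⟨W, hW⟩ := hc.exists_bound_of_continuousOn hv.continuousOn
    exact (h n u U t _ (N.dG ht) (fun i x hx => N.dL t i hx) v W hv fun i x hx => hW _ (N.bd' i hx)).1
  have h0 := U.o P hP
  rw [Net.gh, Finset.mul_sum, ← add_zero (∑ i, _), ← h0, ← Finset.sum_add_distrib]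
  refine Finset.sum_congr rfl fun i _ => ?_
  have q1 := hI (fun _ => Q.eval t) continuous_const i
  have q2 : ∀ x ∈ uIcc 𝟘 1, u i x * ((N.σ i x - t) * P.eval (N.σ i x)) / (N.σ i x - t) = u i x * P.eval (N.σ i x) := by
    intro x hx
    rw [uIcc_of_le zero_le_one] at hx
    have : N.σ i x - t ≠ 0 := sub_ne_zero.2 fun h => ht (h ▸ N.bd' i hx)
    field_simp
  have q3 := hI (fun z => (z - t) * P.eval z) (by fun_prop) i
  rw [← intervalIntegral.integral_congr q2, ← intervalIntegral.integral_const_mul]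
  have q1' : IntervalIntegrable (fun x => Q.eval t * (u i x / (N.σ i x - t))) volume 0 1 :=
    q1.congr (fun x _ => by ring)
  rw [← intervalIntegral.integral_add q1' q3]
  refine intervalIntegral.integral_congr fun x _ => ?_
  rw [e (N.σ i x)]; ring

lemma Un.cpt (N : Net G lam) {S : Set ℂ} (hS : IsCompact S) (hSG : S ⊆ (closure G)ᶜ) : ∃ C > 0, ∃ c > 0,
    ∀ n u, Un N n u → ∀ t ∈ S, ‖N.gh u t‖ ≤ C * Real.exp (-(c * n)) := by
  obtain ⟨C0, hC0, h⟩ := Un.bd N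
  have hc : IsCompact (closure G) := N.Gb.isCompact_closure
  refine hS.induction_on (p := fun S => ∃ C > 0, ∃ c > 0, ∀ n u, Un N n u → ∀ t ∈ S, ‖N.gh u t‖ ≤ C * Real.exp (-(c * n)))
    ⟨1, one_pos, 1, one_pos, by simp⟩ ?_ ?_ ?_
  · rintro s t hst ⟨C, hC, c, hc, h⟩
    exact ⟨C, hC, c, hc, fun n u U x hx => h n u U x (hst hx)⟩
  · rintro s t ⟨C, hC, c, hc, h⟩ ⟨C', hC', c', hc', h'⟩
    refine ⟨max C C', ℘, min c c', ℘, fun n u U x hx => ?_⟩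
    rcases hx with hx | hx
    · refine (h n u U x hx).trans ?_
      gcongr
      · exact le_max_left _ _
      · exact min_le_left _ _
    · refine (h' n u U x hx).trans ?_
      gcongr
      · exact le_max_right _ _
      · exact min_le_right _ _
  · intro t0 ht0
    obtain ⟨q, hq1, hq⟩ := runge hc N.ext (hSG ht0)
    have hd := N.dG (hSG ht0)
    set d := infDist t0 (closure G)
    set D : ℝ := q.natDegree + 1
    have hD : 0 < D := by positivity
    have hlog : Real.log (2 / 3) < 0 := Real.log_neg (by norm_num) (by norm_num)
    have hn1 : ∀ᶠ t in 𝓝 t0, 3 / 4 < ‖q.eval t‖ := q.continuous.norm.continuousAt.eventually_const_lt (by simp [hq1]; norm_num)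
    refine ⟨_, nhdsWithin_le_nhds (inter_mem hn1 (ball_mem_nhds t0 (half_pos hd))), C0 * (d / 2) ^ ħ * (3 / 2), ℘,
      -Real.log (2 / 3) / D, div_pos (neg_pos.2 hlog) hD, fun n u U t ht => ?_⟩
    obtain ⟨ht1, ht2⟩ : 3 / 4 < ‖q.eval t‖ ∧ dist t t0 < d / 2 := ht
    have hdist : ∀ z ∈ closure G, d / 2 ≤ ‖z - t‖ := fun z hz => by
      have h1 : d ≤ dist t0 z := infDist_le_dist_of_mem hz
      have h2 := dist_triangle t0 t z
      rw [dist_comm t0 t, dist_comm t z, dist_eq_norm z t] at h2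
      linarith
    have htG : t ∉ closure G := fun hz => by have := hdist t hz; simp at this; linarith
    set k := n / (q.natDegree + 1) with hk
    have hdeg : (q ^ k).natDegree ≤ n := by
      refine Polynomial.natDegree_pow_le.trans ?_
      calc k * q.natDegree ≤ k * (q.natDegree + 1) := by gcongr; omega
        _ ≤ n := Nat.div_mul_le_self _ _
    have h1 := U.poly htG hdeg
    have h2 := (h n u U t _ (half_pos hd) (fun i x hx => hdist _ (N.bd' i hx)) (fun z => (q ^ k).eval z) ((1 / 2) ^ k)
      (by fun_prop) (fun i x hx => by
        simp only [Polynomial.eval_pow, norm_pow]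
        exact pow_le_pow_left₀ 𝔫 (hq _ (N.bd' i hx)) k)).2
    rw [← h1, norm_mul, Polynomial.eval_pow, norm_pow] at h2
    have h3 : (3 / 4 : ℝ) ^ k * ‖N.gh u t‖ ≤ C0 * (1 / 2) ^ k * (d / 2) ^ ħ :=
      le_trans (by gcongr) h2
    have h4 : (2 / 3 : ℝ) ^ k ≤ 3 / 2 * Real.exp (-(-Real.log (2 / 3) / D * n)) := by
      have a : (n:ℝ) < D * (k + 1) := by
        have := Nat.lt_mul_div_succ n (Nat.succ_pos q.natDegree)
        simp only [D, hk]
        exact_mod_cast this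
      have b : (n:ℝ) / D - 1 ≤ k := by rw [sub_le_iff_le_add, div_le_iff₀ hD]; linarith
      have e1 : (2 / 3 : ℝ) ^ k = Real.exp (k * Real.log (2 / 3)) := by
        rw [mul_comm, Real.exp_mul, Real.exp_log (by norm_num), Real.rpow_natCast]
      have e2 : (3 / 2 : ℝ) = Real.exp (-Real.log (2 / 3)) := by
        rw [Real.exp_neg, Real.exp_log (by norm_num)]; norm_num
      rw [e1, e2, ← Real.exp_add]
      refine Real.exp_le_exp.2 ?_
      have : -Real.log (2 / 3) + -(-Real.log (2 / 3) / D * n) = (n / D - 1) * Real.log (2 / 3) := by ring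
      rw [this]
      exact mul_le_mul_of_nonpos_right b hlog.le
    have h5 : ‖N.gh u t‖ ≤ C0 * (d / 2) ^ ħ * (2 / 3) ^ k := by
      have : (2 / 3 : ℝ) ^ k = (1 / 2) ^ k / (3 / 4) ^ k := by rw [← div_pow]; norm_num
      rw [this, ← mul_div_assoc, le_div_iff₀ ℘]
      linarith
    calc _ ≤ _ := h5
      _ ≤ C0 * (d / 2) ^ ħ * (3 / 2 * Real.exp (-(-Real.log (2 / 3) / D * n))) := by gcongr
      _ = _ := by ring

lemma Un.diff (U : Un N n u) : DifferentiableOn ℂ (N.gh u) (closure G)ᶜ := by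
  intro t0 ht0
  have hd := N.dG ht0
  set d := infDist t0 (closure G)
  refine DifferentiableAt.differentiableWithinAt (DifferentiableAt.fun_sum fun i _ => ?_)
  have hne : ∀ t ∈ ball t0 (d / 2), ∀ x ∈ 𝕀c, d / 2 ≤ ‖N.σ i x - t‖ := fun t ht x hx => by
    have h1 := N.dL t0 i hx
    have h2 := norm_add_le (N.σ i x - t) (t - t0)
    rw [sub_add_sub_cancel] at h2
    rw [mem_ball, dist_eq_norm] at ht
    change d ≤ _ at h1
    linarith
  have hui : IntervalIntegrable (fun x => ‖u i x‖ * (d / 2)⁻¹ ^ 2) volume 0 1 := by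
    have := ((U.s i).add (intervalIntegrable_const (c := (1:ℝ)))).mul_const ((d / 2)⁻¹ ^ 2)
    rw [intervalIntegrable_iff_integrableOn_Ioo_of_le zero_le_one] at this ⊢
    refine this.mono' (((U.c i).norm.mul continuousOn_const).aestronglyMeasurable measurableSet_Ioo) (Eventually.of_forall fun x => ?_)
    rw [Real.norm_of_nonneg ℘]
    gcongr
    nlinarith [sq_nonneg (‖u i x‖ - 1)]
  obtain ⟨C, -, h⟩ := Un.bd N
  have ss : uIoc 𝟘 1 = Ioc 0 1 := uIoc_of_le zero_le_one
  have sr : (volume.restrict (uIoc 𝟘 1)) = volume.restrict (Ioo 0 1) := by rw [ss]; exact Measure.restrict_congr_set Ioo_ae_eq_Ioc.symm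
  have mI : ∀ t ∈ ball t0 (d / 2), ∀ k : ℕ, AEStronglyMeasurable (fun x => u i x / (N.σ i x - t) ^ k) (volume.restrict (uIoc 𝟘 1)) :=
    fun t ht k => by
      rw [sr]
      have s := (N.σC i).mono Ioo_subset_Icc_self
      exact ((U.c i).div ((s.sub continuousOn_const).pow k) fun x hx => pow_ne_zero _ (norm_pos_iff.1
        ((half_pos hd).trans_le (hne t ht x (Ioo_subset_Icc_self hx))))).aestronglyMeasurable measurableSet_Ioo
  refine (intervalIntegral.hasDerivAt_integral_of_dominated_loc_of_deriv_le (F' := fun t x => u i x / (N.σ i x - t) ^ 2)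
    (ball_mem_nhds t0 (half_pos hd)) ?_ ?_ ?_ ?_ hui ?_).2.differentiableAt
  · filter_upwards [ball_mem_nhds t0 (half_pos hd)] with t ht
    simpa using mI t ht 1
  · simpa using (h n u U t0 _ hd (fun i x hx => N.dL t0 i hx) (fun _ => 1) 1 continuous_const 𝔰).1 i
  · exact mI t0 (mem_ball_self (half_pos hd)) 2
  · refine Eventually.of_forall fun x hx t ht => ?_
    rw [ss] at hx
    have h1 := hne t ht x (Ioc_subset_Icc_self hx)
    rw [norm_div, norm_pow, div_eq_mul_inv, ← inv_pow]
    gcongr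
  · refine Eventually.of_forall fun x hx t ht => ?_
    rw [ss] at hx
    have h1 := norm_pos_iff.1 ((half_pos hd).trans_le (hne t ht x (Ioc_subset_Icc_self hx)))
    simp only [div_eq_mul_inv]
    exact ((((hasDerivAt_id t).const_sub (N.σ i x)).inv h1).const_mul (u i x)).congr_deriv (by simp [div_eq_mul_inv])
end

lemma abs_arg_neg {w : ℂ} (h0 : w ≠ 0) : |arg w| + |arg (-w)| = Real.pi := by
  rcases lt_trichotomy w.im 0 with h | h | h
  · rw [arg_neg_eq_arg_add_pi_of_im_neg h, abs_of_neg (arg_neg_iff.2 h), abs_of_nonneg (by linarith [neg_pi_lt_arg w])]; ring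
  · have : w = (w.re : ℂ) := by apply Complex.ext <;> simp [h]
    rw [this, ← ofReal_neg]
    have h1 : w.re ≠ 0 := fun h' => h0 (by rw [this, h']; simp)
    have hp := Real.pi_pos
    rcases lt_or_gt_of_ne h1 with h2 | h2
    · rw [arg_ofReal_of_neg h2, arg_ofReal_of_nonneg ℓ, abs_of_pos hp]; simp
    · rw [arg_ofReal_of_nonneg h2.le, arg_ofReal_of_neg ℓ, abs_of_pos hp]; simp
  · rw [arg_neg_eq_arg_sub_pi_of_im_pos h, abs_of_nonneg (arg_nonneg_iff.2 h.le), abs_of_nonpos (by linarith [arg_le_pi w])]; ring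

noncomputable def hh (a : ℝ) (w : ℂ) : ℂ := w ^ (a : ℂ) + w ^ ((a + 1 / 2 : ℝ) : ℂ)

lemma hh_le {a : ℝ} (ha : 0 < a) {w : ℂ} (hw : ‖w‖ ≤ 1) (h0 : w ≠ 0) : ‖hh a w‖ ≤ 2 * ‖w‖ ^ a := by
  refine (norm_add_le _ _).trans ?_
  rw [norm_cpow_real, norm_cpow_real]
  have := Real.rpow_le_rpow_of_exponent_ge (norm_pos_iff.2 h0) hw (show a ≤ a + 1 / 2 by linarith)
  linarith

lemma hh_deriv {a : ℝ} {w : ℂ} (hw : w ∈ slitPlane) :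
    HasDerivAt (hh a) (a * w ^ ((a:ℂ) - 1) + (a + 1 / 2 : ℝ) * w ^ (((a + 1 / 2 : ℝ) : ℂ) - 1)) w := by
  have h : ∀ b : ℝ, HasDerivAt (fun w : ℂ => w ^ (b : ℂ)) (b * w ^ ((b:ℂ) - 1)) w := fun b => by
    simpa using (hasDerivAt_id w).cpow_const (c := (b:ℂ)) hw
  exact (h a).add (h _)

section
variable {G : Set ℂ} {lam : ℝ}

noncomputable def Net.W (N : Net G lam) (j : Fin N.N) (t : ℂ) : ℂ := -(t - N.σ j 0) / N.e j

lemma Net.nW (N : Net G lam) (j) (t : ℂ) : ‖N.W j t‖ = ‖t - N.σ j 0‖ := by rw [Net.W, norm_div, norm_neg, N.e1, div_one]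

lemma Net.far_seg (N : Net G lam) (t : ℂ) (ht : t ∉ closure G) : closedBall t (infDist t (closure G)) ⊆ Gᶜ := by
  rw [← closure_ball t (N.dG ht).ne']
  refine closure_minimal (fun x hx => ?_) N.Go.isClosed_compl
  intro hxG
  have := infDist_le_dist_of_mem (x := t) (subset_closure hxG)
  rw [dist_comm] at this
  exact absurd hx (by simpa using this)

lemma Net.barrier1 (N : Net G lam) (j) : ∃ δ1 > 0, δ1 ≤ 1 ∧ δ1 < N.δ ∧ ∀ t ∉ G, t ≠ N.σ j 0 → ‖t - N.σ j 0‖ ≤ δ1 →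
    N.W j t ∈ slitPlane ∧ (t ∈ closure G → (hh (1 / N.la j) (N.W j t)).re < 0) := by
  have hl0 : 0 < N.la j := N.lam0.trans_le (N.la1 j)
  have hl2 := N.la2 j
  have hpi := Real.pi_pos
  set l := N.la j
  set a := 1 / l
  have ha : 0 < a := by positivity
  have hal : a * l = 1 := one_div_mul_cancel hl0.ne'
  have hS : 0 < Real.sin (l * Real.pi / 4) := Real.sin_pos_of_pos_of_lt_pi ℘ ℓₙ
  have ev : ∀ᶠ s : ℝ in 𝓝 0, s < N.δ ∧ l * Real.pi / 2 + N.K * s < Real.pi ∧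
      a * N.K * √s + (a + 1 / 2) * N.K * s < Real.sin (l * Real.pi / 4) := by
    refine (eventually_lt_nhds N.δ0).and (Eventually.and ?_ ?_)
    · exact ContinuousAt.eventually_lt (by fun_prop) continuousAt_const ℓₙ
    · exact ContinuousAt.eventually_lt (by fun_prop) continuousAt_const (by simpa using hS)
  obtain ⟨ε, hε, hev⟩ := Metric.eventually_nhds_iff.1 ev
  have hm : min (ε / 2) 1 ≤ ε / 2 := min_le_left _ _
  have hm0 : 0 < min (ε / 2) 1 := by positivity
  have hall : ∀ s : ℝ, 0 ≤ s → s ≤ min (ε / 2) 1 → s < N.δ ∧ l * Real.pi / 2 + N.K * s < Real.pi ∧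
      a * N.K * √s + (a + 1 / 2) * N.K * s < Real.sin (l * Real.pi / 4) := fun s h0 hs => hev (by
      rw [Real.dist_eq, sub_zero, abs_of_nonneg h0]; linarith)
  refine ⟨min (ε / 2) 1, hm0, min_le_right _ _, (hall _ hm0.le le_rfl).1, fun t htG htp hts => ?_⟩
  obtain ⟨h1, h2, h3⟩ := hall _ 𝔫 hts
  have hw0 : N.W j t ≠ 0 := norm_pos_iff.1 (by rw [N.nW]; exact norm_pos_iff.2 (sub_ne_zero.2 htp))
  have hn2 : |arg (N.W j t)| ≤ l * Real.pi / 2 + N.K * ‖t - N.σ j 0‖ := N.n2 j t htG htp h1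
  have hnW := N.nW j t
  set s := ‖t - N.σ j 0‖ with hs
  set w := N.W j t with hw
  have hs0 : 0 < s := by rw [← hnW]; exact norm_pos_iff.2 hw0
  refine ⟨mem_slitPlane_iff_arg.2 ⟨fun h => ?_, hw0⟩, fun htc => ?_⟩
  · rw [h, abs_of_pos hpi] at hn2; linarith
  have hn1 := N.n1 j t htc htp h1
  have e1 : (t - N.σ j 0) / N.e j = -w := by rw [hw, Net.W]; ring
  rw [e1, ← hs] at hn1
  have hsum := abs_arg_neg hw0
  have hth : |(|arg w| - l * Real.pi / 2)| ≤ N.K * s := by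
    rw [abs_le]; constructor <;> linarith
  have hre : ∀ b : ℝ, 0 ≤ b → (w ^ (b:ℂ)).re ≤ s ^ b * (Real.cos (l * Real.pi / 2 * b) + b * (N.K * s)) := fun b hb => by
    rw [cpow_ofReal_re, hnW]
    refine mul_le_mul_of_nonneg_left ?_ ℘
    have h4 := (abs_le.1 (Real.abs_cos_sub_cos_le (|arg w| * b) (l * Real.pi / 2 * b))).2
    rw [← sub_mul, abs_mul, abs_of_nonneg hb] at h4
    have h5 : Real.cos (arg w * b) = Real.cos (|arg w| * b) := by
      rw [← Real.cos_abs (arg w * b), abs_mul, abs_of_nonneg hb]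
    rw [h5]
    have h6 := mul_le_mul_of_nonneg_right hth hb
    linarith
  have r1 := hre a ha.le
  have r2 := hre (a + 1 / 2) ℓ
  have c1 : l * Real.pi / 2 * a = Real.pi / 2 := by linear_combination 𝔭 * hal
  have c2 : l * Real.pi / 2 * (a + 1 / 2) = l * Real.pi / 4 + Real.pi / 2 := by linear_combination 𝔭 * hal
  rw [c1, Real.cos_pi_div_two] at r1
  rw [c2, Real.cos_add_pi_div_two, Real.rpow_add hs0, ← Real.sqrt_eq_rpow] at r2
  have hq : √s * √s = s := Real.mul_self_sqrt hs0.le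
  have hqs : 0 < √s := Real.sqrt_pos.2 hs0
  rw [hh, add_re]
  calc _ ≤ _ := add_le_add r1 r2
    _ = s ^ a * √s * (a * N.K * √s + (a + 1 / 2) * N.K * s - Real.sin (l * Real.pi / 4)) := by
        linear_combination -(s ^ a * a * N.K) * hq
    _ < 0 := mul_neg_of_pos_of_neg ℘ ℓ


lemma Net.pcl (N : Net G lam) (j) : N.σ j 0 ∈ closure G := by simpa using N.bd' j (x := 0) 𝔰

lemma Net.barrier2 (N : Net G lam) (j) {δ1 : ℝ} (hδ1 : δ1 ≤ 1) (hB : ∀ t ∉ G, t ≠ N.σ j 0 → ‖t - N.σ j 0‖ ≤ δ1 →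
    N.W j t ∈ slitPlane ∧ (t ∈ closure G → (hh (1 / N.la j) (N.W j t)).re < 0)) : ∃ c > 0, ∀ t ∉ closure G,
    ‖t - N.σ j 0‖ ≤ δ1 / 2 → 0 < (hh (1 / N.la j) (N.W j t)).re →
    c * (hh (1 / N.la j) (N.W j t)).re ≤ ‖t - N.σ j 0‖ ^ (1 / N.la j - 1) * infDist t (closure G) := by
  have hl0 : 0 < N.la j := N.lam0.trans_le (N.la1 j)
  set a := 1 / N.la j
  have ha : 0 < a := by positivity
  set p := N.σ j 0
  set D := (2 * a + 1) * (2 ^ a * 2)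
  have hD : 0 < D := by positivity
  refine ⟨min (1 / 4) (1 / D), ℘, fun t ht hts hre => ?_⟩
  have htp : t ≠ p := fun h => ht (h ▸ N.pcl j)
  have hs0 : 0 < ‖t - p‖ := norm_pos_iff.2 (sub_ne_zero.2 htp)
  have hnW := N.nW j t
  change ‖N.W j t‖ = ‖t - p‖ at hnW
  set s := ‖t - p‖
  have hd := N.dG ht
  have hfs := N.far_seg t ht
  obtain ⟨z, hz, hzd⟩ := isClosed_closure.exists_infDist_eq_dist N.Gc.nonempty.closure t
  set d := infDist t (closure G)
  rcases le_or_gt (s / 2) d with hds | hds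
  · have h1 := (re_le_norm _).trans (hh_le ha (w := N.W j t) (by rw [hnW]; linarith) (norm_pos_iff.1 (by rwa [hnW])))
    rw [hnW] at h1
    calc _ ≤ 1 / 4 * (2 * s ^ a) := by gcongr; exact min_le_left _ _
      _ = s ^ (a - 1) * (s / 2) := by rw [Real.rpow_sub_one hs0.ne']; field_simp; norm_num
      _ ≤ _ := by gcongr
  have hx : ∀ x ∈ closedBall t d, x ∉ G ∧ s / 2 ≤ ‖x - p‖ ∧ ‖x - p‖ ≤ 2 * s ∧ N.W j x ∈ slitPlane := by
    intro x hx
    have h1 : ‖x - t‖ ≤ d := by simpa [dist_eq_norm] using hx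
    have h2 := norm_sub_le (x - p) (x - t)
    have h3 := norm_add_le (x - t) (t - p)
    rw [sub_sub_sub_cancel_left] at h2
    rw [sub_add_sub_cancel] at h3
    have h4 : s / 2 ≤ ‖x - p‖ := by linarith
    refine ⟨hfs hx, h4, ℓ, (hB x (hfs hx) ?_ (by change ‖x - p‖ ≤ _; linarith)).1⟩
    rintro rfl; simp at h4; linarith
  have hzt : z ∈ closedBall t d := by rw [mem_closedBall, dist_comm, ← hzd]
  have htt : t ∈ closedBall t d := mem_closedBall_self hd.le
  have hder : ∀ x ∈ closedBall t d, HasDerivWithinAt (fun x => hh a (N.W j x)) ((a * N.W j x ^ ((a:ℂ) - 1) +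
      (a + 1 / 2 : ℝ) * N.W j x ^ (((a + 1 / 2 : ℝ) : ℂ) - 1)) * (-1 / N.e j)) (closedBall t d) x := fun x hx' => by
    have h1 : HasDerivAt (N.W j) (-1 / N.e j) x := (((hasDerivAt_id x).sub_const p).neg.div_const (N.e j))
    exact ((hh_deriv (hx x hx').2.2.2).comp x h1).hasDerivWithinAt
  have hbound : ∀ x ∈ closedBall t d, ‖(a * N.W j x ^ ((a:ℂ) - 1) +
      (a + 1 / 2 : ℝ) * N.W j x ^ (((a + 1 / 2 : ℝ) : ℂ) - 1)) * (-1 / N.e j)‖ ≤ D * s ^ (a - 1) := by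
    intro x hx'
    obtain ⟨-, h1, h2, -⟩ := hx x hx'
    have hr := N.nW j x
    change _ = ‖x - p‖ at hr
    set r := ‖x - p‖
    have hr0 : 0 < r := by linarith
    have hr1 : r ≤ 1 := by linarith
    rw [norm_mul, norm_div, norm_neg, norm_one, N.e1, div_one, mul_one]
    refine (norm_add_le _ _).trans ?_
    have e : ∀ b : ℝ, ((b:ℂ) - 1) = ((b - 1 : ℝ) : ℂ) := fun b => by push_cast; ring
    rw [norm_mul, norm_mul, e, e, norm_cpow_real, norm_cpow_real, hr, norm_real, norm_real, Real.norm_of_nonneg ha.le,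
      Real.norm_of_nonneg ℓ]
    have h3 : r ^ (a + 1 / 2 - 1) ≤ r ^ (a - 1) := Real.rpow_le_rpow_of_exponent_ge hr0 hr1 ℓ
    have h4 : r ^ (a - 1) ≤ 2 ^ a * 2 * s ^ (a - 1) := by
      rw [Real.rpow_sub_one hr0.ne', Real.rpow_sub_one hs0.ne']
      calc r ^ a / r ≤ (2 * s) ^ a / (s / 2) := by gcongr
        _ = _ := by rw [Real.mul_rpow (by norm_num) hs0.le]; field_simp
    calc _ ≤ a * r ^ (a - 1) + (a + 1 / 2) * r ^ (a - 1) := by gcongr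
      _ ≤ (2 * a + 1) * r ^ (a - 1) := by nlinarith [Real.rpow_nonneg hr0.le (a - 1)]
      _ ≤ (2 * a + 1) * (2 ^ a * 2 * s ^ (a - 1)) := by gcongr
      _ = _ := by ring
  have hmv := (convex_closedBall t d).norm_image_sub_le_of_norm_hasDerivWithin_le hder hbound hzt htt
  have hzG := (hx z hzt).1
  have hzp : z ≠ p := by
    have := (hx z hzt).2.1
    rintro rfl; simp at this; linarith
  have h1 := (hB z hzG hzp (by have := (hx z hzt).2.2.1; change ‖z - p‖ ≤ _; linarith)).2 hz
  have h2 := (re_le_norm _).trans hmv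
  rw [sub_re, ← dist_eq_norm, ← hzd] at h2
  calc _ ≤ 1 / D * (hh a (N.W j t)).re := by gcongr; exact min_le_right _ _
    _ ≤ 1 / D * (D * s ^ (a - 1) * d) := by gcongr; linarith
    _ = _ := by field_simp

lemma Net.barrier3 (N : Net G lam) (j) {c0 : ℝ} (hc0 : 0 < c0) : ∃ δ1 > 0, ∃ c > 0, ∀ t ∉ closure G,
    ‖t - N.σ j 0‖ ≤ δ1 → c0 * ‖t - N.σ j 0‖ ≤ infDist t (closure G) →
    c * ‖t - N.σ j 0‖ ^ (1 / N.la j) ≤ (hh (1 / N.la j) (N.W j t)).re := by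
  have hl0 : 0 < N.la j := N.lam0.trans_le (N.la1 j)
  have hl2 := N.la2 j
  have hpi := Real.pi_pos
  set l := N.la j
  set a := 1 / l
  have ha : 0 < a := by positivity
  have hal : a * l = 1 := one_div_mul_cancel hl0.ne'
  set p := N.σ j 0
  obtain ⟨b, hb0, hb1, hb2, hb3⟩ : ∃ b > 0, b < c0 ∧ l * Real.pi / 2 + b < Real.pi ∧ b ≤ l * Real.pi / 2 := by
    refine ⟨min (c0 / 2) (min ((Real.pi - l * Real.pi / 2) / 2) (l * Real.pi / 2)), ?_, ?_, ?_, ?_⟩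
    · have : 0 < Real.pi - l * Real.pi / 2 := by nlinarith
      positivity
    · linarith [min_le_left (c0 / 2) (min ((Real.pi - l * Real.pi / 2) / 2) (l * Real.pi / 2))]
    · have h := (min_le_right (c0 / 2) (min ((Real.pi - l * Real.pi / 2) / 2) (l * Real.pi / 2))).trans 𝔩
      nlinarith
    · exact (min_le_right (c0 / 2) _).trans 𝔯
  have hS : 0 < Real.sin (a * (b / 2)) := Real.sin_pos_of_pos_of_lt_pi ℘ ℓₙ
  set S := Real.sin (a * (b / 2))
  have ev : ∀ᶠ s : ℝ in 𝓝 0, s < N.δ ∧ l * Real.pi / 2 + b + N.K * s < Real.pi ∧ N.K * s < b / 2 ∧ √s < S / 2 := by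
    refine (eventually_lt_nhds N.δ0).and (Eventually.and ?_ (Eventually.and ?_ ?_))
    · exact ContinuousAt.eventually_lt (by fun_prop) continuousAt_const ℓ
    · exact ContinuousAt.eventually_lt (by fun_prop) continuousAt_const ℓ
    · exact ContinuousAt.eventually_lt (by fun_prop) continuousAt_const (by simpa using hS)
  obtain ⟨ε, hε, hev⟩ := Metric.eventually_nhds_iff.1 ev
  refine ⟨ε / 2, half_pos hε, S / 2, half_pos hS, fun t ht hts htd => ?_⟩
  obtain ⟨h1, h2, h3, h4⟩ := hev (y := ‖t - p‖) (by rw [Real.dist_eq, sub_zero, abs_of_nonneg 𝔫]; linarith)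
  have htp : t ≠ p := fun h => ht (h ▸ N.pcl j)
  have hs0 : 0 < ‖t - p‖ := norm_pos_iff.2 (sub_ne_zero.2 htp)
  have hnW := N.nW j t
  change ‖N.W j t‖ = ‖t - p‖ at hnW
  have hw0 : N.W j t ≠ 0 := norm_pos_iff.1 (by rwa [hnW])
  have hn2 : |arg (N.W j t)| ≤ l * Real.pi / 2 + N.K * ‖t - p‖ := N.n2 j t (fun h => ht (subset_closure h)) htp h1
  have rot : ∀ β : ℝ, |β| = b → |arg (N.W j t * exp (I * β))| ≤ l * Real.pi / 2 + N.K * ‖t - p‖ := fun β hβ => by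
    set t' := p + (t - p) * exp (I * β)
    have hn : ‖exp (I * (β:ℂ))‖ = 1 := by rw [mul_comm, norm_exp_ofReal_mul_I]
    have e1 : t' - p = (t - p) * exp (I * β) := by ring
    have e2 : N.W j t' = N.W j t * exp (I * β) := by
      unfold Net.W; change -(t' - p) / _ = -(t - p) / _ * _; rw [e1]; ring
    have e3 : ‖t' - p‖ = ‖t - p‖ := by rw [e1, norm_mul, hn, mul_one]
    have e4 : t' ∉ closure G := fun h => by
      have q1 := infDist_le_dist_of_mem (x := t) h
      have q2 : t' - t = (t - p) * (exp (I * β) - 1) := by ring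
      rw [dist_comm, dist_eq_norm, q2, norm_mul] at q1
      have q3 := Real.norm_exp_I_mul_ofReal_sub_one_le (x := β)
      rw [Real.norm_eq_abs, hβ] at q3
      nlinarith
    have := N.n2 j t' (fun h => e4 (subset_closure h)) (fun h => e4 (h ▸ N.pcl j)) (by change ‖t' - p‖ < _; rwa [e3])
    change |arg (N.W j t')| ≤ _ * _ / 2 + _ * ‖t' - p‖ at this
    rwa [e2, e3] at this
  set s := ‖t - p‖
  set w := N.W j t
  have hexp : ∀ β : ℝ, |β| = b → arg w + β ∈ Ioc (-Real.pi) Real.pi → |arg w + β| ≤ l * Real.pi / 2 + N.K * s := fun β hβ hm => by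
    have hβ' : arg (exp (I * β)) = β := by
      rw [mul_comm, arg_exp_mul_I, toIocMod_eq_self]
      have := abs_le.1 hβ.le
      constructor <;> nlinarith
    have := rot β hβ
    rwa [arg_mul hw0 (exp_ne_zero _) (by rwa [hβ']), hβ'] at this
  have hth : |arg w| ≤ l * Real.pi / 2 - b / 2 := by
    have hab := abs_le.1 hn2
    rcases le_total 0 (arg w) with h | h
    · have := hexp b (abs_of_pos hb0) ⟨ℓ, ℓ⟩
      rw [abs_of_nonneg ℓ] at this
      rw [abs_of_nonneg h]; linarith
    · have := hexp (-b) (by rw [abs_neg, abs_of_pos hb0]) ⟨ℓ, ℓ⟩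
      rw [abs_of_nonpos ℓ] at this
      rw [abs_of_nonpos h]; linarith
  have hcos : S ≤ Real.cos (arg w * a) := by
    have e : S = Real.cos (Real.pi / 2 - a * (b / 2)) := (Real.cos_pi_div_two_sub _).symm
    rw [e, ← Real.cos_abs (arg w * a), abs_mul, abs_of_pos ha]
    refine Real.cos_le_cos_of_nonneg_of_le_pi ℘ ?_ ?_
    · have : 0 < a * (b / 2) := by positivity
      linarith
    · have := mul_le_mul_of_nonneg_right hth ha.le
      have e2 : (l * Real.pi / 2 - b / 2) * a = Real.pi / 2 - a * (b / 2) := by linear_combination Real.pi / 2 * hal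
      linarith
  rw [hh, add_re, cpow_ofReal_re, hnW]
  have h5 := neg_le_of_abs_le (abs_re_le_norm (w ^ ((a + 1 / 2 : ℝ) : ℂ)))
  rw [norm_cpow_real, hnW, Real.rpow_add hs0, ← Real.sqrt_eq_rpow] at h5
  have h6 : 0 < s ^ a := by positivity
  nlinarith


lemma sqrt_exp {k y : ℝ} (hk : 0 < k) (hy : 0 ≤ y) : y ^ ½ * Real.exp (-(k * y)) ≤ (1 + 2 / k) * Real.exp (-(k / 2 * y)) := by
  have h1 : y ^ ½ ≤ 1 + y := by
    rw [← Real.sqrt_eq_rpow]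
    nlinarith [Real.sq_sqrt hy, sq_nonneg (√y - 1)]
  have h2 := Real.add_one_le_exp (k / 2 * y)
  have e : Real.exp (-(k * y)) = Real.exp (-(k / 2 * y)) * Real.exp (-(k / 2 * y)) := by rw [← Real.exp_add]; congr 1; ring
  have e2 : Real.exp (-(k / 2 * y)) * Real.exp (k / 2 * y) = 1 := by rw [← Real.exp_add]; simp
  set E := Real.exp (-(k / 2 * y))
  have hE : 0 < E := Real.exp_pos _
  have h3 : 1 + y ≤ (1 + 2 / k) * Real.exp (k / 2 * y) := by
    calc 1 + y ≤ (1 + 2 / k) * (k / 2 * y + 1) := by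
          have : (1 + 2 / k) * (k / 2 * y + 1) = 1 + y + k / 2 * y + 2 / k := by field_simp; ring
          rw [this]; have : 0 ≤ k / 2 * y + 2 / k := by positivity
          linarith
      _ ≤ _ := by gcongr
  rw [e]
  calc y ^ ½ * (E * E) ≤ ((1 + 2 / k) * Real.exp (k / 2 * y)) * (E * E) := by gcongr; linarith
    _ = (1 + 2 / k) * E := by linear_combination (1 + 2 / k) * E * e2

lemma Un.node (N : Net G lam) (j) {c0 : ℝ} (hc0 : 0 < c0) : ∃ δ > 0, ∃ C > 0, ∃ c > 0, ∀ n u, Un N n u → ∀ t ∉ closure G,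
    ‖t - N.σ j 0‖ < δ → c0 * ‖t - N.σ j 0‖ ≤ infDist t (closure G) →
    ‖N.gh u t‖ ≤ C * ‖t - N.σ j 0‖ ^ ħ * Real.exp (-(c * n * ‖t - N.σ j 0‖ ^ (1 / N.la j))) := by
  obtain ⟨d1, hd1, hd1', hd1N, hB⟩ := N.barrier1 j
  obtain ⟨k2, hk2, hB2⟩ := N.barrier2 j hd1' hB
  obtain ⟨d3, hd3, k3, hk3, hB3⟩ := N.barrier3 j hc0
  obtain ⟨C0, hC0, hU⟩ := Un.bd1 N
  have hl0 : 0 < N.la j := N.lam0.trans_le (N.la1 j)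
  set a := 1 / N.la j
  have ha : 0 < a := by positivity
  set p := N.σ j 0 with hp
  set h : ℂ → ℂ := fun t => hh a (N.W j t) with hh'
  set δ := min (d1 / 2) d3
  have hδ : 0 < δ := by positivity
  have hδ1 : δ ≤ d1 / 2 := min_le_left _ _
  have hGc : ∀ t ∉ closure G, t ∉ G := fun t ht h => ht (subset_closure h)
  have hcont : ∀ t ∉ G, t ≠ p → ‖t - p‖ ≤ δ → DifferentiableAt ℂ h t ∧ N.W j t ∈ slitPlane := fun t ht htp hts => by
    have q := (hB t ht htp (hts.trans ℓ)).1
    refine ⟨(hh_deriv q).differentiableAt.comp t ?_, q⟩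
    unfold Net.W; fun_prop
  have hle : ∀ t, t ≠ p → ‖t - p‖ ≤ δ → (h t).re ≤ 2 * ‖t - p‖ ^ a := fun t htp hts => by
    have := (re_le_norm _).trans (hh_le ha (w := N.W j t) (by rw [N.nW]; change ‖t - p‖ ≤ 1; linarith)
      (norm_pos_iff.1 (by rw [N.nW]; exact norm_pos_iff.2 (sub_ne_zero.2 htp))))
    rwa [N.nW] at this
  -- the compact part of the circle
  set S : Set ℂ := {t | t ∈ sphere p δ ∩ Gᶜ ∧ 0 ≤ (h t).re}
  have hpS : ∀ t ∈ sphere p δ ∩ Gᶜ, t ≠ p ∧ ‖t - p‖ = δ := fun t ht => by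
    have h1 : ‖t - p‖ = δ := by simpa [dist_eq_norm] using ht.1
    exact ⟨fun h => by rw [h] at h1; simp at h1; linarith, h1⟩
  have hSc : IsCompact S := by
    have hc : IsCompact (sphere p δ ∩ Gᶜ) := (isCompact_sphere p δ).inter_right N.Go.isClosed_compl
    have hco : ContinuousOn (fun t => (h t).re) (sphere p δ ∩ Gᶜ) := fun t ht =>
      (continuous_re.continuousAt.comp (hcont t ht.2 (hpS t ht).1 (hpS t ht).2.le).1.continuousAt).continuousWithinAt
    exact hc.of_isClosed_subset (hco.preimage_isClosed_of_isClosed hc.isClosed isClosed_Ici) fun t ht => ht.1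
  have hSG : S ⊆ (closure G)ᶜ := fun t ht htc => by
    have q := hpS t ht.1
    exact absurd ((hB t ht.1.2 q.1 (q.2.le.trans ℓ)).2 htc) (not_lt.2 ht.2)
  obtain ⟨C2, hC2, c2, hc2, hU2⟩ := Un.cpt N hSc hSG
  set c := c2 / 2
  have hc : 0 < c := by positivity
  set b := (1 - a) / 2 with hb
  set A := C0 * k2 ^ ħ * Real.exp c + C2 * δ ^ b
  have hA : 0 < A := by positivity
  have key : ∀ n u, Un N n u → 0 < n → ∀ t ∉ closure G, ‖t - p‖ < δ → 1 / (n:ℝ) < (h t).re →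
      ‖N.gh u t‖ * ‖t - p‖ ^ b * Real.exp (n * c * (h t).re) ≤ A * (n:ℝ) ^ ½ := by
    intro n u U hn t ht hts htr
    have hn' : (1:ℝ) ≤ n := by exact_mod_cast hn
    have hn0 : 𝟘 < n := by linarith
    have hdif := U.diff
    set V : Set ℂ := {t | (t ∉ closure G ∧ ‖t - p‖ < δ) ∧ 1 / (n:ℝ) < (h t).re} with hV
    have pne : ∀ t ∉ closure G, t ≠ p := fun t ht h => ht (h ▸ N.pcl j)
    have hO : IsOpen ((closure G)ᶜ ∩ ball p δ) := isClosed_closure.isOpen_compl.inter isOpen_ball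
    have hOm : ∀ t, t ∈ (closure G)ᶜ ∩ ball p δ ↔ (t ∉ closure G ∧ ‖t - p‖ < δ) := fun t => by
      rw [mem_inter_iff, mem_ball, dist_eq_norm]; rfl
    have hVo : IsOpen V := by
      have hco : ContinuousOn (fun t => (h t).re) ((closure G)ᶜ ∩ ball p δ) := fun t ht => by
        rw [hOm] at ht
        exact (continuous_re.continuousAt.comp (hcont t (hGc t ht.1) (pne t ht.1) ht.2.le).1.continuousAt).continuousWithinAt
      have := hco.isOpen_inter_preimage hO (isOpen_Ioi (a := 1 / (n:ℝ)))
      convert this using 1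
      ext t; rw [mem_inter_iff, hOm]; rfl
    set Φ : ℂ → ℂ := fun t => N.gh u t * N.W j t ^ (b:ℂ) * exp ((n * c : ℝ) * h t) with hΦ
    have hΦn : ∀ t, ‖Φ t‖ = ‖N.gh u t‖ * ‖t - p‖ ^ b * Real.exp (n * c * (h t).re) := fun t => by
      rw [hΦ, norm_mul, norm_mul, norm_cpow_real, N.nW, norm_exp, re_ofReal_mul]
    have hΦd : ∀ t ∉ closure G, ‖t - p‖ ≤ δ → DifferentiableAt ℂ Φ t := fun t ht hts => by
      obtain ⟨q1, q2⟩ := hcont t (hGc t ht) (pne t ht) hts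
      have q3 := hdif.differentiableAt (isClosed_closure.isOpen_compl.mem_nhds ht)
      have q4 : DifferentiableAt ℂ (N.W j) t := by unfold Net.W; fun_prop
      exact (q3.mul (q4.cpow_const q2)).mul (q1.const_mul _).cexp
    rw [← hΦn]
    refine maxp hVo (isBounded_ball.subset (fun t ht => (((hOm t).2 ht.1).2))) (fun t ht => (hΦd t ht.1.1 ht.1.2.le).differentiableWithinAt)
      ?_ t ⟨⟨ht, hts⟩, htr⟩
    intro z hz A' hA'
    have hzc : z ∈ closure V := frontier_subset_closure hz
    have hzV : z ∉ V := fun h => by rw [hVo.frontier_eq] at hz; exact hz.2 h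
    have z1 : z ∉ G := closure_minimal (fun t ht => hGc t ht.1.1) N.Go.isClosed_compl hzc
    have z2 : ‖z - p‖ ≤ δ := closure_minimal (s := V) (t := {t | ‖t - p‖ ≤ δ}) (fun t ht => ht.1.2.le)
      (isClosed_le (by fun_prop) continuous_const) hzc
    have z3 : 1 / (n:ℝ) ≤ 2 * ‖z - p‖ ^ a := closure_minimal (s := V) (t := {t | 1 / (n:ℝ) ≤ 2 * ‖t - p‖ ^ a})
      (fun t ht => ht.2.le.trans (hle t (pne t ht.1.1) ht.1.2.le)) (isClosed_le continuous_const
        (continuous_const.mul (Continuous.rpow_const (by fun_prop) fun _ => Or.inr ha.le))) hzc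
    have zp : z ≠ p := fun h => by
      rw [h, sub_self, norm_zero, Real.zero_rpow ha.ne', mul_zero] at z3
      exact absurd z3 (not_le.2 ℘)
    have z4 : 1 / (n:ℝ) ≤ (h z).re := by
      haveI := mem_closure_iff_nhdsWithin_neBot.1 hzc
      refine ge_of_tendsto ((continuous_re.continuousAt.comp (hcont z z1 zp z2).1.continuousAt).tendsto.mono_left
        (nhdsWithin_le_nhds (s := V))) ?_
      filter_upwards [self_mem_nhdsWithin] with t ht using ht.2.le
    have z0 : 0 < (h z).re := lt_of_lt_of_le ℘ z4
    have z5 : z ∉ closure G := fun hc => absurd ((hB z z1 zp (z2.trans ℓ)).2 hc) (not_lt.2 z0.le)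
    have hs0 : 0 < ‖z - p‖ := norm_pos_iff.2 (sub_ne_zero.2 zp)
    have zb : ‖Φ z‖ ≤ A * (n:ℝ) ^ ½ := by
      rw [hΦn]
      have hnp : 1 ≤ (n:ℝ) ^ ½ := Real.one_le_rpow hn' (by norm_num)
      rcases z2.lt_or_eq with hlt | heq
      · have hr : (h z).re = 1 / n := le_antisymm (not_lt.1 fun hh => hzV ⟨⟨z5, hlt⟩, hh⟩) z4
        have q1 := hB2 z z5 (z2.trans hδ1) z0
        change k2 * (h z).re ≤ ‖z - p‖ ^ (a - 1) * _ at q1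
        rw [hr] at q1 ⊢
        have q2 := hU n u U z z5
        have hd := N.dG z5
        set d := infDist z (closure G)
        set s := ‖z - p‖
        have q3 : k2 * (n:ℝ)⁻¹ * s ^ (1 - a) ≤ d := by
          have : s ^ (a - 1) * s ^ (1 - a) = 1 := by rw [← Real.rpow_add hs0]; norm_num
          calc k2 * (n:ℝ)⁻¹ * s ^ (1 - a) = k2 * (1 / n) * s ^ (1 - a) := by rw [one_div]
            _ ≤ s ^ (a - 1) * d * s ^ (1 - a) := by gcongr
            _ = d := by linear_combination d * this
        have q4 : d ^ ħ ≤ k2 ^ ħ * (n:ℝ) ^ ½ * s ^ (-b) := by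
          refine (Real.rpow_le_rpow_of_nonpos ℘ q3 (by norm_num)).trans (le_of_eq ?_)
          rw [Real.mul_rpow ℘ ℘, Real.mul_rpow ℘ ℘, Real.inv_rpow hn0.le,
            Real.rpow_neg hn0.le, inv_inv, ← Real.rpow_mul hs0.le]
          congr 2; rw [hb]; ring
        have q5 : s ^ (-b) * s ^ b = 1 := by rw [← Real.rpow_add hs0]; simp
        have e1 : (n:ℝ) * c * (1 / n) = c := by field_simp
        rw [e1]
        calc _ ≤ C0 * (k2 ^ ħ * (n:ℝ) ^ ½ * s ^ (-b)) * s ^ b * Real.exp c := by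
              gcongr; exact q2.trans (by gcongr)
          _ = C0 * k2 ^ ħ * Real.exp c * (n:ℝ) ^ ½ := by
              linear_combination (C0 * k2 ^ ħ * (n:ℝ) ^ ½ * Real.exp c) * q5
          _ ≤ _ := by gcongr; exact le_add_of_nonneg_right ℘
      · have zS : z ∈ S := ⟨⟨by simpa [dist_eq_norm] using heq, z1⟩, z0.le⟩
        have q1 := hU2 n u U z zS
        have q2 : (h z).re ≤ 2 := (hle z zp z2).trans (by
          have := Real.rpow_le_one hs0.le (z2.trans ℓ : ‖z - p‖ ≤ 1) ha.le
          linarith)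
        rw [heq]
        have e1 : Real.exp (-(c2 * n)) * Real.exp (n * c * 2) = 1 := by rw [← Real.exp_add]; simp only [c]; ring_nf; simp
        calc _ ≤ (C2 * Real.exp (-(c2 * n))) * δ ^ b * Real.exp (n * c * 2) := by gcongr
          _ = C2 * δ ^ b := by linear_combination (C2 * δ ^ b) * e1
          _ ≤ A := le_add_of_nonneg_left ℘
          _ ≤ _ := le_mul_of_one_le_right hA.le hnp
    exact ((hΦd z z5 z2).continuousAt.norm.eventually_lt continuousAt_const (zb.trans_lt hA')).filter_mono nhdsWithin_le_nhds
      |>.mono fun _ h => h.le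
  set k := c * k3
  have hk : 0 < k := by positivity
  refine ⟨δ, hδ, C0 * c0 ^ ħ * Real.exp 1 + A * (1 + 2 / k), ℘, min k3 (k / 2), ℘,
    fun n u U t ht hts htd => ?_⟩
  have htp : t ≠ p := fun h => ht (h ▸ N.pcl j)
  have hs0 : 0 < ‖t - p‖ := norm_pos_iff.2 (sub_ne_zero.2 htp)
  have q3 := hB3 t ht (hts.le.trans 𝔯) htd
  change k3 * ‖t - p‖ ^ a ≤ (h t).re at q3
  set s := ‖t - p‖
  set y := (n:ℝ) * s ^ a with hy
  have hy0 : 0 ≤ y := by positivity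
  have ey : ∀ c : ℝ, c * n * s ^ a = c * y := fun c => by rw [hy]; ring
  rw [ey]
  rcases le_or_gt (n * (h t).re) 1 with hr | hr
  · have q1 : k3 * y ≤ 1 := by
      calc k3 * y = n * (k3 * s ^ a) := by rw [hy]; ring
        _ ≤ n * (h t).re := by gcongr
        _ ≤ 1 := hr
    have q2 := hU n u U t ht
    have q4 : infDist t (closure G) ^ ħ ≤ c0 ^ ħ * s ^ ħ := by
      rw [← Real.mul_rpow hc0.le hs0.le]
      exact Real.rpow_le_rpow_of_nonpos ℘ htd (by norm_num)
    have q5 : 1 ≤ Real.exp 1 * Real.exp (-(min k3 (k / 2) * y)) := by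
      rw [← Real.exp_add]; refine Real.one_le_exp ?_
      have := mul_le_mul_of_nonneg_right (min_le_left k3 (k / 2)) hy0
      linarith
    calc _ ≤ C0 * (c0 ^ ħ * s ^ ħ) * 1 := by rw [mul_one]; exact q2.trans (by gcongr)
      _ ≤ C0 * (c0 ^ ħ * s ^ ħ) * (Real.exp 1 * Real.exp (-(min k3 (k / 2) * y))) := by gcongr
      _ = (C0 * c0 ^ ħ * Real.exp 1) * s ^ ħ * Real.exp (-(min k3 (k / 2) * y)) := by ring
      _ ≤ _ := by gcongr; exact le_add_of_nonneg_right ℘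
  · have hn : 0 < n := Nat.pos_of_ne_zero fun h => by rw [h] at hr; simp at hr; linarith
    have hn0 : 𝟘 < n := by exact_mod_cast hn
    have q1 := key n u U hn t ht hts (by rw [div_lt_iff₀ hn0]; linarith)
    have q2 : Real.exp (k * y) ≤ Real.exp (n * c * (h t).re) := by
      refine Real.exp_le_exp.2 ?_
      calc k * y = n * c * (k3 * s ^ a) := by simp only [k, hy]; ring
        _ ≤ _ := by gcongr
    have q4 : ‖N.gh u t‖ * (s ^ b * Real.exp (k * y)) ≤ A * (n:ℝ) ^ ½ := by
      rw [← mul_assoc]; exact le_trans (by gcongr) q1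
    have e1 : (n:ℝ) ^ ½ / (s ^ b * Real.exp (k * y)) = s ^ ħ * (y ^ ½ * Real.exp (-(k * y))) := by
      rw [div_eq_mul_inv, mul_inv, ← Real.exp_neg, hy, Real.mul_rpow hn0.le ℘, ← Real.rpow_mul hs0.le, ← Real.rpow_neg hs0.le]
      have : s ^ (-b) = s ^ ħ * s ^ (a * (1 / 2)) := by rw [← Real.rpow_add hs0]; congr 1; rw [hb]; ring
      rw [this]; ring
    rw [← le_div_iff₀ ℘, mul_div_assoc, e1] at q4
    calc _ ≤ _ := q4
      _ ≤ A * (s ^ ħ * ((1 + 2 / k) * Real.exp (-(k / 2 * y)))) := mul_le_mul_of_nonneg_left (mul_le_mul_of_nonneg_left (sqrt_exp hk hy0) ℘) hA.le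
      _ ≤ A * (s ^ ħ * ((1 + 2 / k) * Real.exp (-(min k3 (k / 2) * y)))) := by gcongr; exact min_le_right _ _
      _ = (A * (1 + 2 / k)) * s ^ ħ * Real.exp (-(min k3 (k / 2) * y)) := by ring
      _ ≤ _ := by gcongr; exact le_add_of_nonneg_left ℘


lemma Net.lowd (N : Net G lam) (j) {x : ℝ} (hx : x ∈ 𝕀o) :
    N.m * N.κ / 16 * ϖ x ≤ infDist (N.σ j (cp (N.κ / 2) x)) (closure G) := by
  obtain ⟨x0, x1⟩ := hx
  have hκ := N.κ0
  have hκ1 := N.κ1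
  have hm := N.m0
  have hq : 0 < x * (1 - x) := mul_pos x0 ℓ
  set r := N.κ / 8 * ϖ x with hr
  have hr0 : 0 < r := by positivity
  have hrq : r ≤ 1 / 8 * ϖ x := by rw [hr]; gcongr
  have hT : ∀ z ∈ closedBall (cp (N.κ / 2) x) r, z ∈ Tent N.κ N.κ ∧ z.im < 0 := fun z hz => by
    rw [mem_closedBall, dist_eq_norm] at hz
    have a := (abs_re_le_norm _).trans hz
    have b := (abs_im_le_norm _).trans hz
    simp only [cp, sub_re, sub_im, abs_le] at a b
    obtain ⟨a1, a2⟩ := a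
    obtain ⟨b1, b2⟩ := b
    set y := z.re
    have y0 : 0 < y := by nlinarith
    have y1 : y < 1 := by nlinarith
    have hy : x * (1 - x) - r ≤ y * (1 - y) := by
      have : y * (1 - y) - x * (1 - x) = (y - x) * (1 - y - x) := by ring
      have h3 : |(y - x) * (1 - y - x)| ≤ r * 1 := by
        rw [abs_mul]; gcongr <;> rw [abs_le] <;> constructor <;> linarith
      linarith [neg_le_of_abs_le h3]
    have hy2 : 7 / 8 * (N.κ * ϖ x) ≤ N.κ * ϖ y := by nlinarith
    have e : r = 1 / 8 * (N.κ * ϖ x) := by rw [hr]; ring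
    have p : 0 < N.κ * ϖ x := by positivity
    have i0 : z.im < 0 := by linarith
    exact ⟨⟨y0, y1, ℓ, ℓ⟩, i0⟩
  have hV := fun z hz => N.tV j (hT z hz).1
  have h0 := mem_closedBall_self (x := cp (N.κ / 2) x) hr0.le
  have := DiffContOnCl.ball_subset_image_closedBall (f := N.σ j) (ε := N.m * r)
    ((N.diff j).mono (s := closure (ball _ r)) (by rw [closure_ball _ hr0.ne']; exact hV)).diffContOnCl hr0
    (fun z hz => by simpa [mem_sphere_iff_norm.1 hz] using N.lipl j z (hV z (sphere_subset_closedBall hz)) _ (hV _ h0))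
    (Frequently.filter_mono (Eventually.frequently (f := 𝓝[≠] (cp (N.κ / 2) x)) (by
      filter_upwards [self_mem_nhdsWithin, nhdsWithin_le_nhds (closedBall_mem_nhds _ hr0)] with z hz hz' h
      have := N.lipl j z (hV z hz') _ (hV _ h0)
      rw [h, sub_self, norm_zero] at this
      exact hz (sub_eq_zero.1 (norm_le_zero_iff.1 (by nlinarith [norm_nonneg (z - cp (N.κ / 2) x)]))))) nhdsWithin_le_nhds)
  rw [le_infDist N.Gc.nonempty.closure]
  intro y hy
  by_contra! h
  obtain ⟨z, hz, rfl⟩ := this (show y ∈ _ by rw [mem_ball, dist_comm]; refine h.trans_eq ?_; rw [hr]; ring)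
  exact N.low j z (hT z hz).1 (hT z hz).2 hy

lemma Net.gfin (N : Net G lam) : ∃ C > 0, ∃ c > 0, ∀ n u, Un N n u → ∀ j, ∀ x ∈ 𝕀o,
    ‖N.gh u (N.σ j (cp (N.κ / 2) x))‖ ≤ C * ϖ x ^ ħ * Real.exp (-(c * n * ϖ x ^ (1 / lam))) := by
  have hκ := N.κ0
  have hm := N.m0
  have hM := N.M0
  have hl := N.lam0
  have hG : ∀ j, ∀ x ∈ 𝕀o, N.σ j (cp (N.κ / 2) x) ∉ closure G := fun j x hx =>
    N.low j _ (cp_mem ℓ ℓ hx) (by simp [cp]; nlinarith [mul_pos hx.1 (sub_pos.2 hx.2)])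
  suffices h : ∃ C > 0, ∃ c > 0, ∀ n u, Un N n u → ∀ v ∈ (univ : Set (Fin N.N)) ×ˢ 𝕀c, v.2 ∈ 𝕀o →
      ‖N.gh u (N.σ v.1 (cp (N.κ / 2) v.2))‖ ≤ C * (v.2 * (1 - v.2)) ^ ħ *
        Real.exp (-(c * n * (v.2 * (1 - v.2)) ^ (1 / lam))) by
    obtain ⟨C, hC, c, hc, h⟩ := h
    exact ⟨C, hC, c, hc, fun n u U j x hx => h n u U (j, x) ⟨trivial, hx.1.le, hx.2.le⟩ hx⟩
  -- endpoint estimate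
  have node : ∀ (j i : Fin N.N) (c0 : ℝ), 0 < c0 → ∃ δ > 0, ∃ C > 0, ∃ c > 0, ∀ n u, Un N n u → ∀ x ∈ 𝕀o,
      N.m * ϖ x ≤ ‖N.σ j (cp (N.κ / 2) x) - N.σ i 0‖ →
      c0 * ‖N.σ j (cp (N.κ / 2) x) - N.σ i 0‖ ≤ x * (1 - x) → ‖N.σ j (cp (N.κ / 2) x) - N.σ i 0‖ < δ →
      ‖N.gh u (N.σ j (cp (N.κ / 2) x))‖ ≤ C * ϖ x ^ ħ *
        Real.exp (-(c * n * ϖ x ^ (1 / lam))) := by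
    intro j i c0 hc0
    obtain ⟨δ, hδ, C, hC, c, hc, h⟩ := Un.node N i (c0 := N.m * N.κ / 16 * c0) ℘
    refine ⟨δ, hδ, C * N.m ^ ħ, ℘, c * N.m ^ (1 / N.la i), ℘, fun n u U x hx h1 h2 h3 => ?_⟩
    have hq : 0 < x * (1 - x) := mul_pos hx.1 (by linarith [hx.2])
    have hq1 : x * (1 - x) ≤ 1 := by nlinarith [hx.1, hx.2]
    have h4 := h n u U _ (hG j x hx) h3 (by
      rw [mul_assoc]; exact (mul_le_mul_of_nonneg_left h2 ℘).trans (N.lowd j hx))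
    set s := ‖N.σ j (cp (N.κ / 2) x) - N.σ i 0‖
    have hla := N.la1 i
    have e1 : s ^ ħ ≤ N.m ^ ħ * ϖ x ^ ħ := by
      rw [← Real.mul_rpow hm.le hq.le]; exact Real.rpow_le_rpow_of_nonpos ℘ h1 (by norm_num)
    have e2 : N.m ^ (1 / N.la i) * ϖ x ^ (1 / lam) ≤ s ^ (1 / N.la i) := by
      refine le_trans ?_ (Real.rpow_le_rpow ℘ h1 (by positivity [hl.trans_le hla]))
      rw [Real.mul_rpow hm.le hq.le]
      gcongr 1
      exact Real.rpow_le_rpow_of_exponent_ge hq hq1 (one_div_le_one_div_of_le hl hla)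
    refine h4.trans ?_
    rw [mul_assoc C (N.m ^ _)]
    gcongr ?_ * ?_ * Real.exp (-?_)
    calc _ = c * n * (N.m ^ (1 / N.la i) * ϖ x ^ (1 / lam)) := by ring
      _ ≤ _ := by gcongr
  have lu : ∀ j, ∀ x ∈ 𝕀o, ∀ y ∈ N.V j, N.m * |x - y.re| ≤ ‖N.σ j (cp (N.κ / 2) x) - N.σ j y‖ ∧
      ‖N.σ j (cp (N.κ / 2) x) - N.σ j y‖ ≤ N.M * (|x - y.re| + |-(N.κ / 2 * ϖ x) - y.im|) := fun j x hx y hy => by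
    have hv := N.cpV j (η := N.κ / 2) ℓ ℓ ⟨hx.1.le, hx.2.le⟩
    have a := abs_re_le_norm (cp (N.κ / 2) x - y)
    have b := norm_le_abs_re_add_abs_im (cp (N.κ / 2) x - y)
    exact ⟨le_trans (by gcongr; exact a) (N.lipl j _ hv _ hy), (N.lipu j _ hv _ hy).trans (by gcongr; exact b)⟩
  refine (isCompact_univ.prod isCompact_Icc).induction_on (p := fun S => ∃ C > 0, ∃ c > 0, ∀ n u, Un N n u → ∀ v ∈ S, v.2 ∈ 𝕀o →
      ‖N.gh u (N.σ v.1 (cp (N.κ / 2) v.2))‖ ≤ C * (v.2 * (1 - v.2)) ^ ħ *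
        Real.exp (-(c * n * (v.2 * (1 - v.2)) ^ (1 / lam)))) ⟨1, one_pos, 1, one_pos, by simp⟩ ?_ ?_ ?_
  · rintro s t hst ⟨C, hC, c, hc, h⟩
    exact ⟨C, hC, c, hc, fun n u U x hx => h n u U x (hst hx)⟩
  · rintro s t ⟨C, hC, c, hc, h⟩ ⟨C', hC', c', hc', h'⟩
    refine ⟨C + C', ℘, min c c', ℘, fun n u U v hv hx => ?_⟩
    have hq : 0 < v.2 * (1 - v.2) := mul_pos hx.1 (by linarith [hx.2])
    rcases hv with hv | hv
    · refine (h n u U v hv hx).trans ?_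
      gcongr
      · linarith
      · exact min_le_left _ _
    · refine (h' n u U v hv hx).trans ?_
      gcongr
      · linarith
      · exact min_le_right _ _
  rintro ⟨j, x⟩ ⟨-, hx⟩
  suffices h : ∃ U ∈ 𝓝 x, ∃ C > 0, ∃ c > 0, ∀ n u, Un N n u → ∀ y ∈ U, y ∈ 𝕀o →
      ‖N.gh u (N.σ j (cp (N.κ / 2) y))‖ ≤ C * ϖ y ^ ħ * Real.exp (-(c * n * ϖ y ^ (1 / lam))) by
    obtain ⟨U, hU, C, hC, c, hc, h⟩ := h
    refine ⟨{j} ×ˢ U, nhdsWithin_le_nhds (prod_mem_nhds ((isOpen_discrete {j}).mem_nhds rfl) hU), C, hC, c, hc, ?_⟩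
    rintro n u Uu ⟨i, y⟩ ⟨rfl, hy⟩ hy'
    exact h n u Uu y hy hy'
  have hκ1 := N.κ1
  by_cases x0 : x = 0
  · subst x0
    obtain ⟨δ, hδ, C, hC, c, hc, h⟩ := node j j (1 / (4 * N.M)) ℘
    refine ⟨Iio (min (1 / 2) (δ / (2 * N.M))), Iio_mem_nhds ℘, C, hC, c, hc, fun n u U y hy hy' => ?_⟩
    obtain ⟨y1, y2⟩ := lt_min_iff.1 (mem_Iio.1 hy)
    have hy0 := hy'.1
    have hq : 0 < y * (1 - y) := mul_pos hy0 ℓ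
    obtain ⟨a, b⟩ := lu j y hy' 0 (N.V0 j)
    rw [zero_re, sub_zero, abs_of_pos hy0] at a b
    rw [zero_im, sub_zero, abs_neg, abs_of_pos ℘] at b
    have b' : ‖N.σ j (cp (N.κ / 2) y) - N.σ j 0‖ ≤ N.M * (2 * y) := b.trans (by gcongr; nlinarith)
    rw [lt_div_iff₀ ℘] at y2
    refine h n u U y hy' (le_trans (by gcongr; nlinarith) a) ?_ (b'.trans_lt ℓ)
    rw [div_mul_eq_mul_div, one_mul, div_le_iff₀ ℘]
    nlinarith [mul_nonneg (mul_nonneg hM.le hy0.le) (show 0 ≤ 2 - 4 * y by linarith)]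
  by_cases x1 : x = 1
  · subst x1
    obtain ⟨δ, hδ, C, hC, c, hc, h⟩ := node j (N.nxt j) (1 / (4 * N.M)) ℘
    rw [← N.joint] at h
    refine ⟨Ioi (1 - min (1 / 2) (δ / (2 * N.M))), Ioi_mem_nhds (sub_lt_self _ ℘), C, hC, c, hc, fun n u U y hy hy' => ?_⟩
    have hy : 1 - y < min (1 / 2) (δ / (2 * N.M)) := by have : 1 - min (1 / 2) (δ / (2 * N.M)) < y := hy; linarith
    obtain ⟨y1, y2⟩ := lt_min_iff.1 hy
    have hy0 : 0 < 1 - y := by linarith [hy'.2]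
    have hq : 0 < y * (1 - y) := mul_pos hy'.1 hy0
    obtain ⟨a, b⟩ := lu j y hy' 1 (N.V1 j)
    rw [one_re, abs_sub_comm, abs_of_pos hy0] at a b
    rw [one_im, sub_zero, abs_neg, abs_of_pos ℘] at b
    have b' : ‖N.σ j (cp (N.κ / 2) y) - N.σ j 1‖ ≤ N.M * (2 * (1 - y)) := b.trans (by gcongr; nlinarith [hy'.2])
    rw [lt_div_iff₀ ℘] at y2
    refine h n u U y hy' (le_trans (by gcongr; nlinarith [hy'.2]) a) ?_ (b'.trans_lt ℓ)
    rw [div_mul_eq_mul_div, one_mul, div_le_iff₀ ℘]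
    nlinarith [mul_nonneg (mul_nonneg hM.le hy0.le) (show 0 ≤ 4 * y - 2 by linarith)]
  have hx' : x ∈ 𝕀o := ⟨lt_of_le_of_ne hx.1 (Ne.symm x0), lt_of_le_of_ne hx.2 x1⟩
  have hsub : Icc (x / 2) ((x + 1) / 2) ⊆ Ioo 0 1 := fun y hy => ⟨by linarith [hy.1, hx'.1], by linarith [hy.2, hx'.2]⟩
  obtain ⟨C, hC, c, hc, h⟩ := Un.cpt N (S := (fun y => N.σ j (cp (N.κ / 2) y)) '' Icc (x / 2) ((x + 1) / 2))
    (isCompact_Icc.image_of_continuousOn ((N.cpC j ℓ ℓ).1.mono (hsub.trans Ioo_subset_Icc_self)))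
    (by rintro _ ⟨y, hy, rfl⟩; exact hG j y (hsub hy))
  refine ⟨_, Icc_mem_nhds (by linarith [hx'.1]) (by linarith [hx'.2]), C, hC, c, hc, fun n u U y hy hy' => (h n u U _ ⟨y, hy, rfl⟩).trans ?_⟩
  have hq : 0 < y * (1 - y) := mul_pos hy'.1 (by linarith [hy'.2])
  have hq1 : y * (1 - y) ≤ 1 := by nlinarith [hy'.1, hy'.2]
  have e1 := Real.one_le_rpow_of_pos_of_le_one_of_nonpos hq hq1 (show -½ ≤ 0 by norm_num)
  have e2 := Real.rpow_le_one hq.le hq1 (show 0 ≤ 1 / lam by positivity)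
  gcongr ?_ * Real.exp (-?_)
  · exact le_mul_of_one_le_right hC.le e1
  · exact mul_le_of_le_one_right ℘ e2
end

lemma exp_int {s lam c : ℝ} (hs : 0 < s) (hl : 0 < lam) (hc : 0 < c) : ∃ D > 0, ∀ n : ℕ, 1 ≤ n →
    IntervalIntegrable (fun x : ℝ => ϖ x ^ (s - 1) * Real.exp (-(c * n * ϖ x ^ (1 / lam)))) volume 0 1 ∧
    ∫ x in 𝟘..1, ϖ x ^ (s - 1) * Real.exp (-(c * n * ϖ x ^ (1 / lam))) ≤ D * (n:ℝ) ^ (-(s * lam)) := by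
  have hp : 0 < 1 / lam := by positivity
  set c' := c * (1 / 2) ^ (1 / lam) with hc'
  have hc0 : 0 < c' := by positivity
  set D0 := 1 + ½ ^ (s - 1)
  have hD0 : 0 < D0 := by positivity
  set J := c' ^ (-(s * lam)) * (lam * Real.Gamma (s * lam))
  have hJ : 0 < J := by have := Real.Gamma_pos_of_pos (mul_pos hs hl); positivity
  refine ⟨2 * D0 * J, ℘, fun n hn => ?_⟩
  have hn0 : 𝟘 < n := by exact_mod_cast hn
  set h : ℝ → ℝ := fun x => x ^ (s - 1) * Real.exp (-(c' * n) * x ^ (1 / lam)) with hh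
  have hint : IntegrableOn h (Ioi 0) := integrableOn_rpow_mul_exp_neg_mul_rpow ℓ hp ℘
  have hval : ∫ x in Ioi 0, h x = J * (n:ℝ) ^ (-(s * lam)) := by
    rw [hh, _root_.integral_rpow_mul_exp_neg_mul_rpow hp ℓ ℘,
      Real.mul_rpow hc0.le hn0.le]
    have e1 : (s - 1 + 1) / (1 / lam) = s * lam := by field_simp; ring
    have e2 : -(s - 1 + 1) / (1 / lam) = -(s * lam) := by rw [neg_div, e1]
    rw [e1, e2, one_div_one_div]; ring
  have hh0 : ∀ x, 0 < x → 0 ≤ h x := fun x hx => by simp only [hh]; positivity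
  have hi1 : IntervalIntegrable h volume 0 1 := by
    rw [intervalIntegrable_iff_integrableOn_Ioo_of_le zero_le_one]; exact hint.mono_set Ioo_subset_Ioi_self
  have hv1 : ∫ x in 𝟘..1, h x ≤ J * (n:ℝ) ^ (-(s * lam)) := by
    rw [← hval, intervalIntegral.integral_of_le zero_le_one]
    exact setIntegral_mono_set hint ((ae_restrict_iff' measurableSet_Ioi).2 (Eventually.of_forall hh0))
      Ioc_subset_Ioi_self.eventuallyLE
  have hi2 : IntervalIntegrable (fun x => h (1 - x)) volume 0 1 := by
    simpa using! (hi1.comp_sub_left 1).symm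
  have hv2 : ∫ x in 𝟘..1, h (1 - x) = ∫ x in 𝟘..1, h x := by
    rw [intervalIntegral.integral_comp_sub_left]; simp
  have half : ∀ x q : ℝ, 0 < x → x / 2 ≤ q → q ≤ x → q ^ (s - 1) * Real.exp (-(c * n * q ^ (1 / lam))) ≤ D0 * h x := by
    intro x q hx h1 h2
    have hq : 0 < q := by linarith
    have e1 : q ^ (s - 1) ≤ D0 * x ^ (s - 1) := by
      have : D0 * x ^ (s - 1) = x ^ (s - 1) + (x / 2) ^ (s - 1) := by
        rw [div_eq_mul_inv, Real.mul_rpow hx.le (by norm_num), ← one_div]; ring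
      rw [this]
      rcases le_total 0 (s - 1) with h | h
      · exact (Real.rpow_le_rpow hq.le h2 h).trans (le_add_of_nonneg_right ℘)
      · exact (Real.rpow_le_rpow_of_nonpos ℘ h1 h).trans (le_add_of_nonneg_left ℘)
    simp only [hh]
    rw [← mul_assoc]
    refine mul_le_mul e1 (Real.exp_le_exp.2 ?_) ℘ ℘
    have : (1 / 2) ^ (1 / lam) * x ^ (1 / lam) ≤ q ^ (1 / lam) := by
      rw [← Real.mul_rpow (by norm_num) hx.le]
      exact Real.rpow_le_rpow ℘ ℓ hp.le
    have := mul_le_mul_of_nonneg_left this (show 0 ≤ c * n by positivity)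
    rw [hc']; linarith
  have hle : ∀ x ∈ 𝕀o, ϖ x ^ (s - 1) * Real.exp (-(c * n * ϖ x ^ (1 / lam))) ≤
      D0 * h x + D0 * h (1 - x) := fun x hx => by
    have p1 := mul_nonneg hD0.le (hh0 x hx.1)
    have p2 := mul_nonneg hD0.le (hh0 (1 - x) (by linarith [hx.2]))
    rcases le_total x (1 / 2) with h1 | h1
    · have := half x ϖ x hx.1 (by nlinarith [hx.1]) (by nlinarith [hx.1]); linarith
    · have := half (1 - x) ϖ x (by linarith [hx.2]) (by nlinarith [hx.2]) (by nlinarith [hx.2]); linarith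
  have hD := (hi1.const_mul D0).add (hi2.const_mul D0)
  have hI : IntervalIntegrable (fun x : ℝ => ϖ x ^ (s - 1) * Real.exp (-(c * n * ϖ x ^ (1 / lam)))) volume 0 1 := by
    rw [intervalIntegrable_iff_integrableOn_Ioo_of_le zero_le_one] at hD ⊢
    refine hD.mono' (by fun_prop) ((ae_restrict_iff' measurableSet_Ioo).2 (Eventually.of_forall fun x hx => ?_))
    have : 0 < x * (1 - x) := mul_pos hx.1 (by linarith [hx.2])
    rw [Real.norm_of_nonneg ℘]
    exact hle x hx
  refine ⟨hI, (intervalIntegral.integral_mono_on_of_le_Ioo zero_le_one hI hD hle).trans ?_⟩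
  rw [intervalIntegral.integral_add (hi1.const_mul _) (hi2.const_mul _), intervalIntegral.integral_const_mul,
    intervalIntegral.integral_const_mul, hv2]
  nlinarith [mul_le_mul_of_nonneg_left hv1 hD0.le]

section
variable {G : Set ℂ} {lam : ℝ} {N : Net G lam} {n : ℕ} {u : Fin N.N → ℝ → ℂ} {φ ψ : ℂ → ℂ}

lemma Adm.fub {X Xj} (U : Un N n u) (A : Adm N X Xj) (C : Cf G φ ψ) {B a : ℝ} (ha : -(1 / 2) < a)
    (hX : ∀ j, ∀ z ∈ Tent N.κ N.κ, ‖Xj j z‖ ≤ B * ϖ z.re ^ a) :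
    (∑ i, ∫ x in 𝟘..1, u i x * Xj i x) * (2 * Real.pi * I) =
      -∑ j, ∫ y in 𝟘..1, Xj j (cp (N.κ / 2) y) * deriv (N.σ j) (cp (N.κ / 2) y) * cd (N.κ / 2) y *
        N.gh u (N.σ j (cp (N.κ / 2) y)) := by
  have hκ := N.κ0
  have hm := N.m0
  have h2 : N.κ / 2 < N.κ := by linarith
  set η := N.κ / 2 with hη
  have hη0 : 0 < η := by positivity
  set w : Fin N.N → ℝ → ℂ := fun j y => Xj j (cp η y) * deriv (N.σ j) (cp η y) * cd η y with hw
  obtain ⟨Cb, hCb, hbd⟩ := Un.bdn N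
  have hlow := fun j x hx => N.lowd j (x := x) hx
  rw [← hη] at hlow
  have hT : ∀ k > 0, ∀ y ∈ 𝕀o, cp η y ∈ Tent N.κ k := fun k hk y hy => cp_mem h2 ℓ hy
  have hwle : ∀ j, ∀ y ∈ 𝕀o, ‖w j y‖ ≤ |B| * N.M * (1 + η) * ϖ y ^ a := fun j y hy => by
    have hq : 0 < y * (1 - y) := mul_pos hy.1 (by linarith [hy.2])
    have t := hT _ hκ y hy
    have h1 := hX j _ t
    have h3 := (N.dbd j (N.tV j t)).2
    have h4 := cd_le (η := η) (Ioo_subset_Icc_self hy)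
    rw [abs_of_pos hη0] at h4
    simp only [hw, norm_mul]
    calc _ ≤ (|B| * ϖ y ^ a) * N.M * (1 + η) := by
          have hM := N.M0
          gcongr
          exact h1.trans (mul_le_mul_of_nonneg_right (le_abs_self B) ℘)
      _ = _ := by ring
  have hwc : ∀ j, ContinuousOn (w j) (Ioo 0 1) := fun j => by
    obtain ⟨k, k0, -, _, h⟩ := A.t
    exact (((h j).1.continuousOn.comp (cp_cont η).continuousOn fun y hy => hT k k0 y hy).mul
      ((N.cpC j hη0.le h2).2.mono Ioo_subset_Icc_self)).mul (cd_cont η).continuousOn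
  have hden : ∀ i j, ∀ x ∈ 𝕀c, ∀ y ∈ 𝕀o, N.m * N.κ / 16 * ϖ y ≤ ‖N.σ i x - N.σ j (cp η y)‖ :=
    fun i j x hx y hy => (hlow j y hy).trans (N.dL _ i hx)
  have hqp : ∀ y ∈ 𝕀o, 0 < N.m * N.κ / 16 * ϖ y := fun y hy =>
    mul_pos ℘ (mul_pos hy.1 (by linarith [hy.2]))
  have hbd' := fun j y hy => hbd n u U (N.σ j (cp η y)) _ (hqp y hy) (fun i x hx => hden i j x hx y hy) (fun _ => 1) 1
    continuous_const 𝔰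
  simp only [mul_one] at hbd'
  set μ := (volume : Measure ℝ).restrict (Ioo 0 1)
  have cv : ∀ g : ℝ → ℂ, ∫ x in 𝟘..1, g x = ∫ x, g x ∂μ := fun g => by
    rw [intervalIntegral.integral_of_le zero_le_one, integral_Ioc_eq_integral_Ioo]
  have cvr : ∀ g : ℝ → ℝ, ∫ x in 𝟘..1, g x = ∫ x, g x ∂μ := fun g => by
    rw [intervalIntegral.integral_of_le zero_le_one, integral_Ioc_eq_integral_Ioo]
  have ii : ∀ {g : ℝ → ℂ}, IntervalIntegrable g volume 0 1 ↔ Integrable g μ :=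
    intervalIntegrable_iff_integrableOn_Ioo_of_le zero_le_one
  have aeμ : ∀ {P : ℝ → Prop}, (∀ y ∈ 𝕀o, P y) → ∀ᵐ y ∂μ, P y := fun h =>
    (ae_restrict_iff' measurableSet_Ioo).2 (Eventually.of_forall h)
  have hK : ∀ i j, Integrable (Function.uncurry fun x y => w j y * (u i x / (N.σ i x - N.σ j (cp η y)))) (μ.prod μ) := by
    intro i j
    have hme : AEStronglyMeasurable (Function.uncurry fun x y => w j y * (u i x / (N.σ i x - N.σ j (cp η y)))) (μ.prod μ) := by
      rw [Measure.prod_restrict]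
      refine ContinuousOn.aestronglyMeasurable ?_ (measurableSet_Ioo.prod measurableSet_Ioo)
      refine ((hwc j).comp continuousOn_snd fun v hv => hv.2).mul (((U.c i).comp continuousOn_fst fun v hv => hv.1).div
        (((N.σC i).comp continuousOn_fst fun v hv => Ioo_subset_Icc_self hv.1).sub
          ((N.cpC j hη0.le h2).1.comp continuousOn_snd fun v hv => Ioo_subset_Icc_self hv.2)) fun v hv => ?_)
      exact norm_pos_iff.1 ((hqp v.2 hv.2).trans_le (hden i j v.1 (Ioo_subset_Icc_self hv.1) v.2 hv.2))
    refine (integrable_prod_iff' hme).2 ⟨aeμ fun y hy => ?_, ?_⟩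
    · exact (ii.1 ((hbd' j y hy).1 i)).const_mul (w j y)
    have hd := (xx_int (a := a - 1 / 2) ℓ).const_mul (|B| * N.M * (1 + η) * (Cb * (N.m * N.κ / 16) ^ ħ))
    rw [intervalIntegrable_iff_integrableOn_Ioo_of_le zero_le_one] at hd
    refine hd.mono' hme.norm.prod_swap.integral_prod_right' (aeμ fun y hy => ?_)
    have hq : 0 < y * (1 - y) := mul_pos hy.1 (by linarith [hy.2])
    simp only [Function.uncurry_apply_pair, norm_mul, Prod.swap_prod_mk]
    rw [integral_const_mul, norm_mul, norm_norm, ← cvr, Real.norm_of_nonneg (intervalIntegral.integral_nonneg zero_le_one fun x _ => norm_nonneg _)]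
    have h5 := (Finset.single_le_sum (f := fun i => ∫ x in 𝟘..1, ‖u i x / (N.σ i x - N.σ j (cp η y))‖) (fun i _ =>
      intervalIntegral.integral_nonneg zero_le_one fun x _ => norm_nonneg _) (Finset.mem_univ i)).trans (hbd' j y hy).2
    rw [Real.mul_rpow ℘ hq.le] at h5
    refine (mul_le_mul (hwle j y hy) h5 (intervalIntegral.integral_nonneg zero_le_one fun x _ => norm_nonneg _) (by positivity [N.M0])).trans_eq ?_
    rw [sub_eq_add_neg a, Real.rpow_add hq]; ring
  have e1 : ∀ i, (∫ x in 𝟘..1, u i x * Xj i x) * (2 * Real.pi * I) =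
      -∑ j, ∫ x, ∫ y, w j y * (u i x / (N.σ i x - N.σ j (cp η y))) ∂μ ∂μ := fun i => by
    have q := integral_finsetSum Finset.univ fun j _ => (hK i j).integral_prod_left
    simp only [Function.uncurry_apply_pair] at q
    rw [cv, ← integral_mul_const, ← q, ← integral_neg]
    refine integral_congr_ae (aeμ fun x hx => ?_)
    simp only []
    obtain ⟨c1, c2⟩ := A.cauchyB C i hx hη0 h2
    rw [mul_assoc, ← c2, Net.Ig, Finset.mul_sum, ← Finset.sum_neg_distrib]
    refine Finset.sum_congr rfl fun j _ => ?_
    rw [cv, ← integral_const_mul, ← integral_neg]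
    refine integral_congr_ae (Eventually.of_forall fun y => ?_)
    simp only [hw]
    rw [← neg_sub (N.σ i x), div_neg]; ring
  rw [Finset.sum_mul, Finset.sum_congr rfl fun i _ => e1 i, Finset.sum_neg_distrib, Finset.sum_comm]
  congr 1
  refine Finset.sum_congr rfl fun j _ => ?_
  have q := integral_finsetSum Finset.univ fun i _ => (hK i j).integral_prod_right
  simp only [Function.uncurry_apply_pair] at q
  rw [Finset.sum_congr rfl fun i _ => integral_integral_swap (hK i j), ← q, cv]
  refine integral_congr_ae (Eventually.of_forall fun y => ?_)
  simp only [Net.gh, Finset.mul_sum, integral_const_mul, cv]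
  rfl
end

section
variable {G : Set ℂ} {lam : ℝ} {N : Net G lam}

noncomputable def Net.ip (N : Net G lam) (Y Z : Fin N.N → ℝ → ℂ) : ℂ :=
  ∑ i, ∫ x in 𝟘..1, Y i x * ℭ (Z i x) * ‖deriv (N.σ i) x‖

structure L2 (N : Net G lam) (Y : Fin N.N → ℝ → ℂ) : Prop where
  c : ∀ i, ContinuousOn (Y i) (Ioo 0 1)
  s : ∀ i, IntervalIntegrable (fun x => ‖Y i x‖ ^ 2) volume 0 1

lemma Net.sC (N : Net G lam) (i) : ContinuousOn (fun x : ℝ => ‖deriv (N.σ i) x‖) (Icc 0 1) := by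
  simpa only [cp0] using (N.cpC i le_rfl N.κ0).2.norm

lemma Net.sM (N : Net G lam) (i) {x : ℝ} (hx : x ∈ 𝕀o) : ‖deriv (N.σ i) x‖ ≤ N.M :=
  (N.dbd i (N.tV i (Tent.real N.κ0 N.κ0 hx))).2

lemma iiIoo {g : ℝ → ℂ} {h : ℝ → ℝ} (hg : ContinuousOn g (Ioo 0 1)) (hh : IntervalIntegrable h volume 0 1)
    (hl : ∀ x ∈ 𝕀o, ‖g x‖ ≤ h x) : IntervalIntegrable g volume 0 1 := by
  rw [intervalIntegrable_iff_integrableOn_Ioo_of_le zero_le_one] at hh ⊢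
  exact hh.mono' (hg.aestronglyMeasurable measurableSet_Ioo) ((ae_restrict_iff' measurableSet_Ioo).2 (Eventually.of_forall hl))

variable {Y Z W : Fin N.N → ℝ → ℂ}

lemma L2.int (hY : L2 N Y) (hZ : L2 N Z) (i) :
    IntervalIntegrable (fun x => Y i x * ℭ (Z i x) * ‖deriv (N.σ i) x‖) volume 0 1 := by
  refine iiIoo (((hY.c i).mul (continuous_conj.comp_continuousOn (hZ.c i))).mul
    (continuous_ofReal.comp_continuousOn ((N.sC i).mono Ioo_subset_Icc_self))) (((hY.s i).add (hZ.s i)).mul_const N.M) fun x hx => ?_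
  rw [norm_mul, norm_mul, norm_conj, norm_real, norm_norm]
  have := N.sM i hx
  gcongr
  nlinarith [sq_nonneg (‖Y i x‖ - ‖Z i x‖), sq_nonneg ‖Y i x‖, sq_nonneg ‖Z i x‖]

lemma L2.comb (hY : L2 N Y) (hZ : L2 N Z) (a : ℂ) : L2 N (fun i x => a * Y i x - Z i x) := by
  refine ⟨fun i => (continuousOn_const.mul (hY.c i)).sub (hZ.c i), fun i => ?_⟩
  have h := (((hY.s i).const_mul (‖a‖ ^ 2)).add (hZ.s i)).const_mul 2
  rw [intervalIntegrable_iff_integrableOn_Ioo_of_le zero_le_one] at h ⊢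
  refine h.mono' ((((continuousOn_const.mul (hY.c i)).sub (hZ.c i)).norm.pow 2).aestronglyMeasurable measurableSet_Ioo)
    ((ae_restrict_iff' measurableSet_Ioo).2 (Eventually.of_forall fun x _ => ?_))
  have := norm_sub_le (a * Y i x) (Z i x)
  rw [norm_mul] at this
  rw [Real.norm_of_nonneg ℘]
  refine (pow_le_pow_left₀ 𝔫 this 2).trans ?_
  change _ ≤ 2 * (‖a‖ ^ 2 * ‖Y i x‖ ^ 2 + ‖Z i x‖ ^ 2)
  nlinarith [sq_nonneg (‖a‖ * ‖Y i x‖ - ‖Z i x‖)]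

lemma L2.ip_l (hY : L2 N Y) (hZ : L2 N Z) (hW : L2 N W) (a : ℂ) :
    N.ip (fun i x => a * Y i x - Z i x) W = a * N.ip Y W - N.ip Z W := by
  simp only [Net.ip, Finset.mul_sum, ← Finset.sum_sub_distrib]
  refine Finset.sum_congr rfl fun i _ => ?_
  rw [← intervalIntegral.integral_const_mul, ← intervalIntegral.integral_sub ((hY.int hW i).const_mul a) (hZ.int hW i)]
  congr 1; ext x; ring

lemma Net.ip_conj (N : Net G lam) (Y Z) : ℭ (N.ip Y Z) = N.ip Z Y := by
  simp only [Net.ip, map_sum]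
  refine Finset.sum_congr rfl fun i _ => ?_
  rw [intervalIntegral.integral_of_le zero_le_one, intervalIntegral.integral_of_le zero_le_one, ← integral_conj]
  congr 1; ext x
  simp only [map_mul, conj_conj, conj_ofReal]; ring

lemma L2.ip_r (hY : L2 N Y) (hZ : L2 N Z) (hW : L2 N W) (a : ℂ) :
    N.ip W (fun i x => a * Y i x - Z i x) = ℭ a * N.ip W Y - N.ip W Z := by
  rw [← N.ip_conj, hY.ip_l hZ hW, map_sub, map_mul, N.ip_conj, N.ip_conj]

lemma Net.ip_self (N : Net G lam) (Y) : N.ip Y Y = ((∑ i, ∫ x in 𝟘..1, ‖Y i x‖ ^ 2 * ‖deriv (N.σ i) x‖ : ℝ) : ℂ) := by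
  simp only [Net.ip, ofReal_sum, ← intervalIntegral.integral_ofReal]
  congr 1; ext i; congr 1; ext x
  rw [mul_conj, normSq_eq_norm_sq]; push_cast; ring

lemma L2.sint (hY : L2 N Y) (i) : IntervalIntegrable (fun x => ‖Y i x‖ ^ 2 * ‖deriv (N.σ i) x‖) volume 0 1 := by
  have := (hY.int hY i).norm
  simpa only [norm_mul, norm_conj, norm_real, norm_norm, ← sq] using this

lemma L2.ip_le (hY : L2 N Y) (hZ : L2 N Z) : ‖N.ip Y Z‖ ≤ ((N.ip Y Y).re + (N.ip Z Z).re) / 2 := by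
  rw [N.ip_self, N.ip_self, ofReal_re, ofReal_re, ← Finset.sum_add_distrib, Finset.sum_div]
  refine norm_sum_le_of_le _ fun i _ => (intervalIntegral.norm_integral_le_integral_norm zero_le_one).trans ?_
  rw [← intervalIntegral.integral_add (hY.sint i) (hZ.sint i), ← intervalIntegral.integral_div]
  refine intervalIntegral.integral_mono_on_of_le_Ioo zero_le_one (hY.int hZ i).norm (((hY.sint i).add (hZ.sint i)).div_const 2) fun x _ => ?_
  rw [norm_mul, norm_mul, norm_conj, norm_real, norm_norm, ← add_mul, mul_div_right_comm]
  gcongr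
  nlinarith [sq_nonneg (‖Y i x‖ - ‖Z i x‖)]

lemma Net.polyL2 (N : Net G lam) (Q : Polynomial ℂ) : L2 N (fun i x => Q.eval (N.σ i x)) := by
  have h := fun i => Q.continuous.comp_continuousOn (N.σC i)
  refine ⟨fun i => (h i).mono Ioo_subset_Icc_self, fun i => ContinuousOn.intervalIntegrable ?_⟩
  rw [uIcc_of_le zero_le_one]
  exact (h i).norm.pow 2

/-- orthonormal polynomials with respect to the net -/
structure On (N : Net G lam) (l : ℝ) (p : ℕ → Polynomial ℂ) : Prop where
  l0 : 0 < l
  d : ∀ k, (p k).natDegree = k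
  z : ∀ k, p k ≠ 0
  o : ∀ j k, N.ip (fun i x => (p j).eval (N.σ i x)) (fun i x => (p k).eval (N.σ i x)) = if j = k then (l:ℂ) else 0

noncomputable def Ks (p : ℕ → Polynomial ℂ) (ζ : ℂ) (n : ℕ) : Polynomial ℂ :=
  ∑ k ∈ Finset.range (n + 1), Polynomial.C (ℭ ((p k).eval ζ)) * p k

variable {l : ℝ} {p : ℕ → Polynomial ℂ}

lemma Ks_eval (ζ z : ℂ) (n : ℕ) : (Ks p ζ n).eval z = partialSum p ζ n z := by
  simp [Ks, partialSum, Polynomial.eval_finsetSum]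

lemma Ks_symm (ζ z : ℂ) (n : ℕ) : ℭ (partialSum p ζ n z) = partialSum p z n ζ := by
  simp only [partialSum, map_sum, map_mul, conj_conj]
  exact Finset.sum_congr rfl fun k _ => mul_comm _ _

lemma On.Ks_deg (O : On N l p) (ζ : ℂ) (n : ℕ) : (Ks p ζ n).natDegree ≤ n :=
  Polynomial.natDegree_sum_le_of_forall_le _ _ fun k hk => (Polynomial.natDegree_C_mul_le _ _).trans
    (by rw [O.d]; exact Nat.lt_succ_iff.1 (Finset.mem_range.1 hk))

lemma On.rep (O : On N l p) (ζ : ℂ) (n : ℕ) : ∀ Q : Polynomial ℂ, Q.natDegree ≤ n →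
    N.ip (fun i x => Q.eval (N.σ i x)) (fun i x => (Ks p ζ n).eval (N.σ i x)) = l * Q.eval ζ := by
  have base : ∀ j ≤ n, N.ip (fun i x => (p j).eval (N.σ i x)) (fun i x => (Ks p ζ n).eval (N.σ i x)) = l * (p j).eval ζ := by
    intro j hj
    have e : ∀ i, (∫ x in 𝟘..1, (p j).eval (N.σ i x) * ℭ ((Ks p ζ n).eval (N.σ i x)) * ‖deriv (N.σ i) x‖) =
        ∑ k ∈ Finset.range (n + 1), (p k).eval ζ * ∫ x in 𝟘..1, (p j).eval (N.σ i x) * ℭ ((p k).eval (N.σ i x)) * ‖deriv (N.σ i) x‖ := by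
      intro i
      simp only [← intervalIntegral.integral_const_mul]
      rw [← intervalIntegral.integral_finsetSum fun k _ => (((N.polyL2 (p j)).int (N.polyL2 (p k)) i).const_mul _)]
      congr 1; ext x
      simp only [Ks_eval, partialSum, map_sum, map_mul, conj_conj, Finset.mul_sum, Finset.sum_mul]
      exact Finset.sum_congr rfl fun k _ => by ring
    rw [Net.ip, Finset.sum_congr rfl fun i _ => e i, Finset.sum_comm]
    have e2 := fun k => O.o j k
    simp only [Net.ip] at e2
    simp only [← Finset.mul_sum, e2, mul_ite, mul_zero]
    rw [Finset.sum_ite_eq, if_pos (Finset.mem_range.2 (by omega)), mul_comm]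
  suffices h : ∀ m ≤ n + 1, ∀ Q : Polynomial ℂ, Q.degree < m →
      N.ip (fun i x => Q.eval (N.σ i x)) (fun i x => (Ks p ζ n).eval (N.σ i x)) = l * Q.eval ζ from fun Q hQ =>
    h (n + 1) le_rfl Q (Polynomial.degree_le_natDegree.trans_lt (by exact_mod_cast Nat.lt_succ_iff.2 hQ))
  intro m
  induction m with
  | zero =>
    intro _ Q hQ
    obtain rfl : Q = 0 := by
      rw [Polynomial.degree_lt_iff_coeff_zero] at hQ
      ext k; simpa using hQ k (Nat.zero_le k)
    simp [Net.ip]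
  | succ m ih =>
    intro hm Q hQ
    have lc : (p m).coeff m ≠ 0 := by
      have := Polynomial.leadingCoeff_ne_zero.2 (O.z m); rwa [Polynomial.leadingCoeff, O.d] at this
    set a := Q.coeff m / (p m).coeff m with ha
    have h := ih (by omega) (Polynomial.C a * p m - Q) (by
      rw [Polynomial.degree_lt_iff_coeff_zero] at hQ ⊢
      intro k hk
      rw [Polynomial.coeff_sub, Polynomial.coeff_C_mul]
      rcases hk.eq_or_lt with rfl | hk
      · rw [ha]; field_simp; ring
      · rw [hQ k hk, Polynomial.coeff_eq_zero_of_natDegree_lt (by rwa [O.d])]; simp)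
    simp only [Polynomial.eval_sub, Polynomial.eval_mul, Polynomial.eval_C] at h
    rw [(N.polyL2 (p m)).ip_l (N.polyL2 Q) (N.polyL2 _), base m (by omega)] at h
    linear_combination -h
end

section
variable {G : Set ℂ} {lam : ℝ} {N : Net G lam} {φ ψ f : ℂ → ℂ} {ρ B B' r l : ℝ} {H F : Fin N.N → ℂ → ℂ}
  {p : ℕ → Polynomial ℂ}

lemma Sq.kkb (S : Sq N φ H f F B') (R : Rf N φ ρ B H) (C : Cf G φ ψ) (hρ : 0 < ρ) (hρ1 : ρ < 1) (hr : r < ρ) {ζ : ℂ}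
    (hz : ‖φ ζ‖ ≤ r) (j) {w : ℂ} (hw : w ∈ Tent N.κ N.κ) :
    ‖kk N H F (φ ζ) j w‖ ≤ |B'| * (1 / (1 - r / ρ)) * ϖ w.re ^ ((1 / (2 - lam) - 1) / 2) := by
  have hq : 0 < w.re * (1 - w.re) := mul_pos hw.1 (by linarith [hw.2.1])
  have h1 := (R.bd2 C hρ (hz.trans_lt hr) ℓ).2 j w hw
  have h3 : 0 < 1 - r / ρ := by rw [sub_pos, div_lt_one hρ]; exact hr
  rw [kk, norm_mul, mul_right_comm]
  gcongr
  · refine (S.b j w hw).trans ?_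
    gcongr; exact le_abs_self _
  · refine h1.trans ?_
    gcongr

lemma Sq.kkL (S : Sq N φ H f F B') (R : Rf N φ ρ B H) (C : Cf G φ ψ) (hρ : 0 < ρ) (hρ1 : ρ < 1) (hr : r < ρ) {ζ : ℂ}
    (hz : ‖φ ζ‖ ≤ r) : L2 N (fun i x => kk N H F (φ ζ) i x) := by
  have hl := N.lam2
  have hl0 := N.lam0
  obtain ⟨k, k0, k1, c, h⟩ := ((S.adm R C).mul (R.bd2 C hρ (hz.trans_lt hr) ℓ).1).t
  have hc : ∀ i, ContinuousOn (fun x : ℝ => kk N H F (φ ζ) i x) (Ioo 0 1) := fun i =>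
    (h i).1.continuousOn.comp continuous_ofReal.continuousOn fun x hx => Tent.real N.κ0 k0 hx
  refine ⟨hc, fun i => ?_⟩
  have ha : (-1:ℝ) < 1 / (2 - lam) - 1 := by linarith [one_div_pos.2 (sub_pos.2 hl)]
  have hi := (xx_int ha).const_mul ((|B'| * (1 / (1 - r / ρ))) ^ 2)
  rw [intervalIntegrable_iff_integrableOn_Ioo_of_le zero_le_one] at hi ⊢
  refine hi.mono' (((hc i).norm.pow 2).aestronglyMeasurable measurableSet_Ioo)
    ((ae_restrict_iff' measurableSet_Ioo).2 (Eventually.of_forall fun x hx => ?_))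
  have hq : 0 < x * (1 - x) := mul_pos hx.1 (by linarith [hx.2])
  have := S.kkb R C hρ hρ1 hr hz i (Tent.real N.κ0 N.κ0 hx)
  rw [ofReal_re] at this
  rw [Real.norm_of_nonneg ℘]
  refine (pow_le_pow_left₀ 𝔫 this 2).trans_eq ?_
  rw [mul_pow, ← Real.rpow_natCast (_ ^ _), ← Real.rpow_mul hq.le]
  congr 2; push_cast; ring

lemma Sq.est (S : Sq N φ H f F B') (R : Rf N φ ρ B H) (C : Cf G φ ψ) (hρ : 0 < ρ) (hρ1 : ρ < 1) (hr : r < ρ) :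
    ∃ D > 0, ∀ n : ℕ, 1 ≤ n → ∀ u, Un N n u → ∀ ζ : ℂ, ‖φ ζ‖ ≤ r →
      ‖∑ i, ∫ x in 𝟘..1, u i x * kk N H F (φ ζ) i x‖ ≤ D * (n:ℝ) ^ (-(lam / (2 - lam) / 2)) := by
  have hl := N.lam2
  have hl0 := N.lam0
  have hκ := N.κ0
  have hM := N.M0
  obtain ⟨C1, hC1, c, hc, hg⟩ := N.gfin
  have hs0 : 0 < 1 / (2 - lam) := one_div_pos.2 (sub_pos.2 hl)
  set a := (1 / (2 - lam) - 1) / 2 with ha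
  have hs : 0 < a + 1 / 2 := by linarith
  obtain ⟨D, hD, h⟩ := exp_int hs hl0 hc
  set b := |B'| * (1 / (1 - r / ρ)) with hb
  have hb0 : 0 ≤ b := by
    have h3 : 0 < 1 - r / ρ := by rw [sub_pos, div_lt_one hρ]; exact hr
    positivity
  set E := b * N.M * (1 + |N.κ / 2|) * C1 with hE
  have hE0 : 0 ≤ E := by positivity
  refine ⟨N.N * (E * D) + 1, ℘, fun n hn u U ζ hz => ?_⟩
  have e := U |> fun U => Adm.fub U ((S.adm R C).mul (R.bd2 C hρ (hz.trans_lt hr) ℓ).1) C (a := a) (B := b) ℓ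
    (fun j w hw => S.kkb R C hρ hρ1 hr hz j hw)
  have e' : ‖∑ i, ∫ x in 𝟘..1, u i x * kk N H F (φ ζ) i x‖ * 𝕥 ≤ N.N * (E * D) * (n:ℝ) ^ (-((a + 1 / 2) * lam)) := by
    have := congrArg norm e
    rw [norm_mul, norm_neg, norm_mul, norm_mul, norm_I, mul_one, norm_real, norm_ofNat, Real.norm_of_nonneg Real.pi_pos.le] at this
    refine this.trans_le ?_
    calc _ ≤ ∑ j : Fin N.N, E * (D * (n:ℝ) ^ (-((a + 1 / 2) * lam))) := norm_sum_le_of_le _ fun j _ => ?_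
      _ = _ := by rw [Finset.sum_const, Finset.card_univ, Fintype.card_fin, nsmul_eq_mul]; ring
    refine le_trans (intervalIntegral.norm_integral_le_of_norm_le zero_le_one ?_ ((h n hn).1.const_mul E)) ?_
    · rw [← ae_restrict_iff' measurableSet_Ioc, restrict_Ioo_eq_restrict_Ioc.symm, ae_restrict_iff' measurableSet_Ioo]
      refine Eventually.of_forall fun x hx => ?_
      have hq : 0 < x * (1 - x) := mul_pos hx.1 (by linarith [hx.2])
      have hm : cp (N.κ / 2) x ∈ Tent N.κ N.κ := cp_mem ℓ ℓ hx
      have h1 := S.kkb R C hρ hρ1 hr hz j hm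
      rw [norm_mul, norm_mul, norm_mul]
      have h2 := (N.dbd j (N.tV j hm)).2
      have h3 := cd_le (η := N.κ / 2) (Ioo_subset_Icc_self hx)
      have h4 := hg n u U j x hx
      refine (mul_le_mul (mul_le_mul (mul_le_mul h1 h2 𝔫 ℘) h3 𝔫 ℘) h4 𝔫 ℘).trans_eq ?_
      have : ϖ x ^ (a + 1 / 2 - 1) = ϖ x ^ a * ϖ x ^ ħ := by
        rw [← Real.rpow_add hq]; congr 1; ring
      rw [this, hE]; simp only [cp]; ring
    · rw [intervalIntegral.integral_const_mul]
      exact mul_le_mul_of_nonneg_left (h n hn).2 hE0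
  have e3 : (a + 1 / 2) * lam = lam / (2 - lam) / 2 := by rw [ha]; ring
  rw [e3] at e'
  have := Real.pi_gt_three
  have h5 : 𝟘 ≤ (n:ℝ) ^ (-(lam / (2 - lam) / 2)) := by positivity
  nlinarith [norm_nonneg (∑ i, ∫ x in 𝟘..1, u i x * kk N H F (φ ζ) i x)]

lemma Sq.main (S : Sq N φ H f F B') (R : Rf N φ ρ B H) (C : Cf G φ ψ) (hρ : 0 < ρ) (hρ1 : ρ < 1) (hr : r < ρ)
    (O : On N l p) : ∃ D > 0, ∀ n : ℕ, 1 ≤ n → ∀ ζ ∈ G, ∀ z ∈ G, ‖φ ζ‖ ≤ r → ‖φ z‖ ≤ r →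
      ‖l / 𝕥 * ℭ (f z) * f ζ * (1 - ℭ (φ z) * φ ζ)⁻¹ - partialSum p z n ζ‖ ≤
        D * (n:ℝ) ^ (-(lam / (2 - lam))) := by
  have hM := N.M0
  have hl := O.l0
  have hpi : (Real.pi : ℂ) ≠ 0 := ofReal_ne_zero.2 Real.pi_ne_zero
  have hl' : (l : ℂ) ≠ 0 := ofReal_ne_zero.2 hl.ne'
  have c2 : ℭ 2 = 2 := map_ofNat _ 2
  obtain ⟨D, hD, hest⟩ := S.est R C hρ hρ1 hr
  obtain ⟨A, hA⟩ := (C.compact (hr.trans hρ1)).exists_bound_of_continuousOn (S.d.continuousOn.mono fun z hz => hz.1)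
  have hf : ∀ ζ ∈ G, f ζ ≠ 0 := fun ζ hζ h => deriv_ne_zero_of_inj N.Go C.d C.injOn hζ (by rw [← S.sq ζ hζ, h]; ring)
  set Aζ : ℂ → ℂ := fun ζ => l / 𝕥 * ℭ (f ζ) with hAζ
  set g : ℕ → ℂ → Fin N.N → ℝ → ℂ := fun n ζ i x => Aζ ζ * kk N H F (φ ζ) i x - (Ks p ζ n).eval (N.σ i x) with hg
  have kL : ∀ ζ, ‖φ ζ‖ ≤ r → L2 N (fun i x => kk N H F (φ ζ) i x) := fun ζ h => S.kkL R C hρ hρ1 hr h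
  have gL : ∀ n ζ, ‖φ ζ‖ ≤ r → L2 N (g n ζ) := fun n ζ h => (kL ζ h).comb (N.polyL2 _) _
  have cA : ∀ ζ, ℭ (Aζ ζ) = l / 𝕥 * f ζ := fun ζ => by simp [hAζ, c2]
  have or : ∀ n, ∀ ζ ∈ G, ‖φ ζ‖ ≤ r → ∀ Q : Polynomial ℂ, Q.natDegree ≤ n → N.ip (fun i x => Q.eval (N.σ i x)) (g n ζ) = 0 := by
    intro n ζ hζ h Q hQ
    have h1 := (S.rep_poly R C hζ (h.trans_lt hr) Q).2
    rw [hg, (kL ζ h).ip_r (N.polyL2 _) (N.polyL2 _), O.rep ζ n Q hQ, Net.ip, h1, cA]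
    have := hf ζ hζ
    field_simp; ring
  have Eb : ∀ n : ℕ, 1 ≤ n → ∀ ζ ∈ G, ‖φ ζ‖ ≤ r → (N.ip (g n ζ) (g n ζ)).re ≤
      (l / 𝕥 * |A| * D) ^ 2 * N.M * (n:ℝ) ^ (-(lam / (2 - lam))) := by
    intro n hn ζ hζ h
    set E := (N.ip (g n ζ) (g n ζ)).re with hE
    rcases le_or_gt E 0 with h0 | h0
    · exact h0.trans ℘
    have hEE : N.ip (g n ζ) (g n ζ) = (E : ℂ) := by rw [hE, N.ip_self, ofReal_re]
    have eE : (E : ℂ) = Aζ ζ * N.ip (fun i x => kk N H F (φ ζ) i x) (g n ζ) := by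
      rw [← hEE]
      nth_rw 1 [hg]
      rw [(kL ζ h).ip_l (N.polyL2 _) (gL n ζ h), or n ζ hζ h _ (O.Ks_deg ζ n), sub_zero]
    set c := √(N.M * E) with hc
    have hc0 : 0 < c := by positivity
    have hc2 : c ^ 2 = N.M * E := Real.sq_sqrt ℘
    set u : Fin N.N → ℝ → ℂ := fun i x => (c : ℂ)⁻¹ * (ℭ (g n ζ i x) * ‖deriv (N.σ i) x‖) with hu
    have eu : ∀ Y, ∑ i, ∫ x in 𝟘..1, u i x * Y i x = (c : ℂ)⁻¹ * N.ip Y (g n ζ) := fun Y => by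
      rw [Net.ip, Finset.mul_sum]
      refine Finset.sum_congr rfl fun i _ => ?_
      rw [← intervalIntegral.integral_const_mul]
      congr 1; ext x; simp only [hu]; ring
    have uc : ∀ i, ContinuousOn (u i) (Ioo 0 1) := fun i => continuousOn_const.mul
      ((continuous_conj.comp_continuousOn ((gL n ζ h).c i)).mul
        (continuous_ofReal.comp_continuousOn ((N.sC i).mono Ioo_subset_Icc_self)))
    have ub : ∀ i, ∀ x ∈ 𝕀o, ‖u i x‖ ^ 2 ≤ c⁻¹ ^ 2 * N.M * (‖g n ζ i x‖ ^ 2 * ‖deriv (N.σ i) x‖) := fun i x hx => by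
      have := N.sM i hx
      simp only [hu, norm_mul, norm_inv, norm_real, norm_conj, norm_norm, mul_pow, Real.norm_of_nonneg hc0.le, _root_.sq ‖deriv (N.σ i) x‖]
      calc _ ≤ c⁻¹ ^ 2 * (‖g n ζ i x‖ ^ 2 * (N.M * ‖deriv (N.σ i) x‖)) := by gcongr
        _ = _ := by ring
    have ui : ∀ i, IntervalIntegrable (fun x => ‖u i x‖ ^ 2) volume 0 1 := fun i => by
      have hi := ((gL n ζ h).sint i).const_mul (c⁻¹ ^ 2 * N.M)
      rw [intervalIntegrable_iff_integrableOn_Ioo_of_le zero_le_one] at hi ⊢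
      refine hi.mono' (((uc i).norm.pow 2).aestronglyMeasurable measurableSet_Ioo)
        ((ae_restrict_iff' measurableSet_Ioo).2 (Eventually.of_forall fun x hx => ?_))
      rw [Real.norm_of_nonneg ℘]
      exact ub i x hx
    have U : Un N n u := by
      refine ⟨uc, ui, ?_, fun Q hQ => ?_⟩
      · calc _ ≤ ∑ i, ∫ x in 𝟘..1, c⁻¹ ^ 2 * N.M * (‖g n ζ i x‖ ^ 2 * ‖deriv (N.σ i) x‖) :=
              Finset.sum_le_sum fun i _ => intervalIntegral.integral_mono_on_of_le_Ioo zero_le_one (ui i)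
                (((gL n ζ h).sint i).const_mul _) (ub i)
          _ = c⁻¹ ^ 2 * N.M * E := by
              simp only [intervalIntegral.integral_const_mul, ← Finset.mul_sum]
              rw [hE, N.ip_self, ofReal_re]
          _ ≤ 1 := by
              rw [inv_pow, hc2, mul_assoc, inv_mul_cancel₀ ℘]
      · have := eu (fun i x => Q.eval (N.σ i x))
        rw [or n ζ hζ h Q hQ, mul_zero] at this; exact this
    have h1 := hest n hn u U ζ h
    rw [eu (fun i x => kk N H F (φ ζ) i x), norm_mul, norm_inv, norm_real, Real.norm_of_nonneg hc0.le] at h1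
    have h2 : ‖Aζ ζ‖ ≤ l / 𝕥 * |A| := by
      rw [hAζ, norm_mul, norm_div, norm_mul, norm_conj, norm_real, norm_real, norm_ofNat, Real.norm_of_nonneg hl.le,
        Real.norm_of_nonneg Real.pi_pos.le]
      gcongr
      exact (hA ζ ⟨hζ, h⟩).trans (le_abs_self A)
    have h3 := congrArg norm eE
    rw [norm_real, norm_mul, Real.norm_of_nonneg h0.le] at h3
    rw [inv_mul_le_iff₀ hc0] at h1
    have h4 : E ≤ l / 𝕥 * |A| * (c * (D * (n:ℝ) ^ (-(lam / (2 - lam) / 2)))) := by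
      rw [h3]; gcongr
    have h5 := pow_le_pow_left₀ h0.le h4 2
    have h6 : ((n:ℝ) ^ (-(lam / (2 - lam) / 2))) ^ 2 = (n:ℝ) ^ (-(lam / (2 - lam))) := by
      rw [← Real.rpow_natCast, ← Real.rpow_mul ℘]; congr 1; push_cast; ring
    have h7 : E * E ≤ E * ((l / 𝕥 * |A| * D) ^ 2 * N.M * (n:ℝ) ^ (-(lam / (2 - lam)))) := by
      rw [← _root_.sq]; refine h5.trans_eq ?_
      rw [mul_pow, mul_pow c, hc2, mul_pow D, h6]; ring
    exact le_of_mul_le_mul_left h7 h0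
  refine ⟨(l / 𝕥 * |A| * D) ^ 2 * N.M / l + 1, ℘, fun n hn ζ hζ z hz h h' => ?_⟩
  have h1 : N.ip (g n z) (g n ζ) = l * (l / 𝕥 * ℭ (f z) * f ζ * (1 - ℭ (φ z) * φ ζ)⁻¹ -
      partialSum p z n ζ) := by
    have a1 := (S.rep_kk R C hρ hρ1 hζ hz (h.trans_lt hr) (h'.trans_lt hr)).2
    have a2 : N.ip (fun i x => kk N H F (φ z) i x) (fun i x => (Ks p ζ n).eval (N.σ i x)) =
        2 * Real.pi * partialSum p z n ζ / ℭ (f z) := by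
      have := (S.rep_poly R C hz (h'.trans_lt hr) (Ks p ζ n)).2
      rw [← N.ip_conj, Net.ip, this, Ks_eval, ← Ks_symm ζ]; simp [c2]
    nth_rw 1 [hg]
    rw [(kL z h').ip_l (N.polyL2 _) (gL n ζ h), or n ζ hζ h _ (O.Ks_deg z n), sub_zero, hg, (kL ζ h).ip_r (N.polyL2 _) (kL z h'),
      a2, cA, Net.ip, a1, hAζ]
    have : ℭ (f z) ≠ 0 := (map_ne_zero _).2 (hf z hz)
    field_simp
  have h2 := (gL n z h').ip_le (gL n ζ h)
  rw [h1, norm_mul, norm_real, Real.norm_of_nonneg hl.le] at h2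
  have h3 := Eb n hn ζ hζ h
  have h4 := Eb n hn z hz h'
  have h5 : 𝟘 ≤ (n:ℝ) ^ (-(lam / (2 - lam))) := by positivity
  rw [add_mul, one_mul]
  refine le_add_of_le_of_nonneg ?_ h5
  rw [div_mul_eq_mul_div (_ ^ 2 * _) l, le_div_iff₀ hl]
  linarith
end

lemma ratio {K K0 P P0 : ℂ} {A ε q D : ℝ} (hq : 0 < q) (hK : ‖K‖ ≤ A) (h : ‖K - P‖ ≤ ε) (h0 : ‖K0 - P0‖ ≤ ε) (hK0 : q ≤ ‖K0‖)
    (hP0 : q ≤ ‖P0‖) (hε : ε ≤ D) : ‖K ^ 2 / K0 - P ^ 2 / P0‖ ≤ ((2 * A + D) / q + A ^ 2 / q ^ 2) * ε := by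
  have k0 : K0 ≠ 0 := norm_pos_iff.1 (hq.trans_le hK0)
  have p0 : P0 ≠ 0 := norm_pos_iff.1 (hq.trans_le hP0)
  have hA : 0 ≤ A := (norm_nonneg _).trans hK
  have hε0 : 0 ≤ ε := (norm_nonneg _).trans h
  have e : K ^ 2 / K0 - P ^ 2 / P0 = (K + P) * (K - P) / P0 - K ^ 2 * (K0 - P0) / (K0 * P0) := by field_simp; ring
  have hP : ‖K + P‖ ≤ 2 * A + D := by
    have := norm_sub_le (2 * K) (K - P)
    rw [norm_mul, norm_ofNat, show 2 * K - (K - P) = K + P by ring] at this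
    linarith
  have h2 : 0 ≤ 2 * A + D := by linarith
  rw [e, add_mul (_ / q), div_mul_eq_mul_div, div_mul_eq_mul_div]
  refine (norm_sub_le _ _).trans (add_le_add ?_ ?_)
  · rw [norm_div, norm_mul]; gcongr
  · rw [norm_div, norm_mul, norm_mul, norm_pow, sq q]; gcongr

section
variable {lam : ℝ} {p : ℕ → Polynomial ℂ}

lemma Jfun_deriv (D : JordanDomain) (ζ : ℂ) (n : ℕ) (z : ℂ) :
    HasDerivAt (Jfun D p ζ n) ((2 * Real.pi / D.l : ℝ) * (partialSum p ζ n z ^ 2 / partialSum p ζ n ζ)) z ∧ Jfun D p ζ n ζ = 0 := by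
  refine ⟨?_, by simp [Jfun]⟩
  have e0 : ∑ k ∈ Finset.range (n + 1), ((‖(p k).eval ζ‖ : ℂ)) ^ 2 = partialSum p ζ n ζ :=
    Finset.sum_congr rfl fun k _ => by rw [conj_mul']
  set S : Polynomial ℂ := Ks p ζ n ^ 2 with hS
  have h : HasDerivAt (fun z => ∑ i ∈ Finset.range (S.natDegree + 1), S.coeff i * ((z ^ (i + 1) - ζ ^ (i + 1)) / ((i : ℂ) + 1)))
      (S.eval z) z := by
    rw [Polynomial.eval_eq_sum_range]
    refine HasDerivAt.fun_sum fun i _ => ?_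
    have hi : (i : ℂ) + 1 ≠ 0 := Nat.cast_add_one_ne_zero i
    convert! (((hasDerivAt_pow (i + 1) z).sub_const (ζ ^ (i + 1))).div_const ((i : ℂ) + 1)).const_mul (S.coeff i) using 1
    push_cast; field_simp
  convert! h.const_mul (((2 * Real.pi / D.l : ℝ) : ℂ) / partialSum p ζ n ζ) using 1
  · ext w; simp only [Jfun, e0]; rfl
  · rw [hS, Polynomial.eval_pow, Ks_eval]; ring

lemma Net.kern {G : Set ℂ} (N : Net G lam) {l r : ℝ} (O : On N l p) {φ ψ : ℂ → ℂ} (C : Cf G φ ψ) (hr0 : 0 ≤ r) (hr : r < 1) :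
    ∃ f : ℂ → ℂ, DifferentiableOn ℂ f G ∧ (∀ z ∈ G, f z ^ 2 = deriv φ z) ∧ ∃ D > 0, ∀ n : ℕ, 1 ≤ n → ∀ ζ ∈ G, ∀ z ∈ G,
      ‖φ ζ‖ ≤ r → ‖φ z‖ ≤ r →
      ‖l / 𝕥 * ℭ (f z) * f ζ * (1 - ℭ (φ z) * φ ζ)⁻¹ - partialSum p z n ζ‖ ≤
        D * (n:ℝ) ^ (-(lam / (2 - lam))) := by
  obtain ⟨k, h0, h1, B, H, R⟩ := Rf.exists N C (ρ := (1 + r) / 2) ℓ ℓ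
  obtain ⟨f, F, B', S⟩ := Sq.exists C R
  exact ⟨f, S.d, S.sq, S.main R C ℓ ℓ ℓ ⟨O.l0, O.d, O.z, O.o⟩⟩

lemma Net.final {D : JordanDomain} (N : Net D.G lam) (O : On N D.l p) {F : Set ℂ} (hF : IsCompact F) (hFG : F ⊆ D.G) :
    ∃ C : ℝ, 0 < C ∧ ∀ ζ ∈ F, ∀ φ : ℂ → ℂ, ConformalOnto D.G φ ζ → ∀ n : ℕ, 0 < n → ∀ z ∈ F,
        ‖φ z - Jfun D p ζ n z‖ ≤ C * (n : ℝ) ^ (-(lam / (2 - lam))) := by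
  by_cases hex : ∃ ζ ∈ F, ∃ φ, ConformalOnto D.G φ ζ
  swap
  · exact ⟨1, one_pos, fun ζ hζ φ h => absurd ⟨ζ, hζ, φ, h⟩ hex⟩
  obtain ⟨ζ0, hζ0, φ0, h0⟩ := hex
  have cf : ∀ φ ζ, ConformalOnto D.G φ ζ → ∃ ψ, Cf D.G φ ψ := fun φ ζ h =>
    Cf.exists N.Go (fun z hz => (h.differentiable z hz).differentiableWithinAt) h.bijOn
  have mx : ∀ {φ ψ : ℂ → ℂ}, Cf D.G φ ψ → ∀ {F : Set ℂ}, IsCompact F → F ⊆ D.G → F.Nonempty →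
      ∃ r, 0 ≤ r ∧ r < 1 ∧ ∀ z ∈ F, ‖φ z‖ ≤ r := fun {φ ψ} C {F} hF hFG hn => by
    obtain ⟨w, hw, h⟩ := hF.exists_isMaxOn hn (C.d.continuousOn.mono hFG).norm
    exact ⟨‖φ w‖, norm_nonneg _, by simpa using C.m (hFG hw), h⟩
  obtain ⟨ψ0, C0⟩ := cf φ0 ζ0 h0
  obtain ⟨r, r0, r1, hr⟩ := mx C0 hF hFG ⟨ζ0, hζ0⟩
  obtain ⟨f, fd, -, D1, hD1, hmain⟩ := N.kern O C0 r0 r1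
  have hl := O.l0
  have hl' : (D.l : ℂ) ≠ 0 := ofReal_ne_zero.2 hl.ne'
  have hpi : (Real.pi : ℂ) ≠ 0 := ofReal_ne_zero.2 Real.pi_ne_zero
  have hlam := N.lam2
  have hlam0 := N.lam0
  have hα : 0 < lam / (2 - lam) := div_pos hlam0 ℓ
  set α := lam / (2 - lam) with hαd
  set Fr := {z | z ∈ D.G ∧ ‖φ0 z‖ ≤ r} with hFr
  have cFr : IsCompact Fr := C0.compact r1
  have hFFr : ∀ z ∈ F, z ∈ Fr := fun z hz => ⟨hFG hz, hr z hz⟩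
  obtain ⟨A, hA⟩ := cFr.exists_bound_of_continuousOn (fd.continuousOn.mono fun z hz => hz.1)
  have hA0 : 0 ≤ A := (norm_nonneg _).trans (hA ζ0 (hFFr ζ0 hζ0))
  obtain ⟨B, hB⟩ := (isCompact_closedBall 𝕫 r).exists_bound_of_continuousOn
    ((C0.d'.deriv isOpen_ball).continuousOn.mono (closedBall_subset_ball r1))
  have hB0 : 0 ≤ B := (norm_nonneg _).trans (hB 0 (by simpa using r0))
  set K : ℂ → ℂ → ℂ := fun ζ z => D.l / 𝕥 * ℭ (f ζ) * f z * (1 - ℭ (φ0 ζ) * φ0 z)⁻¹ with hK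
  set A1 := D.l / 𝕥 * A * A * (1 - r * r)⁻¹ with hA1
  have hrr : 0 < 1 - r * r := by nlinarith
  have hA10 : 0 ≤ A1 := by positivity
  have KA : ∀ ζ ∈ Fr, ∀ z ∈ Fr, ‖K ζ z‖ ≤ A1 := by
    intro ζ hζ z hz
    have h1 : 1 - r * r ≤ ‖1 - ℭ (φ0 ζ) * φ0 z‖ := by
      have := norm_sub_norm_le 1 (ℭ (φ0 ζ) * φ0 z)
      rw [norm_mul, norm_conj, norm_one] at this
      have := mul_le_mul hζ.2 hz.2 𝔫 r0
      linarith
    rw [hK, norm_mul, norm_mul, norm_mul, norm_div, norm_mul, norm_conj, norm_inv, norm_real, norm_real, norm_ofNat,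
      Real.norm_of_nonneg hl.le, Real.norm_of_nonneg Real.pi_pos.le]
    have := hA ζ hζ
    have := hA z hz
    change _ ≤ D.l / 𝕥 * A * A * (1 - r * r)⁻¹
    gcongr
  have KP : ∀ n : ℕ, 1 ≤ n → ∀ ζ ∈ Fr, ∀ z ∈ Fr, ‖K ζ z - partialSum p ζ n z‖ ≤ D1 * (n:ℝ) ^ (-α) :=
    fun n hn ζ hζ z hz => hmain n hn z hz.1 ζ hζ.1 hz.2 hζ.2
  have t0 : ∀ D : ℝ, Tendsto (fun n : ℕ => D * (n:ℝ) ^ (-α)) atTop (𝓝 0) := fun D => by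
    simpa using ((tendsto_rpow_neg_atTop hα).comp tendsto_natCast_atTop_atTop).const_mul D
  have lim : ∀ ζ ∈ Fr, ∀ z ∈ Fr, Tendsto (fun n => partialSum p ζ n z) atTop (𝓝 (K ζ z)) := fun ζ hζ z hz => by
    rw [tendsto_iff_norm_sub_tendsto_zero]
    refine squeeze_zero' (Eventually.of_forall fun _ => norm_nonneg _) ?_ (t0 D1)
    filter_upwards [eventually_ge_atTop 1] with n hn
    rw [norm_sub_rev]; exact KP n hn ζ hζ z hz
  set q := ‖(p 0).eval 0‖ ^ 2 with hq
  have hp0 : ∀ ζ, (p 0).eval ζ = (p 0).coeff 0 := fun ζ => by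
    rw [Polynomial.eq_C_of_natDegree_eq_zero (O.d 0)]; simp
  have q0 : 0 < q := by
    have : (p 0).coeff 0 ≠ 0 := by
      have := Polynomial.leadingCoeff_ne_zero.2 (O.z 0); rwa [Polynomial.leadingCoeff, O.d] at this
    rw [hq, hp0]; positivity
  have Pq : ∀ ζ n, q ≤ ‖partialSum p ζ n ζ‖ := by
    intro ζ n
    have : partialSum p ζ n ζ = ((∑ k ∈ Finset.range (n + 1), ‖(p k).eval ζ‖ ^ 2 : ℝ) : ℂ) := by
      rw [ofReal_sum]; exact Finset.sum_congr rfl fun k _ => by rw [conj_mul']; push_cast; rfl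
    rw [this, norm_real, Real.norm_of_nonneg ℘, hq, hp0 0, ← hp0 ζ]
    exact Finset.single_le_sum (f := fun k => ‖(p k).eval ζ‖ ^ 2) (fun _ _ => by positivity) (Finset.mem_range.2 (Nat.succ_pos n))
  set c := 2 * Real.pi / D.l * ((2 * A1 + D1) / q + A1 ^ 2 / q ^ 2) * D1 with hc
  have hc0 : 0 ≤ c := by positivity
  refine ⟨c * B * 2 + 1, ℘, fun ζ hζ φ hφ n hn z hz => ?_⟩
  have hζr := hFFr ζ hζ
  have hzr := hFFr z hz
  -- the derivative of φ
  have dφ : ∀ t ∈ Fr, deriv φ t = (2 * Real.pi / D.l : ℝ) * (K ζ t ^ 2 / K ζ ζ) := by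
    obtain ⟨ψ, C⟩ := cf φ ζ hφ
    obtain ⟨r', r0', r1', hr'⟩ := mx C cFr (fun z hz => hz.1) ⟨ζ, hζr⟩
    obtain ⟨g, -, hg, D2, -, hm⟩ := N.kern O C r0' r1'
    have e : ∀ t ∈ Fr, K ζ t = D.l / 𝕥 * ℭ (g ζ) * g t := fun t ht => by
      refine tendsto_nhds_unique (lim ζ hζr t ht) ?_
      rw [tendsto_iff_norm_sub_tendsto_zero]
      refine squeeze_zero' (Eventually.of_forall fun _ => norm_nonneg _) ?_ (t0 D2)
      filter_upwards [eventually_ge_atTop 1] with n hn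
      have := hm n hn t ht.1 ζ hζr.1 (hr' t ht) (hr' ζ hζr)
      rw [hφ.map_center, map_zero, zero_mul, sub_zero, inv_one, mul_one] at this
      rw [norm_sub_rev]; exact this
    intro t ht
    obtain ⟨a, a0, ha⟩ := hφ.deriv_center_pos
    have g1 := hg ζ hζr.1
    rw [ha] at g1
    have g2 : ℭ (g ζ) ^ 2 = a := by rw [← map_pow, g1, conj_ofReal]
    have g0 : g ζ ≠ 0 := fun h => a0.ne' (by rw [h] at g1; simpa using g1.symm)
    have g0' : ℭ (g ζ) ≠ 0 := (map_ne_zero _).2 g0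
    have g3 : ℭ (g ζ) * g ζ = a := by
      rw [conj_mul', ← ofReal_pow, ← norm_pow, g1, norm_real, Real.norm_of_nonneg a0.le]
    have a0' : (a : ℂ) ≠ 0 := ofReal_ne_zero.2 a0.ne'
    rw [e t ht, e ζ hζr, ← hg t ht.1, mul_pow, mul_pow, g2, mul_assoc (_ / _), g3]
    push_cast
    field_simp
  have hn1 : (n:ℝ) ^ (-α) ≤ 1 := Real.rpow_le_one_of_one_le_of_nonpos (by exact_mod_cast hn) ℓ
  have hd : ∀ w ∈ closedBall 𝕫 r, HasDerivWithinAt (fun w => φ (ψ0 w) - Jfun D p ζ n (ψ0 w))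
      ((deriv φ (ψ0 w) - (2 * Real.pi / D.l : ℝ) * (partialSum p ζ n (ψ0 w) ^ 2 / partialSum p ζ n ζ)) * deriv ψ0 w) (closedBall 0 r) w := by
    intro w hw
    have hw1 := closedBall_subset_ball r1 hw
    have d1 := ((hφ.differentiable _ (C0.m' hw1)).hasDerivAt.sub (Jfun_deriv (p := p) D ζ n (ψ0 w)).1)
    exact (d1.comp w (C0.d'.differentiableAt (isOpen_ball.mem_nhds hw1)).hasDerivAt).hasDerivWithinAt
  have hb : ∀ w ∈ closedBall 𝕫 r, ‖(deriv φ (ψ0 w) - (2 * Real.pi / D.l : ℝ) * (partialSum p ζ n (ψ0 w) ^ 2 / partialSum p ζ n ζ)) * deriv ψ0 w‖ ≤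
      c * (n:ℝ) ^ (-α) * B := by
    intro w hw
    have hw1 := closedBall_subset_ball r1 hw
    have hwr : ψ0 w ∈ Fr := ⟨C0.m' hw1, by rw [C0.r w hw1]; simpa using hw⟩
    have h3 := ratio q0 (KA ζ hζr _ hwr) (KP n hn ζ hζr _ hwr) (KP n hn ζ hζr ζ hζr)
      (ge_of_tendsto' (lim ζ hζr ζ hζr).norm (Pq ζ)) (Pq ζ n) (mul_le_of_le_one_right hD1.le hn1)
    rw [dφ _ hwr, ← mul_sub, norm_mul, norm_mul, norm_real, Real.norm_of_nonneg ℘]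
    have h4 := hB w hw
    calc _ ≤ 2 * Real.pi / D.l * (((2 * A1 + D1) / q + A1 ^ 2 / q ^ 2) * (D1 * (n:ℝ) ^ (-α))) * B := by gcongr
      _ = _ := by rw [hc]; ring
  have mem : ∀ z ∈ Fr, φ0 z ∈ closedBall 𝕫 r := fun z hz => by simpa using hz.2
  have h := (convex_closedBall 𝕫 r).norm_image_sub_le_of_norm_hasDerivWithin_le hd hb (mem ζ hζr) (mem z hzr)
  rw [C0.l z hzr.1, C0.l ζ hζr.1, (Jfun_deriv D ζ n ζ).2, hφ.map_center, sub_self, sub_zero] at h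
  have h5 : ‖φ0 z - φ0 ζ‖ ≤ 2 := (norm_sub_le _ _).trans (by linarith [hzr.2, hζr.2])
  have h6 : 𝟘 ≤ (n:ℝ) ^ (-α) := by positivity
  calc _ ≤ _ := h
    _ ≤ c * (n:ℝ) ^ (-α) * B * 2 := by gcongr
    _ ≤ _ := by nlinarith
end

lemma biLip {U K : Set ℂ} {f : ℂ → ℂ} (hU : IsOpen U) (hK : IsCompact K) (hKc : Convex ℝ K) (hKU : K ⊆ U)
    (hf : DifferentiableOn ℂ f U) (hi : InjOn f U) : ∃ m > 0, ∃ M > 0, ∀ z ∈ K, ∀ w ∈ K,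
      m * ‖z - w‖ ≤ ‖f z - f w‖ ∧ ‖f z - f w‖ ≤ M * ‖z - w‖ := by
  have hd : ∀ z ∈ K, DifferentiableAt ℂ f z := fun z hz => hf.differentiableAt (hU.mem_nhds (hKU hz))
  obtain ⟨M, hM⟩ := hK.exists_bound_of_continuousOn ((hf.deriv hU).continuousOn.mono hKU)
  have low : ∃ m > 0, ∀ q ∈ K ×ˢ K, m * ‖q.1 - q.2‖ ≤ ‖f q.1 - f q.2‖ := by
    refine (hK.prod hK).induction_on (p := fun s => ∃ m > 0, ∀ q ∈ s, m * ‖q.1 - q.2‖ ≤ ‖f q.1 - f q.2‖)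
      ⟨1, one_pos, by simp⟩ (fun s t hst ⟨m, h0, h⟩ => ⟨m, h0, fun q hq => h q (hst hq)⟩) ?_ ?_
    · rintro s t ⟨m, h0, h⟩ ⟨m', h0', h'⟩
      refine ⟨min m m', lt_min h0 h0', fun q hq => ?_⟩
      rcases hq with hq | hq
      · exact (mul_le_mul_of_nonneg_right 𝔩 𝔫).trans (h q hq)
      · exact (mul_le_mul_of_nonneg_right 𝔯 𝔫).trans (h' q hq)
    · rintro ⟨z, w⟩ ⟨hz, hw⟩
      by_cases hzw : z = w
      · subst hzw
        have h0 := deriv_ne_zero_of_inj hU hf hi (hKU hz)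
        have h1 : HasStrictDerivAt f (deriv f z) z := ((hf.analyticOnNhd hU) z (hKU hz)).hasStrictDerivAt
        have h2 := (hasStrictDerivAt_iff_hasStrictFDerivAt.1 h1).isLittleO.def (half_pos (norm_pos_iff.2 h0))
        refine ⟨_, mem_nhdsWithin_of_mem_nhds h2, ‖deriv f z‖ / 2, ℘, fun q hq => ?_⟩
        have h3 : ‖f q.1 - f q.2 - (q.1 - q.2) * deriv f z‖ ≤ ‖deriv f z‖ / 2 * ‖q.1 - q.2‖ := by simpa using hq
        have := norm_sub_norm_le ((q.1 - q.2) * deriv f z) (f q.1 - f q.2)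
        rw [norm_mul, norm_sub_rev _ (f q.1 - f q.2)] at this
        linarith
      · have hc : 0 < ‖f z - f w‖ := norm_pos_iff.2 (sub_ne_zero.2 fun h => hzw (hi (hKU hz) (hKU hw) h))
        have c1 : ContinuousAt (fun q : ℂ × ℂ => ‖f q.1 - f q.2‖) (z, w) :=
          (((hd z hz).continuousAt.comp continuousAt_fst).sub ((hd w hw).continuousAt.comp continuousAt_snd)).norm
        have c2 : ContinuousAt (fun q : ℂ × ℂ => ‖q.1 - q.2‖) (z, w) := by fun_prop
        have h1 := c1.eventually (lt_mem_nhds (half_lt_self hc))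
        have h2 := c2.eventually (gt_mem_nhds (lt_add_one _))
        refine ⟨_, mem_nhdsWithin_of_mem_nhds (h1.and h2), ‖f z - f w‖ / 2 / (‖z - w‖ + 1), ℘, fun q hq => ?_⟩
        have h3 : ‖f z - f w‖ / 2 < ‖f q.1 - f q.2‖ := hq.1
        have h4 : ‖q.1 - q.2‖ < ‖z - w‖ + 1 := hq.2
        rw [div_mul_eq_mul_div, div_le_iff₀ ℘]
        exact mul_le_mul h3.le h4.le 𝔫 𝔫
  obtain ⟨m, m0, hm⟩ := low
  refine ⟨m, m0, |M| + 1, ℘, fun z hz w hw => ⟨hm (z, w) ⟨hz, hw⟩, ?_⟩⟩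
  exact hKc.norm_image_sub_le_of_norm_deriv_le hd (fun x hx => (hM x hx).trans (by linarith [le_abs_self M])) hw hz

lemma segc : IsCompact (ofReal '' 𝕀c) ∧ Convex ℝ (ofReal '' 𝕀c) :=
  ⟨isCompact_Icc.image continuous_ofReal, (convex_Icc 𝟘 1).linear_image (ofRealCLM : ℝ →L[ℝ] ℂ).toLinearMap⟩

namespace JordanDomain
variable (D : JordanDomain)

lemma per (s : ℝ) : ∃ k : ℤ, s + k * D.l ∈ Ico 0 D.l := by
  refine ⟨-⌊s / D.l⌋, ?_⟩
  have h := D.l_pos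
  have h1 := Int.floor_le (s / D.l)
  have h2 := Int.lt_floor_add_one (s / D.l)
  rw [le_div_iff₀ h] at h1
  rw [div_lt_iff₀ h] at h2
  push_cast
  constructor <;> linarith

lemma per_eq (s : ℝ) (k : ℤ) : D.γ (s + k * D.l) = D.γ s := by
  simpa using D.γ_periodic.int_mul k s

lemma mod {s t : ℝ} (h : D.γ s = D.γ t) : ∃ k : ℤ, t = s + k * D.l := by
  obtain ⟨k, hk⟩ := D.per s
  obtain ⟨k', hk'⟩ := D.per t
  have := D.γ_injOn hk hk' (by rw [D.per_eq, D.per_eq, h])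
  exact ⟨k - k', by push_cast; linarith⟩

lemma mod' {s t : ℝ} (h : D.γ s = D.γ t) (h1 : s ≤ t) (h2 : t < s + D.l) : s = t := by
  obtain ⟨k, rfl⟩ := D.mod h
  have hl := D.l_pos
  have k0 : 𝟘 ≤ k := by by_contra hk; push Not at hk; nlinarith
  have k1 : (k:ℝ) < 1 := by by_contra hk; push Not at hk; nlinarith
  have : k = 0 := by
    have a : (0:ℤ) ≤ k := by exact_mod_cast k0
    have b : k < 1 := by exact_mod_cast k1
    omega
  simp [this]

lemma inj {a b s t : ℝ} (hab : b ≤ a + D.l) (hs : s ∈ Icc a b) (ht : t ∈ Icc a b) (h : D.γ s = D.γ t) :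
    s = t ∨ (s = a ∧ t = b) ∨ (s = b ∧ t = a) := by
  by_contra hc
  push Not at hc
  rcases le_total s t with h' | h'
  · refine hc.1 (D.mod' h h' (lt_of_le_of_ne (by linarith [ht.2, hs.1]) fun e => ?_))
    exact hc.2.1 (by linarith [ht.2, hs.1]) (by linarith [ht.2, hs.1])
  · refine hc.1 (D.mod' h.symm h' (lt_of_le_of_ne (by linarith [ht.1, hs.2]) fun e => ?_)).symm
    exact hc.2.2 (by linarith [ht.1, hs.2]) (by linarith [ht.1, hs.2])

lemma fr (s : ℝ) : D.γ s ∈ frontier D.G := by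
  obtain ⟨k, hk⟩ := D.per s
  rw [← D.γ_boundary, ← D.per_eq s k]
  exact mem_image_of_mem _ hk

lemma fr' {z : ℂ} (hz : z ∈ frontier D.G) (a : ℝ) : ∃ s ∈ Ico a (a + D.l), D.γ s = z := by
  rw [← D.γ_boundary] at hz
  obtain ⟨t, -, rfl⟩ := hz
  obtain ⟨k, hk⟩ := D.per (t - a)
  exact ⟨t + k * D.l, ⟨by linarith [hk.1], by linarith [hk.2]⟩, D.per_eq t k⟩

lemma li (s₀ : ℝ) {ε : ℝ} (hε : 0 < ε) : ∃ δ > 0, ∀ z ∈ frontier D.G, ‖z - D.γ s₀‖ < δ → ∃ s, |s - s₀| < ε ∧ D.γ s = z := by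
  have hc : IsClosed (D.γ '' Icc (s₀ + ε) (s₀ + D.l - ε)) := (isCompact_Icc.image D.γ_cont).isClosed
  have hn : D.γ s₀ ∉ D.γ '' Icc (s₀ + ε) (s₀ + D.l - ε) := by
    rintro ⟨t, ht, e⟩
    have := D.mod' e.symm (by linarith [ht.1]) (by linarith [ht.2])
    linarith [ht.1]
  obtain ⟨δ, hδ, h⟩ := Metric.isOpen_iff.1 hc.isOpen_compl _ hn
  refine ⟨δ, hδ, fun z hz hzd => ?_⟩
  obtain ⟨s, hs, rfl⟩ := D.fr' hz s₀
  have h1 : s ∉ Icc (s₀ + ε) (s₀ + D.l - ε) := fun hm => h (by simpa [dist_eq_norm] using hzd) (mem_image_of_mem _ hm)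
  rcases lt_or_ge s (s₀ + ε) with h2 | h2
  · exact ⟨s, by rw [abs_lt]; constructor <;> linarith [hs.1], rfl⟩
  · have h3 : s₀ + D.l - ε < s := by by_contra hc; exact h1 ⟨h2, not_lt.1 hc⟩
    refine ⟨s + (-1 : ℤ) * D.l, by rw [abs_lt]; push_cast; constructor <;> linarith [hs.2], D.per_eq s _⟩
end JordanDomain

lemma gap (D : JordanDomain) {m : ℕ} {τ : Fin m → ℂ → ℂ} {U : Fin m → Set ℂ} (Uo : ∀ i, IsOpen (U i))
    (seg : ∀ i, (ofReal '' 𝕀c) ⊆ U i) (an : ∀ i, DifferentiableOn ℂ (τ i) (U i)) (inj : ∀ i, InjOn (τ i) (U i))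
    (cover : (⋃ i, τ i '' (ofReal '' 𝕀c)) = frontier D.G) {E : Set ℂ} (E0 : ∀ i, τ i 0 ∈ E) (E1 : ∀ i, τ i 1 ∈ E)
    {a b : ℝ} (hab : a < b) (hl : b ≤ a + D.l) (hE : ∀ t ∈ Ioo a b, D.γ t ∉ E) :
    ∃ (σ : ℂ → ℂ) (V : Set ℂ) (S : ℝ → ℝ), IsOpen V ∧ (ofReal '' 𝕀c ⊆ V) ∧ DifferentiableOn ℂ σ V ∧ InjOn σ V ∧
      StrictMonoOn S (Icc 0 1) ∧ S 0 = a ∧ S 1 = b ∧ (∀ t ∈ Icc a b, ∃ x ∈ 𝕀c, S x = t) ∧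
      ∀ x ∈ 𝕀c, D.γ (S x) = σ x := by
  have hc : (a + b) / 2 ∈ Ioo a b := ⟨ℓ, ℓ⟩
  obtain ⟨i, hi⟩ : ∃ i, D.γ ((a + b) / 2) ∈ τ i '' (ofReal '' 𝕀c) := by
    have := D.fr ((a + b) / 2); rwa [← cover, mem_iUnion] at this
  have cτ : ContinuousOn (fun x : ℝ => τ i x) (Icc 0 1) := (an i).continuousOn.comp continuous_ofReal.continuousOn
    fun x hx => seg i (mem_image_of_mem _ hx)
  have iτ : ∀ {x y : ℝ}, x ∈ 𝕀c → y ∈ 𝕀c → τ i x = τ i y → x = y := fun hx hy h => by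
    exact_mod_cast inj i (seg i (mem_image_of_mem _ hx)) (seg i (mem_image_of_mem _ hy)) h
  have fτ : ∀ x ∈ 𝕀c, τ i x ∈ frontier D.G := fun x hx => by
    rw [← cover]; exact mem_iUnion.2 ⟨i, mem_image_of_mem _ (mem_image_of_mem _ hx)⟩
  have io : ∀ {s t : ℝ}, s ∈ Ioo a b → t ∈ Ioo a b → D.γ s = D.γ t → s = t := fun {s t} hs ht h => by
    rcases D.inj hl (Ioo_subset_Icc_self hs) (Ioo_subset_Icc_self ht) h with h | ⟨h, -⟩ | ⟨h, -⟩
    · exact h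
    · exact absurd h hs.1.ne'
    · exact absurd h hs.2.ne
  have cl : IsClosed (D.γ ⁻¹' (τ i '' (ofReal '' 𝕀c))) := by
    rw [image_image]; exact (isCompact_Icc.image_of_continuousOn cτ).isClosed.preimage D.γ_cont
  set T : Set ℝ := Ioo a b ∩ D.γ ⁻¹' (τ i '' (ofReal '' 𝕀c)) with hT
  have To : IsOpen T := by
    rw [isOpen_iff_mem_nhds]
    rintro t₀ ⟨ht₀, _, ⟨x₀, hx₀, rfl⟩, e₀⟩
    have hx0 : x₀ ∈ 𝕀o := by
      refine ⟨lt_of_le_of_ne hx₀.1 fun h => ?_, lt_of_le_of_ne hx₀.2 fun h => ?_⟩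
      · exact hE t₀ ht₀ (by rw [← e₀, ← h, ofReal_zero]; exact E0 i)
      · exact hE t₀ ht₀ (by rw [← e₀, h, ofReal_one]; exact E1 i)
    obtain ⟨ε, hε, hεs⟩ := Metric.isOpen_iff.1 (isOpen_Ioo (a := a) (b := b)) t₀ ht₀
    obtain ⟨δ, hδ, hli⟩ := D.li t₀ hε
    have c1 : ∀ᶠ x : ℝ in 𝓝 x₀, x ∈ 𝕀o ∧ ‖τ i x - D.γ t₀‖ < δ := by
      refine Filter.Eventually.and (isOpen_Ioo.mem_nhds hx0) ?_
      have := (cτ.continuousAt (Icc_mem_nhds hx0.1 hx0.2)).eventually (ball_mem_nhds _ hδ)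
      simpa [dist_eq_norm, e₀] using this
    obtain ⟨η, hη, h1⟩ := Metric.nhds_basis_closedBall.eventually_iff.1 c1
    rw [Real.closedBall_eq_Icc] at h1
    have h2 : ∀ x : ℝ, ∃ s, x ∈ Icc (x₀ - η) (x₀ + η) → s ∈ Ioo a b ∧ D.γ s = τ i x := fun x => by
      by_cases hx : x ∈ Icc (x₀ - η) (x₀ + η)
      · obtain ⟨s, hs, e⟩ := hli _ (fτ x (Ioo_subset_Icc_self (h1 hx).1)) (h1 hx).2
        exact ⟨s, fun _ => ⟨hεs (by rwa [mem_ball, Real.dist_eq]), e⟩⟩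
      · exact ⟨0, fun h => absurd h hx⟩
    choose g hg using h2
    have gi : InjOn g (Icc (x₀ - η) (x₀ + η)) := fun x hx y hy h =>
      iτ (Ioo_subset_Icc_self (h1 hx).1) (Ioo_subset_Icc_self (h1 hy).1) (by rw [← (hg x hx).2, h, (hg y hy).2])
    have gc : ContinuousOn g (Icc (x₀ - η) (x₀ + η)) := by
      intro x hx
      rw [ContinuousWithinAt, Metric.tendsto_nhds]
      intro ε1 hε1
      obtain ⟨ε2, hε2, hs2⟩ := Metric.isOpen_iff.1 (isOpen_Ioo (a := a) (b := b)) _ (hg x hx).1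
      obtain ⟨δ1, hδ1, hl1⟩ := D.li (g x) (lt_min hε1 hε2)
      have := (cτ.mono (fun y hy => Ioo_subset_Icc_self (h1 hy).1) x hx).eventually (ball_mem_nhds _ hδ1)
      filter_upwards [this, self_mem_nhdsWithin] with y hy hym
      obtain ⟨s, hs, e⟩ := hl1 _ (fτ y (Ioo_subset_Icc_self (h1 hym).1)) (by rw [(hg x hx).2, ← dist_eq_norm]; exact hy)
      have : s = g y := io (hs2 (by rw [mem_ball, Real.dist_eq]; exact hs.trans_le 𝔯)) (hg y hym).1 (by rw [e, (hg y hym).2])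
      rw [← this, Real.dist_eq]; exact hs.trans_le 𝔩
    have m0 : x₀ ∈ Icc (x₀ - η) (x₀ + η) := ⟨ℓ, ℓ⟩
    have m1 : x₀ - η ∈ Icc (x₀ - η) (x₀ + η) := ⟨le_rfl, ℓ⟩
    have m2 : x₀ + η ∈ Icc (x₀ - η) (x₀ + η) := ⟨ℓ, le_rfl⟩
    have g0 : g x₀ = t₀ := io (hg x₀ m0).1 ht₀ (by rw [(hg x₀ m0).2, e₀])
    have hle : x₀ - η ≤ x₀ + η := by linarith
    have sub : uIcc (g (x₀ - η)) (g (x₀ + η)) ⊆ T := by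
      refine (intermediate_value_uIcc (by rwa [uIcc_of_le hle])).trans ?_
      rw [uIcc_of_le hle]
      rintro _ ⟨x, hx, rfl⟩
      exact ⟨(hg x hx).1, x, mem_image_of_mem _ (Ioo_subset_Icc_self (h1 hx).1), (hg x hx).2.symm⟩
    refine mem_of_superset ?_ sub
    rcases gc.strictMonoOn_of_injOn_Icc' hle gi with h | h
    · rw [← g0]
      exact mem_of_superset (Icc_mem_nhds (h m1 m0 ℓ) (h m0 m2 ℓ)) Icc_subset_uIcc
    · rw [← g0]
      exact mem_of_superset (Icc_mem_nhds (h m0 m2 ℓ) (h m1 m0 ℓ)) Icc_subset_uIcc'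
  have sub : Icc a b ⊆ D.γ ⁻¹' (τ i '' (ofReal '' 𝕀c)) := by
    have : Ioo a b ⊆ T := isPreconnected_Ioo.subset_of_closure_inter_subset To ⟨_, hc, hc, hi⟩ fun t ht =>
      ⟨ht.2, cl.closure_subset_iff.2 inter_subset_right ht.1⟩
    rw [← closure_Ioo hab.ne]
    exact cl.closure_subset_iff.2 (this.trans inter_subset_right)
  have h3 : ∀ t : ℝ, ∃ x, t ∈ Icc a b → x ∈ 𝕀c ∧ τ i x = D.γ t := fun t => by
    by_cases ht : t ∈ Icc a b
    · obtain ⟨_, ⟨x, hx, rfl⟩, e⟩ := sub ht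
      exact ⟨x, fun _ => ⟨hx, e⟩⟩
    · exact ⟨0, fun h => absurd h ht⟩
  choose X hX using h3
  obtain ⟨mm, mm0, _, _, hbl⟩ := biLip (Uo i) segc.1 segc.2 (seg i) (an i) (inj i)
  have Xc : ContinuousOn X (Icc a b) := by
    intro t ht
    rw [ContinuousWithinAt, tendsto_iff_norm_sub_tendsto_zero]
    have h1 : Tendsto (fun s => ‖D.γ s - D.γ t‖ / mm) (𝓝[Icc a b] t) (𝓝 0) := by
      simpa using (((D.γ_cont.tendsto t).mono_left (nhdsWithin_le_nhds (s := Icc a b))).sub_const (D.γ t)).norm.div_const mm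
    refine squeeze_zero' (Eventually.of_forall fun _ => norm_nonneg _) ?_ h1
    filter_upwards [self_mem_nhdsWithin] with s hs
    have := (hbl _ (mem_image_of_mem _ (hX s hs).1) _ (mem_image_of_mem _ (hX t ht).1)).1
    rw [(hX s hs).2, (hX t ht).2, ← ofReal_sub, norm_real] at this
    rw [le_div_iff₀ mm0]; linarith
  have ha : a ∈ Icc a b := ⟨le_rfl, hab.le⟩
  have hb : b ∈ Icc a b := ⟨hab.le, le_rfl⟩
  have hab' : X a ≠ X b := by
    intro h
    have mc := Ioo_subset_Icc_self hc
    have ne : X a ≠ X ((a + b) / 2) := fun e => by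
      have := D.mod' (s := a) (t := (a + b) / 2) (by rw [← (hX _ ha).2, ← (hX _ mc).2, e]) hc.1.le (by linarith [hc.2])
      linarith [hc.1]
    set v := (X a + X ((a + b) / 2)) / 2 with hv
    have hv1 : v ∈ uIcc (X a) (X ((a + b) / 2)) := by
      rcases le_total (X a) (X ((a + b) / 2)) with h | h
      · rw [uIcc_of_le h]; constructor <;> linarith
      · rw [uIcc_of_ge h]; constructor <;> linarith
    have i1 := intermediate_value_uIcc (a := a) (b := (a + b) / 2) (by rw [uIcc_of_le hc.1.le]; exact Xc.mono (Icc_subset_Icc_right hc.2.le)) hv1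
    have i2 := intermediate_value_uIcc (a := (a + b) / 2) (b := b) (by rw [uIcc_of_le hc.2.le]; exact Xc.mono (Icc_subset_Icc_left hc.1.le))
      (by rwa [← h, uIcc_comm])
    rw [uIcc_of_le hc.1.le] at i1
    rw [uIcc_of_le hc.2.le] at i2
    obtain ⟨t1, k1, e1⟩ := i1
    obtain ⟨t2, k2, e2⟩ := i2
    have n1 : t1 ≠ a := fun h => ne (by rw [h] at e1; linarith)
    have n2 : t1 ≠ (a + b) / 2 := fun h => ne (by rw [h] at e1; linarith)
    have n3 : t2 ≠ b := fun h' => ne (by rw [h'] at e2; linarith)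
    have k1' := lt_of_le_of_ne k1.2 n2
    have := io (s := t1) (t := t2) ⟨lt_of_le_of_ne k1.1 n1.symm, by linarith [k2.1, k2.2]⟩ ⟨by linarith [k1.1, k2.1], lt_of_le_of_ne k2.2 n3⟩
      (by rw [← (hX t1 ⟨k1.1, by linarith [hc.2]⟩).2, ← (hX t2 ⟨by linarith [hc.1, k2.1], k2.2⟩).2, e1, e2])
    linarith [k2.1]
  set w := X b - X a with hw
  have w0 : w ≠ 0 := sub_ne_zero.2 hab'.symm
  set Y : ℝ → ℝ := fun t => (X t - X a) / w with hY
  have Yi : InjOn Y (Icc a b) := fun s hs t ht h => by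
    have h' : X s = X t := by simp only [hY] at h; field_simp at h; linarith
    rcases D.inj hl hs ht (by rw [← (hX s hs).2, ← (hX t ht).2, h']) with h | ⟨rfl, rfl⟩ | ⟨rfl, rfl⟩
    exacts [h, absurd h' hab', absurd h'.symm hab']
  have Yc : ContinuousOn Y (Icc a b) := (Xc.sub continuousOn_const).div_const w
  have Ya : Y a = 0 := by simp [hY]
  have Yb : Y b = 1 := by simp [hY, ← hw, w0]
  have Ym : StrictMonoOn Y (Icc a b) := by
    rcases Yc.strictMonoOn_of_injOn_Icc' hab.le Yi with h | h
    · exact h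
    · have := h ha hb hab; rw [Ya, Yb] at this; linarith
  have h4 : ∀ x : ℝ, ∃ t, x ∈ 𝕀c → t ∈ Icc a b ∧ Y t = x := fun x => by
    by_cases hx : x ∈ 𝕀c
    · obtain ⟨t, ht, e⟩ := intermediate_value_Icc hab.le Yc (show x ∈ Icc (Y a) (Y b) by rwa [Ya, Yb])
      exact ⟨t, fun _ => ⟨ht, e⟩⟩
    · exact ⟨0, fun h => absurd h hx⟩
  choose S hS using h4
  have z0 : 𝟘 ∈ 𝕀c := ⟨le_rfl, zero_le_one⟩
  have z1 : (1:ℝ) ∈ 𝕀c := ⟨zero_le_one, le_rfl⟩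
  have Yr : ∀ t ∈ Icc a b, Y t ∈ 𝕀c := fun t ht => by
    rw [← Ya, ← Yb]; exact ⟨Ym.monotoneOn ha ht ht.1, Ym.monotoneOn ht hb ht.2⟩
  have SY : ∀ t ∈ Icc a b, S (Y t) = t := fun t ht => Yi (hS _ (Yr t ht)).1 ht (hS _ (Yr t ht)).2
  have aff : ∀ t : ℝ, ((X a + w * Y t : ℝ)) = X t := fun t => by simp only [hY]; field_simp; ring
  refine ⟨fun z => τ i (X a + w * z), (fun z : ℂ => (X a + w * z : ℂ)) ⁻¹' U i, S, (Uo i).preimage (by fun_prop), ?_, ?_, ?_, ?_, ?_, ?_, ?_, ?_⟩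
  · rintro _ ⟨x, hx, rfl⟩
    have := aff (S x)
    rw [(hS x hx).2] at this
    rw [mem_preimage, ← ofReal_mul, ← ofReal_add, this]
    exact seg i (mem_image_of_mem _ (hX _ (hS x hx).1).1)
  · exact (an i).comp (by fun_prop) fun z hz => hz
  · intro z hz y hy h
    have := inj i hz hy h
    exact mul_left_cancel₀ (ofReal_ne_zero.2 w0) (add_left_cancel this)
  · intro x hx y hy hxy
    rw [← Ym.lt_iff_lt (hS x hx).1 (hS y hy).1, (hS x hx).2, (hS y hy).2]; exact hxy
  · rw [← Ya]; exact SY a ha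
  · rw [← Yb]; exact SY b hb
  · exact fun t ht => ⟨Y t, Yr t ht, SY t ht⟩
  · intro x hx
    have := aff (S x)
    rw [(hS x hx).2] at this
    change D.γ (S x) = τ i (X a + w * (x:ℂ))
    rw [← ofReal_mul, ← ofReal_add, this]
    exact (hX _ (hS x hx).1).2.symm

structure Arcs (D : JordanDomain) (lam : ℝ) where
  n : ℕ
  i0 : Fin n
  nxt : Equiv.Perm (Fin n)
  a : Fin n → ℝ
  b : Fin n → ℝ
  ab : ∀ j, a j < b j
  bl : ∀ j, b j ≤ a j + D.l
  link : ∀ j, ∃ k : ℤ, a (nxt j) = b j + k * D.l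
  trans : ∀ P : Fin n → Prop, (∀ j, P j ↔ P (nxt j)) → ∀ i j, P i ↔ P j
  sum : ∀ F : ℝ → ℂ, Continuous F → Function.Periodic F D.l → ∑ j, ∫ t in a j..b j, F t = ∫ t in 𝟘..D.l, F t
  sep : ∀ i j, ∀ s ∈ Ioo (a i) (b i), ∀ t ∈ Ioo (a j) (b j), D.γ s = D.γ t → i = j
  cover : ∀ t, ∃ j, ∃ s ∈ Icc (a j) (b j), D.γ s = D.γ t
  σ : Fin n → ℂ → ℂ
  V : Fin n → Set ℂ
  S : Fin n → ℝ → ℝ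
  Vo : ∀ j, IsOpen (V j)
  seg : ∀ j, ofReal '' 𝕀c ⊆ V j
  diff : ∀ j, DifferentiableOn ℂ (σ j) (V j)
  inj : ∀ j, InjOn (σ j) (V j)
  mono : ∀ j, StrictMonoOn (S j) (Icc 0 1)
  S0 : ∀ j, S j 0 = a j
  S1 : ∀ j, S j 1 = b j
  surj : ∀ j, ∀ t ∈ Icc (a j) (b j), ∃ x ∈ 𝕀c, S j x = t
  eq : ∀ j, ∀ x ∈ 𝕀c, D.γ (S j x) = σ j x
  la : Fin n → ℝ
  la1 : ∀ j, lam ≤ la j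
  la2 : ∀ j, la j < 2
  ang : ∀ j, HasCornerAngle D.G (σ j 0) ((2 - la j) * Real.pi)

lemma sum_adj {F : ℝ → ℂ} (hF : Continuous F) : ∀ (n : ℕ) (e : Fin (n + 2) → ℝ),
    ∑ j : Fin (n + 1), ∫ t in e j.castSucc..e j.succ, F t = ∫ t in e 0..e (Fin.last _), F t
  | 0, e => by simp
  | n + 1, e => by
    have := sum_adj hF n (fun i => e i.castSucc)
    rw [Fin.sum_univ_castSucc]
    simp only [← Fin.castSucc_succ] at *
    rw [this]
    exact intervalIntegral.integral_add_adjacent_intervals (hF.intervalIntegrable _ _) (hF.intervalIntegrable _ _)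

lemma cov_adj {s : ℝ} : ∀ (n : ℕ) (e : Fin (n + 2) → ℝ), s ∈ Icc (e 0) (e (Fin.last _)) →
    ∃ j : Fin (n + 1), s ∈ Icc (e j.castSucc) (e j.succ)
  | 0, e => fun h => ⟨0, h⟩
  | n + 1, e => fun h => by
    rcases le_total s (e (Fin.last (n + 1)).castSucc) with h' | h'
    · obtain ⟨j, hj⟩ := cov_adj n (fun i => e i.castSucc) ⟨h.1, h'⟩
      exact ⟨j.castSucc, hj⟩
    · exact ⟨Fin.last _, h', h.2⟩

lemma Arcs.exists {D : JordanDomain} (B : PiecewiseAnalyticBoundary D) {lam : ℝ} (hmin : ∀ i, lam ≤ B.extAngle i) :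
    Nonempty (Arcs D lam) := by
  set E : Set ℂ := range fun i => B.τ i 1 with hE
  have E1 : ∀ i, B.τ i 1 ∈ E := fun i => mem_range_self i
  have E0 : ∀ i, B.τ i 0 ∈ E := fun i => by
    have hm := B.m_pos
    refine ⟨⟨(i.val + (B.m - 1)) % B.m, Nat.mod_lt _ hm⟩, ?_⟩
    change B.τ _ 1 = _
    rw [B.junction]
    congr 2
    simp only [Nat.mod_add_mod]
    rw [show i.val + (B.m - 1) + 1 = i.val + B.m by omega, Nat.add_mod_right, Nat.mod_eq_of_lt i.2]
  have fE : ∀ i, B.τ i 1 ∈ frontier D.G := fun i => by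
    rw [← B.cover]; exact mem_iUnion.2 ⟨i, mem_image_of_mem _ ⟨1, by simp, by simp⟩⟩
  have hl := D.l_pos
  obtain ⟨s0, -, hs0⟩ := D.fr' (fE ⟨0, B.m_pos⟩) 0
  set P : Set ℝ := {t | t ∈ Icc s0 (s0 + D.l) ∧ D.γ t ∈ E} with hP
  have fin : P.Finite := by
    have h1 : (P ∩ Ico s0 (s0 + D.l)).Finite := by
      refine Finite.of_finite_image ((finite_range fun i => B.τ i 1).subset (by rintro _ ⟨t, ht, rfl⟩; exact ht.1.2)) ?_
      intro s hs t ht h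
      rcases le_total s t with h' | h'
      · exact D.mod' h h' (by linarith [hs.2.1, ht.2.2])
      · exact (D.mod' h.symm h' (by linarith [ht.2.1, hs.2.2])).symm
    refine (h1.insert (s0 + D.l)).subset fun t ht => ?_
    rcases ht.1.2.eq_or_lt with h | h
    · exact Or.inl h
    · exact Or.inr ⟨ht, ht.1.1, h⟩
  have m0 : s0 ∈ P := ⟨⟨le_rfl, ℓ⟩, by rw [hs0]; exact E1 _⟩
  have m1 : s0 + D.l ∈ P := ⟨⟨ℓ, le_rfl⟩, by rw [D.γ_periodic, hs0]; exact E1 _⟩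
  have hcard : 1 < fin.toFinset.card := Finset.one_lt_card.2 ⟨s0, by simpa using m0, _, by simpa using m1, ℓ⟩
  obtain ⟨n, hn⟩ : ∃ n, fin.toFinset.card = n + 2 := ⟨_, (Nat.sub_add_cancel hcard).symm⟩
  set e := fin.toFinset.orderEmbOfFin hn with he
  have er : ∀ t, t ∈ P ↔ ∃ i, e i = t := fun t => by
    have := fin.toFinset.range_orderEmbOfFin hn
    rw [← mem_range, this]; simp
  have eP : ∀ i, e i ∈ P := fun i => (er _).2 ⟨i, rfl⟩
  have e0 : e 0 = s0 := by
    obtain ⟨i, hi⟩ := (er _).1 m0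
    exact le_antisymm (hi ▸ e.monotone (Fin.zero_le i)) (eP 0).1.1
  have eL : e (Fin.last _) = s0 + D.l := by
    obtain ⟨i, hi⟩ := (er _).1 m1
    exact le_antisymm (eP _).1.2 (hi ▸ e.monotone (Fin.le_last i))
  have gaps := fun j : Fin (n + 1) => gap D B.U_open B.seg_sub B.analytic B.inj B.cover E0 E1
    (e.strictMono (Fin.castSucc_lt_succ (i := j))) (by linarith [(eP j.castSucc).1.1, (eP j.succ).1.2]) (fun t ht htE => by
      obtain ⟨i, hi⟩ := (er t).1 ⟨⟨(eP _).1.1.trans ht.1.le, ht.2.le.trans (eP _).1.2⟩, htE⟩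
      rw [← hi] at ht
      have h1 := e.lt_iff_lt.1 ht.1
      have h2 := e.lt_iff_lt.1 ht.2
      rw [Fin.lt_def] at h1 h2
      simp at h1 h2
      omega)
  choose σ V S c1 c2 c3 c4 c5 c6 c7 c8 c9 using gaps
  have hla : ∀ j : Fin (n + 1), ∃ i, B.τ i 1 = σ j 0 := fun j => by
    have := c9 j 0 ⟨le_rfl, zero_le_one⟩
    rw [ofReal_zero] at this
    rw [← this, c6]
    exact (eP _).2
  choose ix hix using hla
  refine ⟨{
    n := n + 1
    i0 := 0
    nxt := finRotate (n + 1)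
    a := fun j => e j.castSucc
    b := fun j => e j.succ
    ab := fun j => e.strictMono Fin.castSucc_lt_succ
    bl := fun j => by linarith [(eP j.castSucc).1.1, (eP j.succ).1.2]
    link := ?_, trans := ?_, sum := ?_, sep := ?_, cover := ?_
    σ := σ, V := V, S := S, Vo := c1, seg := c2, diff := c3, inj := c4, mono := c5, S0 := c6, S1 := c7, surj := c8, eq := c9
    la := fun j => B.extAngle (ix j)
    la1 := fun j => hmin _
    la2 := fun j => (B.extAngle_mem _).2
    ang := fun j => by rw [← hix j]; exact B.extAngle_spec _ }⟩
  · intro j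
    by_cases hj : j = Fin.last n
    · subst hj
      refine ⟨-1, ?_⟩
      rw [finRotate_last, Fin.castSucc_zero, Fin.succ_last, e0, eL]; push_cast; ring
    · have hj' : j.val < n := Fin.val_lt_last hj
      refine ⟨0, ?_⟩
      rw [finRotate_of_lt hj']
      simp only [Int.cast_zero, zero_mul, add_zero]
      rfl
  · intro Q hQ
    have : ∀ k (hk : k < n + 1), Q ⟨k, hk⟩ ↔ Q 0 := by
      intro k
      induction k with
      | zero => intro hk; rfl
      | succ k ih => intro hk; rw [← ih (by omega), hQ ⟨k, by omega⟩, finRotate_of_lt (by omega)]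
    exact fun i j => (this i.1 i.2).trans (this j.1 j.2).symm
  · intro F hF hFp
    rw [sum_adj hF n e, e0, eL, hFp.intervalIntegral_add_eq s0 0, zero_add]
  · have key : ∀ i j : Fin (n + 1), i < j → ∀ s ∈ Ioo (e i.castSucc) (e i.succ), ∀ t ∈ Ioo (e j.castSucc) (e j.succ), D.γ s ≠ D.γ t := by
      intro i j hij s hs t ht h
      have : e i.succ ≤ e j.castSucc := e.monotone (by rw [Fin.le_def]; simpa using hij)
      have h2 := D.mod' h (by linarith [hs.2, ht.1]) (by linarith [ht.2, hs.1, (eP j.succ).1.2, (eP i.castSucc).1.1])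
      linarith [hs.2, ht.1]
    intro i j s hs t ht h
    rcases lt_trichotomy i j with h' | h' | h'
    exacts [absurd h (key i j h' s hs t ht), h', absurd h.symm (key j i h' t ht s hs)]
  · intro t
    obtain ⟨s, hs, h⟩ := D.fr' (D.fr t) s0
    obtain ⟨j, hj⟩ := cov_adj n e (s := s) (by rw [e0, eL]; exact Ico_subset_Icc_self hs)
    exact ⟨j, s, hj, h⟩

namespace Arcs
variable {D : JordanDomain} {lam : ℝ} (A : Arcs D lam)

lemma Vx {j : Fin A.n} {x : ℝ} (hx : x ∈ 𝕀c) : (x:ℂ) ∈ A.V j := A.seg j (mem_image_of_mem _ hx)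

lemma Smem {j : Fin A.n} {x : ℝ} (hx : x ∈ 𝕀c) : A.S j x ∈ Icc (A.a j) (A.b j) := by
  rw [← A.S0, ← A.S1]
  exact ⟨(A.mono j).monotoneOn ⟨le_rfl, zero_le_one⟩ hx hx.1, (A.mono j).monotoneOn hx ⟨zero_le_one, le_rfl⟩ hx.2⟩

lemma dat {j : Fin A.n} {x : ℝ} (hx : x ∈ 𝕀c) : DifferentiableAt ℂ (A.σ j) x :=
  (A.diff j).differentiableAt ((A.Vo j).mem_nhds (A.Vx hx))

lemma dcont (j : Fin A.n) : ContinuousOn (fun x : ℝ => ‖deriv (A.σ j) x‖) (Icc 0 1) :=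
  (((A.diff j).deriv (A.Vo j)).continuousOn.comp continuous_ofReal.continuousOn fun _ hx => A.Vx hx).norm

lemma var {j : Fin A.n} {x y : ℝ} (hx : x ∈ 𝕀c) (hy : y ∈ 𝕀c) (hxy : x ≤ y) :
    eVariationOn (fun u : ℝ => A.σ j u) (Icc x y) = ENNReal.ofReal (A.S j y - A.S j x) := by
  have sub : Icc x y ⊆ Icc 0 1 := fun u hu => ⟨hx.1.trans hu.1, hu.2.trans hy.2⟩
  have hm := (A.mono j).monotoneOn.mono sub
  have h1 := eVariationOn.comp_eq_of_monotoneOn D.γ (A.S j) hm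
  have h2 : A.S j '' Icc x y = Icc (A.S j x) (A.S j y) := by
    apply subset_antisymm
    · rintro _ ⟨u, hu, rfl⟩
      exact ⟨hm ⟨le_rfl, hxy⟩ hu hu.1, hm hu ⟨hxy, le_rfl⟩ hu.2⟩
    · intro t ht
      obtain ⟨u, hu, rfl⟩ := A.surj j t ⟨(A.Smem hx).1.trans ht.1, ht.2.trans (A.Smem hy).2⟩
      exact ⟨u, ⟨((A.mono j).le_iff_le hx hu).1 ht.1, ((A.mono j).le_iff_le hu hy).1 ht.2⟩, rfl⟩
  rw [h2, D.γ_unitSpeed _ _ ((A.mono j).monotoneOn hx hy hxy) (by linarith [(A.Smem (j := j) hx).1, (A.Smem (j := j) hy).2, A.bl j])] at h1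
  rw [← h1]
  exact eVariationOn.congr fun u hu => (A.eq j u (sub hu)).symm

lemma Slow {j : Fin A.n} {x y : ℝ} (hx : x ∈ 𝕀c) (hy : y ∈ 𝕀c) (hxy : x ≤ y) :
    ‖A.σ j y - A.σ j x‖ ≤ A.S j y - A.S j x := by
  have h := eVariationOn.edist_le (fun u : ℝ => A.σ j u) (s := Icc x y) (x := y) (y := x) ⟨hxy, le_rfl⟩ ⟨le_rfl, hxy⟩
  rw [A.var hx hy hxy, edist_dist, dist_eq_norm] at h
  exact (ENNReal.ofReal_le_ofReal_iff (sub_nonneg.2 ((A.mono j).monotoneOn hx hy hxy))).1 h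

lemma Supp {j : Fin A.n} {x y C : ℝ} (hx : x ∈ 𝕀c) (hy : y ∈ 𝕀c) (hxy : x ≤ y)
    (hC : ∀ u ∈ Icc x y, ‖deriv (A.σ j) u‖ ≤ C) : A.S j y - A.S j x ≤ C * (y - x) := by
  have C0 : 0 ≤ C := (norm_nonneg _).trans (hC x ⟨le_rfl, hxy⟩)
  lift C to NNReal using C0
  have sub : Icc x y ⊆ Icc 0 1 := fun u hu => ⟨hx.1.trans hu.1, hu.2.trans hy.2⟩
  have h1 : LipschitzOnWith C (fun u : ℝ => A.σ j u) (Icc x y) :=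
    Convex.lipschitzOnWith_of_nnnorm_hasDerivWithin_le (𝕜 := ℝ) (f' := fun u : ℝ => deriv (A.σ j) u) (convex_Icc x y)
      (fun u hu => ((A.dat (sub hu)).hasDerivAt.comp_ofReal).hasDerivWithinAt) fun u hu => hC u hu
  have h2 := h1.comp_eVariationOn_le (g := id) (s := Icc x y) fun u hu => hu
  rw [Function.comp_id, A.var hx hy hxy, eVariationOn_id_Icc] at h2
  rw [← ENNReal.ofReal_coe_nnreal, ← ENNReal.ofReal_mul C.coe_nonneg] at h2
  exact (ENNReal.ofReal_le_ofReal_iff (mul_nonneg C.coe_nonneg (sub_nonneg.2 hxy))).1 h2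

lemma Scont (j : Fin A.n) : ContinuousOn (A.S j) (Icc 0 1) := by
  obtain ⟨C, hC⟩ := isCompact_Icc.exists_bound_of_continuousOn (A.dcont j)
  simp only [norm_norm] at hC
  have C0 : 0 ≤ C := (norm_nonneg _).trans (hC 0 𝔰)
  refine (LipschitzOnWith.of_dist_le_mul (K := ⟨C, C0⟩) fun x hx y hy => ?_).continuousOn
  have key : ∀ x ∈ 𝕀c, ∀ y ∈ 𝕀c, x ≤ y → dist (A.S j y) (A.S j x) ≤ C * dist y x := fun x hx y hy h => by
    rw [Real.dist_eq, Real.dist_eq, abs_of_nonneg (sub_nonneg.2 ((A.mono j).monotoneOn hx hy h)), abs_of_nonneg (sub_nonneg.2 h)]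
    exact A.Supp hx hy h fun u hu => hC u ⟨hx.1.trans hu.1, hu.2.trans hy.2⟩
  rcases le_total x y with h | h
  · rw [dist_comm, dist_comm x]; exact key x hx y hy h
  · exact key y hy x hx h

lemma Sder {j : Fin A.n} {x : ℝ} (hx : x ∈ 𝕀o) : HasDerivWithinAt (A.S j) ‖deriv (A.σ j) x‖ (Ioi x) x := by
  have hx' := Ioo_subset_Icc_self hx
  rw [hasDerivWithinAt_iff_tendsto_slope' 𝔰, tendsto_order]
  have hI : ∀ᶠ y in 𝓝[>] x, y ∈ Ioo x 1 := Ioo_mem_nhdsGT hx.2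
  constructor
  · intro c hc
    have h1 := ((hasDerivWithinAt_iff_tendsto_slope' (s := Ioi x) 𝔰).1 (A.dat (j := j) hx').hasDerivAt.comp_ofReal.hasDerivWithinAt).norm
    filter_upwards [h1.eventually (lt_mem_nhds hc), hI] with y h2 hy
    have hp : 0 < y - x := sub_pos.2 hy.1
    refine h2.trans_le ?_
    rw [slope, slope, norm_smul, norm_inv, Real.norm_of_nonneg hp.le, smul_eq_mul]
    exact mul_le_mul_of_nonneg_left (A.Slow hx' ⟨hx.1.le.trans hy.1.le, hy.2.le⟩ hy.1.le) (inv_nonneg.2 hp.le)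
  · intro c hc
    obtain ⟨d, hd, hdc⟩ := exists_between hc
    have h1 := ((A.dcont j).continuousAt (Icc_mem_nhds hx.1 hx.2)).eventually (gt_mem_nhds hd)
    obtain ⟨ε, hε, h2⟩ := Metric.eventually_nhds_iff.1 h1
    filter_upwards [Ioo_mem_nhdsGT (show x < x + ε by linarith), hI] with y hy' hy
    have hp : 0 < y - x := sub_pos.2 hy.1
    refine lt_of_le_of_lt ?_ hdc
    rw [slope, vsub_eq_sub, smul_eq_mul, inv_mul_le_iff₀ hp, mul_comm]
    refine A.Supp hx' ⟨hx.1.le.trans hy.1.le, hy.2.le⟩ hy.1.le fun u hu => (h2 ?_).le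
    rw [Real.dist_eq, abs_of_nonneg (by linarith [hu.1])]
    linarith [hu.2, hy'.2]

lemma int {F : ℂ → ℂ} (hF : Continuous F) :
    ∑ j, ∫ x in 𝟘..1, F (A.σ j x) * ‖deriv (A.σ j) x‖ = ∫ t in 𝟘..D.l, F (D.γ t) := by
  rw [← A.sum (fun t => F (D.γ t)) (hF.comp D.γ_cont) (fun t => by simp only [D.γ_periodic t])]
  refine Finset.sum_congr rfl fun j _ => ?_
  have h := intervalIntegral.integral_deriv_smul_comp'' (a := 0) (b := 1) (f := A.S j) (f' := fun x => ‖deriv (A.σ j) x‖)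
    (g := fun t => F (D.γ t)) (by rw [uIcc_of_le zero_le_one]; exact A.Scont j) (by simpa using fun x h1 h2 => A.Sder ⟨h1, h2⟩)
    (by rw [uIcc_of_le zero_le_one]; exact A.dcont j) (hF.comp D.γ_cont).continuousOn
  rw [A.S0, A.S1] at h
  rw [← h]
  refine intervalIntegral.integral_congr fun x hx => ?_
  rw [uIcc_of_le zero_le_one] at hx
  simp only [Function.comp, A.eq j x hx, real_smul, mul_comm]
end Arcs

def Jet (c : ℂ → ℂ) (p e : ℂ) (β : ℝ) : Prop := ∃ K > 0, ∃ η > 0, ∀ w, w ≠ 0 → ‖w‖ < η → c w ≠ p ∧ ‖c w - p‖ ≤ K * ‖w‖ ∧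
  ∃ k : ℤ, |arg ((c w - p) / e) - β - arg w - 2 * Real.pi * k| ≤ K * ‖c w - p‖

lemma Jet.of {c : ℂ → ℂ} {e : ℂ} {β : ℝ} {U : Set ℂ} (hU : U ∈ 𝓝 0) (hd : DifferentiableOn ℂ c U) (h0 : deriv c 0 ≠ 0) (he : ‖e‖ = 1)
    (h : deriv c 0 = ‖deriv c 0‖ * e * exp ((β : ℝ) * I)) : Jet c (c 0) e β := by
  set d := deriv c 0 with hd'
  have e0 : e ≠ 0 := by rintro rfl; simp at he
  have dn : 0 < ‖d‖ := norm_pos_iff.2 h0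
  set q : ℂ → ℂ := fun w => dslope c 0 w / d with hq
  have q0 : q 0 = 1 := by simp only [hq, dslope_same]; exact div_self h0
  have dq : DifferentiableAt ℂ q 0 := (((differentiableOn_dslope hU).2 hd).differentiableAt hU).div_const d
  obtain ⟨C, C0, hC⟩ := dq.isBigO_sub.exists_pos
  rw [Asymptotics.isBigOWith_iff] at hC
  obtain ⟨η, η0, hη⟩ := Metric.eventually_nhds_iff.1 hC
  refine ⟨2 * ‖d‖ + 3 * C / ‖d‖, ℘, min η (1 / (2 * C)), lt_min η0 ℘, fun w w0 hw => ?_⟩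
  have h1 : ‖q w - 1‖ ≤ C * ‖w‖ := by simpa [q0] using @hη w (by simpa using hw.trans_le 𝔩)
  have h2 : C * ‖w‖ ≤ 1 / 2 := by
    have := (hw.trans_le 𝔯).le
    rw [le_div_iff₀ ℘] at this; linarith
  have h3 := h1.trans h2
  have hcw : c w - c 0 = d * w * q w := by
    have := sub_smul_dslope c 0 w
    rw [sub_zero, smul_eq_mul] at this
    simp only [hq]; rw [← this]; field_simp
  have hqn : 1 / 2 ≤ ‖q w‖ := by
    have := norm_sub_norm_le 1 (q w); rw [norm_one, norm_sub_rev] at this; linarith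
  have hqn' : ‖q w‖ ≤ 2 := by
    have := norm_sub_norm_le (q w) 1; rw [norm_one] at this; linarith
  have qn0 : q w ≠ 0 := by intro h; rw [h] at hqn; simp at hqn; linarith
  have hcn : ‖c w - c 0‖ = ‖d‖ * ‖w‖ * ‖q w‖ := by rw [hcw, norm_mul, norm_mul]
  have wn := norm_pos_iff.2 w0
  refine ⟨fun h => ?_, ?_, ?_⟩
  · rw [h, sub_self] at hcw
    exact mul_ne_zero (mul_ne_zero h0 w0) qn0 hcw.symm
  · rw [hcn]
    have : 0 ≤ 3 * C / ‖d‖ * ‖w‖ := by positivity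
    nlinarith [mul_le_mul_of_nonneg_left hqn' (mul_pos dn wn).le]
  · have hdiv : (c w - c 0) / e = ‖d‖ * (exp (β * I) * (w * q w)) := by
      rw [hcw]; nth_rw 1 [h]; field_simp
    have ha : ((arg ((c w - c 0) / e) : ℝ) : Real.Angle) = ((β + arg w + arg (q w) : ℝ) : Real.Angle) := by
      rw [hdiv, arg_real_mul _ dn, arg_mul_coe_angle (exp_ne_zero _) (mul_ne_zero w0 qn0), arg_mul_coe_angle w0 qn0,
        show ((arg (exp (β * I)) : ℝ) : Real.Angle) = β by rw [exp_mul_I]; simpa using arg_cos_add_sin_mul_I_coe_angle (β : Real.Angle)]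
      simp [add_assoc]
    obtain ⟨k, hk⟩ := Real.Angle.angle_eq_iff_two_pi_dvd_sub.1 ha
    refine ⟨k, ?_⟩
    have : arg ((c w - c 0) / e) - β - arg w - 2 * Real.pi * k = arg (q w) := by linarith
    rw [this]
    have h4 := norm_log_one_add_half_le_self h3
    rw [add_sub_cancel] at h4
    have h5 := (abs_im_le_norm (log (q w))).trans h4
    rw [log_im] at h5
    refine h5.trans ?_
    have h6 : ‖w‖ ≤ 2 * (‖c w - c 0‖ / ‖d‖) := by
      rw [hcn, mul_assoc, mul_div_cancel_left₀ _ dn.ne']; nlinarith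
    have h7 : 0 ≤ 2 * ‖d‖ * ‖c w - c 0‖ := by positivity
    calc 3 / 2 * ‖q w - 1‖ ≤ 3 / 2 * (C * (2 * (‖c w - c 0‖ / ‖d‖))) := by gcongr; exact h1.trans (by gcongr)
      _ = 3 * C / ‖d‖ * ‖c w - c 0‖ := by ring
      _ ≤ _ := by rw [add_mul]; linarith

def sec (p e : ℂ) (b K δ : ℝ) : Set ℂ := {z | z ≠ p ∧ ‖z - p‖ < δ ∧ |arg ((z - p) / e)| < b - K * ‖z - p‖}

lemma arg_pol {e : ℂ} (he : ‖e‖ = 1) {r θ : ℝ} (hr : 0 < r) (hθ : |θ| < Real.pi) : arg (r * e * exp (θ * I) / e) = θ := by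
  have e0 : e ≠ 0 := by rintro rfl; simp at he
  rw [show (r * e * exp (θ * I) / e : ℂ) = r * exp (θ * I) by field_simp, arg_real_mul _ hr, exp_mul_I, arg_cos_add_sin_mul_I]
  exact ⟨(abs_lt.1 hθ).1, (abs_lt.1 hθ).2.le⟩

lemma nrm_pol {e : ℂ} (he : ‖e‖ = 1) {r θ : ℝ} (hr : 0 < r) : ‖(r * e * exp (θ * I) : ℂ)‖ = r := by
  rw [norm_mul, norm_mul, he, norm_exp_ofReal_mul_I, norm_real, Real.norm_of_nonneg hr.le]; ring

lemma sec.pc {p e : ℂ} {b K δ : ℝ} (he : ‖e‖ = 1) (hK : 0 < K) (hb : b ≤ Real.pi) : IsPreconnected (sec p e b K δ) := by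
  have e0 : e ≠ 0 := by rintro rfl; simp at he
  have hc : Convex ℝ {q : ℝ × ℝ | 0 < q.1 ∧ q.1 < δ ∧ |q.2| + K * q.1 < b} := by
    intro q hq q' hq' s t hs ht hst
    obtain rfl : t = 1 - s := by linarith
    obtain ⟨h1, h2, h3⟩ := hq
    obtain ⟨h1', h2', h3'⟩ := hq'
    have h4 : |s * q.2 + (1 - s) * q'.2| ≤ s * |q.2| + (1 - s) * |q'.2| := by
      refine (abs_add_le _ _).trans ?_
      rw [abs_mul, abs_mul, abs_of_nonneg hs, abs_of_nonneg ht]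
    refine ⟨?_, ?_, ?_⟩ <;> simp only [Prod.fst_add, Prod.snd_add, Prod.smul_fst, Prod.smul_snd, smul_eq_mul]
    · rcases hs.eq_or_lt with rfl | h <;> nlinarith
    · rcases hs.eq_or_lt with rfl | h <;> nlinarith
    · rcases hs.eq_or_lt with rfl | h
      · simpa using h3'
      · nlinarith [mul_lt_mul_of_pos_left h3 h, mul_le_mul_of_nonneg_left h3'.le ht]
  have : sec p e b K δ = (fun q : ℝ × ℝ => p + q.1 * e * exp (q.2 * I)) '' {q : ℝ × ℝ | 0 < q.1 ∧ q.1 < δ ∧ |q.2| + K * q.1 < b} := by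
    apply subset_antisymm
    · rintro z ⟨h1, h2, h3⟩
      refine ⟨(‖z - p‖, arg ((z - p) / e)), ⟨norm_pos_iff.2 (sub_ne_zero.2 h1), h2, by simpa using by linarith⟩, ?_⟩
      have := norm_mul_exp_arg_mul_I ((z - p) / e)
      rw [norm_div, he, div_one] at this
      change p + (‖z - p‖ : ℂ) * e * exp (_ * I) = z
      rw [mul_right_comm, this]; field_simp; ring
    · rintro _ ⟨⟨r, θ⟩, ⟨h1, h2, h3⟩, rfl⟩
      simp only at h1 h2 h3
      have hθ : |θ| < Real.pi := by nlinarith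
      refine ⟨?_, ?_, ?_⟩ <;> simp only [add_sub_cancel_left, nrm_pol he h1, arg_pol he h1 hθ]
      · intro h
        have := nrm_pol (θ := θ) he h1
        rw [add_eq_left.1 h] at this; simp at this; exact h1.ne this
      · exact h2
      · linarith
  rw [this]
  exact hc.isPreconnected.image _ (by fun_prop)

lemma zk {x : ℝ} {k : ℤ} (h : |x| < 2 * Real.pi) (hx : x = 2 * Real.pi * k) : k = 0 := by
  rw [hx, abs_mul, abs_of_pos Real.two_pi_pos] at h
  have : |(k:ℝ)| < 1 := by nlinarith [Real.pi_pos]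
  have h2 : |k| < 1 := by exact_mod_cast this
  exact Int.abs_lt_one_iff.1 h2

lemma Jet.avoid {c : ℂ → ℂ} {p e : ℂ} {β : ℝ} (hJ : Jet c p e β) (hβ : |β| ≤ Real.pi) :
    ∃ K > 0, ∃ η > 0, ∀ x : ℝ, 0 < x → x < η → ∀ δ, ∀ K' ≥ K, c x ∉ sec p e |β| K' δ := by
  obtain ⟨K, K0, η, η0, h⟩ := hJ
  refine ⟨2 * K, ℘, η, η0, fun x x0 hx δ K' hK' hs => ?_⟩
  obtain ⟨h1, h2, h3⟩ := hs
  obtain ⟨-, -, k, hk⟩ := h x (by exact_mod_cast x0.ne') (by rwa [norm_real, Real.norm_of_nonneg x0.le])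
  rw [arg_ofReal_of_nonneg x0.le, sub_zero] at hk
  set θ := arg ((c x - p) / e)
  have hn : 0 < ‖c x - p‖ := norm_pos_iff.2 (sub_ne_zero.2 h1)
  have h4 : 2 * K * ‖c x - p‖ ≤ K' * ‖c x - p‖ := by gcongr
  have h5 : 0 < K * ‖c x - p‖ := by positivity
  obtain ⟨a1, a2⟩ := abs_le.1 hk
  obtain ⟨b1, b2⟩ := abs_lt.1 h3
  have : k = 0 := by
    have : |2 * Real.pi * (k:ℝ)| < 2 * Real.pi := by
      rcases abs_cases β with ⟨e1, _⟩ | ⟨e1, _⟩ <;> rw [abs_lt] <;> constructor <;> linarith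
    exact zk this rfl
  subst this
  simp only [Int.cast_zero, mul_zero, sub_zero] at a1 a2
  rcases abs_cases β with ⟨e1, _⟩ | ⟨e1, _⟩ <;> linarith

lemma Jet.enter {c : ℂ → ℂ} {p e v : ℂ} {β b K δ : ℝ} (hJ : Jet c p e β) (hv : v ≠ 0) (hb : b ≤ Real.pi) (h : |β + arg v| < b) (hδ : 0 < δ) :
    ∀ᶠ t : ℝ in 𝓝[>] 0, c (t * v) ∈ sec p e b K δ := by
  obtain ⟨K', K0, η, η0, hJ⟩ := hJ
  have vn := norm_pos_iff.2 hv
  have t1 : ∀ ε > 0, ∀ C > 0, ∀ᶠ t : ℝ in 𝓝[>] 0, C * t < ε := fun ε hε C hC => by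
    filter_upwards [Ioo_mem_nhdsGT (show 𝟘 < ε / C by positivity)] with t ht
    have := ht.2; rw [lt_div_iff₀ hC] at this; linarith
  filter_upwards [self_mem_nhdsWithin, t1 η η0 _ vn, t1 δ hδ (K' * ‖v‖) ℘,
    t1 _ (sub_pos.2 h) ((K' + |K|) * (K' * ‖v‖)) ℘] with t (t0 : 0 < t) h1 h2 h3
  have htn : ‖(t * v : ℂ)‖ = ‖v‖ * t := by rw [norm_mul, norm_real, Real.norm_of_nonneg t0.le, mul_comm]
  obtain ⟨n1, n2, k, hk⟩ := hJ (t * v) (mul_ne_zero (by exact_mod_cast t0.ne') hv) (by rwa [htn])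
  rw [arg_real_mul _ t0] at hk
  rw [htn, ← mul_assoc] at n2
  have h4 : (K' + |K|) * ‖c (t * v) - p‖ ≤ (K' + |K|) * (K' * ‖v‖) * t := by
    rw [mul_assoc]; gcongr
  have h5 : 0 ≤ |K| * ‖c (t * v) - p‖ := by positivity
  have h6 : K * ‖c (t * v) - p‖ ≤ |K| * ‖c (t * v) - p‖ := by gcongr; exact le_abs_self K
  set θ := arg ((c (t * v) - p) / e) with hθ
  have h7 := abs_le.1 (abs_arg_le_pi ((c (t * v) - p) / e))
  rw [← hθ] at h7
  obtain ⟨a1, a2⟩ := abs_le.1 hk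
  obtain ⟨b1, b2⟩ := abs_le.1 (le_refl |β + arg v|)
  have : k = 0 := by
    have : |2 * Real.pi * (k:ℝ)| < 2 * Real.pi := by rw [abs_lt]; constructor <;> linarith
    exact zk this rfl
  subst this
  simp only [Int.cast_zero, mul_zero, sub_zero] at a1 a2
  refine ⟨n1, n2.trans_lt h2, ?_⟩
  rw [← hθ, abs_lt]
  constructor <;> linarith

lemma arg_small {μ : ℝ} (hμ : 0 < μ) : ∃ κ > 0, ∀ w : ℂ, 0 < w.re → |w.im| ≤ κ * w.re → |arg w| < μ := by
  have h1 : ContinuousAt (fun t : ℝ => |arg (1 + t * I)|) 0 := by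
    refine ContinuousAt.abs (ContinuousAt.comp (g := arg) ?_ (by fun_prop))
    simpa using continuousAt_arg one_mem_slitPlane
  have h2 := h1.eventually (gt_mem_nhds (show |arg (1 + 𝟘 * I)| < μ by simpa using hμ))
  obtain ⟨κ, κ0, h3⟩ := Metric.nhds_basis_closedBall.eventually_iff.1 h2
  refine ⟨κ, κ0, fun w hw h => ?_⟩
  have : w = w.re * (1 + (w.im / w.re : ℝ) * I) := by
    apply Complex.ext <;> simp; field_simp
  rw [this, arg_real_mul _ hw]
  refine h3 ?_
  rw [mem_closedBall, Real.dist_eq, sub_zero, abs_div, abs_of_pos hw, div_le_iff₀ hw]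
  exact h

lemma Jet.flat {c c' : ℂ → ℂ} {p e : ℂ} {β β' : ℝ} (hJ : Jet c p e β) (hJ' : Jet c' p e β') (h1 : 0 < |β - β'|) (h2 : |β - β'| < 2 * Real.pi) :
    ∃ κ > 0, ∃ r > 0, ∀ w : ℂ, 0 < w.re → |w.im| ≤ κ * w.re → ‖w‖ < r → ∀ x : ℝ, 0 < x → x < r → c w ≠ c' x := by
  obtain ⟨K, K0, η, η0, h⟩ := hJ
  obtain ⟨K', K0', η', η0', h'⟩ := hJ'
  set μ := min |β - β'| (2 * Real.pi - |β - β'|) with hμ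
  have μ0 : 0 < μ := lt_min h1 ℓ
  obtain ⟨κ, κ0, ha⟩ := arg_small (half_pos μ0)
  refine ⟨κ, κ0, min η (min η' (μ / 2 / ((K + K') * K))), ℘, fun w w1 w2 w3 x x0 x1 e1 => ?_⟩
  have w0 : w ≠ 0 := by rintro rfl; simp at w1
  obtain ⟨-, g, k, hk⟩ := h w w0 (w3.trans_le 𝔩)
  obtain ⟨-, -, k', hk'⟩ := h' x (by exact_mod_cast x0.ne')
    (by rw [norm_real, Real.norm_of_nonneg x0.le]; exact x1.trans_le ((min_le_right _ _).trans 𝔩))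
  rw [← e1, arg_ofReal_of_nonneg x0.le, sub_zero] at hk'
  have h3 : (K + K') * ‖c w - p‖ < μ / 2 := by
    have := w3.trans_le ((min_le_right _ _).trans 𝔯)
    rw [lt_div_iff₀ ℘] at this
    nlinarith [mul_le_mul_of_nonneg_left g (add_pos K0 K0').le]
  have h4 := ha w w1 w2
  set θ := arg ((c w - p) / e)
  obtain ⟨a1, a2⟩ := abs_le.1 hk
  obtain ⟨b1, b2⟩ := abs_le.1 hk'
  obtain ⟨d1, d2⟩ := abs_lt.1 h4
  have m1 : μ ≤ |β - β'| := min_le_left _ _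
  have m2 : μ ≤ 2 * Real.pi - |β - β'| := min_le_right _ _
  have k0 : k - k' = 0 := by
    have : |2 * Real.pi * ((k - k' : ℤ):ℝ)| < 2 * Real.pi := by
      push_cast
      rcases abs_cases (β - β') with ⟨e1, _⟩ | ⟨e1, _⟩ <;> rw [abs_lt] <;> constructor <;> linarith
    exact zk this rfl
  obtain rfl : k = k' := by omega
  rcases abs_cases (β - β') with ⟨e1, _⟩ | ⟨e1, _⟩ <;> linarith

lemma arg_add_neg {w : ℂ} (hw : w ≠ 0) : |arg w| + |arg (-w)| = Real.pi := by
  have hp := Real.pi_pos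
  have l := neg_pi_lt_arg w
  have u := arg_le_pi w
  rcases lt_trichotomy w.im 0 with h | h | h
  · rw [arg_neg_eq_arg_add_pi_of_im_neg h, abs_of_neg (arg_neg_iff.2 h), abs_of_nonneg ℓ]; ring
  · have hr : w.re ≠ 0 := fun h' => hw (Complex.ext h' h)
    rcases lt_or_gt_of_ne hr with h' | h'
    · rw [arg_eq_pi_iff.2 ⟨h', h⟩, arg_eq_zero_iff.2 ⟨by simpa using h'.le, by simpa using h⟩, abs_of_pos hp, abs_zero, add_zero]
    · rw [arg_eq_zero_iff.2 ⟨h'.le, h⟩, arg_eq_pi_iff.2 ⟨by simpa using h', by simpa using h⟩, abs_of_pos hp, abs_zero, zero_add]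
  · rw [arg_neg_eq_arg_sub_pi_of_im_pos h, abs_of_nonneg (arg_nonneg_iff.2 h.le), abs_of_nonpos ℓ]; ring

lemma corner {G : Set ℂ} (hG : IsOpen G) {p e : ℂ} (he : ‖e‖ = 1) {b K δ α : ℝ} (b0 : 0 ≤ b) (hb : b < Real.pi) (δ0 : 0 < δ) {ca cb : ℝ}
    (hA : ∀ z ∈ sec p e b K δ, G.indicator (fun _ => (1:ℝ)) z = ca) (hB : ∀ z ∈ sec p (-e) (Real.pi - b) K δ, G.indicator (fun _ => (1:ℝ)) z = cb)
    (h : HasCornerAngle G p α) : α = 2 * Real.pi * cb + (ca - cb) * (2 * b) := by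
  have hpi := Real.pi_pos
  set F : ℝ → ℝ → ℝ := fun r θ => G.indicator (fun _ => (1:ℝ)) (p + r * exp (θ * I)) with hF
  have hms : ∀ r : ℝ, MeasurableSet {θ : ℝ | p + r * exp (θ * I) ∈ G} := fun r => (hG.preimage (by fun_prop)).measurableSet
  have hFi : ∀ r, F r = {θ : ℝ | p + r * exp (θ * I) ∈ G}.indicator 1 := fun r => rfl
  have hFp : ∀ r, Function.Periodic (F r) 𝕥 := fun r θ => by
    simp only [hF]; congr 3
    rw [ofReal_add, add_mul, exp_add]; push_cast; rw [exp_two_pi_mul_I, mul_one]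
  set ψ := arg e
  have hψ : exp (ψ * I) = e := by have := norm_mul_exp_arg_mul_I e; rwa [he, ofReal_one, one_mul] at this
  have h1 : ∀ r : ℝ, (volume {θ : ℝ | θ ∈ Ico 0 𝕥 ∧ p + r * exp (θ * I) ∈ G}).toReal = ∫ φ in (-Real.pi)..Real.pi, F r (φ + ψ) := by
    intro r
    rw [intervalIntegral.integral_comp_add_right (F r), show Real.pi + ψ = (-Real.pi + ψ) + 2 * Real.pi by ring,
      (hFp r).intervalIntegral_add_eq _ 0, zero_add, intervalIntegral.integral_of_le ℓ, ← integral_Ico_eq_integral_Ioc, hFi,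
      integral_indicator_one (hms r), measureReal_restrict_apply (hms r), inter_comm]
    rfl
  have h2 : Tendsto (fun r : ℝ => ∫ φ in (-Real.pi)..Real.pi, F r (φ + ψ)) (𝓝[>] 0)
      (𝓝 (∫ φ in (-Real.pi)..Real.pi, cb + (Ioo (-b) b).indicator (fun _ => ca - cb) φ)) := by
    refine intervalIntegral.tendsto_integral_filter_of_dominated_convergence (fun _ => 1) (Eventually.of_forall fun r => ?_)
      (Eventually.of_forall fun r => ae_of_all _ fun φ _ => ?_) 𝔰 ?_
    · refine Measurable.aestronglyMeasurable ?_
      simp only [hFi]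
      exact (measurable_one.indicator (hms r)).comp (measurable_add_const ψ)
    · simp only [hF, indicator]; split_ifs <;> simp
    · have hae : ∀ x : ℝ, ∀ᵐ φ : ℝ, φ ≠ x := fun x => by simp [ae_iff, measure_singleton]
      filter_upwards [hae b, hae (-b), hae Real.pi] with φ n1 n2 n3 hφ
      rw [uIoc_of_le ℓ] at hφ
      have hφ' : |φ| < Real.pi := abs_lt.2 ⟨hφ.1, lt_of_le_of_ne hφ.2 n3⟩
      have small : ∀ ε > 0, ∀ᶠ r : ℝ in 𝓝[>] 0, 0 < r ∧ r < δ ∧ |K| * r < ε := fun ε hε => by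
        filter_upwards [self_mem_nhdsWithin, Ioo_mem_nhdsGT (show 𝟘 < min δ (ε / (|K| + 1)) by positivity)] with r h0 hr
        have := hr.2.trans_le 𝔯
        rw [lt_div_iff₀ ℘] at this
        exact ⟨h0, hr.2.trans_le 𝔩, by nlinarith [hr.1]⟩
      have mem : ∀ {e' : ℂ} {b' φ' r : ℝ}, ‖e'‖ = 1 → |φ'| < Real.pi → 0 < r → r < δ → |K| * r < b' - |φ'| →
          p + r * e' * exp (φ' * I) ∈ sec p e' b' K δ := fun {e' b' φ' r} he' hp r0 rδ hr => by
        refine ⟨fun h => ?_, by rwa [add_sub_cancel_left, nrm_pol he' r0], ?_⟩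
        · have := nrm_pol (θ := φ') he' r0
          rw [add_eq_left.1 h] at this; simp at this; exact r0.ne this
        · rw [add_sub_cancel_left, nrm_pol he' r0, arg_pol he' r0 hp]; nlinarith [le_abs_self K]
      have hFe : ∀ r : ℝ, F r (φ + ψ) = G.indicator (fun _ => (1:ℝ)) (p + r * e * exp (φ * I)) := fun r => by
        simp only [hF]; congr 2
        rw [ofReal_add, add_mul, exp_add, hψ]; ring
      rcases lt_trichotomy |φ| b with hlt | heq | hgt
      · rw [indicator_of_mem (show φ ∈ Ioo (-b) b from abs_lt.1 hlt), add_sub_cancel]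
        refine tendsto_const_nhds.congr' ?_
        filter_upwards [small _ (sub_pos.2 hlt)] with r hr
        rw [hFe, hA _ (mem he hφ' hr.1 hr.2.1 hr.2.2)]
      · rcases abs_cases φ with ⟨e1, _⟩ | ⟨e1, _⟩
        · exact absurd ℓ n1
        · exact absurd ℓ n2
      · rw [indicator_of_notMem fun hm : φ ∈ Ioo (-b) b => by linarith [abs_lt.2 hm], add_zero]
        refine tendsto_const_nhds.congr' ?_
        obtain ⟨φ', e1, e2⟩ : ∃ φ' : ℝ, |φ'| = Real.pi - |φ| ∧ e * exp (φ * I) = -e * exp (φ' * I) := by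
          rcases abs_cases φ with ⟨e1, _⟩ | ⟨e1, _⟩
          · refine ⟨φ - Real.pi, by rw [e1, abs_of_nonpos (by linarith [hφ.2])]; ring, ?_⟩
            push_cast; rw [sub_mul, exp_sub, exp_pi_mul_I]; ring
          · refine ⟨φ + Real.pi, by rw [e1, abs_of_nonneg (by linarith [hφ.1])]; ring, ?_⟩
            push_cast; rw [add_mul, exp_add, exp_pi_mul_I]; ring
        filter_upwards [small _ (sub_pos.2 hgt)] with r hr
        rw [hFe, mul_assoc, e2, ← mul_assoc, hB _ (mem (by rwa [norm_neg]) (by rw [e1]; linarith) hr.1 hr.2.1 (by rw [e1]; linarith [hr.2.2]))]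
  have h3 := tendsto_nhds_unique h (h2.congr fun r => (h1 r).symm)
  rw [h3, intervalIntegral.integral_of_le ℓ, integral_add 𝔰 ((integrable_const _).indicator measurableSet_Ioo),
    setIntegral_const, setIntegral_indicator measurableSet_Ioo, setIntegral_const,
    inter_eq_right.2 fun x (hx : x ∈ Ioo (-b) b) => show x ∈ Ioc _ _ from ⟨by linarith [hx.1], by linarith [hx.2]⟩]
  simp [Real.volume_real_Ioc_of_le (show -Real.pi ≤ Real.pi by linarith), Real.volume_real_Ioo_of_le (show -b ≤ b by linarith)]
  ring

lemma bis {d1 d2 : ℂ} (h1 : d1 ≠ 0) (h2 : d2 ≠ 0) : ∃ (e : ℂ) (b : ℝ), ‖e‖ = 1 ∧ 0 ≤ b ∧ b < Real.pi ∧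
    d1 = ‖d1‖ * e * exp ((-b : ℝ) * I) ∧ d2 = ‖d2‖ * e * exp ((b : ℝ) * I) := by
  have hp := Real.pi_pos
  have n1 : (‖d1‖ : ℂ) ≠ 0 := by simpa using h1
  have n2 : (‖d2‖ : ℂ) ≠ 0 := by simpa using h2
  obtain ⟨b, b0, b1, hb⟩ : ∃ b : ℝ, 0 ≤ b ∧ b < Real.pi ∧ exp (arg (d2 / d1) * I) = exp ((b:ℝ) * I) * exp ((b:ℝ) * I) := by
    simp only [← exp_add, ← add_mul, ← ofReal_add]
    rcases le_or_gt 0 (arg (d2 / d1)) with h | h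
    · exact ⟨arg (d2 / d1) / 2, ℓ, by linarith [arg_le_pi (d2 / d1)], by rw [add_halves]⟩
    · refine ⟨arg (d2 / d1) / 2 + Real.pi, by linarith [neg_pi_lt_arg (d2 / d1)], ℓ, ?_⟩
      rw [show arg (d2 / d1) / 2 + Real.pi + (arg (d2 / d1) / 2 + Real.pi) = arg (d2 / d1) + 2 * Real.pi by ring, ofReal_add, add_mul, exp_add]
      push_cast; rw [exp_two_pi_mul_I, mul_one]
  have h3 := norm_mul_exp_arg_mul_I (d2 / d1)
  rw [hb, norm_div, ofReal_div] at h3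
  refine ⟨d1 / ‖d1‖ * exp ((b:ℝ) * I), b, ?_, b0, b1, ?_, ?_⟩
  · rw [norm_mul, norm_exp_ofReal_mul_I, norm_div, norm_real, norm_norm, mul_one, div_self (by simpa using h1)]
  · rw [ofReal_neg, neg_mul, exp_neg]; field_simp
  · field_simp at h3 ⊢
    linear_combination -h3

lemma side {G P : Set ℂ} (hG : IsOpen G) (hP : IsPreconnected P) (h : ∀ z ∈ P, z ∉ frontier G) : P ⊆ G ∨ P ⊆ (closure G)ᶜ := by
  refine hP.subset_or_subset hG isClosed_closure.isOpen_compl (disjoint_compl_right.mono_right (compl_subset_compl.2 subset_closure)) fun z hz => ?_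
  by_contra hc
  simp only [mem_union, mem_compl_iff, not_or, not_not] at hc
  exact h z hz (by rw [hG.frontier_eq]; exact ⟨hc.2, hc.1⟩)

structure Nd (G : Set ℂ) (c1 c2 : ℂ → ℂ) (p e : ℂ) (b K δ : ℝ) : Prop where
  he : ‖e‖ = 1
  b0 : 0 < b
  b1 : b < Real.pi
  K0 : 0 < K
  δ0 : 0 < δ
  t1 : deriv c1 0 = ‖deriv c1 0‖ * e * exp ((-b : ℝ) * I)
  t2 : deriv c2 0 = ‖deriv c2 0‖ * e * exp ((b : ℝ) * I)
  j1 : Jet c1 p e (-b)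
  j2 : Jet c2 p e b
  j1' : Jet c1 p (-e) (Real.pi - b)
  j2' : Jet c2 p (-e) (-(Real.pi - b))
  sA : sec p e b K δ ⊆ G
  sB : sec p (-e) (Real.pi - b) K δ ⊆ (closure G)ᶜ

lemma exp_flip (z e : ℂ) (b : ℝ) : z * e * exp ((b : ℝ) * I) = z * (-e) * exp ((-(Real.pi - b) : ℝ) * I) ∧
    z * e * exp ((-b : ℝ) * I) = z * (-e) * exp ((Real.pi - b : ℝ) * I) := by
  constructor
  · rw [show -(Real.pi - b) = b - Real.pi by ring, ofReal_sub, sub_mul, exp_sub, exp_pi_mul_I]; ring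
  · rw [sub_eq_add_neg, ofReal_add, add_mul, exp_add, exp_pi_mul_I]; ring

lemma corner_node {G : Set ℂ} (hG : IsOpen G) {c1 c2 : ℂ → ℂ} {p : ℂ} {U1 U2 : Set ℂ} (hU1 : U1 ∈ 𝓝 0) (hU2 : U2 ∈ 𝓝 0)
    (d1 : DifferentiableOn ℂ c1 U1) (d2 : DifferentiableOn ℂ c2 U2) (n1 : deriv c1 0 ≠ 0) (n2 : deriv c2 0 ≠ 0)
    (hp1 : c1 0 = p) (hp2 : c2 0 = p) (near : ∀ r > 0, ∃ δ > 0, ∀ z ∈ frontier G, ‖z - p‖ < δ → z ≠ p → ∃ x : ℝ, 0 < x ∧ x < r ∧ (z = c1 x ∨ z = c2 x))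
    {la : ℝ} (la0 : 0 < la) (la2 : la < 2) (h : HasCornerAngle G p ((2 - la) * Real.pi)) :
    ∃ e K δ, Nd G c1 c2 p e ((2 - la) * Real.pi / 2) K δ ∨ Nd G c2 c1 p e ((2 - la) * Real.pi / 2) K δ := by
  have hpi := Real.pi_pos
  obtain ⟨e, b, he, b0, b1, t1, t2⟩ := bis n1 n2
  have he' : ‖-e‖ = 1 := by rwa [norm_neg]
  have J1 : Jet c1 p e (-b) := hp1 ▸ Jet.of hU1 d1 n1 he t1
  have J2 : Jet c2 p e b := hp2 ▸ Jet.of hU2 d2 n2 he t2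
  have t1' := t1.trans (exp_flip _ e b).2
  have t2' := t2.trans (exp_flip _ e b).1
  have J1' : Jet c1 p (-e) (Real.pi - b) := hp1 ▸ Jet.of hU1 d1 n1 he' t1'
  have J2' : Jet c2 p (-e) (-(Real.pi - b)) := hp2 ▸ Jet.of hU2 d2 n2 he' t2'
  have av : ∀ {e' : ℂ} {b' : ℝ}, 0 ≤ b' → b' ≤ Real.pi → (Jet c1 p e' (-b') ∧ Jet c2 p e' b' ∨ Jet c1 p e' b' ∧ Jet c2 p e' (-b')) →
      ∃ K > 0, ∃ δ > 0, ∀ K' ≥ K, ∀ δ' ≤ δ, ∀ z ∈ sec p e' b' K' δ', z ∉ frontier G := by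
    intro e' b' b0' b1' hJ
    have A : ∀ {c : ℂ → ℂ}, (Jet c p e' b' ∨ Jet c p e' (-b')) → ∃ K > 0, ∃ η > 0, ∀ x : ℝ, 0 < x → x < η → ∀ δ, ∀ K' ≥ K, c x ∉ sec p e' b' K' δ := by
      rintro c (h | h)
      · simpa only [abs_of_nonneg b0'] using h.avoid (by rwa [abs_of_nonneg b0'])
      · simpa only [abs_neg, abs_of_nonneg b0'] using h.avoid (by rwa [abs_neg, abs_of_nonneg b0'])
    obtain ⟨K1, k1, η1, y1, a1⟩ := A (c := c1) (by tauto)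
    obtain ⟨K2, k2, η2, y2, a2⟩ := A (c := c2) (by tauto)
    obtain ⟨δ, δ0, hδ⟩ := near _ (lt_min y1 y2)
    refine ⟨max K1 K2, ℘, δ, δ0, fun K' hK δ' hδ' z hz hf => ?_⟩
    obtain ⟨x, x0, x1, rfl | rfl⟩ := hδ z hf (hz.2.1.trans_le hδ') hz.1
    · exact a1 x x0 (x1.trans_le 𝔩) _ _ ((le_max_left _ _).trans hK) hz
    · exact a2 x x0 (x1.trans_le 𝔯) _ _ ((le_max_right _ _).trans hK) hz
  obtain ⟨K1, k1, δ1, y1, a1⟩ := av b0 b1.le (Or.inl ⟨J1, J2⟩)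
  obtain ⟨K2, k2, δ2, y2, a2⟩ := av (b' := Real.pi - b) ℓ ℓ (Or.inr ⟨J1', J2'⟩)
  set K := max K1 K2
  set δ := min δ1 δ2
  have K0 : 0 < K := lt_max_of_lt_left k1
  have δ0 : 0 < δ := lt_min y1 y2
  have s1 := side hG (sec.pc (p := p) (b := b) (δ := δ) he K0 b1.le) (a1 K (le_max_left _ _) δ 𝔩)
  have s2 := side hG (sec.pc (p := p) (b := Real.pi - b) (δ := δ) he' K0 ℓ) (a2 K (le_max_right _ _) δ 𝔯)
  have i1 : ∀ {P : Set ℂ}, P ⊆ G → ∀ z ∈ P, G.indicator (fun _ => (1:ℝ)) z = 1 := fun hP z hz => indicator_of_mem (hP hz) _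
  have i0 : ∀ {P : Set ℂ}, P ⊆ (closure G)ᶜ → ∀ z ∈ P, G.indicator (fun _ => (1:ℝ)) z = 0 := fun hP z hz =>
    indicator_of_notMem (fun h => hP hz (subset_closure h)) _
  have lp : 0 < la * Real.pi := by positivity
  have lp' : 0 < (2 - la) * Real.pi := mul_pos ℓ hpi
  rcases s1 with s1 | s1 <;> rcases s2 with s2 | s2
  · have := corner hG he b0 b1 δ0 (i1 s1) (i1 s2) h
    exfalso; linarith
  · have := corner hG he b0 b1 δ0 (i1 s1) (i0 s2) h
    have hb : b = (2 - la) * Real.pi / 2 := by linarith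
    exact ⟨e, K, δ, Or.inl ⟨he, ℓ, ℓ, K0, δ0, hb ▸ t1, hb ▸ t2, hb ▸ J1, hb ▸ J2, hb ▸ J1', hb ▸ J2', hb ▸ s1, hb ▸ s2⟩⟩
  · have := corner hG he b0 b1 δ0 (i0 s1) (i1 s2) h
    have hb : Real.pi - b = (2 - la) * Real.pi / 2 := by linarith
    have hb' : b = Real.pi - (2 - la) * Real.pi / 2 := by linarith
    rw [hb] at t1' t2' J1' J2' s2
    rw [hb'] at J1 J2 s1
    exact ⟨-e, K, δ, Or.inr ⟨he', ℓ, ℓ, K0, δ0, t2', t1', J2', J1', by rwa [neg_neg], by rwa [neg_neg], s2, by rwa [neg_neg]⟩⟩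
  · have := corner hG he b0 b1 δ0 (i0 s1) (i0 s2) h
    exfalso; linarith

namespace Arcs
variable {D : JordanDomain} {lam : ℝ} (A : Arcs D lam)

lemma e0 (j : Fin A.n) : D.γ (A.a j) = A.σ j 0 := by
  have := A.eq j 0 ⟨le_rfl, zero_le_one⟩; rwa [A.S0, ofReal_zero] at this

lemma e1 (j : Fin A.n) : D.γ (A.b j) = A.σ j 1 := by
  have := A.eq j 1 ⟨zero_le_one, le_rfl⟩; rwa [A.S1, ofReal_one] at this

lemma joint (j : Fin A.n) : A.σ j 1 = A.σ (A.nxt j) 0 := by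
  obtain ⟨k, hk⟩ := A.link j
  rw [← A.e0, ← A.e1, hk, D.per_eq]

lemma near (j : Fin A.n) {r : ℝ} (hr : 0 < r) : ∃ δ > 0, ∀ z ∈ frontier D.G, ‖z - A.σ j 1‖ < δ → z ≠ A.σ j 1 →
    ∃ x : ℝ, 0 < x ∧ x < r ∧ x ≤ 1 ∧ (z = A.σ (A.nxt j) x ∨ z = A.σ j (1 - x)) := by
  set r' := min r 1 with hr'
  have r0 : 0 < r' := lt_min hr one_pos
  have r1 : r' ≤ 1 := min_le_right _ _
  have m0 : 𝟘 ∈ 𝕀c := ⟨le_rfl, zero_le_one⟩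
  have m1 : (1:ℝ) ∈ 𝕀c := ⟨zero_le_one, le_rfl⟩
  have mr : r' ∈ 𝕀c := ⟨r0.le, r1⟩
  have mr' : 1 - r' ∈ 𝕀c := ⟨ℓ, ℓ⟩
  have h1 := A.mono (A.nxt j) m0 mr r0
  have h2 := A.mono j mr' m1 ℓ
  rw [A.S0] at h1
  rw [A.S1] at h2
  obtain ⟨k, hk⟩ := A.link j
  obtain ⟨δ, δ0, hδ⟩ := D.li (A.b j) (lt_min (sub_pos.2 h1) (sub_pos.2 h2))
  refine ⟨δ, δ0, fun z hz hzd hzp => ?_⟩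
  obtain ⟨s, hs, rfl⟩ := hδ z hz (by rwa [A.e1])
  obtain ⟨hs1, hs2⟩ := abs_lt.1 hs
  have g1 := min_le_left (A.S (A.nxt j) r' - A.a (A.nxt j)) (A.b j - A.S j (1 - r'))
  have g2 := min_le_right (A.S (A.nxt j) r' - A.a (A.nxt j)) (A.b j - A.S j (1 - r'))
  rcases le_total s (A.b j) with h | h
  · obtain ⟨x, hx, e⟩ := A.surj j s ⟨by linarith [(A.Smem (j := j) mr').1], h⟩
    have hx1 : x ≠ 1 := by rintro rfl; rw [A.S1] at e; exact hzp (by rw [← e, A.e1])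
    have hx2 : 1 - r' < x := ((A.mono j).lt_iff_lt mr' hx).1 ℓ
    refine ⟨1 - x, sub_pos.2 (lt_of_le_of_ne hx.2 hx1), by linarith [min_le_left r 1], by linarith [hx.1], Or.inr ?_⟩
    rw [← e, A.eq j x hx]; push_cast; rw [sub_sub_cancel]
  · obtain ⟨x, hx, e⟩ := A.surj (A.nxt j) (s + k * D.l) ⟨ℓ, by linarith [(A.Smem (j := A.nxt j) mr).2]⟩
    have hx1 : x ≠ 0 := by rintro rfl; rw [A.S0, hk] at e; exact hzp (by rw [← A.e1]; congr 1; linarith)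
    have hx2 : x < r' := ((A.mono (A.nxt j)).lt_iff_lt hx mr).1 ℓ
    refine ⟨x, lt_of_le_of_ne hx.1 (Ne.symm hx1), hx2.trans_le 𝔩, hx.2, Or.inl ?_⟩
    rw [← A.eq _ x hx, e, D.per_eq]

lemma dne {j : Fin A.n} {x : ℝ} (hx : x ∈ 𝕀c) : deriv (A.σ j) x ≠ 0 :=
  deriv_ne_zero_of_inj (A.Vo j) (A.diff j) (A.inj j) (A.Vx hx)

lemma V0 (j : Fin A.n) : A.V j ∈ 𝓝 0 := (A.Vo j).mem_nhds (by simpa using A.Vx (j := j) (x := 0) 𝔰)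

lemma V1 (j : Fin A.n) : (fun v : ℂ => 1 - v) ⁻¹' A.V j ∈ 𝓝 0 :=
  ((A.Vo j).preimage (by fun_prop)).mem_nhds (by simpa using A.Vx (j := j) (x := 1) 𝔰)

lemma d1 (j : Fin A.n) : DifferentiableOn ℂ (fun v => A.σ j (1 - v)) ((fun v : ℂ => 1 - v) ⁻¹' A.V j) :=
  (A.diff j).comp (by fun_prop) fun _ h => h

lemma d1' (f : ℂ → ℂ) : deriv (fun v => f (1 - v)) 0 = -deriv f 1 := by
  rw [deriv_comp_const_sub, sub_zero]

lemma node (h0 : 0 < lam) (j : Fin A.n) : ∃ e K δ,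
    Nd D.G (A.σ (A.nxt j)) (fun v => A.σ j (1 - v)) (A.σ j 1) e ((2 - A.la (A.nxt j)) * Real.pi / 2) K δ ∨
    Nd D.G (fun v => A.σ j (1 - v)) (A.σ (A.nxt j)) (A.σ j 1) e ((2 - A.la (A.nxt j)) * Real.pi / 2) K δ := by
  refine corner_node D.isOpen (A.V0 _) (A.V1 j) (A.diff _) (A.d1 j) (by simpa using A.dne (j := A.nxt j) (x := 0) 𝔰)
    (by rw [d1']; simpa using A.dne (j := j) (x := 1) 𝔰) (A.joint j).symm 𝔰 (fun r hr => ?_) (h0.trans_le (A.la1 _)) (A.la2 _)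
    (by rw [A.joint]; exact A.ang _)
  obtain ⟨δ, δ0, h⟩ := A.near j hr
  exact ⟨δ, δ0, fun z hz h1 h2 => by obtain ⟨x, x0, x1, -, h⟩ := h z hz h1 h2; exact ⟨x, x0, x1, h⟩⟩
end Arcs

lemma flat_end {G U : Set ℂ} {c c' : ℂ → ℂ} {p : ℂ} (hU : U ∈ 𝓝 0) (hc : ContinuousAt c 0) (hi : InjOn c U) (hp : c 0 = p)
    (hx : ∀ x : ℝ, x ∈ 𝕀c → (x:ℂ) ∈ U)
    (near : ∀ r > 0, ∃ δ > 0, ∀ z ∈ frontier G, ‖z - p‖ < δ → z ≠ p → ∃ x : ℝ, 0 < x ∧ x < r ∧ x ≤ 1 ∧ (z = c x ∨ z = c' x))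
    (hf : ∃ κ > 0, ∃ r > 0, ∀ w : ℂ, 0 < w.re → |w.im| ≤ κ * w.re → ‖w‖ < r → ∀ x : ℝ, 0 < x → x < r → c w ≠ c' x) :
    ∃ κ > 0, ∃ r > 0, ∀ w : ℂ, 0 < w.re → |w.im| ≤ κ * w.re → ‖w‖ < r → w ∈ U ∧ (c w ∈ frontier G → w.im = 0) := by
  obtain ⟨κ, κ0, r, r0, h⟩ := hf
  obtain ⟨δ, δ0, hn⟩ := near r r0
  obtain ⟨r', r0', hr'⟩ := Metric.mem_nhds_iff.1 (inter_mem hU (hc.preimage_mem_nhds (ball_mem_nhds _ δ0)))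
  refine ⟨κ, κ0, min r r', lt_min r0 r0', fun w w0 w1 w2 => ?_⟩
  obtain ⟨hwU, hw⟩ := hr' (mem_ball_zero_iff.2 (w2.trans_le 𝔯))
  refine ⟨hwU, fun hfr => ?_⟩
  have hw' : ‖c w - p‖ < δ := by rw [← hp]; exact mem_ball_iff_norm.1 hw
  have h0 : 𝕫 ∈ U := by simpa using hx 0 𝔰
  obtain ⟨x, x0, xr, x1, e | e⟩ := hn _ hfr hw' (fun e => by
    rw [← hp] at e; rw [hi hwU h0 e] at w0; simp at w0)
  · rw [hi hwU (hx x ⟨x0.le, x1⟩) e, ofReal_im]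
  · exact absurd e (h w w0 w1 (w2.trans_le 𝔩) x x0 xr)

namespace Arcs
variable {D : JordanDomain} {lam : ℝ} (A : Arcs D lam)

def Flat (j : Fin A.n) (s : Set ℝ) : Prop := ∃ κ > 0, ∀ w : ℂ, w.re ∈ s → 0 < w.re → w.re < 1 → |w.im| < κ * ϖ w.re →
  w ∈ A.V j ∧ (A.σ j w ∈ frontier D.G → w.im = 0)

lemma flat_in (j : Fin A.n) {x : ℝ} (hx : x ∈ 𝕀o) : ∃ s ∈ 𝓝 x, A.Flat j s := by
  have hx' := Ioo_subset_Icc_self hx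
  have m0 : 𝟘 ∈ 𝕀c := ⟨le_rfl, zero_le_one⟩
  have m1 : (1:ℝ) ∈ 𝕀c := ⟨zero_le_one, le_rfl⟩
  have h1 := A.mono j m0 hx' hx.1
  have h2 := A.mono j hx' m1 hx.2
  rw [A.S0] at h1
  rw [A.S1] at h2
  obtain ⟨δ, δ0, hδ⟩ := D.li (A.S j x) (lt_min (sub_pos.2 h1) (sub_pos.2 h2))
  have hc : ContinuousAt (A.σ j) x := ((A.diff j).differentiableAt ((A.Vo j).mem_nhds (A.Vx hx'))).continuousAt
  obtain ⟨r, r0, hr⟩ := Metric.mem_nhds_iff.1 (inter_mem ((A.Vo j).mem_nhds (A.Vx hx')) (hc.preimage_mem_nhds (ball_mem_nhds _ δ0)))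
  refine ⟨ball x (r/2), ball_mem_nhds _ ℘, r/2, ℘, fun w w0 w1 w2 w3 => ?_⟩
  have w0' : |w.re - x| < r / 2 := w0
  have : ‖w - x‖ < r := by
    refine (norm_le_abs_re_add_abs_im _).trans_lt ?_
    have : w.re * (1 - w.re) ≤ 1 := by nlinarith
    simp only [sub_re, ofReal_re, sub_im, ofReal_im, sub_zero]
    nlinarith
  obtain ⟨hV, hw⟩ := hr (mem_ball_iff_norm.2 this)
  refine ⟨hV, fun hf => ?_⟩
  obtain ⟨s, hs, e⟩ := hδ _ hf (by rw [A.eq j x hx']; exact mem_ball_iff_norm.1 hw)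
  obtain ⟨hs1, hs2⟩ := abs_lt.1 hs
  obtain ⟨y, hy, rfl⟩ := A.surj j s ⟨by linarith [min_le_left (A.S j x - A.a j) (A.b j - A.S j x)], by linarith [min_le_right (A.S j x - A.a j) (A.b j - A.S j x)]⟩
  rw [A.eq j y hy] at e
  rw [← A.inj j (A.Vx hy) hV e, ofReal_im]

lemma flat_of_end {j : Fin A.n} {f : ℂ → ℂ} {U : Set ℂ} {x : ℝ} {τ : ℂ → ℂ} (h1 : ∀ w, |(τ w).im| = |w.im|)
    (h2 : ∀ w, |(τ w).re| = |w.re - x|) (h4 : ∀ w : ℂ, 0 < w.re → w.re < 1 → 0 < (τ w).re ∧ w.re * (1 - w.re) ≤ (τ w).re)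
    (h3 : ∀ w, w ∈ A.V j ↔ τ w ∈ U) (hf : ∀ w, f (τ w) = A.σ j w)
    (h : ∃ κ > 0, ∃ r > 0, ∀ w : ℂ, 0 < w.re → |w.im| ≤ κ * w.re → ‖w‖ < r → w ∈ U ∧ (f w ∈ frontier D.G → w.im = 0)) :
    ∃ s ∈ 𝓝 x, A.Flat j s := by
  obtain ⟨κ, κ0, r, r0, h⟩ := h
  refine ⟨ball x (r/2), ball_mem_nhds _ ℘, min κ (r/2), ℘, fun w w0 w1 w2 w3 => ?_⟩
  have w0' : |w.re - x| < r / 2 := w0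
  obtain ⟨h5, h6⟩ := h4 w w1 w2
  have hle : w.re * (1 - w.re) ≤ 1 := by nlinarith
  have hn : 0 ≤ w.re * (1 - w.re) := mul_nonneg w1.le ℓ
  have := h (τ w) h5 (by
    rw [h1]; refine w3.le.trans ?_
    calc _ ≤ κ * ϖ w.re := by gcongr; exact min_le_left _ _
      _ ≤ _ := by gcongr) (by
    refine (norm_le_abs_re_add_abs_im _).trans_lt ?_
    rw [h1, h2]
    have : min κ (r/2) * ϖ w.re ≤ r/2 * 1 := by gcongr; exact min_le_right _ _
    linarith)
  rw [hf, ← h3] at this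
  refine ⟨this.1, fun hh => ?_⟩
  have h7 := this.2 hh
  have h8 := h1 w
  rw [h7, abs_zero] at h8
  exact abs_eq_zero.1 h8.symm

lemma flat0 (h0 : 0 < lam) (i : Fin A.n) : (∃ s ∈ 𝓝 0, A.Flat (A.nxt i) s) ∧ ∃ s ∈ 𝓝 1, A.Flat i s := by
  obtain ⟨e, K, δ, h⟩ := A.node h0 i
  have hc0 : ContinuousAt (A.σ (A.nxt i)) 0 := ((A.diff _).differentiableAt (A.V0 _)).continuousAt
  have hc1 : ContinuousAt (fun v => A.σ i (1 - v)) 0 := ((A.d1 i).differentiableAt (A.V1 i)).continuousAt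
  have key : (∃ κ > 0, ∃ r > 0, ∀ w : ℂ, 0 < w.re → |w.im| ≤ κ * w.re → ‖w‖ < r → ∀ x : ℝ, 0 < x → x < r → A.σ (A.nxt i) w ≠ (fun v => A.σ i (1 - v)) x) ∧
      (∃ κ > 0, ∃ r > 0, ∀ w : ℂ, 0 < w.re → |w.im| ≤ κ * w.re → ‖w‖ < r → ∀ x : ℝ, 0 < x → x < r → (fun v => A.σ i (1 - v)) w ≠ A.σ (A.nxt i) x) := by
    rcases h with h | h
    · have b0 := h.b0
      have b1 := h.b1
      exact ⟨h.j1.flat h.j2 (abs_pos.2 ℓ) (abs_lt.2 ⟨ℓ, ℓ⟩),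
        h.j2.flat h.j1 (abs_pos.2 ℓ) (abs_lt.2 ⟨ℓ, ℓ⟩)⟩
    · have b0 := h.b0
      have b1 := h.b1
      exact ⟨h.j2.flat h.j1 (abs_pos.2 ℓ) (abs_lt.2 ⟨ℓ, ℓ⟩),
        h.j1.flat h.j2 (abs_pos.2 ℓ) (abs_lt.2 ⟨ℓ, ℓ⟩)⟩
  constructor
  · refine A.flat_of_end (f := A.σ (A.nxt i)) (τ := fun w => w) (fun w => rfl) (fun w => by simp) (fun w w0 w1 => ⟨w0, by nlinarith⟩) (fun w => Iff.rfl) (fun w => rfl)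
      (flat_end (c' := fun v => A.σ i (1 - v)) (A.V0 _) hc0 (A.inj _) (A.joint i).symm (fun x hx => A.Vx hx) (fun r hr => A.near i hr) key.1)
  · refine A.flat_of_end (f := fun v => A.σ i (1 - v)) (U := (fun v : ℂ => 1 - v) ⁻¹' A.V i) (τ := fun w => 1 - w) (fun w => by simp) (fun w => by simp [abs_sub_comm]) (fun w w0 w1 => ⟨by simp; linarith, by simp; nlinarith⟩)
      (fun w => by simp) (fun w => by simp)
      (flat_end (p := A.σ i 1) (c' := A.σ (A.nxt i)) (A.V1 _) hc1 (fun v hv w hw e => by simpa using A.inj i hv hw e) 𝔰 (fun x hx => ?_) (fun r hr => ?_) key.2)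
    · have := A.Vx (j := i) (x := 1 - x) ⟨by linarith [hx.2], by linarith [hx.1]⟩
      simpa using this
    · obtain ⟨δ, δ0, h⟩ := A.near i hr
      refine ⟨δ, δ0, fun z hz h1 h2 => ?_⟩
      obtain ⟨x, a, b, c, d⟩ := h z hz h1 h2
      exact ⟨x, a, b, c, d.symm⟩

lemma flat1 (h0 : 0 < lam) (j : Fin A.n) : A.Flat j (Icc 0 1) := by
  refine IsCompact.induction_on isCompact_Icc (p := A.Flat j) ⟨1, one_pos, fun w hw => hw.elim⟩ ?_ ?_ ?_
  · rintro s t hst ⟨κ, κ0, h⟩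
    exact ⟨κ, κ0, fun w hw => h w (hst hw)⟩
  · rintro s t ⟨κ, κ0, h⟩ ⟨κ', κ0', h'⟩
    refine ⟨min κ κ', lt_min κ0 κ0', fun w hw w0 w1 w2 => ?_⟩
    have hn : 0 ≤ w.re * (1 - w.re) := mul_nonneg w0.le ℓ
    rcases hw with hw | hw
    · exact h w hw w0 w1 (w2.trans_le (by gcongr; exact min_le_left _ _))
    · exact h' w hw w0 w1 (w2.trans_le (by gcongr; exact min_le_right _ _))
  · intro x hx
    have : ∃ s ∈ 𝓝 x, A.Flat j s := by
      rcases eq_or_lt_of_le hx.1 with rfl | h1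
      · have := (A.flat0 h0 (A.nxt.symm j)).1
        rwa [Equiv.apply_symm_apply] at this
      rcases eq_or_lt_of_le hx.2 with rfl | h2
      · exact (A.flat0 h0 j).2
      exact A.flat_in j ⟨h1, h2⟩
    obtain ⟨s, hs, h⟩ := this
    exact ⟨s, mem_nhdsWithin_of_mem_nhds hs, h⟩

lemma flat (h0 : 0 < lam) : ∃ κ > 0, κ ≤ 1 ∧ ∀ j, ∀ w ∈ Tent κ κ, w ∈ A.V j ∧ (A.σ j w ∈ frontier D.G → w.im = 0) := by
  choose k k0 hk using A.flat1 h0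
  obtain ⟨c, hc⟩ := Finite.exists_le (fun j => (k j)⁻¹)
  have hc0 : 0 < c := (inv_pos.2 (k0 A.i0)).trans_le (hc A.i0)
  refine ⟨min c⁻¹ 1, ℘, min_le_right _ _, fun j w hw => hk j w ⟨hw.1.le, hw.2.1.le⟩ hw.1 hw.2.1 ?_⟩
  obtain ⟨w0, w1, w2, w3⟩ := hw
  have hn : 0 ≤ w.re * (1 - w.re) := mul_nonneg w0.le ℓ
  refine lt_of_lt_of_le (abs_lt.2 ⟨ℓ, w3⟩) ?_ |>.trans_le (b := min c⁻¹ 1 * ϖ w.re) (mul_le_mul_of_nonneg_right ((min_le_left _ _).trans (inv_le_of_inv_le₀ (k0 j) (hc j))) hn)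
  linarith
end Arcs

structure Loc (D : JordanDomain) (lam : ℝ) where
  n : ℕ
  i0 : Fin n
  nxt : Equiv.Perm (Fin n)
  σ : Fin n → ℂ → ℂ
  V : Fin n → Set ℂ
  Vo : ∀ j, IsOpen (V j)
  seg : ∀ j, ∀ x ∈ 𝕀c, (x:ℂ) ∈ V j
  diff : ∀ j, DifferentiableOn ℂ (σ j) (V j)
  inj : ∀ j, InjOn (σ j) (V j)
  sep : ∀ i j, ∀ x ∈ 𝕀o, ∀ y ∈ 𝕀o, σ i x = σ j y → i = j
  bd : ∀ j, ∀ x ∈ 𝕀c, σ j x ∈ frontier D.G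
  cover : ∀ z ∈ frontier D.G, ∃ j, ∃ x ∈ 𝕀c, z = σ j x
  joint : ∀ j, σ j 1 = σ (nxt j) 0
  trans : ∀ P : Fin n → Prop, (∀ j, P j ↔ P (nxt j)) → ∀ i j, P i ↔ P j
  la : Fin n → ℝ
  la1 : ∀ j, lam ≤ la j
  la2 : ∀ j, la j < 2
  κ : ℝ
  κ0 : 0 < κ
  κ1 : κ ≤ 1
  flat : ∀ j, ∀ w ∈ Tent κ κ, w ∈ V j ∧ (σ j w ∈ frontier D.G → w.im = 0)
  nd : ∀ j, (∃ e K δ, Nd D.G (σ (nxt j)) (fun v => σ j (1 - v)) (σ j 1) e ((2 - la (nxt j)) * Real.pi / 2) K δ) ∨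
    (∃ e K δ, Nd D.G (fun v => σ j (1 - v)) (σ (nxt j)) (σ j 1) e ((2 - la (nxt j)) * Real.pi / 2) K δ)
  int : ∀ F : ℂ → ℂ, Continuous F → ∑ j, ∫ x in 𝟘..1, F (σ j x) * ‖deriv (σ j) x‖ = ∫ t in 𝟘..D.l, F (D.γ t)

lemma Arcs.loc {D : JordanDomain} {lam : ℝ} (A : Arcs D lam) (h0 : 0 < lam) : Nonempty (Loc D lam) := by
  obtain ⟨κ, κ0, κ1, hk⟩ := A.flat h0
  refine ⟨⟨A.n, A.i0, A.nxt, A.σ, A.V, A.Vo, fun j x hx => A.Vx hx, A.diff, A.inj, fun i j x hx y hy e => ?_, fun j x hx => ?_, fun z hz => ?_,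
    A.joint, A.trans, A.la, A.la1, A.la2, κ, κ0, κ1, hk, fun j => ?_, fun F hF => A.int hF⟩⟩
  · have m0 : 𝟘 ∈ 𝕀c := ⟨le_rfl, zero_le_one⟩
    have m1 : (1:ℝ) ∈ 𝕀c := ⟨zero_le_one, le_rfl⟩
    have S : ∀ i, ∀ x ∈ 𝕀o, A.S i x ∈ Ioo (A.a i) (A.b i) := fun i x hx =>
      ⟨A.S0 i ▸ A.mono i m0 (Ioo_subset_Icc_self hx) hx.1, A.S1 i ▸ A.mono i (Ioo_subset_Icc_self hx) m1 hx.2⟩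
    exact A.sep i j _ (S i x hx) _ (S j y hy) (by rw [A.eq i x (Ioo_subset_Icc_self hx), A.eq j y (Ioo_subset_Icc_self hy), e])
  · rw [← A.eq j x hx]; exact D.fr _
  · obtain ⟨t, -, rfl⟩ := D.fr' hz 0
    obtain ⟨j, s, hs, e⟩ := A.cover t
    obtain ⟨x, hx, rfl⟩ := A.surj j s hs
    exact ⟨j, x, hx, by rw [← e, A.eq j x hx]⟩
  · obtain ⟨e, K, δ, h | h⟩ := A.node h0 j
    exacts [Or.inl ⟨e, K, δ, h⟩, Or.inr ⟨e, K, δ, h⟩]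

lemma Tent.flip {κ : ℝ} {w : ℂ} (h : w ∈ Tent κ κ) : 1 - w ∈ Tent κ κ := by
  obtain ⟨h1, h2, h3, h4⟩ := h
  refine ⟨?_, ?_, ?_, ?_⟩ <;> simp <;> linarith

def Loc.rev {D : JordanDomain} {lam : ℝ} (A : Loc D lam) : Loc D lam where
  n := A.n
  i0 := A.i0
  nxt := A.nxt.symm
  σ j z := A.σ j (1 - z)
  V j := (fun v : ℂ => 1 - v) ⁻¹' A.V j
  Vo j := (A.Vo j).preimage (by fun_prop)
  seg j x hx := by
    have := A.seg j (1 - x) ⟨by linarith [hx.2], by linarith [hx.1]⟩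
    simpa using this
  diff j := (A.diff j).comp (by fun_prop) fun _ h => h
  inj j v hv w hw e := by simpa using A.inj j hv hw e
  sep i j x hx y hy e := A.sep i j (1 - x) ⟨by linarith [hx.2], by linarith [hx.1]⟩ (1 - y) ⟨by linarith [hy.2], by linarith [hy.1]⟩ (by simpa using e)
  bd j x hx := by simpa using A.bd j (1 - x) ⟨by linarith [hx.2], by linarith [hx.1]⟩
  cover z hz := by
    obtain ⟨j, x, hx, e⟩ := A.cover z hz
    exact ⟨j, 1 - x, ⟨by linarith [hx.2], by linarith [hx.1]⟩, by simpa using e⟩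
  joint j := by simpa using (A.joint (A.nxt.symm j)).symm
  trans P h i j := A.trans P (fun j => by simpa using (h (A.nxt j)).symm) i j
  la j := A.la (A.nxt j)
  la1 j := A.la1 _
  la2 j := A.la2 _
  κ := A.κ
  κ0 := A.κ0
  κ1 := A.κ1
  flat j w hw := by simpa using A.flat j (1 - w) (Tent.flip hw)
  nd j := by
    have h := (A.nd (A.nxt.symm j)).symm
    have hj := A.joint (A.nxt.symm j)
    simp only [Equiv.apply_symm_apply, sub_sub_cancel, sub_self] at h hj ⊢
    rw [hj] at h
    exact h
  int F hF := by
    rw [← A.int F hF]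
    refine Finset.sum_congr rfl fun j _ => ?_
    have := intervalIntegral.integral_comp_sub_left (fun x : ℝ => F (A.σ j x) * ‖deriv (A.σ j) x‖) (a := 0) (b := 1) 1
    simp only [sub_self, sub_zero] at this
    rw [← this]
    refine intervalIntegral.integral_congr fun x _ => ?_
    simp only [deriv_comp_const_sub, norm_neg]
    push_cast; rfl

lemma Jet.hit {c : ℂ → ℂ} {p e : ℂ} {b K δ κ s : ℝ} (hs : s = 1 ∨ s = -1) (hJ : Jet c p e (-(s * b))) (b0 : 0 < b) (b1 : b ≤ Real.pi)
    (δ0 : 0 < δ) (κ0 : 0 < κ) : ∃ w ∈ Tent κ κ, 0 < s * w.im ∧ c w ∈ sec p e b K δ := by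
  obtain ⟨k, k0, hk⟩ := arg_small b0
  set ε := min k (κ / 2) with hε
  have ε0 : 0 < ε := by positivity
  have ε1 : ε ≤ k := min_le_left _ _
  have ε2 : ε ≤ κ / 2 := min_le_right _ _
  have re : (1 + (s * ε : ℝ) * I : ℂ).re = 1 := by simp
  have im : (1 + (s * ε : ℝ) * I : ℂ).im = s * ε := by simp
  have ab : |s * ε| = ε := by rcases hs with rfl | rfl <;> simp [abs_of_pos ε0]
  have h1 := hk (1 + (s * ε : ℝ) * I) (by rw [re]; exact one_pos) (by rw [re, im, ab]; linarith)
  obtain ⟨h2, h3⟩ := abs_lt.1 h1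
  have h4 : |(-(s * b)) + arg (1 + (s * ε : ℝ) * I)| < b := by
    rcases hs with rfl | rfl
    · have : 0 < arg (1 + ((1:ℝ) * ε : ℝ) * I) := lt_of_le_of_ne (arg_nonneg_iff.2 (by rw [im]; linarith))
        fun h => by have := (arg_eq_zero_iff.1 h.symm).2; rw [im] at this; linarith
      rw [abs_lt]; constructor <;> linarith
    · have : arg (1 + ((-1:ℝ) * ε : ℝ) * I) < 0 := arg_neg_iff.2 (by rw [im]; linarith)
      rw [abs_lt]; constructor <;> linarith
  have h5 := hJ.enter (K := K) (fun h => by rw [h] at re; simp at re) b1 h4 δ0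
  obtain ⟨t, ht, t0, t1⟩ := (h5.and (Ioo_mem_nhdsGT (show 𝟘 < 1/2 by norm_num))).exists
  refine ⟨_, ?_, ?_, ht⟩
  · have hre : ((t:ℂ) * (1 + (s * ε : ℝ) * I)).re = t := by simp
    have him : ((t:ℂ) * (1 + (s * ε : ℝ) * I)).im = t * (s * ε) := by simp
    have h6 : |t * (s * ε)| < κ * ϖ t := by
      rw [abs_mul, ab, abs_of_pos t0]
      have : t * ε ≤ t * (κ / 2) := by gcongr
      have : t * κ * (1/2) < t * κ * (1 - t) := mul_lt_mul_of_pos_left ℓ ℘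
      linarith
    obtain ⟨h7, h8⟩ := abs_lt.1 h6
    exact ⟨by rw [hre]; exact t0, by rw [hre]; linarith, by rw [hre, him]; exact h7, by rw [hre, him]; exact h8⟩
  · have him : ((t:ℂ) * (1 + (s * ε : ℝ) * I)).im = t * (s * ε) := by simp
    rw [him]
    have : s * s = 1 := by rcases hs with rfl | rfl <;> norm_num
    rw [show s * (t * (s * ε)) = (s * s) * (t * ε) by ring, this]; positivity

namespace Loc
variable {D : JordanDomain} {lam : ℝ} (A : Loc D lam)

def L (j : Fin A.n) : Prop := ∃ e K δ, Nd D.G (A.σ (A.nxt j)) (fun v => A.σ j (1 - v)) (A.σ j 1) e ((2 - A.la (A.nxt j)) * Real.pi / 2) K δ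

def half (s : ℝ) : Set ℂ := Tent A.κ A.κ ∩ {w | 0 < s * w.im}

lemma half_pc (j : Fin A.n) (s : ℝ) : IsPreconnected (A.σ j '' A.half s) := by
  have : Convex ℝ (A.half s) := by
    refine (Tent.convex A.κ0.le A.κ0.le).inter ?_
    exact (convex_Ioi 𝟘).linear_preimage (s • imLm)
  exact this.isPreconnected.image _ ((A.diff j).continuousOn.mono fun w hw => (A.flat j w hw.1).1)

lemma half_side (j : Fin A.n) (s : ℝ) : A.σ j '' A.half s ⊆ D.G ∨ A.σ j '' A.half s ⊆ (closure D.G)ᶜ := by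
  refine side D.isOpen (A.half_pc j s) ?_
  rintro _ ⟨w, hw, rfl⟩ hf
  have : 0 < s * w.im := hw.2
  rw [(A.flat j w hw.1).2 hf, mul_zero] at this
  exact lt_irrefl _ this

lemma in_of {j : Fin A.n} {s : ℝ} {w : ℂ} (hw : w ∈ Tent A.κ A.κ) (hs : 0 < s * w.im) (h : A.σ j w ∈ D.G) : A.σ j '' A.half s ⊆ D.G :=
  (A.half_side j s).resolve_right fun h' => h' ⟨w, ⟨hw, hs⟩, rfl⟩ (subset_closure h)

lemma out_of {j : Fin A.n} {s : ℝ} {w : ℂ} (hw : w ∈ Tent A.κ A.κ) (hs : 0 < s * w.im) (h : A.σ j w ∈ (closure D.G)ᶜ) : A.σ j '' A.half s ⊆ (closure D.G)ᶜ :=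
  (A.half_side j s).resolve_left fun h' => h (subset_closure (h' ⟨w, ⟨hw, hs⟩, rfl⟩))

lemma not_both {j : Fin A.n} {s : ℝ} {w : ℂ} (hw : w ∈ Tent A.κ A.κ) (hs : 0 < s * w.im) (h : A.σ j w ∈ (closure D.G)ᶜ) : ¬ A.σ j '' A.half s ⊆ D.G :=
  fun h' => h (subset_closure (h' ⟨w, ⟨hw, hs⟩, rfl⟩))

lemma up_iff (j : Fin A.n) : (A.L j ↔ A.σ j '' A.half 1 ⊆ D.G) ∧ (A.L j ↔ A.σ (A.nxt j) '' A.half 1 ⊆ D.G) := by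
  have hL : A.L j → (A.σ j '' A.half 1 ⊆ D.G) ∧ (A.σ (A.nxt j) '' A.half 1 ⊆ D.G) := by
    rintro ⟨e, K, δ, h⟩
    obtain ⟨w, hw, h1, h2⟩ := Jet.hit (K := K) (s := 1) (κ := A.κ) (Or.inl rfl) (by simpa using h.j1) h.b0 h.b1.le h.δ0 A.κ0
    obtain ⟨w', hw', h1', h2'⟩ := Jet.hit (K := K) (s := -1) (κ := A.κ) (Or.inr rfl) (by simpa using h.j2) h.b0 h.b1.le h.δ0 A.κ0
    exact ⟨A.in_of (Tent.flip hw') (by simp; linarith) (h.sA h2'), A.in_of hw h1 (h.sA h2)⟩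
  have hR : ¬ A.L j → (¬ A.σ j '' A.half 1 ⊆ D.G) ∧ (¬ A.σ (A.nxt j) '' A.half 1 ⊆ D.G) := by
    intro hn
    obtain ⟨e, K, δ, h⟩ := (A.nd j).resolve_left hn
    have b0 := h.b0
    have b1 := h.b1
    obtain ⟨w, hw, h1, h2⟩ := Jet.hit (K := K) (s := 1) (κ := A.κ) (Or.inl rfl) (by rw [one_mul]; exact h.j2') ℓ ℓ h.δ0 A.κ0
    obtain ⟨w', hw', h1', h2'⟩ := Jet.hit (K := K) (s := -1) (κ := A.κ) (Or.inr rfl) (by simpa using h.j1') ℓ ℓ h.δ0 A.κ0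
    exact ⟨A.not_both (Tent.flip hw') (by simp; linarith) (h.sB h2'), A.not_both hw h1 (h.sB h2)⟩
  by_cases h : A.L j
  · exact ⟨⟨fun _ => (hL h).1, fun _ => h⟩, ⟨fun _ => (hL h).2, fun _ => h⟩⟩
  · exact ⟨⟨fun h' => absurd h' h, fun h' => absurd h' (hR h).1⟩, ⟨fun h' => absurd h' h, fun h' => absurd h' (hR h).2⟩⟩

lemma rev_L (j : Fin A.n) (h : ¬ A.L (A.nxt.symm j)) : A.rev.L j := by
  have h := (A.nd (A.nxt.symm j)).resolve_left h
  have hj := A.joint (A.nxt.symm j)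
  unfold L rev
  simp only [Equiv.apply_symm_apply, sub_sub_cancel, sub_self] at h hj ⊢
  rw [hj] at h
  exact h

lemma exists_L (A : Loc D lam) : ∃ B : Loc D lam, ∀ j, B.L j := by
  have := A.trans A.L fun j => (A.up_iff j).2.trans (A.up_iff (A.nxt j)).1.symm
  by_cases h : A.L A.i0
  · exact ⟨A, fun j => (this _ _).1 h⟩
  · exact ⟨A.rev, fun j => A.rev_L j fun h' => h ((this _ _).1 h')⟩

lemma down (h : ∀ j, A.L j) (j : Fin A.n) : A.σ j '' A.half (-1) ⊆ (closure D.G)ᶜ := by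
  obtain ⟨e, K, δ, h⟩ := h (A.nxt.symm j)
  simp only [Equiv.apply_symm_apply] at h
  have b0 := h.b0
  have b1 := h.b1
  obtain ⟨w, hw, h1, h2⟩ := Jet.hit (K := K) (s := -1) (κ := A.κ) (Or.inr rfl) (by simpa using h.j1') ℓ ℓ h.δ0 A.κ0
  exact A.out_of hw h1 (h.sB h2)


lemma ext (h : ∀ j, A.L j) : IsPreconnected (closure D.G)ᶜ := by
  set Ω := (closure D.G)ᶜ with hΩ
  have Ωo : IsOpen Ω := isClosed_closure.isOpen_compl
  have W : ∀ i, ∃ T ⊆ Ω, IsPreconnected T ∧ A.σ i '' A.half (-1) ⊆ T ∧ A.σ (A.nxt i) '' A.half (-1) ⊆ T := by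
    intro i
    obtain ⟨e, K, δ, h'⟩ := h i
    have b0 := h'.b0
    have b1 := h'.b1
    obtain ⟨w, hw, h1, h2⟩ := Jet.hit (K := K) (s := -1) (κ := A.κ) (Or.inr rfl) (by simpa using h'.j1') ℓ ℓ h'.δ0 A.κ0
    obtain ⟨w', hw', h1', h2'⟩ := Jet.hit (K := K) (s := 1) (κ := A.κ) (Or.inl rfl) (by rw [one_mul]; exact h'.j2') ℓ ℓ h'.δ0 A.κ0
    have pc := sec.pc (p := A.σ i 1) (δ := δ) (K := K) (b := Real.pi - (2 - A.la (A.nxt i)) * Real.pi / 2) (e := -e) (by rw [norm_neg, h'.he]) h'.K0 ℓ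
    have p1 := pc.union _ h2 (mem_image_of_mem (A.σ (A.nxt i)) (show w ∈ A.half (-1) from ⟨hw, h1⟩)) (A.half_pc (A.nxt i) (-1))
    have p2 := p1.union _ (mem_union_left _ h2') (mem_image_of_mem (A.σ i) (show 1 - w' ∈ A.half (-1) from ⟨Tent.flip hw', show 0 < -1 * (1 - w').im by simpa using h1'⟩)) (A.half_pc i (-1))
    exact ⟨_, union_subset (union_subset h'.sB (A.down h _)) (A.down h _), p2, subset_union_right, subset_union_right.trans subset_union_left⟩
  have ne : ∀ j, (A.σ j '' A.half (-1)).Nonempty := by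
    intro j
    refine Nonempty.image _ ⟨1/2 - (A.κ/8 : ℝ) * I, ⟨?_, ?_, ?_, ?_⟩, ?_⟩ <;> simp <;> linarith [A.κ0]
  obtain ⟨x0, hx0⟩ := ne A.i0
  set C := connectedComponentIn Ω x0 with hC
  have tr := A.trans (fun j => A.σ j '' A.half (-1) ⊆ C) (fun j => by
    obtain ⟨T, T1, T2, T3, T4⟩ := W j
    have : ∀ y ∈ T, y ∈ C → T ⊆ C := fun y hy hyC => by rw [hC, connectedComponentIn_eq hyC]; exact T2.subset_connectedComponentIn hy T1
    obtain ⟨y, hy⟩ := ne j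
    obtain ⟨y', hy'⟩ := ne (A.nxt j)
    exact ⟨fun h => T4.trans (this y (T3 hy) (h hy)), fun h => T3.trans (this y' (T4 hy') (h hy'))⟩)
  have all : ∀ j, A.σ j '' A.half (-1) ⊆ C := fun j => (tr A.i0 j).1 ((A.half_pc _ _).subset_connectedComponentIn hx0 (A.down h _))
  suffices hs : Ω ⊆ C by rw [hs.antisymm (connectedComponentIn_subset _ _)]; exact isPreconnected_connectedComponentIn
  intro t ht
  set T := connectedComponentIn Ω t with hT
  have To : IsOpen T := Ωo.connectedComponentIn
  have tT : t ∈ T := mem_connectedComponentIn ht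
  have TΩ : T ⊆ Ω := connectedComponentIn_subset _ _
  have fT : frontier T ⊆ frontier D.G := by
    intro y hy
    rw [To.frontier_eq] at hy
    rw [D.isOpen.frontier_eq]
    refine ⟨not_not.1 fun hn => hy.2 ?_, fun hG => ?_⟩
    · obtain ⟨z, hz, hz'⟩ := mem_closure_iff.1 hy.1 _ (Ωo.connectedComponentIn (x := y)) (mem_connectedComponentIn hn)
      rw [hT, connectedComponentIn_eq hz', ← connectedComponentIn_eq hz]
      exact mem_connectedComponentIn hn
    · obtain ⟨z, hz, hz'⟩ := mem_closure_iff.1 hy.1 _ D.isOpen hG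
      exact TΩ hz' (subset_closure hz)
  have key : ∃ y ∈ frontier T, ∀ i, y ≠ A.σ i 1 := by
    by_contra hn
    push Not at hn
    have nf : ∀ i, A.σ i 1 ∈ frontier D.G := fun i => by simpa using A.bd i 1 𝔰
    have pc : IsPreconnected (range fun i => A.σ i 1)ᶜ :=
      (Set.Countable.isConnected_compl_of_one_lt_rank 𝔰 (finite_range _).countable).2
    obtain ⟨g, hg⟩ := D.nonempty
    have nm : ∀ z, z ∉ frontier D.G → z ∈ (range fun i => A.σ i 1)ᶜ := by
      rintro z hz ⟨i, rfl⟩; exact hz (nf i)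
    have hsub := pc.subset_left_of_subset_union To isClosed_closure.isOpen_compl (v := (closure T)ᶜ) (disjoint_compl_right.mono_right (compl_subset_compl.2 subset_closure))
      (fun z hz => by
        by_contra hc
        simp only [mem_union, mem_compl_iff, not_or, not_not] at hc
        obtain ⟨i, hi⟩ := hn z (by rw [To.frontier_eq]; exact ⟨hc.2, hc.1⟩)
        exact hz ⟨i, hi.symm⟩) ⟨t, nm t fun hf => ht (frontier_subset_closure hf), tT⟩
    exact TΩ (hsub (nm g fun hf => by rw [D.isOpen.frontier_eq] at hf; exact hf.2 hg)) (subset_closure hg)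
  obtain ⟨y, hyT, hy⟩ := key
  obtain ⟨j, x, hx, rfl⟩ := A.cover y (fT hyT)
  have x1 : x ≠ 1 := by rintro rfl; exact hy j 𝔰
  have x2 : x ≠ 0 := by
    rintro rfl; refine hy (A.nxt.symm j) ?_
    rw [A.joint, Equiv.apply_symm_apply]; simp
  have hx' : x ∈ 𝕀o := ⟨lt_of_le_of_ne hx.1 (Ne.symm x2), lt_of_le_of_ne hx.2 x1⟩
  have hV := (A.Vo j).mem_nhds (A.seg j x hx)
  have hd : HasStrictDerivAt (A.σ j) (deriv (A.σ j) x) x := ((A.diff j).analyticAt hV).hasStrictDerivAt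
  have hm := hd.map_nhds_eq (deriv_ne_zero_of_inj (A.Vo j) (A.diff j) (A.inj j) (A.seg j x hx))
  have hfr : ∃ᶠ z in 𝓝 (A.σ j x), z ∈ T := mem_closure_iff_frequently.1 (frontier_subset_closure hyT)
  rw [← hm, frequently_map] at hfr
  obtain ⟨w, hwT, hw⟩ := (hfr.and_eventually ((Tent.isOpen A.κ A.κ).mem_nhds (Tent.real A.κ0 A.κ0 hx'))).exists
  have him : w.im < 0 := by
    by_contra hc
    rcases lt_or_eq_of_le (not_lt.1 hc) with h1 | h1
    · exact TΩ hwT (subset_closure ((A.up_iff j).1.1 (h j) ⟨w, ⟨hw, show 0 < 1 * w.im by linarith⟩, rfl⟩))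
    · have : w = (w.re : ℂ) := Complex.ext 𝔰 (by simp [← h1])
      rw [this] at hwT
      exact TΩ hwT (frontier_subset_closure (A.bd j _ ⟨hw.1.le, hw.2.1.le⟩))
  have hwC : A.σ j w ∈ C := all j ⟨w, ⟨hw, show 0 < -1 * w.im by linarith⟩, rfl⟩
  rw [hC, connectedComponentIn_eq hwC, ← connectedComponentIn_eq hwT]
  exact tT

end Loc

lemma fin_min {n : ℕ} (i : Fin n) (f : Fin n → ℝ) (hf : ∀ j, 0 < f j) : ∃ c > 0, ∀ j, c ≤ f j := by
  obtain ⟨c, hc⟩ := Finite.exists_le (fun j => (f j)⁻¹)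
  have hc0 : 0 < c := (inv_pos.2 (hf i)).trans_le (hc i)
  exact ⟨c⁻¹, ℘, fun j => inv_le_of_inv_le₀ (hf j) (hc j)⟩

lemma fin_max {n : ℕ} (f : Fin n → ℝ) : ∃ c > 0, ∀ j, f j ≤ c := by
  obtain ⟨c, hc⟩ := Finite.exists_le f
  exact ⟨max c 1, ℘, fun j => (hc j).trans (le_max_left _ _)⟩

lemma Nd.n1 {G : Set ℂ} {c1 c2 : ℂ → ℂ} {p e z : ℂ} {b K δ : ℝ} (h : Nd G c1 c2 p e b K δ) (hz : z ≠ p) (hd : ‖z - p‖ < δ) :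
    (z ∈ closure G → |arg ((z - p) / e)| ≤ b + K * ‖z - p‖) ∧ (z ∉ G → |arg (-(z - p) / e)| ≤ Real.pi - b + K * ‖z - p‖) := by
  have e0 : e ≠ 0 := by rintro rfl; simpa using h.he
  have a := arg_add_neg (div_ne_zero (sub_ne_zero.2 hz) e0)
  constructor
  · intro hc
    by_contra hn
    exact h.sB ⟨hz, hd, by rw [div_neg]; linarith⟩ hc
  · intro hc
    by_contra hn
    rw [neg_div] at hn
    exact hc (h.sA ⟨hz, hd, ℓ⟩)

lemma Loc.net {D : JordanDomain} {lam : ℝ} (A : Loc D lam) (h0 : 0 < lam) (h : ∀ j, A.L j) {p : ℕ → Polynomial ℂ} (hp : D.IsONPolys p) :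
    ∃ N : Net D.G lam, On N D.l p := by
  choose e K δ nd using h
  obtain ⟨K', K0', hK⟩ := fin_max K
  obtain ⟨δ', δ0', hδ⟩ := fin_min A.i0 δ fun j => (nd j).δ0
  have st : ∀ j, ∃ r > 0, ∃ m > 0, ∃ M > 0, cthickening r (ofReal '' 𝕀c) ⊆ A.V j ∧ ∀ z ∈ cthickening r (ofReal '' 𝕀c), ∀ w ∈ cthickening r (ofReal '' 𝕀c),
      m * ‖z - w‖ ≤ ‖A.σ j z - A.σ j w‖ ∧ ‖A.σ j z - A.σ j w‖ ≤ M * ‖z - w‖ := by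
    intro j
    obtain ⟨r, r0, hr⟩ := segc.1.exists_cthickening_subset_open (A.Vo j) (by rintro _ ⟨x, hx, rfl⟩; exact A.seg j x hx)
    obtain ⟨m, m0, M, M0, hb⟩ := biLip (A.Vo j) segc.1.cthickening (segc.2.cthickening r) hr (A.diff j) (A.inj j)
    exact ⟨r, r0, m, m0, M, M0, hr, hb⟩
  choose r r0 m m0 M M0 hr hb using st
  obtain ⟨r', r0', hr'⟩ := fin_min A.i0 r r0
  obtain ⟨m', m0', hm⟩ := fin_min A.i0 m m0
  obtain ⟨M', M0', hM⟩ := fin_max M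
  have ts : ∀ j, thickening (r j) (ofReal '' 𝕀c) ⊆ cthickening (r j) (ofReal '' 𝕀c) := fun j => thickening_subset_cthickening _ _
  have kk : 0 < min A.κ r' := lt_min A.κ0 r0'
  have tm : Tent (min A.κ r') (min A.κ r') ⊆ Tent A.κ A.κ := Tent.mono 𝔩 𝔩
  have sg : ∀ j, ∀ x ∈ 𝕀c, (x:ℂ) ∈ thickening (r j) (ofReal '' 𝕀c) := fun j x hx => self_subset_thickening (r0 j) _ ⟨x, hx, rfl⟩
  have nn : ∀ j z, z ≠ A.σ j 0 → ‖z - A.σ j 0‖ < δ' → (z ∈ closure D.G → |arg ((z - A.σ j 0) / e (A.nxt.symm j))| ≤ (2 - A.la j) * Real.pi / 2 + K' * ‖z - A.σ j 0‖) ∧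
      (z ∉ D.G → |arg (-(z - A.σ j 0) / e (A.nxt.symm j))| ≤ A.la j * Real.pi / 2 + K' * ‖z - A.σ j 0‖) := by
    intro j z h1 h2
    have hj := A.joint (A.nxt.symm j)
    have N := nd (A.nxt.symm j)
    rw [Equiv.apply_symm_apply] at hj N
    rw [hj] at N
    obtain ⟨a, b⟩ := N.n1 h1 (h2.trans_le (hδ _))
    have : K (A.nxt.symm j) * ‖z - A.σ j 0‖ ≤ K' * ‖z - A.σ j 0‖ := by gcongr; exact hK _
    exact ⟨fun h => by linarith [a h], fun h => by linarith [b h]⟩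
  refine ⟨{
    lam0 := h0
    Go := D.isOpen
    Gb := D.bounded
    Gc := D.connected
    N := A.n
    nxt := A.nxt
    i0 := A.i0
    σ := A.σ
    V := fun j => thickening (r j) (ofReal '' 𝕀c)
    κ := min A.κ r'
    κ0 := kk
    κ1 := (min_le_left _ _).trans A.κ1
    m := m'
    M := M'
    m0 := m0'
    M0 := M0'
    Vo := fun j => isOpen_thickening
    diff := fun j => (A.diff j).mono ((ts j).trans (hr j))
    lipl := fun j z hz w hw => le_trans (by gcongr; exact hm j) (hb j z (ts j hz) w (ts j hw)).1
    lipu := fun j z hz w hw => (hb j z (ts j hz) w (ts j hw)).2.trans (by gcongr; exact hM j)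
    tV := fun j z hz => by
      refine mem_thickening_iff.2 ⟨z.re, ⟨z.re, ⟨hz.1.le, hz.2.1.le⟩, rfl⟩, ?_⟩
      have e : z - (z.re : ℂ) = z.im * I := Complex.ext 𝔰 𝔰
      rw [dist_eq_norm, e, norm_mul, norm_I, mul_one, norm_real, Real.norm_eq_abs]
      obtain ⟨h1, h2, h3, h4⟩ := hz
      have h5 : z.re * (1 - z.re) ≤ 1 := by nlinarith
      have h6 : min A.κ r' * ϖ z.re ≤ r j * 1 := by
        gcongr
        · exact (r0 j).le
        · exact (min_le_right _ _).trans (hr' j)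
      exact abs_lt.2 ⟨ℓ, ℓ⟩
    V0 := fun j => by simpa using sg j 0 𝔰
    V1 := fun j => by simpa using sg j 1 𝔰
    up := fun j z hz h' => (A.up_iff j).1.1 ⟨_, _, _, nd j⟩ ⟨z, ⟨tm hz, show 0 < 1 * z.im by linarith⟩, rfl⟩
    low := fun j z hz h' => A.down (fun j => ⟨_, _, _, nd j⟩) j ⟨z, ⟨tm hz, show 0 < -1 * z.im by linarith⟩, rfl⟩
    bd := A.bd
    cover := A.cover
    joint := A.joint
    e := fun j => e (A.nxt.symm j)
    la := A.la
    e1 := fun j => (nd _).he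
    la1 := A.la1
    la2 := A.la2
    K := K'
    δ := δ'
    K0 := K0'
    δ0 := δ0'
    n1 := fun j z h1 h2 h3 => (nn j z h2 h3).1 h1
    n2 := fun j z h1 h2 h3 => (nn j z h2 h3).2 h1
    tan0 := fun j => by
      have := (nd (A.nxt.symm j)).t1
      rw [Equiv.apply_symm_apply] at this
      exact this
    tan1 := fun j => by
      have := (nd j).t2
      rw [Arcs.d1', norm_neg] at this
      rw [Equiv.symm_apply_apply]
      exact this
    ext := A.ext fun j => ⟨_, _, _, nd j⟩
    sep := A.sep }, D.l_pos, hp.1, fun k hk => ?_, fun j k => ?_⟩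
  · obtain ⟨c, c0, hc⟩ := hp.2.1 k
    rw [hk, Polynomial.leadingCoeff_zero] at hc
    exact c0.ne (by exact_mod_cast hc)
  · have h1 := hp.2.2 j k
    have h2 := A.int (fun z => (p j).eval z * ℭ ((p k).eval z)) (by fun_prop)
    have l0 : (D.l : ℂ) ≠ 0 := by exact_mod_cast D.l_pos.ne'
    rw [← h2] at h1
    have h3 : (∑ i, ∫ x in 𝟘..1, (p j).eval (A.σ i x) * ℭ ((p k).eval (A.σ i x)) * ‖deriv (A.σ i) x‖) = D.l * if j = k then 1 else 0 := by
      rw [← h1]; field_simp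
    rw [Net.ip]
    simp only []
    rw [h3]; split_ifs <;> simp

theorem conformalMap_interior_rate
    (D : JordanDomain) (B : PiecewiseAnalyticBoundary D)
    (lam : ℝ) (hlam0 : 0 < lam) (hlam2 : lam < 2)
    (hmin : ∀ i, lam ≤ B.extAngle i) (hattained : ∃ i, B.extAngle i = lam)
    (p : ℕ → Polynomial ℂ) (hp : D.IsONPolys p)
    (F : Set ℂ) (hF : IsCompact F) (hFG : F ⊆ D.G) :
    ∃ C : ℝ, 0 < C ∧ ∀ ζ ∈ F, ∀ φ : ℂ → ℂ,
      ConformalOnto D.G φ ζ →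
      ∀ n : ℕ, 0 < n → ∀ z ∈ F,
        ‖φ z - Jfun D p ζ n z‖ ≤ C * (n : ℝ) ^ (-(lam / (2 - lam))) := by
  obtain ⟨A⟩ := Arcs.exists B hmin
  obtain ⟨L⟩ := A.loc hlam0
  obtain ⟨L', hL⟩ := L.exists_L
  obtain ⟨N, O⟩ := L'.net hlam0 hL hp
  exact N.final O hF hFG
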